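/- Let d > 4. There exist β0 > 0 and C > 0 such that for all β ∈ (0, β0], all integers r ≥ 3 and all z ∈ ℂ with |z| ≤ ζ = z_c(1 − V^{−1/2}), one has χ(z) ≠ 0, χ^𝕋(z) ≠ 0, and the function Δ(z) = 1/χ^𝕋(z) − 1/χ(z) satisfies |Δ(z)| ≤ C β (r² + χ(|z|)) / V. -/

import Mathlib

open scoped BigOperators

/-- A unit step in `ℤ^d`: a coordinate direction together with a sign. -/
def wsawStep (d : ℕ) (e : Fin d × Bool) : Fin d → ℤ :=
  fun i => if i = e.1 then (if e.2 then 1 else -1) else 0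

/-- The position after `k` steps of the walk on `ℤ^d` with step sequence `s`.
(An `n`-step nearest-neighbour walk on `ℤ^d` started at `0` is the same thing as a
sequence of `n` unit steps.) -/
def wsawPos {d n : ℕ} (s : Fin n → Fin d × Bool) (k : ℕ) : Fin d → ℤ :=
  ∑ j ∈ Finset.univ.filter (fun j : Fin n => (j : ℕ) < k), wsawStep d (s j)

/-- The weakly self-avoiding walk weight `∏_{0 ≤ s < t ≤ n} (1 + β U_{st}(ω))`
of the `ℤ^d` walk with step sequence `s`. -/
noncomputable def wsawWeight {d : ℕ} (β : ℝ) (n : ℕ) (s : Fin n → Fin d × Bool) : ℝ :=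
  ∏ p ∈ (Finset.range (n + 1) ×ˢ Finset.range (n + 1)).filter (fun p => p.1 < p.2),
    (1 + β * (if wsawPos s p.1 = wsawPos s p.2 then (-1 : ℝ) else 0))

/-- The two-point partition function `c_n(x)` on `ℤ^d`. -/
noncomputable def cZx (d : ℕ) (β : ℝ) (n : ℕ) (x : Fin d → ℤ) : ℝ :=
  ∑ s ∈ Finset.univ.filter (fun s : Fin n → Fin d × Bool => wsawPos s n = x),
    wsawWeight β n s

/-- The partition function `c_n = Σ_x c_n(x)` on `ℤ^d`. -/
noncomputable def cZ (d : ℕ) (β : ℝ) (n : ℕ) : ℝ :=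
  ∑ s : Fin n → Fin d × Bool, wsawWeight β n s

/-- The position after `k` steps of the torus walk with step sequence `s`:
the mod-`r` projection of the `ℤ^d` position (for `r ≥ 3`, `n`-step torus walks
started at `0` correspond bijectively to step sequences). -/
def wsawPosT {d : ℕ} (r : ℕ) {n : ℕ} (s : Fin n → Fin d × Bool) (k : ℕ) : Fin d → ZMod r :=
  fun i => ((wsawPos s k i : ℤ) : ZMod r)

/-- The weakly self-avoiding walk weight of the torus walk with step sequence `s`. -/
noncomputable def wsawWeightT {d : ℕ} (r : ℕ) (β : ℝ) (n : ℕ) (s : Fin n → Fin d × Bool) : ℝ :=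
  ∏ p ∈ (Finset.range (n + 1) ×ˢ Finset.range (n + 1)).filter (fun p => p.1 < p.2),
    (1 + β * (if wsawPosT r s p.1 = wsawPosT r s p.2 then (-1 : ℝ) else 0))

/-- The torus partition function `c_n^𝕋`. -/
noncomputable def cT (d r : ℕ) (β : ℝ) (n : ℕ) : ℝ :=
  ∑ s : Fin n → Fin d × Bool, wsawWeightT r β n s

/-- `μ` is the growth constant: `μ = lim_{n→∞} c_n^{1/n}`. -/
def HasGrowthConst (d : ℕ) (β μ : ℝ) : Prop :=
  Filter.Tendsto (fun n : ℕ => (cZ d β n) ^ ((n : ℝ)⁻¹)) Filter.atTop (nhds μ)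

/-- The susceptibility `χ(z)` on `ℤ^d`, for complex `z`. -/
noncomputable def chi (d : ℕ) (β : ℝ) (z : ℂ) : ℂ := ∑' n : ℕ, (cZ d β n : ℂ) * z ^ n

/-- The susceptibility `χ(z)` on `ℤ^d`, for real `z`. -/
noncomputable def chiR (d : ℕ) (β : ℝ) (z : ℝ) : ℝ := ∑' n : ℕ, cZ d β n * z ^ n

/-- The torus susceptibility `χ^𝕋(z)`, for complex `z`. -/
noncomputable def chiT (d r : ℕ) (β : ℝ) (z : ℂ) : ℂ := ∑' n : ℕ, (cT d r β n : ℂ) * z ^ n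

/-- The torus susceptibility `χ^𝕋(z)`, for real `z`. -/
noncomputable def chiTR (d r : ℕ) (β : ℝ) (z : ℝ) : ℝ := ∑' n : ℕ, cT d r β n * z ^ n

/-- The sup norm `‖x‖_∞` of `x ∈ ℤ^d`, as a real number. -/
noncomputable def nInf {d : ℕ} (x : Fin d → ℤ) : ℝ :=
  ((Finset.univ.sup fun i => (x i).natAbs : ℕ) : ℝ)

/-- `⟨x⟩ = max {1, ‖x‖_∞}`. -/
noncomputable def vee {d : ℕ} (x : Fin d → ℤ) : ℝ := max 1 (nInf x)

/-- The two-point function `G_z(x) = Σ_n c_n(x) z^n` on `ℤ^d`. -/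
noncomputable def Gpt (d : ℕ) (β z : ℝ) (x : Fin d → ℤ) : ℝ := ∑' n : ℕ, cZx d β n x * z ^ n

/-- The bubble diagram `B_z = G_z * G_z`. -/
noncomputable def Bpt (d : ℕ) (β z : ℝ) (x : Fin d → ℤ) : ℝ :=
  ∑' y : Fin d → ℤ, Gpt d β z (x - y) * Gpt d β z y

/-- The triangle diagram `T_z = G_z * G_z * G_z`. -/
noncomputable def Tpt (d : ℕ) (β z : ℝ) (x : Fin d → ℤ) : ℝ :=
  ∑' y : Fin d → ℤ, Bpt d β z (x - y) * Gpt d β z y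

/-- The representative in `[-r/2, r/2) ∩ ℤ` of `x ∈ ℤ/rℤ`. -/
def repC (r : ℕ) (x : ZMod r) : ℤ :=
  if 2 * (x.val : ℤ) < (r : ℤ) then (x.val : ℤ) else (x.val : ℤ) - (r : ℤ)

open scoped ENNReal

namespace WSAW

section Lists

variable {E A : Type*} [AddCommGroup A]

/-- The displacement of a walk given by its list of steps. -/
def disp (st : E → A) (l : List E) : A := (l.map st).sum

@[simp] lemma disp_nil (st : E → A) : disp st [] = 0 := rfl

@[simp] lemma disp_cons (st : E → A) (e : E) (l : List E) :
    disp st (e :: l) = st e + disp st l := by simp [disp]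

@[simp] lemma disp_append (st : E → A) (l l' : List E) :
    disp st (l ++ l') = disp st l + disp st l' := by simp [disp]

variable [DecidableEq A]

/-- The number of nonempty suffixes of `p` whose displacement is `-x`. -/
def hits (st : E → A) : List E → A → ℕ
  | [], _ => 0
  | e :: p, x => hits st p x + if disp st (e :: p) + x = 0 then 1 else 0

/-- The number of intersections of the walk `l` (started at position `x` relative to the end of
`p`) with the past `p`. -/
def cross (st : E → A) (p : List E) : A → List E → ℕ
  | _, [] => 0
  | x, e :: l => hits st p (x + st e) + cross st p (x + st e) l

/-- The number of self-intersections of a walk. -/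
def selfHits (st : E → A) : List E → ℕ
  | [] => 0
  | e :: l => selfHits st l + cross st [e] 0 l

lemma cross_append (st : E → A) (p : List E) (l l' : List E) (x : A) :
    cross st p x (l ++ l') = cross st p x l + cross st p (x + disp st l) l' := by
  induction l generalizing x with
  | nil => simp [cross]
  | cons e l ih => simp [cross, ih, add_assoc]

lemma cross_cons (st : E → A) (e : E) (p l : List E) (x : A) :
    cross st (e :: p) x l = cross st p x l + cross st [e] (disp st p + x) l := by
  induction l generalizing x with
  | nil => simp [cross]
  | cons f l ih =>
    simp only [cross, ih, hits, disp_cons, disp_nil, add_zero, zero_add]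
    have h : st e + disp st p + (x + st f) = st e + (disp st p + x + st f) := by abel
    rw [h, ← add_assoc (disp st p) x (st f)]
    ring

lemma selfHits_append (st : E → A) (p l : List E) :
    selfHits st (p ++ l) = selfHits st p + selfHits st l + cross st p 0 l := by
  induction p with
  | nil =>
    have : ∀ x : A, cross st [] x l = 0 := by
      induction l with
      | nil => simp [cross]
      | cons e l ih => simp [cross, hits, ih]
    simp [selfHits, this]
  | cons e p ih =>
    simp only [List.cons_append, selfHits, ih, cross_append, cross_cons st e p, zero_add, add_zero]
    ring

/-- The weight `q ^ (number of self-intersections)`. -/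
noncomputable def K (st : E → A) (q : ℝ) (l : List E) : ℝ := q ^ selfHits st l

/-- The weight of a walk `l` in presence of a past `p`. -/
noncomputable def X (st : E → A) (q : ℝ) (p l : List E) : ℝ := q ^ cross st p 0 l * K st q l

/-- The weight of the walk `l` whose end point is the first one interacting with the past `p`. -/
noncomputable def ker (st : E → A) (q : ℝ) (p l : List E) : ℝ :=
  (q ^ cross st p 0 l.dropLast - q ^ cross st p 0 l) * K st q l

/-- The inverse kernel: `X p = Y p ⋆ K`. -/
noncomputable def Y (st : E → A) (q : ℝ) (p l : List E) : ℝ :=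
  (if l.length = 0 then 1 else 0) -
    ∑ i : Fin l.length, ker st q p (l.take (i + 1)) * Y st q (l.take (i + 1)) (l.drop (i + 1))
termination_by l.length
decreasing_by
  have := i.2
  simp only [List.length_drop]
  omega

/-- Convolution of functions of lists. -/
noncomputable def conv {R : Type*} [Semiring R] (f g : List E → R) (l : List E) : R :=
  ∑ j ∈ Finset.range (l.length + 1), f (l.take j) * g (l.drop j)

/-- The lace kernel. -/
noncomputable def P (st : E → A) (q : ℝ) : List E → ℝ
  | [] => 0
  | e :: l => Y st q [e] l

lemma Y_eq (st : E → A) (q : ℝ) (p l : List E) :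
    Y st q p l = (if l.length = 0 then 1 else 0) -
      ∑ i ∈ Finset.range l.length,
        ker st q p (l.take (i + 1)) * Y st q (l.take (i + 1)) (l.drop (i + 1)) := by
  rw [Y, Finset.sum_range]

lemma K_append (st : E → A) (q : ℝ) (p l : List E) :
    K st q (p ++ l) = K st q p * X st q p l := by
  simp only [K, X, selfHits_append, pow_add]; ring

lemma X_eq (st : E → A) (q : ℝ) (p l : List E) :
    X st q p l = K st q l - ∑ i ∈ Finset.range l.length,
      ker st q p (l.take (i + 1)) * X st q (l.take (i + 1)) (l.drop (i + 1)) := by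
  have h1 : ∀ i ∈ Finset.range l.length,
      ker st q p (l.take (i + 1)) * X st q (l.take (i + 1)) (l.drop (i + 1)) =
      (q ^ cross st p 0 (l.take i) - q ^ cross st p 0 (l.take (i + 1))) * K st q l := by
    intro i hi
    rw [Finset.mem_range] at hi
    have h2 : (l.take (i + 1)).dropLast = l.take i := by
      rw [List.dropLast_eq_take, List.take_take, List.length_take]; congr 1; omega
    rw [ker, h2, mul_assoc, ← K_append, List.take_append_drop]
  rw [Finset.sum_congr rfl h1, ← Finset.sum_mul,
    Finset.sum_range_sub' (fun i => q ^ cross st p 0 (l.take i))]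
  simp [X, cross]
  ring

lemma X_eq_conv (st : E → A) (q : ℝ) (p l : List E) :
    X st q p l = conv (Y st q p) (K st q) l := by
  induction hn : l.length using Nat.strong_induction_on generalizing p l with
  | _ n ih =>
  subst hn
  have h1 : ∀ j ∈ Finset.range (l.length + 1),
      Y st q p (l.take j) * K st q (l.drop j) =
      (if j = 0 then K st q l else 0) - ∑ i ∈ Finset.range j,
        ker st q p (l.take (i + 1)) *
          (Y st q (l.take (i + 1)) ((l.take j).drop (i + 1)) * K st q (l.drop j)) := by
    intro j hj
    rw [Finset.mem_range] at hj
    have hl : (l.take j).length = j := by simp; omega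
    rw [Y_eq, hl, sub_mul, Finset.sum_mul]
    congr 1
    · by_cases h : j = 0 <;> simp [h]
    · refine Finset.sum_congr rfl fun i hi => ?_
      rw [Finset.mem_range] at hi
      rw [List.take_take, min_eq_left (by omega), mul_assoc]
  rw [conv, Finset.sum_congr rfl h1, Finset.sum_sub_distrib, X_eq]
  congr 1
  · simp
  · have h2 : ∀ i ∈ Finset.range l.length,
        ker st q p (l.take (i + 1)) * X st q (l.take (i + 1)) (l.drop (i + 1)) =
        ∑ j ∈ Finset.Ico (i + 1) (l.length + 1), ker st q p (l.take (i + 1)) *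
          (Y st q (l.take (i + 1)) ((l.take j).drop (i + 1)) * K st q (l.drop j)) := by
      intro i hi
      rw [Finset.mem_range] at hi
      rw [ih (l.drop (i + 1)).length (by simp; omega) _ _ rfl, conv, Finset.mul_sum,
        Finset.sum_Ico_eq_sum_range]
      have : (l.drop (i + 1)).length + 1 = l.length + 1 - (i + 1) := by simp; omega
      rw [this]
      refine Finset.sum_congr rfl fun j hj => ?_
      rw [List.drop_drop, List.drop_take, Nat.add_sub_cancel_left]
    rw [Finset.sum_congr rfl h2]
    refine Finset.sum_comm' fun i j => ?_
    simp only [Finset.mem_range, Finset.mem_Ico]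
    omega

/-- The renewal equation `K = 1 + P ⋆ K`. -/
lemma K_eq_conv (st : E → A) (q : ℝ) (l : List E) :
    K st q l = (if l.length = 0 then 1 else 0) + conv (P st q) (K st q) l := by
  cases l with
  | nil => simp [conv, P, K, selfHits]
  | cons e l =>
    have h : K st q (e :: l) = X st q [e] l := by
      simp [K, X, selfHits, pow_add, mul_comm]
    rw [h, X_eq_conv, conv, conv, List.length_cons, Finset.sum_range_succ' _ (l.length + 1)]
    simp [P]

/-! Bounds on the weights. -/

lemma K_nonneg (st : E → A) {q : ℝ} (hq : 0 ≤ q) (l : List E) : 0 ≤ K st q l := pow_nonneg hq _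

lemma K_le_one (st : E → A) {q : ℝ} (hq : 0 ≤ q) (hq1 : q ≤ 1) (l : List E) : K st q l ≤ 1 :=
  pow_le_one₀ hq hq1

lemma K_append_le (st : E → A) {q : ℝ} (hq : 0 ≤ q) (hq1 : q ≤ 1) (p l : List E) :
    K st q (p ++ l) ≤ K st q p * K st q l := by
  rw [K_append]
  refine mul_le_mul_of_nonneg_left ?_ (K_nonneg st hq p)
  exact mul_le_of_le_one_left (K_nonneg st hq l) (pow_le_one₀ hq hq1)

lemma cross_dropLast (st : E → A) (p l : List E) (hl : l ≠ []) :
    cross st p 0 l = cross st p 0 l.dropLast + hits st p (disp st l) := by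
  conv_lhs => rw [← List.dropLast_append_getLast hl]
  conv_rhs => rw [← List.dropLast_append_getLast hl]
  simp [cross_append, cross]

lemma one_sub_pow_le {q : ℝ} (hq : 0 ≤ q) (n : ℕ) : 1 - q ^ n ≤ (1 - q) * n := by
  have := one_add_mul_le_pow (a := q - 1) (by linarith) n
  have h2 : (1 : ℝ) + (q - 1) = q := by ring
  rw [h2] at this
  linarith

lemma ker_nil (st : E → A) (q : ℝ) (p : List E) : ker st q p [] = 0 := by simp [ker, cross]

lemma ker_nonneg (st : E → A) {q : ℝ} (hq : 0 ≤ q) (hq1 : q ≤ 1) (p l : List E) :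
    0 ≤ ker st q p l := by
  by_cases hl : l = []
  · simp [hl, ker_nil]
  refine mul_nonneg (sub_nonneg.2 ?_) (K_nonneg st hq l)
  rw [cross_dropLast st p l hl]
  exact pow_le_pow_of_le_one hq hq1 (by omega)

lemma ker_le (st : E → A) {q : ℝ} (hq : 0 ≤ q) (hq1 : q ≤ 1) (p l : List E) :
    ker st q p l ≤ (1 - q) * hits st p (disp st l) * K st q l := by
  by_cases hl : l = []
  · subst hl
    simp only [ker_nil]
    have := K_nonneg st hq ([] : List E)
    have : 0 ≤ 1 - q := by linarith
    positivity
  refine mul_le_mul_of_nonneg_right ?_ (K_nonneg st hq l)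
  rw [cross_dropLast st p l hl, pow_add]
  have h1 := one_sub_pow_le hq (hits st p (disp st l))
  have h2 : q ^ cross st p 0 l.dropLast ≤ 1 := pow_le_one₀ hq hq1
  have h3 : 0 ≤ q ^ cross st p 0 l.dropLast := pow_nonneg hq _
  have h4 : q ^ hits st p (disp st l) ≤ 1 := pow_le_one₀ hq hq1
  nlinarith

end Lists

end WSAW

namespace WSAW

section Splits

variable {E : Type*} [DecidableEq E]

/-- The sum of `f` over all ways of splitting a list in two. -/
noncomputable def splitSum (f : List E → List E → ℝ≥0∞) (l : List E) : ℝ≥0∞ :=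
  ∑' a, ∑' s, if a ++ s = l then f a s else 0

lemma splitSum_eq_sum (f : List E → List E → ℝ≥0∞) (l : List E) :
    splitSum f l = ∑ i ∈ Finset.range (l.length + 1), f (l.take i) (l.drop i) := by
  rw [splitSum, ← ENNReal.tsum_prod (f := fun a s => if a ++ s = l then f a s else 0),
    tsum_eq_sum (s := (Finset.range (l.length + 1)).image fun i => (l.take i, l.drop i)),
    Finset.sum_image]
  · exact Finset.sum_congr rfl fun i _ => by simp
  · intro i hi j hj h
    have h1 := congrArg List.length (congrArg Prod.fst h)
    simp only [Finset.coe_range, Set.mem_Iio] at hi hj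
    simp only [List.length_take] at h1
    omega
  · rintro ⟨a, s⟩ h
    rw [if_neg]
    rintro rfl
    refine h (Finset.mem_image.2 ⟨a.length, ?_, ?_⟩)
    · simp
    · simp

lemma splitSum_nil (f : List E → List E → ℝ≥0∞) : splitSum f [] = f [] [] := by
  simp [splitSum_eq_sum]

lemma splitSum_cons (f : List E → List E → ℝ≥0∞) (e : E) (l : List E) :
    splitSum f (e :: l) = splitSum (fun a s => f (e :: a) s) l + f [] (e :: l) := by
  simp only [splitSum_eq_sum, List.length_cons]
  rw [Finset.sum_range_succ']
  simp

lemma splitSum_mono {f g : List E → List E → ℝ≥0∞} (l : List E)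
    (h : ∀ a s, a ++ s = l → f a s ≤ g a s) : splitSum f l ≤ splitSum g l :=
  ENNReal.tsum_le_tsum fun a => ENNReal.tsum_le_tsum fun s => by
    split_ifs with h1
    · exact h a s h1
    · exact le_rfl

lemma mul_splitSum (c : ℝ≥0∞) (f : List E → List E → ℝ≥0∞) (l : List E) :
    c * splitSum f l = splitSum (fun a s => c * f a s) l := by
  simp only [splitSum, ← ENNReal.tsum_mul_left, mul_ite, mul_zero]

lemma splitSum_add (f g : List E → List E → ℝ≥0∞) (l : List E) :
    splitSum (fun a s => f a s + g a s) l = splitSum f l + splitSum g l := by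
  simp only [splitSum_eq_sum, Finset.sum_add_distrib]

lemma tsum_splitSum (g : List E → ℝ≥0∞) (f : List E → List E → ℝ≥0∞) :
    ∑' l, g l * splitSum f l = ∑' a, ∑' s, g (a ++ s) * f a s := by
  simp only [splitSum, ← ENNReal.tsum_mul_left]
  rw [ENNReal.tsum_comm]
  refine tsum_congr fun a => ?_
  rw [ENNReal.tsum_comm]
  refine tsum_congr fun s => ?_
  rw [tsum_eq_single (a ++ s)]
  · simp
  · intro l hl
    rw [if_neg (Ne.symm hl), mul_zero]

lemma tsum_splitSum' (f : List E → List E → ℝ≥0∞) :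
    ∑' l, splitSum f l = ∑' a, ∑' s, f a s := by
  simpa using tsum_splitSum (fun _ => 1) f

lemma splitSum_congr {f g : List E → List E → ℝ≥0∞} (l : List E)
    (h : ∀ a s, a ++ s = l → f a s = g a s) : splitSum f l = splitSum g l :=
  le_antisymm (splitSum_mono l fun a s hs => (h a s hs).le)
    (splitSum_mono l fun a s hs => (h a s hs).ge)

/-- Two splittings of the same list have a common refinement. -/
lemma splitSum_mul_splitSum_le (f g : List E → List E → ℝ≥0∞) (l : List E) :
    splitSum f l * splitSum g l ≤
      splitSum (fun a s => splitSum (fun b c => f a (b ++ c) * g (a ++ b) c) s) l +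
      splitSum (fun a s => splitSum (fun b c => f (a ++ b) c * g a (b ++ c)) s) l := by
  induction l generalizing f g with
  | nil => simp [splitSum_nil]
  | cons e l ih =>
    have h1 : splitSum (fun b c => f [] (b ++ c) * g ([] ++ b) c) (e :: l) =
        f [] (e :: l) * splitSum g (e :: l) := by
      rw [mul_splitSum]
      exact splitSum_congr _ fun a s h => by simp [h]
    have h2 : splitSum (fun b c => f ([] ++ b) c * g [] (b ++ c)) (e :: l) =
        g [] (e :: l) * splitSum f (e :: l) := by
      rw [mul_splitSum]
      exact splitSum_congr _ fun a s h => by simp [h, mul_comm]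
    rw [splitSum_cons (fun a s => splitSum (fun b c => f a (b ++ c) * g (a ++ b) c) s),
      splitSum_cons (fun a s => splitSum (fun b c => f (a ++ b) c * g a (b ++ c)) s), h1, h2,
      splitSum_cons f, splitSum_cons g]
    have h3 := ih (fun a => f (e :: a)) (fun a => g (e :: a))
    simp only [List.cons_append]
    calc _ = splitSum (fun a => f (e :: a)) l * splitSum (fun a => g (e :: a)) l +
          (f [] (e :: l) * splitSum (fun a => g (e :: a)) l +
            g [] (e :: l) * splitSum (fun a => f (e :: a)) l + f [] (e :: l) * g [] (e :: l)) := by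
          ring
      _ ≤ _ := by
          refine (add_le_add h3 le_rfl).trans (le_trans
            (le_self_add (b := f [] (e :: l) * g [] (e :: l))) (le_of_eq ?_))
          ring

end Splits

end WSAW

namespace WSAW

section Lines

variable {E A : Type*} [AddCommGroup A] [DecidableEq A]

/-- The weights `w`, summed over the walks with a given displacement, are bounded by `t`. -/
def Line (st : E → A) (w : List E → ℝ≥0∞) (t : A → ℝ≥0∞) : Prop :=
  ∀ x, ∑' l, (if disp st l = x then w l else 0) ≤ t x

lemma Line.tsum_le {st : E → A} {w : List E → ℝ≥0∞} {t : A → ℝ≥0∞} (h : Line st w t)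
    (f : A → ℝ≥0∞) : ∑' l, w l * f (disp st l) ≤ ∑' x, t x * f x := by
  have h1 : ∀ l, w l * f (disp st l) = ∑' x, (if disp st l = x then w l else 0) * f x := by
    intro l
    rw [tsum_eq_single (disp st l)]
    · simp
    · intro x hx
      rw [if_neg (Ne.symm hx), zero_mul]
  rw [tsum_congr h1, ENNReal.tsum_comm]
  refine ENNReal.tsum_le_tsum fun x => ?_
  rw [ENNReal.tsum_mul_right]
  exact mul_le_mul_left (h x) _

lemma Line.tsum_ite_le {st : E → A} {w : List E → ℝ≥0∞} {t : A → ℝ≥0∞} (h : Line st w t)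
    (x : A) : ∑' l, w l * (if disp st l = x then 1 else 0) ≤ t x := by
  simpa using h x

/-- A profile dominating the two-point function. -/
structure Good (st : E → A) (T : A → ℝ≥0∞) (C : ℝ≥0∞) : Prop where
  neg : ∀ x, T (-x) = T x
  sq : ∑' x, T x ^ 2 ≤ C
  inf : ∀ x y, min (T x) (T y) ≤ C * T (x + y)
  zero : 1 ≤ T 0
  step : ∀ e, 1 ≤ T (st e)

lemma mul_le_sq_add_sq (a b : ℝ≥0∞) : a * b ≤ a ^ 2 + b ^ 2 := by
  rcases le_total a b with h | h
  · exact le_add_left (by rw [sq]; gcongr)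
  · exact le_add_right (by rw [sq]; gcongr)

lemma mul_le_of_min_le {a b c : ℝ≥0∞} (h : min a b ≤ c) : a * b ≤ c * (a + b) := by
  rcases le_total a b with h' | h'
  · rw [min_eq_left h'] at h
    gcongr
    exact le_add_self
  · rw [min_eq_right h'] at h
    rw [mul_comm]
    gcongr
    exact le_self_add

namespace Good

variable {st : E → A} {T : A → ℝ≥0∞} {C : ℝ≥0∞}

lemma one_le (hT : Good st T C) : 1 ≤ C :=
  le_trans (le_trans (one_le_pow₀ hT.zero) (ENNReal.le_tsum (0 : A))) hT.sq

lemma sq_shift (hT : Good st T C) (a : A) : ∑' x, T (x + a) ^ 2 ≤ C := by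
  exact ((Equiv.addRight a).tsum_eq (fun x => T x ^ 2)).trans_le hT.sq

lemma bubble (hT : Good st T C) (a b : A) : ∑' x, T (x + a) * T (x + b) ≤ 2 * C := by
  calc _ ≤ ∑' x, (T (x + a) ^ 2 + T (x + b) ^ 2) :=
        ENNReal.tsum_le_tsum fun x => mul_le_sq_add_sq _ _
    _ ≤ 2 * C := by
        rw [ENNReal.tsum_add, two_mul]
        exact add_le_add (hT.sq_shift a) (hT.sq_shift b)

lemma mul_le (hT : Good st T C) (x a b : A) : T (x + a) * T (x + b) ≤ C * T (a - b) * (T (x + a) + T (x + b)) := by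
  refine mul_le_of_min_le ?_
  have := hT.inf (x + a) (-(x + b))
  rwa [hT.neg, show x + a + -(x + b) = a - b by abel] at this

lemma star (hT : Good st T C) (a b c : A) : ∑' x, T (x + a) * T (x + b) * T (x + c) ≤ 4 * C ^ 2 * T (a - b) := by
  calc _ ≤ ∑' x, C * T (a - b) * (T (x + a) * T (x + c) + T (x + b) * T (x + c)) :=
        ENNReal.tsum_le_tsum fun x => by
          rw [← add_mul, ← mul_assoc]
          exact mul_le_mul_left (hT.mul_le x a b) _
    _ ≤ C * T (a - b) * (2 * C + 2 * C) := by
        rw [ENNReal.tsum_mul_left, ENNReal.tsum_add]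
        gcongr
        · exact hT.bubble a c
        · exact hT.bubble b c
    _ = _ := by ring

lemma double_star (hT : Good st T C) (x y : A) :
    ∑' w, T w * (T (x - y + w) ^ 2 * T (y - w)) ≤ 8 * C ^ 3 * (T x * T (x - y)) := by
  have e : ∀ w, T (y - w) = T (w + -y) := fun w => by rw [← hT.neg]; congr 1; abel
  calc _ ≤ ∑' w, C * T x * (C * T (x - y)) * (
        (T (w + (x - y)) * T (w + (x - y)) + T (w + (x - y)) * T (w + 0)) +
        (T (w + -y) * T (w + (x - y)) + T (w + -y) * T (w + 0))) :=
        ENNReal.tsum_le_tsum fun w => by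
          have h1 := hT.mul_le w (x - y) (-y)
          have h2 := hT.mul_le w (x - y) 0
          rw [show x - y - -y = x by abel] at h1
          rw [sub_zero] at h2
          rw [e, add_comm (x - y) w]
          calc _ = T (w + (x - y)) * T (w + -y) * (T (w + (x - y)) * T (w + 0)) := by
                rw [add_zero]; ring
            _ ≤ _ := mul_le_mul' h1 h2
            _ = _ := by ring
    _ ≤ C * T x * (C * T (x - y)) * ((2 * C + 2 * C) + (2 * C + 2 * C)) := by
        rw [ENNReal.tsum_mul_left, ENNReal.tsum_add, ENNReal.tsum_add, ENNReal.tsum_add]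
        gcongr <;> exact hT.bubble _ _
    _ = _ := by ring

end Good

end Lines

section Expansion

variable {E A : Type*} [DecidableEq E] [AddCommGroup A] [DecidableEq A]

lemma hits_eq (st : E → A) (p : List E) (x : A) : (hits st p x : ℝ≥0∞) =
    splitSum (fun _ s => if s ≠ [] ∧ disp st s + x = 0 then 1 else 0) p := by
  induction p with
  | nil => simp [hits, splitSum_nil]
  | cons e p ih =>
    rw [splitSum_cons, ← ih]
    simp [hits]

lemma cross_eq (st : E → A) (p : List E) (x : A) (l : List E) : (cross st p x l : ℝ≥0∞) =
    splitSum (fun t _ => if t ≠ [] then (hits st p (x + disp st t) : ℝ≥0∞) else 0) l := by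
  induction l generalizing x with
  | nil => simp [cross, splitSum_nil]
  | cons e l ih =>
    rw [splitSum_cons]
    simp only [cross, Nat.cast_add, ih, ne_eq, reduceCtorEq, not_false_eq_true, if_true, disp_cons,
      not_true, if_false, add_zero, add_assoc]
    cases l with
    | nil => simp [splitSum_nil]
    | cons f l => rw [splitSum_cons, splitSum_cons]; simp; ring

lemma tsum_le_of_trunc {f : List E → ℝ≥0∞} {c : ℝ≥0∞}
    (h : ∀ n, ∑' l : List E, (if l.length < n then f l else 0) ≤ c) : ∑' l, f l ≤ c := by
  rw [ENNReal.tsum_eq_iSup_sum]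
  refine iSup_le fun s => ?_
  refine le_trans ?_ (h (s.sup List.length + 1))
  refine le_trans (Finset.sum_le_sum fun l hl => ?_) (ENNReal.sum_le_tsum s)
  rw [if_pos]
  exact Nat.lt_succ_of_le (Finset.le_sup hl)

/-- Hypotheses on a kernel: it vanishes unless the endpoint of the walk hits the past. -/
structure Kern (st : E → A) (W : List E → ℝ≥0∞) (b : ℝ≥0∞) (k : List E → List E → ℝ≥0∞) :
    Prop where
  nil : ∀ p, k p [] = 0
  le : ∀ p l, k p l ≤ b * hits st p (disp st l) * W l

variable {st : E → A} {W : List E → ℝ≥0∞} {T : A → ℝ≥0∞} {C b : ℝ≥0∞}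
  {k : List E → List E → ℝ≥0∞}

/-- One step of the recursion, with truncation. -/
lemma trunc_step (hk : Kern st W b k) (φ : A → ℝ≥0∞) {y v : List E → List E → ℝ≥0∞}
    (hy : ∀ p l, y p l ≤ v p l + splitSum (fun a s => k p a * y a s) l) (n : ℕ) (p : List E) :
    ∑' l : List E, (if l.length < n + 1 then y p l * φ (disp st l) else 0) ≤
      ∑' l, v p l * φ (disp st l) + ∑' a, k p a *
        ∑' s : List E, (if s.length < n then y a s * φ (disp st a + disp st s) else 0) := by
  calc _ ≤ ∑' l : List E, (v p l * φ (disp st l) + splitSum (fun a s => k p a *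
          (if s.length < n then y a s * φ (disp st a + disp st s) else 0)) l) := by
        refine ENNReal.tsum_le_tsum fun l => ?_
        split_ifs with h
        · refine (mul_le_mul_left (hy p l) _).trans ?_
          rw [add_mul]
          gcongr
          rw [mul_comm, mul_splitSum]
          refine splitSum_mono l fun a s has => ?_
          by_cases ha : a = []
          · simp [ha, hk.nil]
          · have : s.length < n := by
              have := List.length_pos_of_ne_nil ha
              have := congrArg List.length has
              simp at this
              omega
            rw [if_pos this, ← has, disp_append]
            exact le_of_eq (by ring)
        · exact zero_le
    _ = _ := by
        rw [ENNReal.tsum_add, tsum_splitSum']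
        simp only [ENNReal.tsum_mul_left]

lemma tsum_kern_le (hk : Kern st W b k) (p : List E) (f : List E → ℝ≥0∞) :
    ∑' a, k p a * f a ≤ b * splitSum (fun _ s => if s ≠ [] then
      ∑' a, (if disp st a = -disp st s then W a * f a else 0) else 0) p := by
  calc _ ≤ ∑' a, b * splitSum (fun _ s => if s ≠ [] then
        (if disp st a = -disp st s then W a * f a else 0) else 0) p := by
        refine ENNReal.tsum_le_tsum fun a => ?_
        refine (mul_le_mul_left (hk.le p a) _).trans ?_
        rw [mul_assoc, mul_assoc]
        gcongr
        rw [mul_comm, hits_eq, mul_splitSum]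
        refine splitSum_mono _ fun _ s _ => ?_
        simp only [mul_ite, mul_one, mul_zero, ← ite_and]
        refine le_of_eq (if_congr (and_congr_right fun _ => ?_) rfl rfl)
        rw [add_comm, add_eq_zero_iff_eq_neg]
    _ = _ := by
        rw [ENNReal.tsum_mul_left]
        congr 1
        simp only [splitSum_eq_sum]
        rw [Summable.tsum_finsetSum fun _ _ => ENNReal.summable]
        refine Finset.sum_congr rfl fun i _ => ?_
        split_ifs <;> simp

/-- Bound on the inverse kernel, by a supersolution of its recursion. -/
lemma tsum_disp_le (hT : Good st T C) (hW : ∀ l l', W (l ++ l') ≤ W l * W l') (hl : Line st W T)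
    (hk : Kern st W b k) (hb : 16 * b * C ^ 3 ≤ 1) {y : List E → List E → ℝ≥0∞}
    (hy : ∀ p l, y p l ≤ (if l = [] then 1 else 0) + splitSum (fun a s => k p a * y a s) l)
    (p : List E) (x : A) :
    ∑' l, (if disp st l = x then y p l else 0) ≤ (if x = 0 then 1 else 0) +
      2 * b * T x * splitSum (fun _ s => if s ≠ [] then T (x + disp st s) ^ 2 else 0) p := by
  refine tsum_le_of_trunc fun n => ?_
  induction n generalizing p x with
  | zero => simp
  | succ n ih =>
    have h1 := trunc_step (v := fun _ l => if l = [] then 1 else 0) hk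
      (fun z => if z = x then 1 else 0) hy n p
    have h2 : ∀ c : ℝ≥0∞, ∀ z : A, c * (if z = x then 1 else 0) = if z = x then c else 0 := by simp
    simp only [h2] at h1
    refine h1.trans ?_
    rw [tsum_eq_single ([] : List E) (by intro l h; simp [h])]
    simp only [if_true, disp_nil, eq_comm (a := (0 : A)), mul_assoc]
    gcongr
    calc _ ≤ ∑' a, k p a * ((if x - disp st a = 0 then 1 else 0) +
          2 * b * T (x - disp st a) * splitSum (fun _ s => if s ≠ [] then
            T (x - disp st a + disp st s) ^ 2 else 0) a) := by
          gcongr with a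
          refine le_trans (le_of_eq (tsum_congr fun s => ?_)) (ih a (x - disp st a))
          simp only [eq_sub_iff_add_eq']
      _ ≤ b * splitSum (fun _ s => if s ≠ [] then 2 * T x * T (x + disp st s) ^ 2 else 0) p := by
          refine (tsum_kern_le hk p _).trans ?_
          gcongr
          refine splitSum_mono _ fun _ s _ => ?_
          split_ifs with hs
          swap
          · exact le_rfl
          obtain ⟨y, hy⟩ : ∃ y, y = -disp st s := ⟨_, rfl⟩
          rw [show x + disp st s = x - y by rw [hy]; abel, ← hy]
          calc _ = ∑' a, ((if disp st a = y then W a else 0) * (if x - y = 0 then 1 else 0) +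
                2 * b * T (x - y) * ((if disp st a = y then W a else 0) *
                  splitSum (fun _ s => if s ≠ [] then T (x - y + disp st s) ^ 2 else 0) a)) := by
                refine tsum_congr fun a => ?_
                by_cases h : disp st a = y
                · simp only [h, if_true]; ring
                · simp [h]
            _ ≤ T x * T (x - y) ^ 2 + 2 * b * T (x - y) * (8 * C ^ 3 * (T x * T (x - y))) := by
                rw [ENNReal.tsum_add, ENNReal.tsum_mul_right, ENNReal.tsum_mul_left]
                refine add_le_add ?_ (mul_le_mul_right ?_ _)
                · by_cases h : x - y = 0
                  · rw [if_pos h, h, sub_eq_zero.1 h]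
                    exact mul_le_mul' (hl y) (one_le_pow₀ hT.zero)
                  · simp [h]
                · rw [tsum_splitSum]
                  calc _ ≤ ∑' a, ∑' s, W s * T (x - y + disp st s) ^ 2 *
                        (if disp st a = y - disp st s then W a else 0) := by
                        refine ENNReal.tsum_le_tsum fun a => ENNReal.tsum_le_tsum fun s => ?_
                        simp only [disp_append, eq_sub_iff_add_eq]
                        split_ifs
                        · calc _ ≤ W a * W s * T (x - y + disp st s) ^ 2 :=
                              mul_le_mul_left (hW a s) _
                            _ = _ := by ring
                        all_goals simp
                    _ ≤ ∑' s, W s * (T (x - y + disp st s) ^ 2 * T (y - disp st s)) := by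
                        rw [ENNReal.tsum_comm]
                        refine ENNReal.tsum_le_tsum fun s => ?_
                        rw [ENNReal.tsum_mul_left, mul_assoc]
                        gcongr
                        exact hl _
                    _ ≤ _ := (hl.tsum_le (fun z => T (x - y + z) ^ 2 * T (y - z))).trans
                        (hT.double_star x y)
            _ = T x * T (x - y) ^ 2 + 16 * b * C ^ 3 * (T x * T (x - y) ^ 2) := by ring
            _ ≤ T x * T (x - y) ^ 2 + 1 * (T x * T (x - y) ^ 2) := by gcongr
            _ = _ := by ring
      _ = _ := by
          simp only [mul_splitSum, mul_ite, mul_zero]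
          congr 1
          funext _ s
          split_ifs <;> ring

/-- The total mass of the inverse kernel. -/
lemma tsum_le_splitSum (hT : Good st T C) (hW : ∀ l l', W (l ++ l') ≤ W l * W l')
    (hl : Line st W T) (hk : Kern st W b k) (hb : 16 * b * C ^ 3 ≤ 1)
    {y : List E → List E → ℝ≥0∞}
    (hy : ∀ p l, y p l ≤ (if l = [] then 1 else 0) + splitSum (fun a s => k p a * y a s) l)
    (p : List E) : ∑' l, y p l ≤ splitSum (fun _ s => T (disp st s)) p := by
  have h1 : ∑' l, y p l = ∑' x, ∑' l, (if disp st l = x then y p l else 0) := by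
    rw [ENNReal.tsum_comm]
    refine tsum_congr fun l => ?_
    rw [tsum_eq_single (disp st l) (by intro x hx; simp [hx.symm])]
    simp
  rw [h1]
  calc _ ≤ ∑' x, ((if x = 0 then 1 else 0) + 2 * b * T x *
        splitSum (fun _ s => if s ≠ [] then T (x + disp st s) ^ 2 else 0) p) :=
        ENNReal.tsum_le_tsum fun x => tsum_disp_le hT hW hl hk hb hy p x
    _ = 1 + 2 * b * splitSum (fun _ s => if s ≠ [] then
        ∑' x, T x * T (x + disp st s) ^ 2 else 0) p := by
        rw [ENNReal.tsum_add, tsum_ite_eq]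
        simp only [mul_assoc, ENNReal.tsum_mul_left]
        congr 3
        simp only [splitSum_eq_sum, Finset.mul_sum]
        rw [Summable.tsum_finsetSum fun _ _ => ENNReal.summable]
        refine Finset.sum_congr rfl fun i _ => ?_
        split_ifs <;> simp
    _ ≤ 1 + splitSum (fun _ s => if s ≠ [] then T (disp st s) else 0) p := by
        rw [mul_splitSum]
        gcongr
        refine splitSum_mono _ fun _ s _ => ?_
        split_ifs with h
        · have := hT.star 0 (disp st s) (disp st s)
          rw [zero_sub, hT.neg] at this
          calc _ ≤ 2 * b * (4 * C ^ 2 * T (disp st s)) := by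
                gcongr
                simpa [sq, mul_assoc] using this
            _ = 8 * b * (C ^ 2 * 1) * T (disp st s) := by ring
            _ ≤ 16 * b * (C ^ 2 * C) * T (disp st s) := by
                gcongr
                · norm_num
                · exact hT.one_le
            _ = 16 * b * C ^ 3 * T (disp st s) := by ring
            _ ≤ 1 * T (disp st s) := by gcongr
            _ = _ := one_mul _
        · simp
    _ ≤ splitSum (fun _ s => if s = [] then 1 else 0) p +
          splitSum (fun _ s => if s ≠ [] then T (disp st s) else 0) p := by
        gcongr
        rw [splitSum_eq_sum, Finset.sum_range_succ]
        simp
    _ ≤ _ := by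
        rw [← splitSum_add]
        refine splitSum_mono _ fun _ s _ => ?_
        split_ifs with h h'
        · exact absurd h h'
        · simpa [h] using hT.zero
        · simp

/-- Forward iteration of the kernel. -/
lemma tsum_mul_le_of_forward (hk : Kern st W b k) {D v : List E → List E → ℝ≥0∞}
    (hD : ∀ p l, D p l ≤ v p l + splitSum (fun a s => k p a * D a s) l) {f F : List E → ℝ≥0∞}
    (hF : ∀ l, f l + ∑' p, F p * k p l ≤ F l) :
    ∑' p, f p * ∑' l, D p l ≤ ∑' p, F p * ∑' l, v p l := by
  have key : ∀ n : ℕ, ∀ f F : List E → ℝ≥0∞, (∀ l, f l + ∑' p, F p * k p l ≤ F l) →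
      ∑' p, f p * ∑' l : List E, (if l.length < n then D p l else 0) ≤
        ∑' p, F p * ∑' l, v p l := by
    intro n
    induction n with
    | zero => simp
    | succ n ih =>
      intro f F hF
      have h3 := ih (fun l => ∑' p, f p * k p l) (fun l => ∑' p, F p * k p l) (by
        intro l
        calc _ = ∑' p, f p * k p l + ∑' q, ∑' p, F p * k p q * k q l := by
              simp only [ENNReal.tsum_mul_right]
          _ = ∑' p, (f p + ∑' q, F q * k q p) * k p l := by
              rw [← ENNReal.tsum_add]
              simp only [add_mul, ENNReal.tsum_mul_right]
          _ ≤ _ := ENNReal.tsum_le_tsum fun p => mul_le_mul_left (hF p) _)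
      calc _ ≤ ∑' p, f p * (∑' l, v p l +
            ∑' a, k p a * ∑' s : List E, (if s.length < n then D a s else 0)) := by
            gcongr with p
            have := trunc_step hk (fun _ => 1) hD n p
            simpa only [mul_one] using this
        _ = ∑' p, f p * ∑' l, v p l +
            ∑' a, (∑' p, f p * k p a) * ∑' s : List E, (if s.length < n then D a s else 0) := by
            simp only [mul_add, ENNReal.tsum_add, ← ENNReal.tsum_mul_left, ← ENNReal.tsum_mul_right]
            congr 1
            rw [ENNReal.tsum_comm]
            refine tsum_congr fun a => ?_
            rw [ENNReal.tsum_comm]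
            simp only [mul_assoc]
        _ ≤ ∑' p, f p * ∑' l, v p l + ∑' l, (∑' p, F p * k p l) * ∑' s, v l s := by gcongr
        _ = ∑' l, (f l + ∑' p, F p * k p l) * ∑' s, v l s := by
            rw [← ENNReal.tsum_add]
            simp only [add_mul]
        _ ≤ _ := ENNReal.tsum_le_tsum fun p => mul_le_mul_left (hF p) _
  have e : ∀ D : List E → List E → ℝ≥0∞,
      ∑' p, f p * ∑' l, D p l = ∑' l, ∑' p, f p * D p l := by
    intro D
    simp only [← ENNReal.tsum_mul_left]
    rw [ENNReal.tsum_comm]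
  rw [e]
  refine tsum_le_of_trunc fun n => ?_
  refine le_trans (le_of_eq ?_) (key n f F hF)
  rw [e]
  refine tsum_congr fun l => ?_
  split_ifs <;> simp

lemma forward_supersolution (hT : Good st T C) (hW : ∀ l l', W (l ++ l') ≤ W l * W l')
    (hl : Line st W T) (hk : Kern st W b k) (hb : 16 * b * C ^ 3 ≤ 1) (l : List E) :
    (if l.length = 1 then W l else 0) + ∑' p, 2 * (W p * T (disp st p) ^ 2) * k p l ≤
      2 * (W l * T (disp st l) ^ 2) := by
  have h1 : (if l.length = 1 then W l else 0) ≤ W l * T (disp st l) ^ 2 := by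
    split_ifs with h
    · obtain ⟨e, rfl⟩ := List.length_eq_one_iff.1 h
      refine le_mul_of_one_le_right' (one_le_pow₀ ?_)
      simpa using hT.step e
    · exact zero_le
  have h2 : ∑' p, 2 * (W p * T (disp st p) ^ 2) * k p l ≤ W l * T (disp st l) ^ 2 := by
    obtain ⟨y, hy⟩ : ∃ y, y = disp st l := ⟨_, rfl⟩
    rw [← hy]
    calc _ ≤ ∑' p, 2 * b * W l * (W p * T (disp st p) ^ 2 * hits st p y) := by
          refine ENNReal.tsum_le_tsum fun p => ?_
          refine (mul_le_mul_right (hk.le p l) _).trans (le_of_eq ?_)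
          rw [hy]; ring
      _ ≤ 2 * b * W l * (4 * C ^ 2 * T y * T y) := by
          rw [ENNReal.tsum_mul_left]
          gcongr
          simp only [hits_eq]
          rw [tsum_splitSum (fun p => W p * T (disp st p) ^ 2)]
          calc _ ≤ ∑' a, ∑' s, W a * (T (disp st a + -y) * T (disp st a + -y)) *
                (if disp st s = -y then W s else 0) := by
                refine ENNReal.tsum_le_tsum fun a => ENNReal.tsum_le_tsum fun s => ?_
                simp only [← eq_neg_iff_add_eq_zero]
                by_cases h : disp st s = -y
                · simp only [h, disp_append, and_true, if_true]
                  split_ifs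
                  · rw [mul_one, sq, mul_right_comm]
                    gcongr
                    exact hW a s
                  · simp
                · simp [h]
            _ ≤ ∑' a, W a * (T (disp st a + -y) * T (disp st a + -y)) * T (-y) := by
                simp only [ENNReal.tsum_mul_left]
                gcongr
                exact hl _
            _ ≤ _ := by
                rw [ENNReal.tsum_mul_right, hT.neg]
                gcongr
                refine (hl.tsum_le (fun z => T (z + -y) * T (z + -y))).trans ?_
                have := hT.star 0 (-y) (-y)
                simpa [mul_assoc] using this
      _ = 8 * b * (C ^ 2 * 1) * (W l * T y ^ 2) := by ring
      _ ≤ 16 * b * (C ^ 2 * C) * (W l * T y ^ 2) := by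
          gcongr
          · norm_num
          · exact hT.one_le
      _ = 16 * b * C ^ 3 * (W l * T y ^ 2) := by ring
      _ ≤ 1 * (W l * T y ^ 2) := by gcongr
      _ = _ := one_mul _
  rw [two_mul]
  exact add_le_add h1 h2

end Expansion

end WSAW

namespace WSAW

section Vacuum

variable {E A : Type*} [AddCommGroup A] [DecidableEq A] {st : E → A} {T : A → ℝ≥0∞} {C : ℝ≥0∞}

lemma tsum_le_of_elim {α : Type*} {f : α → α → α → ℝ≥0∞} {g : α → α → ℝ≥0∞} {h : α → ℝ≥0∞}
    {c : ℝ≥0∞} (h0 : ∀ y w, ∑' x, f x y w ≤ g y w) (h1 : ∀ w, ∑' y, g y w ≤ h w)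
    (h2 : ∑' w, h w ≤ c) : ∑' x, ∑' y, ∑' w, f x y w ≤ c := by
  calc ∑' x, ∑' y, ∑' w, f x y w = ∑' w, ∑' y, ∑' x, f x y w := by
        rw [ENNReal.tsum_comm, tsum_congr fun y => ENNReal.tsum_comm, ENNReal.tsum_comm]
    _ ≤ ∑' w, ∑' y, g y w :=
        ENNReal.tsum_le_tsum fun w => ENNReal.tsum_le_tsum fun y => h0 y w
    _ ≤ ∑' w, h w := ENNReal.tsum_le_tsum h1
    _ ≤ c := h2

namespace Good

lemma bubble_le (hT : Good st T C) (c : ℝ≥0∞) (a b : A) {f : A → ℝ≥0∞} (hf : ∀ x, f x = c * (T (x + a) * T (x + b))) :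
    ∑' x, f x ≤ c * (2 * C) := by
  rw [tsum_congr hf, ENNReal.tsum_mul_left]
  exact mul_le_mul_right (hT.bubble a b) _

lemma star_le (hT : Good st T C) (c : ℝ≥0∞) (a b e : A) {f : A → ℝ≥0∞}
    (hf : ∀ x, f x = c * (T (x + a) * T (x + b) * T (x + e))) :
    ∑' x, f x ≤ c * (4 * C ^ 2 * T (a - b)) := by
  rw [tsum_congr hf, ENNReal.tsum_mul_left]
  exact mul_le_mul_right (hT.star a b e) _

lemma sq_le (hT : Good st T C) (c : ℝ≥0∞) {f : A → ℝ≥0∞} (hf : ∀ x, f x = c * T x ^ 2) : ∑' x, f x ≤ c * C := by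
  rw [tsum_congr hf, ENNReal.tsum_mul_left]
  exact mul_le_mul_right hT.sq _

lemma pow_le_pow (hT : Good st T C) {m n : ℕ} (h : m ≤ n) : C ^ m ≤ C ^ n := pow_le_pow_right₀ hT.one_le h

/-- Comparison of the constants. -/
lemma const_le (hT : Good st T C) {a : ℝ≥0∞} {m : ℕ} (ha : a ≤ 16) (hm : m ≤ 5) : a * C ^ m ≤ 16 * C ^ 5 :=
  mul_le_mul' ha (hT.pow_le_pow hm)

lemma vac1 (hT : Good st T C) : ∑' x, ∑' y, ∑' s, T x * T y * T s * T s * T (x + (y + s)) ^ 2 ≤ 16 * C ^ 5 := by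
  refine (tsum_le_of_elim
    (fun y s => hT.star_le (T y * T s * T s) (y + s) 0 (y + s) fun x => by rw [add_zero]; ring)
    (fun s => hT.bubble_le (T s ^ 2 * (4 * C ^ 2)) 0 s fun y => by rw [sub_zero, add_zero]; ring)
    (hT.sq_le (8 * C ^ 3) fun s => by ring)).trans ?_
  exact le_trans (le_of_eq (by ring)) (hT.const_le (a := 8) (m := 4) (by norm_num) (by norm_num))

lemma vac2 (hT : Good st T C) : ∑' a, ∑' x, ∑' y, T x * T y * T a * T (a + -y) * T (x + y) ^ 2 ≤ 16 * C ^ 5 := by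
  refine (tsum_le_of_elim
    (fun x y => hT.bubble_le (T x * T y * T (x + y) ^ 2) 0 (-y) fun a => by rw [add_zero]; ring)
    (fun y => hT.star_le (T y * (2 * C)) y 0 y fun x => by rw [add_zero]; ring)
    (hT.sq_le (8 * C ^ 3) fun s => by rw [sub_zero]; ring)).trans ?_
  exact le_trans (le_of_eq (by ring)) (hT.const_le (a := 8) (m := 4) (by norm_num) (by norm_num))

lemma vac3 (hT : Good st T C) : ∑' x, ∑' w, ∑' y, T x * T w * T y * T (w + y) * T (x + (w + y)) ^ 2 ≤ 16 * C ^ 5 := by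
  refine (tsum_le_of_elim
    (fun w y => hT.star_le (T w * T y * T (w + y)) (w + y) 0 (w + y) fun x => by
      rw [add_zero]; ring)
    (fun y => hT.star_le (T y * (4 * C ^ 2)) y 0 y fun w => by rw [sub_zero, add_zero]; ring)
    (hT.sq_le (16 * C ^ 4) fun s => by rw [sub_zero]; ring)).trans ?_
  exact le_trans (le_of_eq (by ring)) (hT.const_le (a := 16) (m := 5) (by norm_num) (by norm_num))

lemma vac4 (hT : Good st T C) : ∑' x, ∑' y, ∑' w, T x * T y * T w * T w * T (y + w) * T (x + (y + w)) ≤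
    16 * C ^ 5 := by
  refine (tsum_le_of_elim
    (fun y w => hT.bubble_le (T y * T w * T w * T (y + w)) 0 (y + w) fun x => by
      rw [add_zero]; ring)
    (fun w => hT.bubble_le (T w * T w * (2 * C)) 0 w fun y => by rw [add_zero]; ring)
    (hT.sq_le (4 * C ^ 2) fun s => by ring)).trans ?_
  exact le_trans (le_of_eq (by ring)) (hT.const_le (a := 4) (m := 3) (by norm_num) (by norm_num))

lemma vac5 (hT : Good st T C) : ∑' x, ∑' y, ∑' w, T y * T w * T w * T (x + y) * T (y + w) * T (x + (y + w)) ≤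
    16 * C ^ 5 := by
  refine (tsum_le_of_elim
    (fun y w => hT.bubble_le (T y * T w * T w * T (y + w)) y (y + w) fun x => by ring)
    (fun w => hT.bubble_le (T w * T w * (2 * C)) 0 w fun y => by rw [add_zero]; ring)
    (hT.sq_le (4 * C ^ 2) fun s => by ring)).trans ?_
  exact le_trans (le_of_eq (by ring)) (hT.const_le (a := 4) (m := 3) (by norm_num) (by norm_num))

lemma vac6 (hT : Good st T C) : ∑' x, ∑' y, ∑' w, T x * T w * T w * T (x + y) * T (y + w) * T (x + (y + w)) ≤
    16 * C ^ 5 := by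
  refine (tsum_le_of_elim
    (fun y w => hT.star_le (T w * T w * T (y + w)) (y + w) 0 y fun x => by rw [add_zero]; ring)
    (fun w => hT.bubble_le (T w * T w * (4 * C ^ 2)) w w fun y => by rw [sub_zero]; ring)
    (hT.sq_le (8 * C ^ 3) fun s => by ring)).trans ?_
  exact le_trans (le_of_eq (by ring)) (hT.const_le (a := 8) (m := 4) (by norm_num) (by norm_num))

lemma vac7 (hT : Good st T C) : ∑' x, ∑' y, ∑' w, T x * T x * T y * T w * T w * T (x + (y + w)) ≤
    16 * C ^ 5 := by
  refine (tsum_le_of_elim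
    (fun y w => hT.star_le (T y * T w * T w) (y + w) 0 0 fun x => by rw [add_zero]; ring)
    (fun w => hT.bubble_le (T w * T w * (4 * C ^ 2)) 0 w fun y => by
      rw [sub_zero, add_zero]; ring)
    (hT.sq_le (8 * C ^ 3) fun s => by ring)).trans ?_
  exact le_trans (le_of_eq (by ring)) (hT.const_le (a := 8) (m := 4) (by norm_num) (by norm_num))

lemma vac8 (hT : Good st T C) : ∑' x, ∑' y, ∑' w, T x * T x * T y * T w * T w * T (y + w) ≤ 16 * C ^ 5 := by
  refine (tsum_le_of_elim
    (fun y w => hT.sq_le (T y * T w * T w * T (y + w)) fun x => by ring)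
    (fun w => hT.bubble_le (T w * T w * C) 0 w fun y => by rw [add_zero]; ring)
    (hT.sq_le (2 * C ^ 2) fun s => by ring)).trans ?_
  exact le_trans (le_of_eq (by ring)) (hT.const_le (a := 2) (m := 3) (by norm_num) (by norm_num))

lemma vac9 (hT : Good st T C) : ∑' x, ∑' y, ∑' w, T x * T y * T w * T (x + y) * T (y + w) * T (x + (y + w)) ≤
    16 * C ^ 5 := by
  refine (tsum_le_of_elim
    (fun y w => hT.star_le (T y * T w * T (y + w)) (y + w) y 0 fun x => by rw [add_zero]; ring)
    (fun w => hT.bubble_le (T w * T w * (4 * C ^ 2)) 0 w fun y => by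
      rw [add_sub_cancel_left, add_zero]; ring)
    (hT.sq_le (8 * C ^ 3) fun s => by ring)).trans ?_
  exact le_trans (le_of_eq (by ring)) (hT.const_le (a := 8) (m := 4) (by norm_num) (by norm_num))

lemma vac10 (hT : Good st T C) : ∑' x, ∑' y, ∑' w, T x * T y * T w * T w * T (x + y) * T (y + w) ≤
    16 * C ^ 5 := by
  refine (tsum_le_of_elim
    (fun y w => hT.bubble_le (T y * T w * T w * T (y + w)) 0 y fun x => by rw [add_zero]; ring)
    (fun w => hT.bubble_le (T w * T w * (2 * C)) 0 w fun y => by rw [add_zero]; ring)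
    (hT.sq_le (4 * C ^ 2) fun s => by ring)).trans ?_
  exact le_trans (le_of_eq (by ring)) (hT.const_le (a := 4) (m := 3) (by norm_num) (by norm_num))

end Good

end Vacuum

end WSAW

namespace WSAW

section LineSums

variable {E A : Type*} [AddCommGroup A] [DecidableEq A] {st : E → A}
  {w₁ w₂ w₃ w₄ w₅ : List E → ℝ≥0∞} {t₁ t₂ t₃ t₄ t₅ : A → ℝ≥0∞}

lemma Line.tsum₂_le (h₁ : Line st w₁ t₁) (h₂ : Line st w₂ t₂) (f : A → A → ℝ≥0∞) :
    ∑' a, ∑' b, w₁ a * (w₂ b * f (disp st a) (disp st b)) ≤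
      ∑' x, ∑' y, t₁ x * (t₂ y * f x y) := by
  simp only [ENNReal.tsum_mul_left]
  exact (h₁.tsum_le fun x => ∑' b, w₂ b * f x (disp st b)).trans
    (ENNReal.tsum_le_tsum fun x => mul_le_mul_right (h₂.tsum_le _) _)

lemma Line.tsum₃_le (h₁ : Line st w₁ t₁) (h₂ : Line st w₂ t₂) (h₃ : Line st w₃ t₃)
    (f : A → A → A → ℝ≥0∞) :
    ∑' a, ∑' b, ∑' c, w₁ a * (w₂ b * (w₃ c * f (disp st a) (disp st b) (disp st c))) ≤
      ∑' x, ∑' y, ∑' z, t₁ x * (t₂ y * (t₃ z * f x y z)) := by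
  simp only [ENNReal.tsum_mul_left]
  exact (h₁.tsum_le fun x => ∑' b, w₂ b * ∑' c, w₃ c * f x (disp st b) (disp st c)).trans
    (ENNReal.tsum_le_tsum fun x => mul_le_mul_right ((h₂.tsum_le fun y =>
      ∑' c, w₃ c * f x y (disp st c)).trans
      (ENNReal.tsum_le_tsum fun y => mul_le_mul_right (h₃.tsum_le _) _)) _)

/-- A sum over two free and a constrained walk. -/
lemma Line.tsum₂₁_le (h₁ : Line st w₁ t₁) (h₂ : Line st w₂ t₂) (h₄ : Line st w₄ t₄)
    (Y : A → A → A) (f : A → A → ℝ≥0∞) :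
    ∑' a, ∑' b, ∑' p, w₁ a * (w₂ b * ((w₄ p *
      if disp st p = Y (disp st a) (disp st b) then 1 else 0) *
      f (disp st a) (disp st b))) ≤
      ∑' x, ∑' y, t₁ x * (t₂ y * (t₄ (Y x y) * f x y)) := by
  refine le_trans ?_ (h₁.tsum₂_le h₂ fun x y => t₄ (Y x y) * f x y)
  refine ENNReal.tsum_le_tsum fun a => ENNReal.tsum_le_tsum fun b => ?_
  simp only [ENNReal.tsum_mul_left, ENNReal.tsum_mul_right]
  gcongr
  exact h₄.tsum_ite_le _

/-- A sum over three free and a constrained walk. -/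
lemma Line.tsum₃₁_le (h₁ : Line st w₁ t₁) (h₂ : Line st w₂ t₂) (h₃ : Line st w₃ t₃)
    (h₄ : Line st w₄ t₄) (Y : A → A → A → A) (f : A → A → A → ℝ≥0∞) :
    ∑' a, ∑' b, ∑' c, ∑' p, w₁ a * (w₂ b * (w₃ c * ((w₄ p *
      if disp st p = Y (disp st a) (disp st b) (disp st c) then 1 else 0) *
      f (disp st a) (disp st b) (disp st c)))) ≤
      ∑' x, ∑' y, ∑' z, t₁ x * (t₂ y * (t₃ z * (t₄ (Y x y z) * f x y z))) := by
  refine le_trans ?_ (h₁.tsum₃_le h₂ h₃ fun x y z => t₄ (Y x y z) * f x y z)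
  refine ENNReal.tsum_le_tsum fun a => ENNReal.tsum_le_tsum fun b => ENNReal.tsum_le_tsum fun c => ?_
  simp only [ENNReal.tsum_mul_left, ENNReal.tsum_mul_right]
  gcongr
  exact h₄.tsum_ite_le _

/-- A sum over three free and two constrained walks. -/
lemma Line.tsum₃₂_le (h₁ : Line st w₁ t₁) (h₂ : Line st w₂ t₂) (h₃ : Line st w₃ t₃)
    (h₄ : Line st w₄ t₄) (h₅ : Line st w₅ t₅) (Y Z : A → A → A → A) (f : A → A → A → ℝ≥0∞) :
    ∑' a, ∑' b, ∑' c, ∑' p, ∑' q, w₁ a * (w₂ b * (w₃ c * ((w₄ p *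
      if disp st p = Y (disp st a) (disp st b) (disp st c) then 1 else 0) * ((w₅ q *
      if disp st q = Z (disp st a) (disp st b) (disp st c) then 1 else 0) *
      f (disp st a) (disp st b) (disp st c))))) ≤
      ∑' x, ∑' y, ∑' z, t₁ x * (t₂ y * (t₃ z * (t₄ (Y x y z) * (t₅ (Z x y z) * f x y z)))) := by
  refine le_trans ?_ (h₁.tsum₃₁_le h₂ h₃ h₄ Y fun x y z => t₅ (Z x y z) * f x y z)
  refine ENNReal.tsum_le_tsum fun a => ENNReal.tsum_le_tsum fun b =>
    ENNReal.tsum_le_tsum fun c => ENNReal.tsum_le_tsum fun p => ?_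
  simp only [ENNReal.tsum_mul_left, ENNReal.tsum_mul_right]
  gcongr
  exact h₅.tsum_ite_le _

end LineSums

section Wrapping

open Classical in
/-- The restriction of a weight to long walks. -/
noncomputable def cut {E : Type*} (L : List E → Prop) (W : List E → ℝ≥0∞) (l : List E) : ℝ≥0∞ :=
  if L l then W l else 0

open Classical in
/-- The indicator function of a predicate on walks. -/
noncomputable def ind {E : Type*} (wr : List E → Prop) (l : List E) : ℝ≥0∞ := if wr l then 1 else 0

/-- A family `wr` of closed walks such that one of any four pieces of such a walk is long. -/
structure Wrap {E A : Type*} [AddCommGroup A] (st : E → A) (wr L : List E → Prop) : Prop where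
  disp : ∀ l, wr l → disp st l = 0
  nil : ¬ L []
  long : ∀ a b c e, wr (a ++ (b ++ (c ++ e))) → L a ∨ L b ∨ L c ∨ L e

namespace Wrap

variable {E A : Type*} [AddCommGroup A] [DecidableEq A] {st : E → A} {wr L : List E → Prop}
  (W : List E → ℝ≥0∞)

lemma ind_mul₁ (h : Wrap st wr L) (a : List E) (u : ℝ≥0∞) :
    ind wr a * (W a * u) ≤ (cut L W a * if WSAW.disp st a = 0 then 1 else 0) * u := by
  by_cases hw : wr a
  · have := h.long a [] [] [] (by simpa using hw)
    have h0 := h.disp _ hw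
    simp_all [ind, cut, h.nil]
  · simp [ind, hw]

lemma ind_mul₄ (h : Wrap st wr L) (a b c e : List E) (u : ℝ≥0∞) :
    ind wr (a ++ (b ++ (c ++ e))) * (W a * (W b * (W c * (W e * u)))) ≤
      (if WSAW.disp st a + (WSAW.disp st b + (WSAW.disp st c + WSAW.disp st e)) = 0 then 1 else 0) *
      (cut L W a * (W b * (W c * (W e * u))) + W a * (cut L W b * (W c * (W e * u))) +
       W a * (W b * (cut L W c * (W e * u))) + W a * (W b * (W c * (cut L W e * u)))) := by
  by_cases hw : wr (a ++ (b ++ (c ++ e)))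
  · have h0 := h.disp _ hw
    simp only [disp_append] at h0
    rw [if_pos h0, ind, if_pos hw, one_mul, one_mul]
    rcases h.long a b c e hw with h1 | h1 | h1 | h1
    · exact le_add_right (le_add_right (le_add_right (by rw [cut, if_pos h1])))
    · exact le_add_right (le_add_right (le_add_left (by rw [cut, if_pos h1])))
    · exact le_add_right (le_add_left (by rw [cut, if_pos h1]))
    · exact le_add_left (by rw [cut, if_pos h1])
  · simp [ind, hw]

lemma cut_nil (h : Wrap st wr L) : cut L W [] = 0 := by simp [cut, h.nil]

lemma ind_mul₃ (h : Wrap st wr L) (hW : W [] = 1) (a b c : List E) (u : ℝ≥0∞) :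
    ind wr (a ++ (b ++ c)) * (W a * (W b * (W c * u))) ≤
      (if WSAW.disp st a + (WSAW.disp st b + WSAW.disp st c) = 0 then 1 else 0) *
      (cut L W a * (W b * (W c * u)) + W a * (cut L W b * (W c * u)) +
       W a * (W b * (cut L W c * u))) := by
  simpa [hW, h.cut_nil] using h.ind_mul₄ W a b c [] u

lemma ind_mul₂ (h : Wrap st wr L) (hW : W [] = 1) (a b : List E) (u : ℝ≥0∞) :
    ind wr (a ++ b) * (W a * (W b * u)) ≤
      (if WSAW.disp st a + WSAW.disp st b = 0 then 1 else 0) *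
      (cut L W a * (W b * u) + W a * (cut L W b * u)) := by
  simpa [hW, h.cut_nil] using h.ind_mul₃ W hW a b [] u

end Wrap

end Wrapping

end WSAW

namespace WSAW

section Diagrams

lemma ite_mul_ite_le {p q p' q' : Prop} [Decidable p] [Decidable q] [Decidable p'] [Decidable q']
    (h : p → q → p' ∧ q') : (if p then (1 : ℝ≥0∞) else 0) * (if q then 1 else 0) ≤
      (if p' then 1 else 0) * (if q' then 1 else 0) := by
  by_cases hp : p <;> by_cases hq : q <;> simp [hp, hq]
  simp [(h hp hq).1, (h hp hq).2]

lemma tsum₃_le_mul {α : Type*} {f g : α → α → α → ℝ≥0∞} {c k : ℝ≥0∞}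
    (hg : ∑' x, ∑' y, ∑' z, g x y z ≤ k) (hf : ∀ x y z, f x y z = c * g x y z) :
    ∑' x, ∑' y, ∑' z, f x y z ≤ c * k := by
  simp only [hf, ENNReal.tsum_mul_left]
  exact mul_le_mul_right hg _

variable {E A : Type*} [AddCommGroup A] [DecidableEq A] {st : E → A} {T : A → ℝ≥0∞}
  {C γ : ℝ≥0∞} {W : List E → ℝ≥0∞} {wr L : List E → Prop}

/-- The data used to bound the effect of wrapping. -/
structure WrapData (st : E → A) (T : A → ℝ≥0∞) (C γ : ℝ≥0∞) (W : List E → ℝ≥0∞)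
    (wr L : List E → Prop) : Prop where
  good : Good st T C
  sub : ∀ l l', W (l ++ l') ≤ W l * W l'
  one : W [] = 1
  line : Line st W T
  wrap : Wrap st wr L
  long : Line st (cut L W) fun _ => γ

namespace WrapData

lemma diagram₁₁ (D : WrapData st T C γ W wr L) : ∑' a, ∑' b, ∑' c, ∑' p, ∑' q, W a * (W b * (W c * (W p * (W q *
    ((if disp st p + disp st q + (disp st a + (disp st b + disp st c)) = 0 then 1 else 0) *
    ind wr (q ++ a) * (T (disp st a + (disp st b + disp st c)) * T (disp st c))))))) ≤
    2 * (γ * (16 * C ^ 5)) := by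
  have key : ∀ a b c p q, W a * (W b * (W c * (W p * (W q *
      ((if disp st p + disp st q + (disp st a + (disp st b + disp st c)) = 0 then 1 else 0) *
      ind wr (q ++ a) * (T (disp st a + (disp st b + disp st c)) * T (disp st c))))))) ≤
      W a * (W b * (W c * ((W p * if disp st p = -(disp st b + disp st c) then 1 else 0) *
        ((cut L W q * if disp st q = -disp st a then 1 else 0) *
        (T (disp st a + (disp st b + disp st c)) * T (disp st c)))))) +
      cut L W a * (W b * (W c * ((W p * if disp st p = -(disp st b + disp st c) then 1 else 0) *
        ((W q * if disp st q = -disp st a then 1 else 0) *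
        (T (disp st a + (disp st b + disp st c)) * T (disp st c)))))) := by
    intro a b c p q
    refine le_trans (le_of_eq ?_) (((mul_le_mul_right (D.wrap.ind_mul₂ W D.one q a
      (W b * (W c * (W p * (T (disp st a + (disp st b + disp st c)) * T (disp st c))))))
      (if disp st p + disp st q + (disp st a + (disp st b + disp st c)) = 0 then 1 else 0)).trans
      (le_trans (le_of_eq (mul_assoc _ _ _).symm) (mul_le_mul_left (ite_mul_ite_le (p' :=
        disp st p = -(disp st b + disp st c)) (q' := disp st q = -disp st a) ?_) _))).trans
        (le_of_eq ?_))
    · ring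
    · intro h1 h2
      refine ⟨?_, eq_neg_of_add_eq_zero_left h2⟩
      rw [eq_neg_of_add_eq_zero_left h2] at h1
      rw [← sub_eq_zero, ← h1]; abel
    · ring
  refine (ENNReal.tsum_le_tsum fun a => ENNReal.tsum_le_tsum fun b => ENNReal.tsum_le_tsum fun c =>
    ENNReal.tsum_le_tsum fun p => ENNReal.tsum_le_tsum fun q => key a b c p q).trans ?_
  simp only [ENNReal.tsum_add]
  rw [two_mul]
  refine add_le_add ?_ ?_
  · refine (D.line.tsum₃₂_le D.line D.line D.line D.long (fun x y z => -(y + z)) (fun x y z => -x)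
      fun x y z => T (x + (y + z)) * T z).trans (tsum₃_le_mul D.good.vac4 fun x y z => ?_)
    simp only [D.good.neg]; ring
  · refine (D.long.tsum₃₂_le D.line D.line D.line D.line (fun x y z => -(y + z)) (fun x y z => -x)
      fun x y z => T (x + (y + z)) * T z).trans (tsum₃_le_mul D.good.vac4 fun x y z => ?_)
    simp only [D.good.neg]; ring

lemma diagram₁₂ (D : WrapData st T C γ W wr L) : ∑' a, ∑' b, ∑' c, ∑' p, ∑' q, W a * (W b * (W c * (W p * (W q * ((if disp st p + disp st q + (disp st a + (disp st b + disp st c)) = 0 then 1 else 0) * ind wr (q ++ (a ++ b)) * (T (disp st a + (disp st b + disp st c)) * T (disp st b + disp st c))))))) ≤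
    3 * (γ * (16 * C ^ 5)) := by
  have key : ∀ a b c p q, W a * (W b * (W c * (W p * (W q * ((if disp st p + disp st q + (disp st a + (disp st b + disp st c)) = 0 then 1 else 0) * ind wr (q ++ (a ++ b)) * (T (disp st a + (disp st b + disp st c)) * T (disp st b + disp st c))))))) ≤
      W a * (W b * (W c * ((W p * if disp st p = -disp st c then 1 else 0) * ((cut L W q * if disp st q = -(disp st a + disp st b) then 1 else 0) * (T (disp st a + (disp st b + disp st c)) * T (disp st b + disp st c)))))) +
      cut L W a * (W b * (W c * ((W p * if disp st p = -disp st c then 1 else 0) * ((W q * if disp st q = -(disp st a + disp st b) then 1 else 0) * (T (disp st a + (disp st b + disp st c)) * T (disp st b + disp st c)))))) +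
      W a * (cut L W b * (W c * ((W p * if disp st p = -disp st c then 1 else 0) * ((W q * if disp st q = -(disp st a + disp st b) then 1 else 0) * (T (disp st a + (disp st b + disp st c)) * T (disp st b + disp st c)))))) := by
    intro a b c p q
    refine le_trans (le_of_eq ?_) (((mul_le_mul_right (D.wrap.ind_mul₃ W D.one q a b
      (W c * (W p * (T (disp st a + (disp st b + disp st c)) * T (disp st b + disp st c)))))
      (if disp st p + disp st q + (disp st a + (disp st b + disp st c)) = 0 then 1 else 0)).trans
      (le_trans (le_of_eq (mul_assoc _ _ _).symm) (mul_le_mul_left (ite_mul_ite_le (p' :=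
        disp st p = -disp st c) (q' := disp st q = -(disp st a + disp st b)) ?_) _))).trans
        (le_of_eq ?_))
    · ring
    · intro h1 h2
      have hq := eq_neg_of_add_eq_zero_left h2
      refine ⟨?_, hq⟩
      rw [hq] at h1
      rw [← sub_eq_zero, ← h1]; abel
    · ring
  refine (ENNReal.tsum_le_tsum fun a => ENNReal.tsum_le_tsum fun b => ENNReal.tsum_le_tsum fun c =>
    ENNReal.tsum_le_tsum fun p => ENNReal.tsum_le_tsum fun q => key a b c p q).trans ?_
  simp only [ENNReal.tsum_add]
  rw [show (3 : ℝ≥0∞) = 1 + 1 + 1 by norm_num, add_mul, add_mul, one_mul]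
  refine add_le_add (add_le_add ?_ ?_) ?_
  · refine (D.line.tsum₃₂_le D.line D.line D.line D.long (fun x y z => -z) (fun x y z => -(x + y))
      fun x y z => T (x + (y + z)) * T (y + z)).trans (tsum₃_le_mul D.good.vac4 fun x y z => ?_)
    simp only [D.good.neg]; ring
  · refine (D.long.tsum₃₂_le D.line D.line D.line D.line (fun x y z => -z) (fun x y z => -(x + y))
      fun x y z => T (x + (y + z)) * T (y + z)).trans (tsum₃_le_mul D.good.vac5 fun x y z => ?_)
    simp only [D.good.neg]; ring
  · refine (D.line.tsum₃₂_le D.long D.line D.line D.line (fun x y z => -z) (fun x y z => -(x + y))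
      fun x y z => T (x + (y + z)) * T (y + z)).trans (tsum₃_le_mul D.good.vac6 fun x y z => ?_)
    simp only [D.good.neg]; ring

lemma diagram₂₁ (D : WrapData st T C γ W wr L) : ∑' a, ∑' b, ∑' c, ∑' p, ∑' q, W a * (W b * (W c * (W p * (W q * ((if disp st q + (disp st a + (disp st b + disp st c)) = 0 then 1 else 0) * ind wr (p ++ (q ++ a)) * (T (disp st a) * T (disp st c))))))) ≤
    3 * (γ * (16 * C ^ 5)) := by
  have key : ∀ a b c p q, W a * (W b * (W c * (W p * (W q * ((if disp st q + (disp st a + (disp st b + disp st c)) = 0 then 1 else 0) * ind wr (p ++ (q ++ a)) * (T (disp st a) * T (disp st c))))))) ≤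
      W a * (W b * (W c * ((cut L W p * if disp st p = (disp st b + disp st c) then 1 else 0) * ((W q * if disp st q = -(disp st a + (disp st b + disp st c)) then 1 else 0) * (T (disp st a) * T (disp st c)))))) +
      W a * (W b * (W c * ((W p * if disp st p = (disp st b + disp st c) then 1 else 0) * ((cut L W q * if disp st q = -(disp st a + (disp st b + disp st c)) then 1 else 0) * (T (disp st a) * T (disp st c)))))) +
      cut L W a * (W b * (W c * ((W p * if disp st p = (disp st b + disp st c) then 1 else 0) * ((W q * if disp st q = -(disp st a + (disp st b + disp st c)) then 1 else 0) * (T (disp st a) * T (disp st c)))))) := by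
    intro a b c p q
    refine le_trans (le_of_eq ?_) (((mul_le_mul_right (D.wrap.ind_mul₃ W D.one p q a
      (W b * (W c * (T (disp st a) * T (disp st c)))))
      (if disp st q + (disp st a + (disp st b + disp st c)) = 0 then 1 else 0)).trans
      (le_trans (le_of_eq (mul_assoc _ _ _).symm) (mul_le_mul_left (ite_mul_ite_le (p' :=
        disp st p = (disp st b + disp st c)) (q' := disp st q = -(disp st a + (disp st b + disp st c))) ?_) _))).trans
        (le_of_eq ?_))
    · ring
    · intro h1 h2
      have hq := eq_neg_of_add_eq_zero_left h1
      refine ⟨?_, hq⟩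
      rw [hq] at h2
      rw [← sub_eq_zero, ← h2]; abel
    · ring
  refine (ENNReal.tsum_le_tsum fun a => ENNReal.tsum_le_tsum fun b => ENNReal.tsum_le_tsum fun c =>
    ENNReal.tsum_le_tsum fun p => ENNReal.tsum_le_tsum fun q => key a b c p q).trans ?_
  simp only [ENNReal.tsum_add]
  rw [show (3 : ℝ≥0∞) = 1 + 1 + 1 by norm_num, add_mul, add_mul, one_mul]
  refine add_le_add (add_le_add ?_ ?_) ?_
  · refine (D.line.tsum₃₂_le D.line D.line D.long D.line (fun x y z => (y + z)) (fun x y z => -(x + (y + z)))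
      fun x y z => T x * T z).trans (tsum₃_le_mul D.good.vac7 fun x y z => ?_)
    simp only [D.good.neg]; ring
  · refine (D.line.tsum₃₂_le D.line D.line D.line D.long (fun x y z => (y + z)) (fun x y z => -(x + (y + z)))
      fun x y z => T x * T z).trans (tsum₃_le_mul D.good.vac8 fun x y z => ?_)
    ring
  · refine (D.long.tsum₃₂_le D.line D.line D.line D.line (fun x y z => (y + z)) (fun x y z => -(x + (y + z)))
      fun x y z => T x * T z).trans (tsum₃_le_mul D.good.vac4 fun x y z => ?_)
    simp only [D.good.neg]; ring

lemma diagram₂₂ (D : WrapData st T C γ W wr L) : ∑' a, ∑' b, ∑' c, ∑' p, ∑' q, W a * (W b * (W c * (W p * (W q * ((if disp st q + (disp st a + (disp st b + disp st c)) = 0 then 1 else 0) * ind wr (p ++ (q ++ (a ++ b))) * (T (disp st a + disp st b) * T (disp st b + disp st c))))))) ≤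
    4 * (γ * (16 * C ^ 5)) := by
  have key : ∀ a b c p q, W a * (W b * (W c * (W p * (W q * ((if disp st q + (disp st a + (disp st b + disp st c)) = 0 then 1 else 0) * ind wr (p ++ (q ++ (a ++ b))) * (T (disp st a + disp st b) * T (disp st b + disp st c))))))) ≤
      W a * (W b * (W c * ((cut L W p * if disp st p = disp st c then 1 else 0) * ((W q * if disp st q = -(disp st a + (disp st b + disp st c)) then 1 else 0) * (T (disp st a + disp st b) * T (disp st b + disp st c)))))) +
      W a * (W b * (W c * ((W p * if disp st p = disp st c then 1 else 0) * ((cut L W q * if disp st q = -(disp st a + (disp st b + disp st c)) then 1 else 0) * (T (disp st a + disp st b) * T (disp st b + disp st c)))))) +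
      cut L W a * (W b * (W c * ((W p * if disp st p = disp st c then 1 else 0) * ((W q * if disp st q = -(disp st a + (disp st b + disp st c)) then 1 else 0) * (T (disp st a + disp st b) * T (disp st b + disp st c)))))) +
      W a * (cut L W b * (W c * ((W p * if disp st p = disp st c then 1 else 0) * ((W q * if disp st q = -(disp st a + (disp st b + disp st c)) then 1 else 0) * (T (disp st a + disp st b) * T (disp st b + disp st c)))))) := by
    intro a b c p q
    refine le_trans (le_of_eq ?_) (((mul_le_mul_right (D.wrap.ind_mul₄ W p q a b
      (W c * (T (disp st a + disp st b) * T (disp st b + disp st c))))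
      (if disp st q + (disp st a + (disp st b + disp st c)) = 0 then 1 else 0)).trans
      (le_trans (le_of_eq (mul_assoc _ _ _).symm) (mul_le_mul_left (ite_mul_ite_le (p' :=
        disp st p = disp st c) (q' := disp st q = -(disp st a + (disp st b + disp st c))) ?_) _))).trans
        (le_of_eq ?_))
    · ring
    · intro h1 h2
      have hq := eq_neg_of_add_eq_zero_left h1
      refine ⟨?_, hq⟩
      rw [hq] at h2
      rw [← sub_eq_zero, ← h2]; abel
    · ring
  refine (ENNReal.tsum_le_tsum fun a => ENNReal.tsum_le_tsum fun b => ENNReal.tsum_le_tsum fun c =>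
    ENNReal.tsum_le_tsum fun p => ENNReal.tsum_le_tsum fun q => key a b c p q).trans ?_
  simp only [ENNReal.tsum_add]
  rw [show (4 : ℝ≥0∞) = 1 + 1 + 1 + 1 by norm_num, add_mul, add_mul, add_mul, one_mul]
  refine add_le_add (add_le_add (add_le_add ?_ ?_) ?_) ?_
  · refine (D.line.tsum₃₂_le D.line D.line D.long D.line (fun x y z => z) (fun x y z => -(x + (y + z)))
      fun x y z => T (x + y) * T (y + z)).trans (tsum₃_le_mul D.good.vac9 fun x y z => ?_)
    simp only [D.good.neg]; ring
  · refine (D.line.tsum₃₂_le D.line D.line D.line D.long (fun x y z => z) (fun x y z => -(x + (y + z)))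
      fun x y z => T (x + y) * T (y + z)).trans (tsum₃_le_mul D.good.vac10 fun x y z => ?_)
    ring
  · refine (D.long.tsum₃₂_le D.line D.line D.line D.line (fun x y z => z) (fun x y z => -(x + (y + z)))
      fun x y z => T (x + y) * T (y + z)).trans (tsum₃_le_mul D.good.vac5 fun x y z => ?_)
    simp only [D.good.neg]; ring
  · refine (D.line.tsum₃₂_le D.long D.line D.line D.line (fun x y z => z) (fun x y z => -(x + (y + z)))
      fun x y z => T (x + y) * T (y + z)).trans (tsum₃_le_mul D.good.vac6 fun x y z => ?_)
    simp only [D.good.neg]; ring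

end WrapData

end Diagrams

end WSAW

namespace WSAW

section Assembly

lemma tsum₂_le_mul {α : Type*} {f g : α → α → ℝ≥0∞} {c k : ℝ≥0∞}
    (hg : ∑' x, ∑' y, g x y ≤ k) (hf : ∀ x y, f x y = c * g x y) :
    ∑' x, ∑' y, f x y ≤ c * k := by
  simp only [hf, ENNReal.tsum_mul_left]
  exact mul_le_mul_right hg _

lemma tsum₂_le_of_elim {α : Type*} {f : α → α → ℝ≥0∞} {g : α → ℝ≥0∞}
    {c : ℝ≥0∞} (h0 : ∀ w, ∑' x, f x w ≤ g w) (h1 : ∑' w, g w ≤ c) : ∑' x, ∑' w, f x w ≤ c := by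
  rw [ENNReal.tsum_comm]
  exact (ENNReal.tsum_le_tsum h0).trans h1

variable {E A : Type*} [AddCommGroup A] [DecidableEq A] {st : E → A} {T : A → ℝ≥0∞}
  {C γ : ℝ≥0∞} {W : List E → ℝ≥0∞} {wr L : List E → Prop}

namespace Good

lemma vac_a (hT : Good st T C) : ∑' x, ∑' y, T x * T y * T y * T (x + y) ≤ 16 * C ^ 5 := by
  refine (tsum₂_le_of_elim
    (fun y => hT.bubble_le (T y ^ 2) 0 y fun x => by rw [add_zero]; ring)
    (hT.sq_le (2 * C) fun y => by ring)).trans ?_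
  exact le_trans (le_of_eq (by ring)) (hT.const_le (a := 2) (m := 2) (by norm_num) (by norm_num))

lemma vac_b (hT : Good st T C) : ∑' x, ∑' y, T y * T y * T (x + y) * T (x + y) ≤ 16 * C ^ 5 := by
  refine (tsum₂_le_of_elim
    (fun y => hT.bubble_le (T y ^ 2) y y fun x => by ring)
    (hT.sq_le (2 * C) fun y => by ring)).trans ?_
  exact le_trans (le_of_eq (by ring)) (hT.const_le (a := 2) (m := 2) (by norm_num) (by norm_num))

lemma vac_c (hT : Good st T C) : ∑' x, ∑' y, T x * T y * T (x + y) * T (x + y) ≤ 16 * C ^ 5 := by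
  refine (tsum₂_le_of_elim
    (fun y => hT.star_le (T y) y 0 y fun x => by rw [add_zero]; ring)
    (hT.sq_le (4 * C ^ 2) fun y => by rw [sub_zero]; ring)).trans ?_
  exact le_trans (le_of_eq (by ring)) (hT.const_le (a := 4) (m := 3) (by norm_num) (by norm_num))

end Good

namespace WrapData

lemma diagram_kernel (D : WrapData st T C γ W wr L) : ∑' b, ∑' c, ∑' s, W b * (W c * (W s * (ind wr (s ++ (b ++ c)) *
    (T (disp st s) * T (disp st c))))) ≤ 3 * (γ * (16 * C ^ 5)) := by
  have key : ∀ b c s, W b * (W c * (W s * (ind wr (s ++ (b ++ c)) *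
      (T (disp st s) * T (disp st c))))) ≤
      W b * (W c * ((cut L W s * if disp st s = -(disp st b + disp st c) then 1 else 0) *
        (T (disp st b + disp st c) * T (disp st c)))) +
      cut L W b * (W c * ((W s * if disp st s = -(disp st b + disp st c) then 1 else 0) *
        (T (disp st b + disp st c) * T (disp st c)))) +
      W b * (cut L W c * ((W s * if disp st s = -(disp st b + disp st c) then 1 else 0) *
        (T (disp st b + disp st c) * T (disp st c)))) := by
    intro b c s
    refine le_trans (le_of_eq ?_) ((D.wrap.ind_mul₃ W D.one s b c
      (T (disp st s) * T (disp st c))).trans ?_)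
    · ring
    · by_cases h : disp st s + (disp st b + disp st c) = 0
      · have h' := eq_neg_of_add_eq_zero_left h
        rw [if_pos h, if_pos h', h', D.good.neg]
        exact le_of_eq (by ring)
      · rw [if_neg h, zero_mul]; exact zero_le
  refine (ENNReal.tsum_le_tsum fun b => ENNReal.tsum_le_tsum fun c =>
    ENNReal.tsum_le_tsum fun s => key b c s).trans ?_
  simp only [ENNReal.tsum_add]
  rw [show (3 : ℝ≥0∞) = 1 + 1 + 1 by norm_num, add_mul, add_mul, one_mul]
  refine add_le_add (add_le_add ?_ ?_) ?_
  · refine (D.line.tsum₂₁_le D.line D.long (fun x y => -(x + y))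
      fun x y => T (x + y) * T y).trans (tsum₂_le_mul D.good.vac_a fun x y => ?_)
    ring
  · refine (D.long.tsum₂₁_le D.line D.line (fun x y => -(x + y))
      fun x y => T (x + y) * T y).trans (tsum₂_le_mul D.good.vac_b fun x y => ?_)
    rw [D.good.neg]; ring
  · refine (D.line.tsum₂₁_le D.long D.line (fun x y => -(x + y))
      fun x y => T (x + y) * T y).trans (tsum₂_le_mul D.good.vac_c fun x y => ?_)
    rw [D.good.neg]; ring

lemma diagram_self₁ (D : WrapData st T C γ W wr L) : ∑' a, ∑' b, ∑' c, ∑' i, W a * (W b * (W c * (W i * (ind wr i *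
    (T (disp st a + (disp st i + (disp st b + disp st c))) ^ 2 * T (disp st c)))))) ≤
    γ * (16 * C ^ 5) := by
  have key : ∀ a b c i, W a * (W b * (W c * (W i * (ind wr i *
      (T (disp st a + (disp st i + (disp st b + disp st c))) ^ 2 * T (disp st c)))))) ≤
      W a * (W b * (W c * ((cut L W i * if disp st i = 0 then 1 else 0) *
      (T (disp st a + (disp st b + disp st c)) ^ 2 * T (disp st c))))) := by
    intro a b c i
    refine le_trans (le_of_eq ?_) ((mul_le_mul_right (D.wrap.ind_mul₁ W i
      (T (disp st a + (disp st i + (disp st b + disp st c))) ^ 2 * T (disp st c)))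
      (W a * (W b * W c))).trans ?_)
    · ring
    · by_cases h : disp st i = 0
      · rw [h, zero_add]
        exact le_of_eq (by ring)
      · simp [if_neg h]
  refine (ENNReal.tsum_le_tsum fun a => ENNReal.tsum_le_tsum fun b => ENNReal.tsum_le_tsum fun c =>
    ENNReal.tsum_le_tsum fun i => key a b c i).trans ?_
  refine (D.line.tsum₃₁_le D.line D.line D.long (fun x y z => 0)
      fun x y z => T (x + (y + z)) ^ 2 * T z).trans (tsum₃_le_mul D.good.vac1 fun x y z => ?_)
  ring

lemma diagram_self₃ (D : WrapData st T C γ W wr L) : ∑' a, ∑' b, ∑' c, ∑' i, W a * (W b * (W c * (W i * (ind wr i *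
    (T (disp st a + (disp st b + (disp st i + disp st c))) ^ 2 *
    T (disp st b + (disp st i + disp st c))))))) ≤
    γ * (16 * C ^ 5) := by
  have key : ∀ a b c i, W a * (W b * (W c * (W i * (ind wr i *
      (T (disp st a + (disp st b + (disp st i + disp st c))) ^ 2 *
      T (disp st b + (disp st i + disp st c))))))) ≤
      W a * (W b * (W c * ((cut L W i * if disp st i = 0 then 1 else 0) *
      (T (disp st a + (disp st b + disp st c)) ^ 2 * T (disp st b + disp st c))))) := by
    intro a b c i
    refine le_trans (le_of_eq ?_) ((mul_le_mul_right (D.wrap.ind_mul₁ W i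
      (T (disp st a + (disp st b + (disp st i + disp st c))) ^ 2 *
      T (disp st b + (disp st i + disp st c))))
      (W a * (W b * W c))).trans ?_)
    · ring
    · by_cases h : disp st i = 0
      · rw [h, zero_add]
        exact le_of_eq (by ring)
      · simp [if_neg h]
  refine (ENNReal.tsum_le_tsum fun a => ENNReal.tsum_le_tsum fun b => ENNReal.tsum_le_tsum fun c =>
    ENNReal.tsum_le_tsum fun i => key a b c i).trans ?_
  refine (D.line.tsum₃₁_le D.line D.line D.long (fun x y z => 0)
      fun x y z => T (x + (y + z)) ^ 2 * T (y + z)).trans (tsum₃_le_mul D.good.vac3 fun x y z => ?_)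
  ring

lemma diagram_self₂ (D : WrapData st T C γ W wr L) : ∑' b, ∑' a, ∑' e, ∑' c, W b * (W a * (W e * (W c * (ind wr (b ++ c) *
    (T (disp st a + (disp st b + (disp st c + disp st e))) ^ 2 *
    T (disp st c + disp st e)))))) ≤ 2 * (γ * (16 * C ^ 5)) := by
  have key : ∀ b a e c, W b * (W a * (W e * (W c * (ind wr (b ++ c) *
      (T (disp st a + (disp st b + (disp st c + disp st e))) ^ 2 *
      T (disp st c + disp st e)))))) ≤
      cut L W b * (W a * (W e * ((W c * if disp st c = - disp st b then 1 else 0) *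
      (T (disp st a + disp st e) ^ 2 * T (disp st b + -disp st e))))) +
      W b * (W a * (W e * ((cut L W c * if disp st c = - disp st b then 1 else 0) *
      (T (disp st a + disp st e) ^ 2 * T (disp st b + -disp st e))))) := by
    intro b a e c
    refine le_trans (le_of_eq ?_) ((mul_le_mul_right (D.wrap.ind_mul₂ W D.one b c
      (T (disp st a + (disp st b + (disp st c + disp st e))) ^ 2 * T (disp st c + disp st e)))
      (W a * W e)).trans ?_)
    · ring
    · by_cases h : disp st b + disp st c = 0
      · have h' := eq_neg_of_add_eq_zero_right h
        have h1 : T (disp st c + disp st e) = T (disp st b + -disp st e) := by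
          rw [← D.good.neg, h']; congr 1; abel
        rw [if_pos h, if_pos h', ← add_assoc (disp st b), h, zero_add, h1]
        exact le_of_eq (by ring)
      · simp [if_neg h]
  refine (ENNReal.tsum_le_tsum fun b => ENNReal.tsum_le_tsum fun a => ENNReal.tsum_le_tsum fun e =>
    ENNReal.tsum_le_tsum fun c => key b a e c).trans ?_
  simp only [ENNReal.tsum_add]
  rw [two_mul]
  refine add_le_add ?_ ?_
  · refine (D.long.tsum₃₁_le D.line D.line D.line (fun x y z => -x)
      fun x y z => T (y + z) ^ 2 * T (x + -z)).trans (tsum₃_le_mul D.good.vac2 fun x y z => ?_)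
    rw [D.good.neg]; ring
  · refine (D.line.tsum₃₁_le D.line D.line D.long (fun x y z => -x)
      fun x y z => T (y + z) ^ 2 * T (x + -z)).trans (tsum₃_le_mul D.good.vac2 fun x y z => ?_)
    ring

end WrapData

end Assembly

end WSAW

namespace WSAW

section Total

variable {E A : Type*} [AddCommGroup A] [DecidableEq A] {st : E → A} {T : A → ℝ≥0∞}
  {C γ : ℝ≥0∞} {W : List E → ℝ≥0∞} {wr L : List E → Prop}

lemma tsum_comm₃₁ {α : Type*} (f : α → α → α → ℝ≥0∞) :
    ∑' a, ∑' b, ∑' c, f a b c = ∑' b, ∑' c, ∑' a, f a b c := by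
  rw [ENNReal.tsum_comm]
  exact tsum_congr fun b => ENNReal.tsum_comm

lemma tsum_mul_splitSum₂_le [DecidableEq E] (hW : ∀ l l', W (l ++ l') ≤ W l * W l')
    (F : List E → List E → List E → List E → ℝ≥0∞) :
    ∑' l, W l * splitSum (fun a s => splitSum (fun b c => F l a b c) s) l ≤
      ∑' a, ∑' b, ∑' c, W a * (W b * (W c * F (a ++ (b ++ c)) a b c)) := by
  have h : ∀ l, W l * splitSum (fun a s => splitSum (fun b c => F l a b c) s) l =
      W l * splitSum (fun a s => splitSum (fun b c => F (a ++ (b ++ c)) a b c) s) l := by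
    intro l
    congr 1
    refine splitSum_congr l fun a s h => splitSum_congr s fun b c h' => ?_
    rw [h', h]
  simp only [h]
  rw [tsum_splitSum]
  refine ENNReal.tsum_le_tsum fun a => ?_
  rw [tsum_splitSum (fun s => W (a ++ s)) (fun b c => F (a ++ (b ++ c)) a b c)]
  refine ENNReal.tsum_le_tsum fun b => ENNReal.tsum_le_tsum fun c => ?_
  calc _ ≤ W a * (W b * W c) * F (a ++ (b ++ c)) a b c := by
        gcongr; exact (hW _ _).trans (mul_le_mul_right (hW _ _) _)
    _ = _ := by ring

lemma tsum_mul_splitSum₃_le [DecidableEq E] (hW : ∀ l l', W (l ++ l') ≤ W l * W l')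
    (F : List E → List E → List E → List E → List E → ℝ≥0∞) :
    ∑' l, W l * splitSum (fun a s => splitSum (fun b m => splitSum (fun c e => F l a b c e) m) s) l ≤
      ∑' a, ∑' b, ∑' c, ∑' e, W a * (W b * (W c * (W e * F (a ++ (b ++ (c ++ e))) a b c e))) := by
  refine (tsum_mul_splitSum₂_le hW fun l a b m => splitSum (fun c e => F l a b c e) m).trans ?_
  refine ENNReal.tsum_le_tsum fun a => ENNReal.tsum_le_tsum fun b => ?_
  simp only [ENNReal.tsum_mul_left]
  refine mul_le_mul_right (mul_le_mul_right ?_ _) _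
  have h : ∀ m, W m * splitSum (fun c e => F (a ++ (b ++ m)) a b c e) m =
      W m * splitSum (fun c e => F (a ++ (b ++ (c ++ e))) a b c e) m := by
    intro m
    congr 1
    exact splitSum_congr m fun c e h => by rw [h]
  simp only [h]
  rw [tsum_splitSum]
  refine ENNReal.tsum_le_tsum fun c => ?_
  rw [← ENNReal.tsum_mul_left]
  refine ENNReal.tsum_le_tsum fun e => ?_
  rw [← mul_assoc]
  gcongr
  exact hW _ _

/-- The number of wrapping pairs between a past and an end point. -/
noncomputable def wrapHits [DecidableEq E] (wr : List E → Prop) (p t : List E) : ℝ≥0∞ :=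
  splitSum (fun _ s => ind wr (s ++ t)) p

/-- The number of wrapping pairs between a past and a walk. -/
noncomputable def wrapCross [DecidableEq E] (wr : List E → Prop) (p l : List E) : ℝ≥0∞ :=
  splitSum (fun t _ => wrapHits wr p t) l

/-- The number of wrapping pairs in a walk. -/
noncomputable def wrapSelf [DecidableEq E] (wr : List E → Prop) (l : List E) : ℝ≥0∞ :=
  splitSum (fun _ m => splitSum (fun i _ => ind wr i) m) l

/-- Bound for the total weight of the continuations of a past. -/
noncomputable def pastSum [DecidableEq E] (st : E → A) (T : A → ℝ≥0∞) (l : List E) : ℝ≥0∞ :=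
  splitSum (fun _ s => T (disp st s)) l

/-- The contribution of the wrapping pairs between a given past and an end point. -/
noncomputable def crossSum [DecidableEq E] (st : E → A) (T : A → ℝ≥0∞) (W : List E → ℝ≥0∞)
    (wr : List E → Prop) (x : A) (t : List E) : ℝ≥0∞ :=
  ∑' p, W p * T (disp st p) ^ 2 * (hits st p x * wrapHits wr p t)

lemma tsum_mul_splitSum₁_le [DecidableEq E] (hW : ∀ l l', W (l ++ l') ≤ W l * W l')
    (F : List E → List E → List E → ℝ≥0∞) :
    ∑' l, W l * splitSum (fun a s => F l a s) l ≤
      ∑' a, ∑' b, W a * (W b * F (a ++ b) a b) := by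
  have h : ∀ l, W l * splitSum (fun a s => F l a s) l =
      W l * splitSum (fun a s => F (a ++ s) a s) l := by
    intro l
    congr 1
    exact splitSum_congr l fun a s h => by rw [h]
  simp only [h]
  rw [tsum_splitSum]
  refine ENNReal.tsum_le_tsum fun a => ENNReal.tsum_le_tsum fun b => ?_
  rw [← mul_assoc]
  exact mul_le_mul_left (hW _ _) _

namespace WrapData

variable [DecidableEq E]

lemma tsum_past_le (D : WrapData st T C γ W wr L) (g : List E → ℝ≥0∞) :
    ∑' p, W p * T (disp st p) ^ 2 * splitSum (fun _ s => g s) p ≤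
      4 * C ^ 2 * ∑' s, W s * (T (disp st s) * g s) := by
  rw [tsum_splitSum (fun p => W p * T (disp st p) ^ 2) (fun _ s => g s), ENNReal.tsum_comm,
    ← ENNReal.tsum_mul_left]
  refine ENNReal.tsum_le_tsum fun s => ?_
  calc _ ≤ ∑' a, W a * (T (disp st a + disp st s) ^ 2) * (W s * g s) := by
        refine ENNReal.tsum_le_tsum fun a => ?_
        rw [disp_append]
        calc _ ≤ W a * W s * T (disp st a + disp st s) ^ 2 * g s := by gcongr; exact D.sub _ _
          _ = _ := by ring
    _ ≤ (4 * C ^ 2 * T (disp st s)) * (W s * g s) := by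
        rw [ENNReal.tsum_mul_right]
        gcongr
        refine (D.line.tsum_le fun x => T (x + disp st s) ^ 2).trans ?_
        have := D.good.star 0 (disp st s) (disp st s)
        rw [zero_sub, D.good.neg] at this
        refine le_trans (le_of_eq (tsum_congr fun x => ?_)) this
        rw [add_zero]; ring
    _ = _ := by ring

lemma kernel_le (D : WrapData st T C γ W wr L) : ∑' p, ∑' l, W p * T (disp st p) ^ 2 *
    (wrapHits wr p l * (W l * pastSum st T l)) ≤ 4 * C ^ 2 * (3 * (γ * (16 * C ^ 5))) := by
  have h1 : ∀ p, ∑' l, W p * T (disp st p) ^ 2 * (wrapHits wr p l * (W l * pastSum st T l)) =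
      W p * T (disp st p) ^ 2 * splitSum (fun _ s => ∑' l, ind wr (s ++ l) * (W l * pastSum st T l))
        p := by
    intro p
    rw [ENNReal.tsum_mul_left]
    congr 1
    rw [splitSum_eq_sum, ← Summable.tsum_finsetSum fun _ _ => ENNReal.summable]
    refine tsum_congr fun l => ?_
    rw [wrapHits, splitSum_eq_sum, Finset.sum_mul]
  simp only [h1]
  refine (D.tsum_past_le _).trans (mul_le_mul_right ?_ _)
  refine le_trans ?_ D.diagram_kernel
  have h2 : ∀ s, W s * (T (disp st s) * ∑' l, ind wr (s ++ l) * (W l * pastSum st T l)) ≤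
      ∑' b, ∑' c, W b * (W c * (W s * (ind wr (s ++ (b ++ c)) *
        (T (disp st s) * T (disp st c))))) := by
    intro s
    rw [← ENNReal.tsum_mul_left, ← ENNReal.tsum_mul_left]
    have h3 : ∀ l, W s * (T (disp st s) * (ind wr (s ++ l) * (W l * pastSum st T l))) =
        (W s * (T (disp st s) * (ind wr (s ++ l) * W l))) *
          splitSum (fun _ c => T (disp st c)) l := by intro l; rw [pastSum]; ring
    simp only [h3]
    rw [tsum_splitSum (fun l => W s * (T (disp st s) * (ind wr (s ++ l) * W l)))
      (fun _ c => T (disp st c))]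
    refine ENNReal.tsum_le_tsum fun b => ENNReal.tsum_le_tsum fun c => ?_
    calc _ ≤ W s * (T (disp st s) * (ind wr (s ++ (b ++ c)) * (W b * W c))) * T (disp st c) := by
          gcongr; exact D.sub _ _
      _ = _ := by ring
  refine (ENNReal.tsum_le_tsum h2).trans (le_of_eq ?_)
  exact tsum_comm₃₁ _

lemma self_le (D : WrapData st T C γ W wr L) : ∑' p, ∑' l, W p * T (disp st p) ^ 2 *
    (hits st p (disp st l) * wrapSelf wr l * (W l * pastSum st T l)) ≤
    4 * C ^ 2 * (4 * (γ * (16 * C ^ 5))) := by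
  have h1 : ∀ p, ∑' l, W p * T (disp st p) ^ 2 *
      (hits st p (disp st l) * wrapSelf wr l * (W l * pastSum st T l)) ≤
      W p * T (disp st p) ^ 2 * splitSum (fun _ s => ∑' l, (if disp st s + disp st l = 0 then 1
        else 0) * (wrapSelf wr l * (W l * pastSum st T l))) p := by
    intro p
    rw [ENNReal.tsum_mul_left]
    gcongr
    rw [splitSum_eq_sum, ← Summable.tsum_finsetSum fun _ _ => ENNReal.summable]
    refine ENNReal.tsum_le_tsum fun l => ?_
    rw [hits_eq, splitSum_eq_sum, mul_assoc, Finset.sum_mul]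
    refine Finset.sum_le_sum fun i _ => ?_
    gcongr
    split_ifs <;> simp_all
  refine (ENNReal.tsum_le_tsum h1).trans ((D.tsum_past_le _).trans (mul_le_mul_right ?_ _))
  have h2 : ∀ s, W s * (T (disp st s) * ∑' l, (if disp st s + disp st l = 0 then 1
        else 0) * (wrapSelf wr l * (W l * pastSum st T l))) =
      ∑' l, (W s * if disp st s = -disp st l then 1 else 0) * (T (disp st l) *
        (wrapSelf wr l * (W l * pastSum st T l))) := by
    intro s
    rw [← ENNReal.tsum_mul_left, ← ENNReal.tsum_mul_left]
    refine tsum_congr fun l => ?_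
    by_cases h : disp st s + disp st l = 0
    · have h' := eq_neg_of_add_eq_zero_left h
      rw [if_pos h, if_pos h', h', D.good.neg]; ring
    · have h' : ¬ disp st s = -disp st l := fun h1 => h (by rw [h1]; abel)
      simp [h, h']
  simp only [h2]
  rw [ENNReal.tsum_comm]
  simp only [ENNReal.tsum_mul_right]
  calc _ ≤ ∑' l, W l * (T (disp st l) ^ 2 * (wrapSelf wr l * pastSum st T l)) := by
        refine ENNReal.tsum_le_tsum fun l => ?_
        refine (mul_le_mul_left (D.line.tsum_ite_le _) _).trans (le_of_eq ?_)
        rw [D.good.neg]; ring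
    _ ≤ ∑' l, (W l * (splitSum (fun a s => splitSum (fun b c => T (disp st l) ^ 2 *
          (splitSum (fun i _ => ind wr i) (b ++ c) * T (disp st c))) s) l) +
          W l * (splitSum (fun a s => splitSum (fun b c => T (disp st l) ^ 2 *
          (splitSum (fun i _ => ind wr i) c * T (disp st b + disp st c))) s) l)) := by
        refine ENNReal.tsum_le_tsum fun l => ?_
        have := splitSum_mul_splitSum_le (fun _ m => splitSum (fun i _ => ind wr i) m)
          (fun _ s => T (disp st s)) l
        rw [← mul_add]
        gcongr
        simp only [← mul_splitSum, ← mul_add]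
        gcongr
        simpa only [disp_append, wrapSelf, pastSum] using this
    _ ≤ 3 * (γ * (16 * C ^ 5)) + γ * (16 * C ^ 5) := by
        rw [ENNReal.tsum_add]
        refine add_le_add ?_ ?_
        · calc _ ≤ ∑' l, (W l * splitSum (fun a s => splitSum (fun i m => splitSum (fun b c =>
                  T (disp st l) ^ 2 * (ind wr i * T (disp st c))) m) s) l +
                W l * splitSum (fun a s => splitSum (fun b m => splitSum (fun c e =>
                  T (disp st l) ^ 2 * (ind wr (b ++ c) * T (disp st c + disp st e))) m) s) l) := by
                refine ENNReal.tsum_le_tsum fun l => ?_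
                rw [← mul_add, ← splitSum_add]
                gcongr
                refine splitSum_mono l fun a s _ => ?_
                simp only [← mul_splitSum, ← mul_add]
                gcongr
                have := splitSum_mul_splitSum_le (fun i _ => ind wr i)
                  (fun _ s => T (disp st s)) s
                simp only [disp_append, ← mul_splitSum] at this
                refine le_trans (le_of_eq ?_) this
                rw [mul_splitSum]
                exact splitSum_congr s fun b c h => by rw [h]
            _ ≤ γ * (16 * C ^ 5) + 2 * (γ * (16 * C ^ 5)) := by
                rw [ENNReal.tsum_add]
                refine add_le_add ?_ ?_
                · refine (tsum_mul_splitSum₃_le D.sub fun l a i b c =>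
                    T (disp st l) ^ 2 * (ind wr i * T (disp st c))).trans
                    (le_trans (le_of_eq ?_) D.diagram_self₁)
                  refine tsum_congr fun a => (tsum_comm₃₁ _).trans ?_
                  refine tsum_congr fun b => tsum_congr fun c => tsum_congr fun i => ?_
                  simp only [disp_append]; ring
                · refine (tsum_mul_splitSum₃_le D.sub fun l a b c e =>
                    T (disp st l) ^ 2 * (ind wr (b ++ c) * T (disp st c + disp st e))).trans
                    (le_trans (le_of_eq ?_) D.diagram_self₂)
                  rw [ENNReal.tsum_comm]
                  refine tsum_congr fun b => tsum_congr fun a => ?_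
                  rw [ENNReal.tsum_comm]
                  refine tsum_congr fun e => tsum_congr fun c => ?_
                  simp only [disp_append]; ring
            _ = _ := by ring
        · refine le_trans (le_of_eq ?_) ((tsum_mul_splitSum₃_le D.sub fun l a b i c =>
            T (disp st l) ^ 2 * (ind wr i * T (disp st b + (disp st i + disp st c)))).trans
            (le_trans (le_of_eq ?_) D.diagram_self₃))
          · refine tsum_congr fun l => ?_
            congr 1
            refine splitSum_congr l fun a s _ => splitSum_congr s fun b m _ => ?_
            rw [mul_comm (splitSum _ _), mul_splitSum, mul_splitSum]
            refine splitSum_congr m fun i c h => ?_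
            rw [← h, disp_append]; ring
          · refine tsum_congr fun a => tsum_congr fun b => ?_
            rw [ENNReal.tsum_comm]
            refine tsum_congr fun c => tsum_congr fun i => ?_
            simp only [disp_append]; ring
    _ = _ := by ring

lemma crossSum_le (D : WrapData st T C γ W wr L) (x : A) (t : List E) : crossSum st T W wr x t ≤ 4 * C ^ 2 * (∑' b, ∑' c, W b * (W c *
    ((if disp st b + disp st c + x = 0 then 1 else 0) * ind wr (c ++ t) * T x)) +
    ∑' b, ∑' c, W b * (W c *
    ((if disp st c + x = 0 then 1 else 0) * ind wr (b ++ (c ++ t)) * T (disp st t)))) := by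
  have h1 : ∀ p, (hits st p x * wrapHits wr p t) ≤ splitSum (fun _ s =>
      splitSum (fun b c => (if disp st b + disp st c + x = 0 then 1 else 0) * ind wr (c ++ t)) s +
      splitSum (fun b c => (if disp st c + x = 0 then 1 else 0) * ind wr (b ++ (c ++ t))) s) p := by
    intro p
    rw [splitSum_add]
    refine le_trans (mul_le_mul_left ?_ _) ((splitSum_mul_splitSum_le
      (fun _ s => if disp st s + x = 0 then 1 else 0) (fun _ s => ind wr (s ++ t)) p).trans
      (le_of_eq ?_))
    · rw [hits_eq]
      refine splitSum_mono p fun a s _ => ?_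
      split_ifs <;> simp_all
    · simp only [disp_append, List.append_assoc]
  refine (ENNReal.tsum_le_tsum fun p => mul_le_mul_right (h1 p) _).trans
    ((D.tsum_past_le _).trans (mul_le_mul_right ?_ _))
  simp only [mul_add]
  rw [ENNReal.tsum_add]
  refine add_le_add ?_ ?_
  · simp only [mul_splitSum (T _)]
    refine (tsum_mul_splitSum₁_le D.sub fun l b c => T (disp st l) *
      ((if disp st b + disp st c + x = 0 then 1 else 0) * ind wr (c ++ t))).trans ?_
    refine ENNReal.tsum_le_tsum fun b => ENNReal.tsum_le_tsum fun c => ?_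
    by_cases h : disp st b + disp st c + x = 0
    · rw [if_pos h, disp_append, eq_neg_of_add_eq_zero_left h, D.good.neg]
      exact le_of_eq (by ring)
    · simp [h]
  · simp only [mul_splitSum (T _)]
    refine (tsum_mul_splitSum₁_le D.sub fun l b c => T (disp st l) *
      ((if disp st c + x = 0 then 1 else 0) * ind wr (b ++ (c ++ t)))).trans ?_
    refine ENNReal.tsum_le_tsum fun b => ENNReal.tsum_le_tsum fun c => ?_
    by_cases h : wr (b ++ (c ++ t))
    · have h' := D.wrap.disp _ h
      simp only [disp_append] at h' ⊢
      rw [← add_assoc] at h'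
      rw [eq_neg_of_add_eq_zero_left h', D.good.neg]
      exact le_of_eq (by ring)
    · simp [h, ind]

lemma cross_le (D : WrapData st T C γ W wr L) : ∑' p, ∑' l, W p * T (disp st p) ^ 2 *
    (hits st p (disp st l) * wrapCross wr p l * (W l * pastSum st T l)) ≤
    4 * C ^ 2 * (12 * (γ * (16 * C ^ 5))) := by
  have h1 : ∀ l, ∑' p, W p * T (disp st p) ^ 2 *
      (hits st p (disp st l) * wrapCross wr p l * (W l * pastSum st T l)) ≤
      W l * splitSum (fun a s => splitSum (fun b c =>
        crossSum st T W wr (disp st l) a * T (disp st c)) s) l +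
      W l * splitSum (fun a s => splitSum (fun b c =>
        crossSum st T W wr (disp st l) (a ++ b) * T (disp st b + disp st c)) s) l := by
    intro l
    have h2 : ∑' p, W p * T (disp st p) ^ 2 *
      (hits st p (disp st l) * wrapCross wr p l * (W l * pastSum st T l)) =
      W l * (splitSum (fun t _ => crossSum st T W wr (disp st l) t) l * pastSum st T l) := by
      have h3 : ∀ p, W p * T (disp st p) ^ 2 *
          (hits st p (disp st l) * wrapCross wr p l * (W l * pastSum st T l)) =
          W p * T (disp st p) ^ 2 * (hits st p (disp st l) * wrapCross wr p l) *
          (W l * pastSum st T l) := fun p => by ring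
      simp only [h3]
      rw [ENNReal.tsum_mul_right, mul_comm, mul_assoc, mul_comm (pastSum st T l)]
      congr 2
      simp only [crossSum, wrapCross, mul_splitSum]
      simp only [splitSum_eq_sum]
      rw [Summable.tsum_finsetSum fun _ _ => ENNReal.summable]
    rw [h2, ← mul_add]
    refine mul_le_mul_right ?_ _
    have := splitSum_mul_splitSum_le (fun t _ => crossSum st T W wr (disp st l) t)
      (fun _ s => T (disp st s)) l
    simpa only [disp_append, pastSum] using this
  rw [ENNReal.tsum_comm]
  refine (ENNReal.tsum_le_tsum h1).trans ?_
  rw [ENNReal.tsum_add]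
  have e12 : (12 : ℝ≥0∞) = (2 + 3) + (3 + 4) := by norm_num
  rw [e12, add_mul, mul_add]
  refine add_le_add ?_ ?_
  · refine (tsum_mul_splitSum₂_le D.sub fun l a b c =>
      crossSum st T W wr (disp st l) a * T (disp st c)).trans ?_
    have h2 : ∀ a b c, W a * (W b * (W c * (crossSum st T W wr (disp st (a ++ (b ++ c))) a *
        T (disp st c)))) ≤ 4 * C ^ 2 * (
        (∑' p, ∑' q, W a * (W b * (W c * (W p * (W q *
    ((if disp st p + disp st q + (disp st a + (disp st b + disp st c)) = 0 then 1 else 0) *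
    ind wr (q ++ a) * (T (disp st a + (disp st b + disp st c)) * T (disp st c)))))))) +
        ∑' p, ∑' q, W a * (W b * (W c * (W p * (W q *
    ((if disp st q + (disp st a + (disp st b + disp st c)) = 0 then 1 else 0) *
    ind wr (p ++ (q ++ a)) * (T (disp st a) * T (disp st c)))))))) := by
      intro a b c
      refine (mul_le_mul_right (mul_le_mul_right (mul_le_mul_right (mul_le_mul_left
        (D.crossSum_le _ _) _) _) _) _).trans (le_of_eq ?_)
      simp only [disp_append, mul_add, add_mul, ← ENNReal.tsum_mul_left, ← ENNReal.tsum_mul_right]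
      congr 1 <;> exact tsum_congr fun p => tsum_congr fun q => by ring
    refine (ENNReal.tsum_le_tsum fun a => ENNReal.tsum_le_tsum fun b =>
      ENNReal.tsum_le_tsum fun c => h2 a b c).trans ?_
    simp only [ENNReal.tsum_mul_left, ENNReal.tsum_add]
    rw [add_mul]
    refine mul_le_mul_right (add_le_add ?_ ?_) _
    · simpa only [ENNReal.tsum_mul_left] using D.diagram₁₁
    · simpa only [ENNReal.tsum_mul_left] using D.diagram₂₁
  · refine (tsum_mul_splitSum₂_le D.sub fun l a b c =>
      crossSum st T W wr (disp st l) (a ++ b) * T (disp st b + disp st c)).trans ?_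
    have h2 : ∀ a b c, W a * (W b * (W c * (crossSum st T W wr (disp st (a ++ (b ++ c))) (a ++ b) *
        T (disp st b + disp st c)))) ≤ 4 * C ^ 2 * (
        (∑' p, ∑' q, W a * (W b * (W c * (W p * (W q *
    ((if disp st p + disp st q + (disp st a + (disp st b + disp st c)) = 0 then 1 else 0) *
    ind wr (q ++ (a ++ b)) * (T (disp st a + (disp st b + disp st c)) *
    T (disp st b + disp st c)))))))) +
        ∑' p, ∑' q, W a * (W b * (W c * (W p * (W q *
    ((if disp st q + (disp st a + (disp st b + disp st c)) = 0 then 1 else 0) *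
    ind wr (p ++ (q ++ (a ++ b))) * (T (disp st a + disp st b) *
    T (disp st b + disp st c)))))))) := by
      intro a b c
      refine (mul_le_mul_right (mul_le_mul_right (mul_le_mul_right (mul_le_mul_left
        (D.crossSum_le _ _) _) _) _) _).trans (le_of_eq ?_)
      simp only [disp_append, mul_add, add_mul, ← ENNReal.tsum_mul_left, ← ENNReal.tsum_mul_right]
      congr 1 <;> exact tsum_congr fun p => tsum_congr fun q => by ring
    refine (ENNReal.tsum_le_tsum fun a => ENNReal.tsum_le_tsum fun b =>
      ENNReal.tsum_le_tsum fun c => h2 a b c).trans ?_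
    simp only [ENNReal.tsum_mul_left, ENNReal.tsum_add]
    rw [add_mul]
    refine mul_le_mul_right (add_le_add ?_ ?_) _
    · simpa only [ENNReal.tsum_mul_left] using D.diagram₁₂
    · simpa only [ENNReal.tsum_mul_left] using D.diagram₂₂

/-- The total effect of wrapping on the lace kernel. -/
theorem tsum_diff_le (D : WrapData st T C γ W wr L) {b : ℝ≥0∞} {k D' yB dk : List E → List E → ℝ≥0∞} (hk : Kern st W b k)
    (hb : 16 * b * C ^ 3 ≤ 1)
    (hdk : ∀ p l, dk p l ≤ b * (wrapHits wr p l + hits st p (disp st l) *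
      (wrapCross wr p l + wrapSelf wr l)) * W l)
    (hy : ∀ p, ∑' l, yB p l ≤ pastSum st T p)
    (hD : ∀ p l, D' p l ≤ splitSum (fun a s => dk p a * yB a s) l +
      splitSum (fun a s => k p a * D' a s) l) :
    ∑' p, (if p.length = 1 then W p else 0) * ∑' l, D' p l ≤ 2432 * b * C ^ 7 * γ := by
  refine (tsum_mul_le_of_forward hk hD
    (forward_supersolution D.good D.sub D.line hk hb)).trans ?_
  calc _ ≤ ∑' p, ∑' l, 2 * b * (W p * T (disp st p) ^ 2 * (wrapHits wr p l *
        (W l * pastSum st T l)) + (W p * T (disp st p) ^ 2 *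
        (hits st p (disp st l) * wrapCross wr p l * (W l * pastSum st T l)) +
        W p * T (disp st p) ^ 2 *
        (hits st p (disp st l) * wrapSelf wr l * (W l * pastSum st T l)))) := by
        refine ENNReal.tsum_le_tsum fun p => ?_
        rw [tsum_splitSum', ← ENNReal.tsum_mul_left]
        refine ENNReal.tsum_le_tsum fun l => ?_
        rw [ENNReal.tsum_mul_left]
        refine (mul_le_mul_right (mul_le_mul' (hdk p l) (hy l)) _).trans (le_of_eq ?_)
        ring
    _ ≤ 2 * b * (4 * C ^ 2 * (3 * (γ * (16 * C ^ 5))) + (4 * C ^ 2 * (12 * (γ * (16 * C ^ 5))) +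
        4 * C ^ 2 * (4 * (γ * (16 * C ^ 5))))) := by
        simp only [ENNReal.tsum_mul_left (a := 2 * b), ENNReal.tsum_add]
        exact mul_le_mul_right (add_le_add D.kernel_le (add_le_add D.cross_le D.self_le)) _
    _ = _ := by ring

end WrapData

end Total

end WSAW

namespace WSAW

section Projection

variable {E A B : Type*} [DecidableEq E] [AddCommGroup A] [DecidableEq A] [AddCommGroup B]
  [DecidableEq B] {st : E → A} {φ : A →+ B} {stB : E → B}

/-- A walk which is closed after projection only. -/
def wrapping (st : E → A) (stB : E → B) (l : List E) : Prop := disp st l ≠ 0 ∧ disp stB l = 0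

lemma disp_map (hφ : ∀ e, stB e = φ (st e)) (l : List E) : disp stB l = φ (disp st l) := by
  induction l with
  | nil => simp
  | cons e l ih => simp [ih, hφ]

/-- The number of wrapping pairs between a past and an end point. -/
noncomputable def wrapHits' (wr : List E → Prop) (p t : List E) : ℝ≥0∞ :=
  splitSum (fun _ s => if s ≠ [] then ind wr (s ++ t) else 0) p

lemma wrapHits'_le (wr : List E → Prop) (p t : List E) : wrapHits' wr p t ≤ wrapHits wr p t :=
  splitSum_mono p fun a s _ => by split_ifs <;> simp

lemma hits_map_le' (hφ : ∀ e, stB e = φ (st e)) (p t : List E) :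
    (hits stB p (disp stB t) : ℝ≥0∞) ≤
      hits st p (disp st t) + wrapHits' (wrapping st stB) p t := by
  rw [hits_eq, hits_eq, wrapHits', ← splitSum_add]
  refine splitSum_mono p fun a s _ => ?_
  by_cases hs : s = []
  · simp [hs]
  by_cases h : disp st s + disp st t = 0
  · rw [if_pos (show s ≠ [] ∧ disp st s + disp st t = 0 from ⟨hs, h⟩)]
    exact le_add_right (by split_ifs <;> simp)
  · by_cases h' : disp stB s + disp stB t = 0
    · have : wrapping st stB (s ++ t) := ⟨by simpa using h, by simpa using h'⟩
      rw [if_pos (show s ≠ [] ∧ disp stB s + disp stB t = 0 from ⟨hs, h'⟩), if_pos hs, ind,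
        if_pos this]
      exact le_add_self
    · simp [hs, h']

lemma cross_map_le' (hφ : ∀ e, stB e = φ (st e)) (p l : List E) :
    (cross stB p 0 l : ℝ≥0∞) ≤
      cross st p 0 l + splitSum (fun t _ => wrapHits' (wrapping st stB) p t) l := by
  rw [cross_eq, cross_eq, ← splitSum_add]
  refine splitSum_mono l fun t s _ => ?_
  simp only [zero_add]
  split_ifs
  · exact hits_map_le' hφ p t
  · exact zero_le

lemma hits_map_le (hφ : ∀ e, stB e = φ (st e)) (p t : List E) :
    (hits stB p (disp stB t) : ℝ≥0∞) ≤ hits st p (disp st t) + wrapHits (wrapping st stB) p t :=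
  (hits_map_le' hφ p t).trans (add_le_add_right (wrapHits'_le _ _ _) _)

lemma cross_map_le (hφ : ∀ e, stB e = φ (st e)) (p l : List E) :
    (cross stB p 0 l : ℝ≥0∞) ≤ cross st p 0 l + wrapCross (wrapping st stB) p l :=
  (cross_map_le' hφ p l).trans
    (add_le_add_right (splitSum_mono l fun _ _ _ => wrapHits'_le _ _ _) _)

lemma selfHits_map_le (hφ : ∀ e, stB e = φ (st e)) (l : List E) :
    (selfHits stB l : ℝ≥0∞) ≤ selfHits st l + wrapSelf (wrapping st stB) l := by
  induction l with
  | nil => simp [selfHits]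
  | cons e l ih =>
    have h1 : splitSum (fun t _ => wrapHits' (wrapping st stB) [e] t) l ≤
        splitSum (fun i _ => ind (wrapping st stB) i) (e :: l) := by
      rw [splitSum_cons]
      refine le_add_right (splitSum_mono l fun t s _ => ?_)
      simp [wrapHits', splitSum_cons, splitSum_nil]
    simp only [selfHits, Nat.cast_add]
    rw [wrapSelf, splitSum_cons]
    calc _ ≤ _ := add_le_add ih ((cross_map_le' hφ [e] l).trans (add_le_add_right h1 _))
      _ = _ := by rw [wrapSelf]; ring

lemma hits_le_hits_map (hφ : ∀ e, stB e = φ (st e)) (p : List E) (x : A) :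
    hits st p x ≤ hits stB p (φ x) := by
  induction p with
  | nil => simp [hits]
  | cons e p ih =>
    simp only [hits]
    refine add_le_add ih ?_
    rw [disp_map hφ, ← map_add]
    split_ifs with h1 h2 <;> simp_all

lemma cross_le_cross_map (hφ : ∀ e, stB e = φ (st e)) (p l : List E) (x : A) :
    cross st p x l ≤ cross stB p (φ x) l := by
  induction l generalizing x with
  | nil => simp [cross]
  | cons e l ih =>
    simp only [cross]
    rw [hφ, ← map_add]
    exact add_le_add (hits_le_hits_map hφ p _) (ih _)

lemma selfHits_le_selfHits_map (hφ : ∀ e, stB e = φ (st e)) (l : List E) :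
    selfHits st l ≤ selfHits stB l := by
  induction l with
  | nil => simp [selfHits]
  | cons e l ih =>
    simp only [selfHits]
    have := cross_le_cross_map hφ [e] l 0
    rw [map_zero] at this
    exact add_le_add ih this

lemma K_map_le (hφ : ∀ e, stB e = φ (st e)) {q : ℝ} (hq : 0 ≤ q) (hq1 : q ≤ 1) (l : List E) :
    K stB q l ≤ K st q l :=
  pow_le_pow_of_le_one hq hq1 (selfHits_le_selfHits_map hφ l)

lemma abs_kernel_sub_le {q : ℝ} (hq : 0 ≤ q) (hq1 : q ≤ 1) (a m N s v u : ℕ) :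
    |(q ^ (a + s) - q ^ (a + s + (m + v))) * q ^ (N + u) - (q ^ a - q ^ (a + m)) * q ^ N| ≤
      (1 - q) * (v + m * (s + u)) * q ^ N := by
  have e : (q ^ (a + s) - q ^ (a + s + (m + v))) * q ^ (N + u) - (q ^ a - q ^ (a + m)) * q ^ N =
      q ^ a * (q ^ (s + u) * q ^ m * (1 - q ^ v) - (1 - q ^ (s + u)) * (1 - q ^ m)) * q ^ N := by
    ring
  have p1 : ∀ n : ℕ, 0 ≤ q ^ n := fun n => pow_nonneg hq n
  have p2 : ∀ n : ℕ, q ^ n ≤ 1 := fun n => pow_le_one₀ hq hq1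
  rw [e, abs_mul, abs_mul, abs_of_nonneg (p1 a), abs_of_nonneg (p1 N)]
  refine mul_le_mul_of_nonneg_right ?_ (p1 N)
  refine (mul_le_of_le_one_left (abs_nonneg _) (p2 a)).trans ?_
  have h1 := one_sub_pow_le hq v
  have h2 := one_sub_pow_le hq m
  have h3 : 1 - q ^ (s + u) ≤ s + u := by
    refine (one_sub_pow_le hq (s + u)).trans ?_
    push_cast
    exact mul_le_of_le_one_left (by positivity) (by linarith)
  have h4 : 0 ≤ q ^ (s + u) * q ^ m * (1 - q ^ v) :=
    mul_nonneg (mul_nonneg (p1 _) (p1 _)) (by linarith [p2 v])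
  have h5 : q ^ (s + u) * q ^ m * (1 - q ^ v) ≤ (1 - q) * v := by
    refine le_trans (mul_le_of_le_one_left (by linarith [p2 v]) ?_) h1
    exact mul_le_one₀ (p2 _) (p1 _) (p2 _)
  have h6 : 0 ≤ (1 - q ^ (s + u)) * (1 - q ^ m) :=
    mul_nonneg (by linarith [p2 (s + u)]) (by linarith [p2 m])
  have h7 : (1 - q ^ (s + u)) * (1 - q ^ m) ≤ (s + u) * ((1 - q) * m) :=
    mul_le_mul h3 h2 (by linarith [p2 m]) (by positivity)
  have h8 : 0 ≤ (1 - q) * v := mul_nonneg (by linarith) (by positivity)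
  have h9 : 0 ≤ (s + u) * ((1 - q) * m) := h6.trans h7
  rw [abs_le]
  constructor <;> nlinarith

/-- Comparison of the kernels. -/
lemma abs_ker_sub_ker_le (hφ : ∀ e, stB e = φ (st e)) {q : ℝ} (hq : 0 ≤ q) (hq1 : q ≤ 1)
    (p l : List E) : ENNReal.ofReal |ker stB q p l - ker st q p l| ≤
      ENNReal.ofReal (1 - q) * (wrapHits (wrapping st stB) p l + hits stB p (disp stB l) *
        (wrapCross (wrapping st stB) p l + wrapSelf (wrapping st stB) l)) *
        ENNReal.ofReal (K st q l) := by
  by_cases hl : l = []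
  · simp [hl, ker_nil]
  obtain ⟨v, hv⟩ := Nat.exists_eq_add_of_le (hits_le_hits_map hφ p (disp st l))
  obtain ⟨s, hs⟩ := Nat.exists_eq_add_of_le (cross_le_cross_map hφ p l.dropLast 0)
  obtain ⟨u, hu⟩ := Nat.exists_eq_add_of_le (selfHits_le_selfHits_map hφ l)
  rw [map_zero] at hs
  rw [← disp_map hφ] at hv
  have h1 := abs_kernel_sub_le hq hq1 (cross st p 0 l.dropLast) (hits st p (disp st l))
    (selfHits st l) s v u
  have c1 := cross_dropLast st p l hl
  have c2 := cross_dropLast stB p l hl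
  rw [← hv, ← hs, ← hu, ← c1, ← c2] at h1
  have hvE : (v : ℝ≥0∞) ≤ wrapHits (wrapping st stB) p l := by
    have := hits_map_le hφ p l
    rw [hv, Nat.cast_add] at this
    exact (ENNReal.add_le_add_iff_left (ENNReal.natCast_ne_top _)).1 this
  have hsE : (s : ℝ≥0∞) ≤ wrapCross (wrapping st stB) p l := by
    have := cross_map_le hφ p l
    have e : cross stB p 0 l = cross st p 0 l + (s + v) := by omega
    rw [e, Nat.cast_add, Nat.cast_add] at this
    exact le_add_right le_rfl |>.trans
      ((ENNReal.add_le_add_iff_left (ENNReal.natCast_ne_top _)).1 this)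
  have huE : (u : ℝ≥0∞) ≤ wrapSelf (wrapping st stB) l := by
    have := selfHits_map_le hφ l
    rw [hu, Nat.cast_add] at this
    exact (ENNReal.add_le_add_iff_left (ENNReal.natCast_ne_top _)).1 this
  have h1' : |ker stB q p l - ker st q p l| ≤
      (1 - q) * ((v + hits stB p (disp stB l) * (s + u) : ℕ) : ℝ) * K st q l := by
    refine h1.trans ?_
    rw [K]
    refine mul_le_mul_of_nonneg_right (mul_le_mul_of_nonneg_left ?_ (by linarith))
      (pow_nonneg hq _)
    push_cast
    gcongr
    rw [hv]; exact Nat.le_add_right _ _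
  refine (ENNReal.ofReal_le_ofReal h1').trans ?_
  rw [ENNReal.ofReal_mul (mul_nonneg (by linarith) (Nat.cast_nonneg _)),
    ENNReal.ofReal_mul (by linarith), ENNReal.ofReal_natCast]
  push_cast
  gcongr

end Projection

end WSAW

namespace WSAW

section Weights

variable {E A : Type*} [DecidableEq E] [AddCommGroup A] [DecidableEq A] {st : E → A} {q x : ℝ}

/-- The weight of a walk at activity `x`. -/
noncomputable def wt (st : E → A) (q x : ℝ) (l : List E) : ℝ≥0∞ :=
  ENNReal.ofReal (K st q l * x ^ l.length)

/-- The interaction kernel at activity `x`. -/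
noncomputable def kerWt (st : E → A) (q x : ℝ) (p l : List E) : ℝ≥0∞ :=
  ENNReal.ofReal (ker st q p l * x ^ l.length)

/-- The absolute value of the inverse kernel at activity `x`. -/
noncomputable def yWt (st : E → A) (q x : ℝ) (p l : List E) : ℝ≥0∞ :=
  ENNReal.ofReal (|Y st q p l| * x ^ l.length)

lemma wt_append_le (hq : 0 ≤ q) (hq1 : q ≤ 1) (hx : 0 ≤ x) (l l' : List E) :
    wt st q x (l ++ l') ≤ wt st q x l * wt st q x l' := by
  rw [wt, wt, wt, ← ENNReal.ofReal_mul (mul_nonneg (K_nonneg st hq l) (pow_nonneg hx _))]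
  refine ENNReal.ofReal_le_ofReal ?_
  rw [List.length_append, pow_add]
  calc _ ≤ K st q l * K st q l' * (x ^ l.length * x ^ l'.length) :=
        mul_le_mul_of_nonneg_right (K_append_le st hq hq1 l l') (by positivity)
    _ = _ := by ring

lemma wt_nil : wt st q x [] = 1 := by simp [wt, K, selfHits]

lemma wt_singleton (e : E) : wt st q x [e] = ENNReal.ofReal x := by
  simp [wt, K, selfHits, cross]

lemma Y_nil (st : E → A) (q : ℝ) (p : List E) : Y st q p [] = 1 := by
  rw [Y_eq]; simp

lemma Y_eq_sub_sum (st : E → A) (q : ℝ) (p l : List E) :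
    Y st q p l = (if l.length = 0 then 1 else 0) -
      ∑ i ∈ Finset.range (l.length + 1),
        ker st q p (l.take i) * Y st q (l.take i) (l.drop i) := by
  rw [Y_eq, Finset.sum_range_succ']
  simp [ker_nil]

lemma pow_take_mul_pow_drop (x : ℝ) (l : List E) {i : ℕ} (hi : i ∈ Finset.range (l.length + 1)) :
    x ^ l.length = x ^ (l.take i).length * x ^ (l.drop i).length := by
  rw [← pow_add, ← List.length_append, List.take_append_drop]

lemma yWt_le (hq : 0 ≤ q) (hq1 : q ≤ 1) (hx : 0 ≤ x) (p l : List E) :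
    yWt st q x p l ≤ (if l = [] then 1 else 0) +
      splitSum (fun a s => kerWt st q x p a * yWt st q x a s) l := by
  have h : |Y st q p l| * x ^ l.length ≤ (if l = [] then 1 else 0) +
      ∑ i ∈ Finset.range (l.length + 1), (ker st q p (l.take i) * x ^ (l.take i).length) *
        (|Y st q (l.take i) (l.drop i)| * x ^ (l.drop i).length) := by
    have h1 : |Y st q p l| ≤ (if l.length = 0 then 1 else 0) +
        ∑ i ∈ Finset.range (l.length + 1), ker st q p (l.take i) *
          |Y st q (l.take i) (l.drop i)| := by
      rw [Y_eq_sub_sum]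
      refine (abs_sub _ _).trans (add_le_add (by split_ifs <;> simp) ?_)
      refine (Finset.abs_sum_le_sum_abs _ _).trans (Finset.sum_le_sum fun i hi => ?_)
      rw [abs_mul, abs_of_nonneg (ker_nonneg st hq hq1 _ _)]
    refine (mul_le_mul_of_nonneg_right h1 (by positivity)).trans (le_of_eq ?_)
    rw [add_mul, Finset.sum_mul]
    congr 1
    · cases l <;> simp
    · refine Finset.sum_congr rfl fun i hi => ?_
      rw [pow_take_mul_pow_drop x l hi]; ring
  have hnn : ∀ i, 0 ≤ ker st q p (l.take i) * x ^ (l.take i).length := fun i =>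
    mul_nonneg (ker_nonneg st hq hq1 _ _) (by positivity)
  refine (ENNReal.ofReal_le_ofReal h).trans ?_
  refine ENNReal.ofReal_add_le.trans (add_le_add (by split_ifs <;> simp) ?_)
  rw [splitSum_eq_sum, ENNReal.ofReal_sum_of_nonneg fun i _ => mul_nonneg (hnn i) (by positivity)]
  refine Finset.sum_le_sum fun i hi => ?_
  rw [ENNReal.ofReal_mul (hnn i)]
  rfl

lemma kern_wt (hq : 0 ≤ q) (hq1 : q ≤ 1) (hx : 0 ≤ x) :
    Kern st (wt st q x) (ENNReal.ofReal (1 - q)) (kerWt st q x) where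
  nil p := by simp [kerWt, ker_nil]
  le p l := by
    rw [← ENNReal.ofReal_natCast (hits st p (disp st l)), ← ENNReal.ofReal_mul (by linarith), wt,
      ← ENNReal.ofReal_mul (mul_nonneg (by linarith) (Nat.cast_nonneg _))]
    refine ENNReal.ofReal_le_ofReal ?_
    rw [← mul_assoc]
    exact mul_le_mul_of_nonneg_right (ker_le st hq hq1 p l) (by positivity)

/-- The lace kernel at activity `x`. -/
noncomputable def pWt (st : E → A) (q x : ℝ) (l : List E) : ℝ≥0∞ :=
  ENNReal.ofReal (|P st q l| * x ^ l.length)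

lemma pWt_cons (hx : 0 ≤ x) (e : E) (l : List E) :
    pWt st q x (e :: l) = ENNReal.ofReal x * yWt st q x [e] l := by
  rw [pWt, yWt, ← ENNReal.ofReal_mul hx, P, List.length_cons]
  congr 1; ring

lemma tsum_list_cons [Fintype E] (f : List E → ℝ≥0∞) :
    ∑' l, f l = f [] + ∑ e, ∑' l, f (e :: l) := by
  have h : ∀ l, f l = (if l = [] then f [] else 0) + ∑ e, ∑' l', if e :: l' = l then f (e :: l') else 0 := by
    intro l
    cases l with
    | nil => simp
    | cons e l =>
      rw [Finset.sum_eq_single e]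
      · rw [tsum_eq_single l]
        · simp
        · intro l' h; simp [h]
      · intro e' _ h; simp [h]
      · simp
  rw [tsum_congr h, ENNReal.tsum_add, tsum_ite_eq, Summable.tsum_finsetSum fun _ _ => ENNReal.summable]
  congr 1
  refine Finset.sum_congr rfl fun e _ => ?_
  rw [ENNReal.tsum_comm]
  refine tsum_congr fun l => ?_
  simp

variable {T : A → ℝ≥0∞} {C : ℝ≥0∞}

/-- The total mass of the lace kernel. -/
lemma tsum_pWt_le [Fintype E] (hT : Good st T C) {W : List E → ℝ≥0∞}
    {b : ℝ≥0∞} (hq : 0 ≤ q) (hq1 : q ≤ 1) (hx : 0 ≤ x)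
    (hl : Line st W T) (hW : ∀ l l', W (l ++ l') ≤ W l * W l')
    (hk : Kern st W b (kerWt st q x)) (hb : 16 * b * C ^ 3 ≤ 1) :
    ∑' l, pWt st q x l ≤ ENNReal.ofReal x * ∑ e, (T (st e) + T 0) := by
  rw [tsum_list_cons, Finset.mul_sum]
  have h0 : pWt st q x [] = 0 := by simp [pWt, P]
  rw [h0, zero_add]
  refine Finset.sum_le_sum fun e _ => ?_
  simp only [pWt_cons hx, ENNReal.tsum_mul_left]
  gcongr
  refine (tsum_le_splitSum hT hW hl hk hb (yWt_le hq hq1 hx) [e]).trans (le_of_eq ?_)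
  simp [splitSum_cons, splitSum_nil, add_comm]

/-- The pointwise bound on the lace kernel. -/
lemma tsum_pWt_disp_le [Fintype E] (hT : Good st T C) (hq : 0 ≤ q) (hq1 : q ≤ 1) (hx : 0 ≤ x)
    (hl : Line st (wt st q x) T) (hb : 16 * ENNReal.ofReal (1 - q) * C ^ 3 ≤ 1) (v : A) :
    ∑' l, (if disp st l = v ∧ l.length ≠ 1 then pWt st q x l else 0) ≤
      ENNReal.ofReal x * (2 * ENNReal.ofReal (1 - q) * T v ^ 2 * ∑ e, T (v - st e)) := by
  rw [tsum_list_cons, Finset.mul_sum, Finset.mul_sum]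
  have h0 : pWt st q x [] = 0 := by simp [pWt, P]
  simp only [h0, ite_self, zero_add]
  refine Finset.sum_le_sum fun e _ => ?_
  have h1 := tsum_disp_le hT (wt_append_le hq hq1 hx) hl (kern_wt hq hq1 hx) hb (yWt_le hq hq1 hx)
    [e] (v - st e)
  have h2 : ∑' l, (if disp st l = v - st e then yWt st q x [e] l else 0) =
      (if v - st e = 0 then 1 else 0) +
        ∑' l, (if disp st l = v - st e ∧ l ≠ [] then yWt st q x [e] l else 0) := by
    rw [← tsum_ite_eq ([] : List E) (fun _ => if v - st e = 0 then (1 : ℝ≥0∞) else 0),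
      ← ENNReal.tsum_add]
    refine tsum_congr fun l => ?_
    by_cases hl : l = []
    · subst hl
      simp [yWt, Y_nil, eq_comm]
    · simp [hl]
  rw [h2, ENNReal.add_le_add_iff_left (by split_ifs <;> simp)] at h1
  have h3 : ∀ l, (if disp st (e :: l) = v ∧ (e :: l).length ≠ 1 then pWt st q x (e :: l) else 0) =
      ENNReal.ofReal x *
        (if disp st l = v - st e ∧ l ≠ [] then yWt st q x [e] l else 0) := by
    intro l
    rw [pWt_cons hx]
    simp [eq_sub_iff_add_eq, add_comm]
  rw [tsum_congr h3, ENNReal.tsum_mul_left]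
  gcongr
  refine h1.trans (le_of_eq ?_)
  simp [splitSum_cons, splitSum_nil]
  ring

end Weights

section Difference

variable {E A B : Type*} [DecidableEq E] [AddCommGroup A] [DecidableEq A] [AddCommGroup B]
  [DecidableEq B] {st : E → A} {φ : A →+ B} {stB : E → B} {q x : ℝ}

lemma kern_wt_proj (hφ : ∀ e, stB e = φ (st e)) (hq : 0 ≤ q) (hq1 : q ≤ 1) (hx : 0 ≤ x) :
    Kern stB (wt st q x) (ENNReal.ofReal (1 - q)) (kerWt st q x) where
  nil p := (kern_wt hq hq1 hx).nil p
  le p l := by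
    refine ((kern_wt hq hq1 hx).le p l).trans ?_
    gcongr
    rw [disp_map hφ]
    exact hits_le_hits_map hφ p _

lemma wt_proj_le (hφ : ∀ e, stB e = φ (st e)) (hq : 0 ≤ q) (hq1 : q ≤ 1) (hx : 0 ≤ x)
    (l : List E) : wt stB q x l ≤ wt st q x l :=
  ENNReal.ofReal_le_ofReal
    (mul_le_mul_of_nonneg_right (K_map_le hφ hq hq1 l) (by positivity))

lemma kern_wt_target (hφ : ∀ e, stB e = φ (st e)) (hq : 0 ≤ q) (hq1 : q ≤ 1) (hx : 0 ≤ x) :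
    Kern stB (wt st q x) (ENNReal.ofReal (1 - q)) (kerWt stB q x) where
  nil p := (kern_wt hq hq1 hx).nil p
  le p l := ((kern_wt hq hq1 hx).le p l).trans (by gcongr; exact wt_proj_le hφ hq hq1 hx l)

/-- The difference of the inverse kernels. -/
noncomputable def yDiff (st : E → A) (stB : E → B) (q x : ℝ) (p l : List E) : ℝ≥0∞ :=
  ENNReal.ofReal (|Y stB q p l - Y st q p l| * x ^ l.length)

/-- The difference of the interaction kernels. -/
noncomputable def kerDiff (st : E → A) (stB : E → B) (q x : ℝ) (p l : List E) : ℝ≥0∞ :=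
  ENNReal.ofReal (|ker stB q p l - ker st q p l| * x ^ l.length)

lemma yDiff_le (hq : 0 ≤ q) (hq1 : q ≤ 1) (hx : 0 ≤ x) (p l : List E) :
    yDiff st stB q x p l ≤ splitSum (fun a s => kerDiff st stB q x p a * yWt stB q x a s) l +
      splitSum (fun a s => kerWt st q x p a * yDiff st stB q x a s) l := by
  rw [← splitSum_add, splitSum_eq_sum]
  have h : |Y stB q p l - Y st q p l| * x ^ l.length ≤ ∑ i ∈ Finset.range (l.length + 1),
      ((|ker stB q p (l.take i) - ker st q p (l.take i)| * x ^ (l.take i).length) *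
        (|Y stB q (l.take i) (l.drop i)| * x ^ (l.drop i).length) +
      (ker st q p (l.take i) * x ^ (l.take i).length) *
        (|Y stB q (l.take i) (l.drop i) - Y st q (l.take i) (l.drop i)| *
          x ^ (l.drop i).length)) := by
    rw [Y_eq_sub_sum stB, Y_eq_sub_sum st, sub_sub_sub_cancel_left, ← Finset.sum_sub_distrib]
    refine (mul_le_mul_of_nonneg_right (Finset.abs_sum_le_sum_abs _ _)
      (by positivity)).trans ?_
    rw [Finset.sum_mul]
    refine Finset.sum_le_sum fun i hi => ?_
    rw [pow_take_mul_pow_drop x l hi]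
    have e : ker st q p (l.take i) * Y st q (l.take i) (l.drop i) -
        ker stB q p (l.take i) * Y stB q (l.take i) (l.drop i) =
        -((ker stB q p (l.take i) - ker st q p (l.take i)) * Y stB q (l.take i) (l.drop i)) -
        ker st q p (l.take i) *
          (Y stB q (l.take i) (l.drop i) - Y st q (l.take i) (l.drop i)) := by ring
    rw [e]
    calc _ ≤ (|ker stB q p (l.take i) - ker st q p (l.take i)| *
            |Y stB q (l.take i) (l.drop i)| + ker st q p (l.take i) *
            |Y stB q (l.take i) (l.drop i) - Y st q (l.take i) (l.drop i)|) *
            (x ^ (l.take i).length * x ^ (l.drop i).length) := by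
          refine mul_le_mul_of_nonneg_right ((abs_sub _ _).trans (le_of_eq ?_)) (by positivity)
          rw [abs_neg, abs_mul, abs_mul, abs_of_nonneg (ker_nonneg st hq hq1 _ _)]
      _ = _ := by ring
  have hnn : ∀ i, 0 ≤ ker st q p (l.take i) * x ^ (l.take i).length := fun i =>
    mul_nonneg (ker_nonneg st hq hq1 _ _) (by positivity)
  refine (ENNReal.ofReal_le_ofReal h).trans ?_
  rw [ENNReal.ofReal_sum_of_nonneg fun i _ => add_nonneg (by positivity)
    (mul_nonneg (hnn i) (by positivity))]
  refine Finset.sum_le_sum fun i hi => ENNReal.ofReal_add_le.trans (le_of_eq ?_)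
  rw [ENNReal.ofReal_mul (hnn i), ENNReal.ofReal_mul (by positivity)]
  rfl

/-- The lace kernels of two walk models, one of which is a projection of the other. -/
theorem tsum_P_sub_P_le (hφ : ∀ e, stB e = φ (st e)) (hq : 0 ≤ q) (hq1 : q ≤ 1) (hx : 0 ≤ x)
    {T : B → ℝ≥0∞} {C γ : ℝ≥0∞} {L : List E → Prop}
    (D : WrapData stB T C γ (wt st q x) (wrapping st stB) L)
    (hb : 16 * ENNReal.ofReal (1 - q) * C ^ 3 ≤ 1) :
    ∑' l, ENNReal.ofReal (|P stB q l - P st q l| * x ^ l.length) ≤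
      2432 * ENNReal.ofReal (1 - q) * C ^ 7 * γ := by
  refine le_trans ?_ (D.tsum_diff_le (k := kerWt st q x) (D' := yDiff st stB q x)
    (yB := yWt stB q x) (dk := kerDiff st stB q x) (kern_wt_proj hφ hq hq1 hx) hb ?_ ?_
    (yDiff_le hq hq1 hx))
  · simp only [← ENNReal.tsum_mul_left]
    rw [← tsum_splitSum']
    refine ENNReal.tsum_le_tsum fun l => ?_
    cases l with
    | nil => simp [P]
    | cons e l =>
      rw [splitSum_eq_sum]
      refine le_trans ?_ (Finset.single_le_sum (fun _ _ => zero_le) (a := 1) (by simp))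
      simp only [P, List.take_succ_cons, List.take_zero, List.drop_succ_cons, List.drop_zero,
        List.length_singleton, if_true, wt_singleton, yDiff, ← ENNReal.ofReal_mul hx]
      refine ENNReal.ofReal_le_ofReal (le_of_eq ?_)
      rw [List.length_cons]; ring
  · intro p l
    rw [kerDiff, ENNReal.ofReal_mul (abs_nonneg _), wt, ENNReal.ofReal_mul (K_nonneg st hq l),
      ← mul_assoc]
    gcongr
    exact abs_ker_sub_ker_le hφ hq hq1 p l
  · intro p
    exact tsum_le_splitSum D.good D.sub D.line (kern_wt_target hφ hq hq1 hx) hb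
      (yWt_le hq hq1 hx) p

end Difference

end WSAW

namespace WSAW

section Decay

variable {d : ℕ}

/-- Polynomial decay at scale `a`. -/
noncomputable def dec (n : ℕ) (a : ℝ) (x : Fin d → ℤ) : ℝ≥0∞ := ENNReal.ofReal (((a + ‖x‖) ^ n)⁻¹)

lemma dec_ne_top (n : ℕ) (a : ℝ) (x : Fin d → ℤ) : dec n a x ≠ ∞ := ENNReal.ofReal_ne_top

lemma dec_neg (n : ℕ) (a : ℝ) (x : Fin d → ℤ) : dec n a (-x) = dec n a x := by
  simp [dec]

lemma dec_le {n : ℕ} {a c k : ℝ} {x z : Fin d → ℤ} (hc : 0 < c) (hk : 0 ≤ k)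
    (h : c + ‖z‖ ≤ k * (a + ‖x‖)) : dec n a x ≤ ENNReal.ofReal (k ^ n) * dec n c z := by
  rw [dec, dec, ← ENNReal.ofReal_mul (by positivity)]
  refine ENNReal.ofReal_le_ofReal ?_
  have h1 : 0 < c + ‖z‖ := by positivity
  have h2 : 0 < a + ‖x‖ := by
    by_contra h'
    have := mul_nonpos_of_nonneg_of_nonpos hk (not_lt.1 h')
    linarith
  rw [inv_eq_one_div, ← div_eq_mul_inv, div_le_div_iff₀ (by positivity) (by positivity), one_mul,
    ← mul_pow]
  exact pow_le_pow_left₀ h1.le h n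

lemma dec_anti {n : ℕ} {a c : ℝ} {x z : Fin d → ℤ} (hc : 0 < c) (h : c + ‖z‖ ≤ a + ‖x‖) :
    dec n a x ≤ dec n c z := by
  simpa using dec_le (n := n) (k := 1) hc zero_le_one (by simpa using h)

lemma dec_pow_anti {n m : ℕ} (h : n ≤ m) {a : ℝ} (ha : 1 ≤ a) (x : Fin d → ℤ) :
    dec m a x ≤ dec n a x := by
  refine ENNReal.ofReal_le_ofReal (inv_anti₀ (by positivity) ?_)
  exact pow_le_pow_right₀ (by linarith [norm_nonneg x]) h

lemma dec_mul (n m : ℕ) {a : ℝ} (ha : 0 ≤ a) (x : Fin d → ℤ) :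
    dec n a x * dec m a x = dec (n + m) a x := by
  rw [dec, dec, dec, ← ENNReal.ofReal_mul (by positivity), ← mul_inv, pow_add]

lemma dec_min {n : ℕ} {a b c : ℝ} {x y z : Fin d → ℤ} (hc : 0 < c)
    (h : c + ‖z‖ ≤ (a + ‖x‖) + (b + ‖y‖)) :
    min (dec n a x) (dec n b y) ≤ ENNReal.ofReal (2 ^ n) * dec n c z := by
  rcases le_total (a + ‖x‖) (b + ‖y‖) with h' | h'
  · exact (min_le_right _ _).trans (dec_le hc (by norm_num) (by linarith))
  · exact (min_le_left _ _).trans (dec_le hc (by norm_num) (by linarith))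

lemma tsum_indicator_ball_le (R : ℝ) (hR : 0 ≤ R) :
    ∑' x : Fin d → ℤ, (if ‖x‖ ≤ R then (1 : ℝ≥0∞) else 0) ≤ ENNReal.ofReal ((2 * R + 1) ^ d) := by
  have hn : 0 ≤ ⌊R⌋ := Int.floor_nonneg.2 hR
  rw [tsum_eq_sum (s := Fintype.piFinset fun _ : Fin d => Finset.Icc (-⌊R⌋) ⌊R⌋)]
  · refine (Finset.sum_le_card_nsmul _ _ 1 fun x _ => by split_ifs <;> simp).trans ?_
    rw [Fintype.card_piFinset_const, nsmul_one, Int.card_Icc, ← ENNReal.ofReal_natCast]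
    refine ENNReal.ofReal_le_ofReal ?_
    rw [Nat.cast_pow]
    refine pow_le_pow_left₀ (by positivity) ?_ _
    have h1 : ((⌊R⌋ + 1 - -⌊R⌋).toNat : ℝ) = 2 * (⌊R⌋ : ℝ) + 1 := by
      have : ((⌊R⌋ + 1 - -⌊R⌋).toNat : ℤ) = 2 * ⌊R⌋ + 1 := by omega
      exact_mod_cast this
    rw [h1]
    linarith [Int.floor_le R]
  · intro x hx
    rw [if_neg]
    contrapose! hx
    rw [Fintype.mem_piFinset]
    intro i
    have h1 := (norm_le_pi_norm x i).trans hx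
    rw [Int.norm_eq_abs, ← Int.cast_abs] at h1
    have := Int.le_floor.2 h1
    rw [Finset.mem_Icc]
    exact abs_le.1 this

/-- The total mass of the basic profile is bounded uniformly in the scale. -/
lemma mul_tsum_dec_le {a : ℝ} (ha : 1 ≤ a) :
    ENNReal.ofReal a * ∑' x : Fin d → ℤ, dec (d + 1) a x ≤ ENNReal.ofReal (2 * 5 ^ d) := by
  have ha0 : 0 < a := by linarith
  have h1 : ∀ x : Fin d → ℤ, dec (d + 1) a x ≤ ∑' k : ℕ, ENNReal.ofReal (((2 ^ k * a) ^ (d + 1))⁻¹) *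
      (if ‖x‖ ≤ 2 ^ (k + 1) * a then 1 else 0) := by
    intro x
    obtain ⟨k, hk1, hk2⟩ := exists_nat_pow_near (x := (a + ‖x‖) / a) (y := (2 : ℝ))
      ((one_le_div ha0).2 (by linarith [norm_nonneg x])) (by norm_num)
    rw [le_div_iff₀ ha0] at hk1
    rw [div_lt_iff₀ ha0] at hk2
    refine le_trans ?_ (ENNReal.le_tsum k)
    rw [if_pos (by linarith), mul_one]
    refine ENNReal.ofReal_le_ofReal (inv_anti₀ (by positivity) ?_)
    exact pow_le_pow_left₀ (by positivity) hk1 _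
  calc _ ≤ ENNReal.ofReal a * ∑' x : Fin d → ℤ, ∑' k : ℕ,
          ENNReal.ofReal (((2 ^ k * a) ^ (d + 1))⁻¹) *
            (if ‖x‖ ≤ 2 ^ (k + 1) * a then 1 else 0) := by
        gcongr with x; exact h1 x
    _ = ∑' k : ℕ, ENNReal.ofReal a * (ENNReal.ofReal (((2 ^ k * a) ^ (d + 1))⁻¹) *
          ∑' x : Fin d → ℤ, (if ‖x‖ ≤ 2 ^ (k + 1) * a then 1 else 0)) := by
        rw [ENNReal.tsum_comm]
        simp only [ENNReal.tsum_mul_left]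
    _ ≤ ∑' k : ℕ, ENNReal.ofReal (5 ^ d * (1 / 2) ^ k) := by
        refine ENNReal.tsum_le_tsum fun k => ?_
        have hk : (1 : ℝ) ≤ 2 ^ k * a := one_le_mul_of_one_le_of_one_le
          (one_le_pow₀ (by norm_num)) ha
        refine (mul_le_mul' le_rfl (mul_le_mul' le_rfl (tsum_indicator_ball_le _
          (by positivity)))).trans ?_
        rw [← ENNReal.ofReal_mul (by positivity), ← ENNReal.ofReal_mul ha0.le]
        refine ENNReal.ofReal_le_ofReal ?_
        calc a * (((2 ^ k * a) ^ (d + 1))⁻¹ * (2 * (2 ^ (k + 1) * a) + 1) ^ d)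
            ≤ a * (((2 ^ k * a) ^ (d + 1))⁻¹ * (5 * (2 ^ k * a)) ^ d) := by
              gcongr
              rw [pow_succ]; nlinarith
          _ = _ := by
              have h2k : (2 : ℝ) ^ k ≠ 0 := by positivity
              rw [mul_pow 5, pow_succ (2 ^ k * a), one_div, inv_pow]
              field_simp
    _ = _ := by
        rw [← ENNReal.ofReal_tsum_of_nonneg (fun _ => by positivity)
          ((summable_geometric_of_lt_one (by norm_num) (by norm_num)).mul_left _), tsum_mul_left,
          tsum_geometric_of_lt_one (by norm_num) (by norm_num)]
        congr 1
        ring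

lemma tsum_dec_le {n : ℕ} (hn : d + 1 ≤ n) :
    ∑' x : Fin d → ℤ, dec n 1 x ≤ ENNReal.ofReal (2 * 5 ^ d) := by
  refine le_trans (ENNReal.tsum_le_tsum fun x => dec_pow_anti hn le_rfl x) ?_
  simpa using mul_tsum_dec_le (d := d) (a := 1) le_rfl

/-- Convolution with a summable profile at scale one preserves the profile at scale `a`. -/
lemma tsum_dec_mul_dec_le {a : ℝ} (ha : 1 ≤ a) (x : Fin d → ℤ) :
    ∑' y, dec (d + 1) 1 (x - y) * dec (d + 1) a y ≤
      ENNReal.ofReal (2 ^ (d + 3) * 5 ^ d) * dec (d + 1) a x := by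
  have h1 : ∀ y, dec (d + 1) 1 (x - y) * dec (d + 1) a y ≤
      ENNReal.ofReal (2 ^ (d + 1)) * dec (d + 1) a x *
        (dec (d + 1) 1 (x - y) + dec (d + 1) a y) := fun y =>
    mul_le_of_min_le (dec_min (by linarith) (by
      have := norm_add_le (x - y) y
      rw [sub_add_cancel] at this
      linarith))
  have h2 : ∑' y : Fin d → ℤ, dec (d + 1) 1 (x - y) ≤ ENNReal.ofReal (2 * 5 ^ d) := by
    exact ((Equiv.subLeft x).tsum_eq fun y => dec (d + 1) 1 y).trans_le (tsum_dec_le le_rfl)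
  have h3 : ∑' y : Fin d → ℤ, dec (d + 1) a y ≤ ENNReal.ofReal (2 * 5 ^ d) :=
    (ENNReal.tsum_le_tsum fun y => dec_anti one_pos (by linarith)).trans (tsum_dec_le le_rfl)
  refine (ENNReal.tsum_le_tsum h1).trans ?_
  rw [ENNReal.tsum_mul_left, ENNReal.tsum_add]
  calc _ ≤ ENNReal.ofReal (2 ^ (d + 1)) * dec (d + 1) a x *
        (ENNReal.ofReal (2 * 5 ^ d) + ENNReal.ofReal (2 * 5 ^ d)) := by gcongr
    _ = _ := by
      rw [← ENNReal.ofReal_add (by positivity) (by positivity), mul_right_comm,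
        ← ENNReal.ofReal_mul (by positivity)]
      congr 2; ring

/-- Reduction modulo `r`. -/
def red (d r : ℕ) : (Fin d → ℤ) →+ (Fin d → ZMod r) where
  toFun x i := (x i : ZMod r)
  map_zero' := by ext; simp
  map_add' x y := by ext; simp

/-- The mass of the far part of a residue class. -/
lemma tsum_class_le {a : ℝ} (ha : 1 ≤ a) {r : ℕ} (hr : 1 ≤ r) (x : Fin d → ZMod r) :
    (r : ℝ≥0∞) ^ d * (ENNReal.ofReal a * ∑' y : Fin d → ℤ,
      (if red d r y = x ∧ (r : ℝ) ≤ 4 * ‖y‖ then dec (d + 1) a y else 0)) ≤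
      ENNReal.ofReal (5 ^ (d + 1)) * ENNReal.ofReal (2 * 5 ^ d) := by
  have : NeZero r := ⟨by omega⟩
  let lift : (Fin d → ZMod r) → (Fin d → ℤ) := fun v i => ((v i).val : ℤ)
  have hlift : ∀ v, red d r (lift v) = v := by
    intro v; ext i; simp [red, lift]
  have hnorm : ∀ v, ‖lift v‖ ≤ r := by
    intro v
    rw [pi_norm_le_iff_of_nonneg (by positivity)]
    intro i
    have := (ZMod.val_lt (v i)).le
    simp only [lift, Int.norm_natCast]
    exact_mod_cast this
  have h1 : (r : ℝ≥0∞) ^ d * ∑' y : Fin d → ℤ,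
      (if red d r y = x ∧ (r : ℝ) ≤ 4 * ‖y‖ then dec (d + 1) a y else 0) ≤
      ENNReal.ofReal (5 ^ (d + 1)) * ∑' w : Fin d → ℤ, dec (d + 1) a w := by
    calc _ = ∑ v : Fin d → ZMod r, ∑' y : Fin d → ℤ,
          (if red d r y = x ∧ (r : ℝ) ≤ 4 * ‖y‖ then dec (d + 1) a y else 0) := by
          rw [Finset.sum_const, nsmul_eq_mul]
          simp [ZMod.card]
      _ ≤ ∑ v : Fin d → ZMod r, ∑' y : Fin d → ℤ, ENNReal.ofReal (5 ^ (d + 1)) *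
          (if red d r (y + lift v) = x + v then dec (d + 1) a (y + lift v) else 0) := by
          refine Finset.sum_le_sum fun v _ => ENNReal.tsum_le_tsum fun y => ?_
          split_ifs with h1 h2 h2
          · refine dec_le (by linarith) (by norm_num) ?_
            have := norm_add_le y (lift v)
            linarith [hnorm v, h1.2]
          · exact absurd (by rw [map_add, hlift, h1.1]) h2
          · simp
          · simp
      _ = ∑ v : Fin d → ZMod r, ∑' w : Fin d → ℤ, ENNReal.ofReal (5 ^ (d + 1)) *
          (if red d r w = x + v then dec (d + 1) a w else 0) :=
          Finset.sum_congr rfl fun v _ => (Equiv.addRight (lift v)).tsum_eq fun w =>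
            ENNReal.ofReal (5 ^ (d + 1)) * (if red d r w = x + v then dec (d + 1) a w else 0)
      _ = _ := by
          rw [← Summable.tsum_finsetSum fun _ _ => ENNReal.summable, ← ENNReal.tsum_mul_left]
          refine tsum_congr fun w => ?_
          rw [← Finset.mul_sum, Finset.sum_eq_single (red d r w - x)]
          · simp
          · intro v _ hv
            rw [if_neg]
            rintro h
            exact hv (by rw [h]; simp)
          · simp
  calc _ = ENNReal.ofReal a * ((r : ℝ≥0∞) ^ d * ∑' y : Fin d → ℤ,
      (if red d r y = x ∧ (r : ℝ) ≤ 4 * ‖y‖ then dec (d + 1) a y else 0)) := by ring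
    _ ≤ ENNReal.ofReal a * (ENNReal.ofReal (5 ^ (d + 1)) * ∑' w : Fin d → ℤ, dec (d + 1) a w) := by
        gcongr
    _ = ENNReal.ofReal (5 ^ (d + 1)) * (ENNReal.ofReal a * ∑' w : Fin d → ℤ, dec (d + 1) a w) := by
        ring
    _ ≤ _ := by gcongr; exact mul_tsum_dec_le ha

end Decay

end WSAW

namespace WSAW

section HeatKernel

open Real

/-- The integrand of the heat kernel. -/
noncomputable def hkInt (α : ℕ) (t : ℝ) (j : ℤ) (θ : ℝ) : ℝ :=
  exp (-t * (1 - cos θ)) *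
    ((Complex.exp (Complex.I * θ) - 1) ^ α * Complex.exp (Complex.I * (j * θ))).re

/-- The `α`-th difference of the heat kernel of the simple random walk on `ℤ`. -/
noncomputable def hk (α : ℕ) (t : ℝ) (j : ℤ) : ℝ :=
  (2 * π)⁻¹ * ∫ θ in (-π)..π, hkInt α t j θ

lemma continuous_hkInt (α : ℕ) (t : ℝ) (j : ℤ) : Continuous (hkInt α t j) := by
  unfold hkInt; fun_prop

lemma intervalIntegrable_hkInt (α : ℕ) (t : ℝ) (j : ℤ) (a b : ℝ) :
    IntervalIntegrable (hkInt α t j) MeasureTheory.volume a b :=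
  (continuous_hkInt α t j).intervalIntegrable a b

lemma hk_succ (α : ℕ) (t : ℝ) (j : ℤ) : hk (α + 1) t j = hk α t (j + 1) - hk α t j := by
  rw [hk, hk, hk, ← mul_sub, ← intervalIntegral.integral_sub (intervalIntegrable_hkInt _ _ _ _ _)
    (intervalIntegrable_hkInt _ _ _ _ _)]
  congr 2
  ext θ
  rw [hkInt, hkInt, hkInt, ← mul_sub, ← Complex.sub_re]
  congr 2
  rw [show Complex.I * (((j + 1 : ℤ) : ℂ) * θ) = Complex.I * θ + Complex.I * (j * θ) by
    push_cast; ring, Complex.exp_add]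
  ring

lemma hkInt_zero (t : ℝ) (j : ℤ) (θ : ℝ) :
    hkInt 0 t j θ = exp (-t * (1 - cos θ)) * cos (j * θ) := by
  have : Complex.I * (j * θ) = ((j * θ : ℝ) : ℂ) * Complex.I := by push_cast; ring
  rw [hkInt, pow_zero, one_mul, this, Complex.exp_ofReal_mul_I_re]

lemma hk_zero_zero (j : ℤ) : hk 0 0 j = if j = 0 then 1 else 0 := by
  rw [hk]
  have : ∀ θ, hkInt 0 0 j θ = cos (j * θ) := fun θ => by simp [hkInt_zero]
  simp only [this]
  split_ifs with h
  · subst h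
    simp; field_simp; ring
  · have hj : (j : ℝ) ≠ 0 := by exact_mod_cast h
    rw [intervalIntegral.integral_comp_mul_left (fun x => cos x) hj, integral_cos]
    simp [sin_int_mul_pi]

lemma hasDerivAt_hk (t : ℝ) (j : ℤ) :
    HasDerivAt (fun t => hk 0 t j) ((hk 0 t (j - 1) + hk 0 t (j + 1)) / 2 - hk 0 t j) t := by
  have h := (intervalIntegral.hasDerivAt_integral_of_dominated_loc_of_deriv_le
    (μ := MeasureTheory.volume) (a := -π) (b := π)
    (F := fun t θ => hkInt 0 t j θ)
    (F' := fun t θ => (hkInt 0 t (j - 1) θ + hkInt 0 t (j + 1) θ) / 2 - hkInt 0 t j θ)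
    (x₀ := t) (s := Metric.ball t 1) (bound := fun _ => 2 * exp (2 * (|t| + 1)))
    (Metric.ball_mem_nhds t one_pos)
    (Filter.Eventually.of_forall fun t => (continuous_hkInt 0 t j).aestronglyMeasurable)
    (intervalIntegrable_hkInt _ _ _ _ _)
    (by
      refine Continuous.aestronglyMeasurable ?_
      exact (((continuous_hkInt _ _ _).add (continuous_hkInt _ _ _)).div_const 2).sub
        (continuous_hkInt _ _ _))
    (Filter.Eventually.of_forall fun θ _ s hs => by
      have h0 : ∀ i : ℤ, |hkInt 0 s i θ| ≤ exp (2 * (|t| + 1)) := by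
        intro i
        rw [hkInt_zero, abs_mul, abs_of_pos (exp_pos _)]
        refine (mul_le_of_le_one_right (exp_pos _).le (abs_cos_le_one _)).trans ?_
        refine exp_le_exp.2 ?_
        have h1 : |s| ≤ |t| + 1 := by
          have := abs_sub_abs_le_abs_sub s t
          rw [Metric.mem_ball, Real.dist_eq] at hs
          linarith
        have h2 := abs_le.1 (abs_cos_le_one θ)
        have h3 := abs_le.1 (le_refl |s|)
        nlinarith
      rw [Real.norm_eq_abs]
      have e1 := abs_sub ((hkInt 0 s (j - 1) θ + hkInt 0 s (j + 1) θ) / 2) (hkInt 0 s j θ)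
      have e2 := abs_add_le (hkInt 0 s (j - 1) θ) (hkInt 0 s (j + 1) θ)
      rw [abs_div, abs_two] at e1
      linarith [h0 (j - 1), h0 (j + 1), h0 j])
    intervalIntegrable_const
    (Filter.Eventually.of_forall fun θ _ s hs => by
      have h1 : HasDerivAt (fun s => exp (-s * (1 - cos θ)) * cos (j * θ))
          (exp (-s * (1 - cos θ)) * (-1 * (1 - cos θ)) * cos (j * θ)) s :=
        (((hasDerivAt_id s).neg.mul_const (1 - cos θ)).exp).mul_const _
      simp only [hkInt_zero]
      refine h1.congr_deriv ?_
      have h2 := cos_add_cos ((j - 1 : ℤ) * θ) ((j + 1 : ℤ) * θ)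
      have e1 : ((j - 1 : ℤ) * θ + (j + 1 : ℤ) * θ) / 2 = j * θ := by push_cast; ring
      have e2 : ((j - 1 : ℤ) * θ - (j + 1 : ℤ) * θ) / 2 = -θ := by push_cast; ring
      rw [e1, e2, cos_neg] at h2
      linear_combination (-exp (-s * (1 - cos θ)) / 2) * h2)).2
  refine (HasDerivAt.const_mul ((2 * π)⁻¹ : ℝ) h).congr_deriv ?_
  rw [intervalIntegral.integral_sub, intervalIntegral.integral_div,
    intervalIntegral.integral_add (intervalIntegrable_hkInt _ _ _ _ _)
      (intervalIntegrable_hkInt _ _ _ _ _)]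
  · simp only [hk]; ring
  · have e1 := continuous_hkInt 0 t (j - 1)
    have e2 := continuous_hkInt 0 t (j + 1)
    exact Continuous.intervalIntegrable (by fun_prop) _ _
  · exact intervalIntegrable_hkInt _ _ _ _ _

lemma mul_hk_zero (t : ℝ) (j : ℤ) :
    j * hk 0 t j = t / 2 * (hk 0 t (j - 1) - hk 0 t (j + 1)) := by
  have h1 : ∀ θ, HasDerivAt (fun θ => exp (-t * (1 - cos θ)) * sin (j * θ))
      (j * hkInt 0 t j θ - t / 2 * (hkInt 0 t (j - 1) θ - hkInt 0 t (j + 1) θ)) θ := by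
    intro θ
    have h2 : HasDerivAt (fun θ => exp (-t * (1 - cos θ)) * sin (j * θ))
        (exp (-t * (1 - cos θ)) * (-t * (0 - -sin θ)) * sin (j * θ) +
          exp (-t * (1 - cos θ)) * (cos (j * θ) * (j * 1))) θ :=
      ((((hasDerivAt_const θ (1 : ℝ)).sub (hasDerivAt_cos θ)).const_mul (-t)).exp).mul
        (((hasDerivAt_id θ).const_mul (j : ℝ)).sin)
    refine h2.congr_deriv ?_
    simp only [hkInt_zero]
    have h3 := cos_sub_cos ((j - 1 : ℤ) * θ) ((j + 1 : ℤ) * θ)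
    have e1 : ((j - 1 : ℤ) * θ + (j + 1 : ℤ) * θ) / 2 = j * θ := by push_cast; ring
    have e2 : ((j - 1 : ℤ) * θ - (j + 1 : ℤ) * θ) / 2 = -θ := by push_cast; ring
    rw [e1, e2, sin_neg] at h3
    linear_combination (t / 2 * exp (-t * (1 - cos θ))) * h3
  have h2 := intervalIntegral.integral_eq_sub_of_hasDerivAt (a := -π) (b := π)
    (fun θ _ => h1 θ) (Continuous.intervalIntegrable (by
      exact ((continuous_hkInt _ _ _).const_mul _).sub
        (((continuous_hkInt _ _ _).sub (continuous_hkInt _ _ _)).const_mul _)) _ _)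
  rw [intervalIntegral.integral_sub, intervalIntegral.integral_const_mul,
    intervalIntegral.integral_const_mul,
    intervalIntegral.integral_sub (intervalIntegrable_hkInt _ _ _ _ _)
      (intervalIntegrable_hkInt _ _ _ _ _)] at h2
  · have h3 : sin (j * π) = 0 := sin_int_mul_pi j
    rw [mul_neg, sin_neg, h3] at h2
    simp only [hk]
    linear_combination (2 * π)⁻¹ * h2
  · exact (intervalIntegrable_hkInt _ _ _ _ _).const_mul _
  · exact ((intervalIntegrable_hkInt _ _ _ _ _).sub
      (intervalIntegrable_hkInt _ _ _ _ _)).const_mul _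

lemma mul_hk (α : ℕ) (t : ℝ) (j : ℤ) :
    j * hk α t j = -(t / 2) * (hk (α + 1) t j + hk (α + 1) t (j - 1)) -
      α * hk (α - 1) t (j + 1) := by
  induction α generalizing j with
  | zero =>
    rw [mul_hk_zero, hk_succ, hk_succ, sub_add_cancel]
    simp; ring
  | succ α ih =>
    have h1 := ih j
    have h2 := ih (j + 1)
    rw [hk_succ α, hk_succ (α + 1) t j, hk_succ (α + 1) t (j - 1), sub_add_cancel]
    rw [add_sub_cancel_right] at h2
    push_cast at h2 ⊢
    cases α with
    | zero =>
      simp only [Nat.cast_zero, zero_mul, sub_zero, zero_add] at *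
      linear_combination h2 - h1
    | succ n =>
      rw [Nat.add_sub_cancel] at *
      have h3 := hk_succ n t (j + 1)
      push_cast at *
      linear_combination h2 - h1 + (n + 1) * h3

lemma abs_hk_le (α : ℕ) : ∃ C : ℝ, 0 < C ∧ ∀ t : ℝ, 0 ≤ t → ∀ j : ℤ,
    |hk α t j| * √(1 + t) ^ (α + 1) ≤ C := by
  let c : ℝ := 2 / π ^ 2
  have hc : 0 < c := by positivity
  let N := α + 1
  let M : ℝ := exp 2 * (exp c * (N.factorial / c ^ N))
  have hM : 0 < M := by positivity
  refine ⟨M, hM, fun t ht j => ?_⟩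
  set a := √(1 + t) with ha
  have ha2 : a ^ 2 = 1 + t := by rw [ha, sq_sqrt (by linarith)]
  have ha0 : 0 < a := by rw [ha]; exact sqrt_pos.2 (by linarith)
  have key : ∀ θ ∈ Set.Icc (-π) π, |hkInt α t j θ| ≤ M / a ^ α * (1 + (a * θ) ^ 2)⁻¹ := by
    intro θ hθ
    have h1 : |hkInt α t j θ| ≤ exp (-t * (c * θ ^ 2)) * |θ| ^ α := by
      rw [hkInt, abs_mul, abs_of_pos (exp_pos _)]
      refine mul_le_mul (exp_le_exp.2 ?_) ?_ (abs_nonneg _) (exp_pos _).le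
      · have := cos_le_one_sub_mul_cos_sq (x := θ) (abs_le.2 hθ)
        simp only [c]
        nlinarith
      · refine (Complex.abs_re_le_norm _).trans ?_
        rw [norm_mul, norm_pow]
        have e1 : ‖Complex.exp (Complex.I * (j * θ))‖ = 1 := by
          have : Complex.I * (j * θ) = ((j * θ : ℝ) : ℂ) * Complex.I := by push_cast; ring
          rw [this, Complex.norm_exp_ofReal_mul_I]
        rw [e1, mul_one]
        refine pow_le_pow_left₀ (norm_nonneg _) ?_ _
        have := norm_exp_I_mul_ofReal_sub_one_le (x := θ)
        simpa using this
    have h2 : exp (-t * (c * θ ^ 2)) ≤ exp 2 * exp (-(c * (a * θ) ^ 2)) := by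
      rw [← exp_add]
      refine exp_le_exp.2 ?_
      have h3 : c * θ ^ 2 ≤ 2 := by
        have : θ ^ 2 ≤ π ^ 2 := sq_le_sq' hθ.1 hθ.2
        simp only [c]
        rw [div_mul_eq_mul_div, div_le_iff₀ (by positivity)]
        linarith
      rw [mul_pow, ha2]
      nlinarith
    set u := (a * θ) ^ 2 with hu
    have hu0 : 0 ≤ u := sq_nonneg _
    have h3 : exp (-(c * u)) ≤ exp c * (N.factorial / (c * (1 + u)) ^ N) := by
      have := pow_div_factorial_le_exp (c * (1 + u)) (by positivity) N
      rw [div_le_iff₀ (by positivity)] at this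
      rw [show -(c * u) = c + -(c * (1 + u)) by ring, exp_add]
      refine mul_le_mul_of_nonneg_left ?_ (exp_pos _).le
      rw [exp_neg, le_div_iff₀ (by positivity), inv_mul_le_iff₀ (exp_pos _)]
      exact this
    have h4 : |θ| ^ α * a ^ α ≤ (1 + u) ^ α := by
      rw [← mul_pow]
      refine pow_le_pow_left₀ (by positivity) ?_ _
      have : |θ| * a = |a * θ| := by rw [abs_mul, abs_of_pos ha0]; ring
      rw [this, hu, ← sq_abs (a * θ)]
      nlinarith [sq_nonneg (|a * θ| - 1), abs_nonneg (a * θ)]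
    rw [div_mul_eq_mul_div, le_div_iff₀ (by positivity)]
    calc _ ≤ exp (-t * (c * θ ^ 2)) * |θ| ^ α * a ^ α := by gcongr
      _ = exp (-t * (c * θ ^ 2)) * (|θ| ^ α * a ^ α) := by ring
      _ ≤ (exp 2 * (exp c * (N.factorial / (c * (1 + u)) ^ N))) * (1 + u) ^ α := by
          gcongr
          exact h2.trans (by gcongr)
      _ = _ := by
          simp only [M, N]
          rw [mul_pow, pow_succ (1 + u)]
          field_simp
  have h5 : |∫ θ in (-π)..π, hkInt α t j θ| ≤ M / a ^ α * (a⁻¹ * π) := by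
    have hle : -π ≤ π := by linarith [pi_pos]
    refine (intervalIntegral.abs_integral_le_integral_abs hle).trans ?_
    have hcont : Continuous fun θ : ℝ => M / a ^ α * (1 + (a * θ) ^ 2)⁻¹ := by
      refine continuous_const.mul (Continuous.inv₀ (by fun_prop) fun θ => by positivity)
    refine (intervalIntegral.integral_mono_on hle ((continuous_hkInt _ _ _).abs.intervalIntegrable
      _ _) (hcont.intervalIntegrable _ _) key).trans ?_
    rw [intervalIntegral.integral_const_mul,
      intervalIntegral.integral_comp_mul_left (fun x => (1 + x ^ 2)⁻¹) ha0.ne',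
      integral_inv_one_add_sq, smul_eq_mul]
    gcongr
    have e1 := arctan_lt_pi_div_two (a * π)
    have e2 := neg_pi_div_two_lt_arctan (a * -π)
    linarith
  rw [hk, abs_mul, abs_of_pos (by positivity)]
  calc _ ≤ (2 * π)⁻¹ * (M / a ^ α * (a⁻¹ * π)) * a ^ (α + 1) := by gcongr
    _ = M / 2 := by rw [pow_succ]; field_simp
    _ ≤ M := by linarith

/-- The weighted bound on the heat kernel. -/
lemma pow_mul_abs_hk_le (k α : ℕ) : ∃ C : ℝ, 0 < C ∧ ∀ t : ℝ, 0 ≤ t → ∀ j : ℤ,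
    (1 + |(j : ℝ)|) ^ k * |hk α t j| * √(1 + t) ^ (α + 1) ≤ C * √(1 + t) ^ k := by
  induction k generalizing α with
  | zero =>
    obtain ⟨C, hC, h⟩ := abs_hk_le α
    exact ⟨C, hC, fun t ht j => by simpa using h t ht j⟩
  | succ k ih =>
    obtain ⟨C0, hC0, h0⟩ := ih α
    obtain ⟨C1, hC1, h1⟩ := ih (α + 1)
    obtain ⟨C2, hC2, h2⟩ := ih (α - 1)
    refine ⟨C0 + 2 ^ k * C1 + α * (2 ^ k * C2), by positivity, fun t ht j => ?_⟩
    have g0 := h0 t ht j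
    have g1 := h1 t ht j
    have g1' := h1 t ht (j - 1)
    have g2 := h2 t ht (j + 1)
    set a := √(1 + t) with ha
    have ha2 : a ^ 2 = 1 + t := by rw [ha, sq_sqrt (by linarith)]
    have ha1 : 1 ≤ a := by rw [ha]; exact one_le_sqrt.2 (by linarith)
    set f0 := |hk α t j|
    set f1 := |hk (α + 1) t j|
    set f1' := |hk (α + 1) t (j - 1)|
    set f2 := |hk (α - 1) t (j + 1)|
    have hj : |(j : ℝ)| * f0 ≤ a ^ 2 / 2 * (f1 + f1') + α * f2 := by
      rw [← abs_mul, mul_hk]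
      refine (abs_sub _ _).trans (add_le_add ?_ (by rw [abs_mul, Nat.abs_cast]))
      rw [abs_mul, abs_neg, abs_of_nonneg (by positivity)]
      exact mul_le_mul (by linarith) (abs_add_le _ _) (abs_nonneg _) (by positivity)
    have s1 : (1 + |(j : ℝ)|) ^ k ≤ 2 ^ k * (1 + |((j - 1 : ℤ) : ℝ)|) ^ k := by
      rw [← mul_pow]
      refine pow_le_pow_left₀ (by positivity) ?_ _
      have : |(j : ℝ)| ≤ |((j - 1 : ℤ) : ℝ)| + 1 := by
        have := abs_add_le ((j - 1 : ℤ) : ℝ) 1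
        push_cast at this ⊢
        simpa using this
      linarith [abs_nonneg ((j - 1 : ℤ) : ℝ)]
    have s2 : (1 + |(j : ℝ)|) ^ k ≤ 2 ^ k * (1 + |((j + 1 : ℤ) : ℝ)|) ^ k := by
      rw [← mul_pow]
      refine pow_le_pow_left₀ (by positivity) ?_ _
      have : |(j : ℝ)| ≤ |((j + 1 : ℤ) : ℝ)| + 1 := by
        have := abs_add_le ((j + 1 : ℤ) : ℝ) (-1)
        push_cast at this ⊢
        simpa using this
      linarith [abs_nonneg ((j + 1 : ℤ) : ℝ)]
    have hα : (α : ℝ) * a ^ (α + 1) = α * a ^ (α - 1 + 1) * a := by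
      cases α with
      | zero => simp
      | succ n => rw [Nat.add_sub_cancel, pow_succ a (n + 1)]; ring
    have t2 : (1 + |(j : ℝ)|) ^ k * f1' ≤ 2 ^ k * ((1 + |((j - 1 : ℤ) : ℝ)|) ^ k * f1') := by
      rw [← mul_assoc]; gcongr
    have t3 : (1 + |(j : ℝ)|) ^ k * f2 ≤ 2 ^ k * ((1 + |((j + 1 : ℤ) : ℝ)|) ^ k * f2) := by
      rw [← mul_assoc]; gcongr
    have hk1 : (1 : ℝ) ≤ 2 ^ k := one_le_pow₀ (by norm_num)
    calc _ = (1 + |(j : ℝ)|) ^ k * f0 * a ^ (α + 1) +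
          (1 + |(j : ℝ)|) ^ k * (|(j : ℝ)| * f0) * a ^ (α + 1) := by ring
      _ ≤ C0 * a ^ k + (1 + |(j : ℝ)|) ^ k * (a ^ 2 / 2 * (f1 + f1') + α * f2) * a ^ (α + 1) := by
          gcongr
      _ = C0 * a ^ k + (a / 2 * ((1 + |(j : ℝ)|) ^ k * f1 * a ^ (α + 1 + 1)) +
          a / 2 * (((1 + |(j : ℝ)|) ^ k * f1') * a ^ (α + 1 + 1)) +
          (α * a ^ (α + 1)) * ((1 + |(j : ℝ)|) ^ k * f2)) := by ring
      _ ≤ C0 * a ^ k + (a / 2 * (C1 * a ^ k) + a / 2 *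
          ((2 ^ k * ((1 + |((j - 1 : ℤ) : ℝ)|) ^ k * f1')) * a ^ (α + 1 + 1)) +
          (α * a ^ (α + 1)) * (2 ^ k * ((1 + |((j + 1 : ℤ) : ℝ)|) ^ k * f2))) := by gcongr
      _ = C0 * a ^ k + (a / 2 * (C1 * a ^ k) + a / 2 *
          (2 ^ k * ((1 + |((j - 1 : ℤ) : ℝ)|) ^ k * f1' * a ^ (α + 1 + 1))) +
          α * a * (2 ^ k * ((1 + |((j + 1 : ℤ) : ℝ)|) ^ k * f2 * a ^ (α - 1 + 1)))) := by
          rw [hα]; ring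
      _ ≤ C0 * (a ^ k * a) + (a / 2 * (2 ^ k * C1 * a ^ k) + a / 2 * (2 ^ k * (C1 * a ^ k)) +
          α * a * (2 ^ k * (C2 * a ^ k))) := by
          gcongr
          · exact le_mul_of_one_le_right (by positivity) ha1
          · exact le_mul_of_one_le_left hC1.le hk1
      _ = _ := by ring

end HeatKernel

end WSAW

namespace WSAW

section ProductKernel

open Real

variable {d : ℕ}

/-- The differences of the heat kernel of the continuous time simple random walk on `ℤ^d`. -/
noncomputable def pk (α : Fin d → ℕ) (t : ℝ) (x : Fin d → ℤ) : ℝ := ∏ i, hk (α i) (t / d) (x i)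

/-- The forward difference in the direction `i`. -/
def fdiff (i : Fin d) (f : (Fin d → ℤ) → ℝ) (x : Fin d → ℤ) : ℝ := f (x + Pi.single i 1) - f x

lemma prod_apply_add_single {M : Type*} (f : Fin d → M → ℝ) (u : Fin d → M) (i : Fin d) (v : M) :
    ∏ k, f k (Function.update u i v k) = f i v * ∏ k ∈ Finset.univ.erase i, f k (u k) := by
  rw [← Finset.mul_prod_erase _ _ (Finset.mem_univ i), Function.update_self]
  congr 1
  refine Finset.prod_congr rfl fun k hk => ?_
  rw [Function.update_of_ne (Finset.ne_of_mem_erase hk)]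

lemma add_single_eq_update {M : Type*} [AddZeroClass M] (u : Fin d → M) (i : Fin d) (v : M) :
    u + Pi.single i v = Function.update u i (u i + v) := by
  ext k
  by_cases h : k = i
  · subst h; simp
  · simp [h]

lemma pk_add_single (α : Fin d → ℕ) (t : ℝ) (x : Fin d → ℤ) (i : Fin d) (v : ℤ) :
    pk α t (x + Pi.single i v) =
      hk (α i) (t / d) (x i + v) * ∏ k ∈ Finset.univ.erase i, hk (α k) (t / d) (x k) := by
  rw [pk, add_single_eq_update]
  exact prod_apply_add_single (fun k => hk (α k) (t / d)) x i (x i + v)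

lemma pk_eq (α : Fin d → ℕ) (t : ℝ) (x : Fin d → ℤ) (i : Fin d) :
    pk α t x = hk (α i) (t / d) (x i) * ∏ k ∈ Finset.univ.erase i, hk (α k) (t / d) (x k) := by
  rw [pk, Finset.mul_prod_erase _ (fun k => hk (α k) (t / d) (x k)) (Finset.mem_univ i)]

lemma fdiff_pk (α : Fin d → ℕ) (t : ℝ) (i : Fin d) :
    fdiff i (pk α t) = pk (α + Pi.single i 1) t := by
  ext x
  have h : pk (α + Pi.single i 1) t x = hk (α i + 1) (t / d) (x i) *
      ∏ k ∈ Finset.univ.erase i, hk (α k) (t / d) (x k) := by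
    rw [pk, add_single_eq_update]
    exact prod_apply_add_single (fun k a => hk a (t / d) (x k)) α i (α i + 1)
  rw [fdiff, h, pk_add_single, pk_eq α t x i, hk_succ]
  ring

lemma pk_zero_zero (x : Fin d → ℤ) : pk 0 0 x = if x = 0 then 1 else 0 := by
  simp only [pk, Pi.zero_apply, zero_div, hk_zero_zero]
  split_ifs with h
  · subst h; simp
  · obtain ⟨i, hi⟩ := Function.ne_iff.1 h
    exact Finset.prod_eq_zero (Finset.mem_univ i) (if_neg hi)

lemma continuous_hk_zero (j : ℤ) : Continuous fun t => hk 0 t j :=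
  continuous_iff_continuousAt.2 fun t => (hasDerivAt_hk t j).continuousAt

lemma continuous_hk (α : ℕ) (j : ℤ) : Continuous fun t => hk α t j := by
  induction α generalizing j with
  | zero => exact continuous_hk_zero j
  | succ α ih =>
    simp only [hk_succ]
    exact (ih (j + 1)).sub (ih j)

lemma continuous_pk (α : Fin d → ℕ) (x : Fin d → ℤ) : Continuous fun t => pk α t x := by
  unfold pk
  exact continuous_finsetProd _ fun i _ => (continuous_hk _ _).comp (continuous_id.div_const _)

/-- The heat equation. -/
lemma hasDerivAt_pk (hd : 0 < d) (t : ℝ) (x : Fin d → ℤ) :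
    HasDerivAt (fun t => pk 0 t x)
      ((2 * d : ℝ)⁻¹ * ∑ i, (pk 0 t (x + Pi.single i 1) + pk 0 t (x + Pi.single i (-1))) -
        pk 0 t x) t := by
  have hd' : (d : ℝ) ≠ 0 := by positivity
  have h := HasDerivAt.fun_finsetProd (u := Finset.univ) (x := t)
    (f := fun (i : Fin d) (t : ℝ) => hk 0 (t / d) (x i))
    (f' := fun i => ((hk 0 (t / d) (x i - 1) + hk 0 (t / d) (x i + 1)) / 2 -
      hk 0 (t / d) (x i)) * (1 / d)) fun i _ =>
        HasDerivAt.comp (h₂ := fun t => hk 0 t (x i)) (h := fun t : ℝ => t / d) t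
          (hasDerivAt_hk (t / d) (x i)) ((hasDerivAt_id' t).div_const _)
  refine HasDerivAt.congr_deriv (f := fun t => pk 0 t x) h ?_
  have e : pk 0 t x = (d : ℝ)⁻¹ * ∑ i : Fin d, pk 0 t x := by
    rw [Finset.sum_const, Finset.card_univ, Fintype.card_fin, nsmul_eq_mul]
    field_simp
  rw [e, Finset.mul_sum, Finset.mul_sum, ← Finset.sum_sub_distrib]
  refine Finset.sum_congr rfl fun i _ => ?_
  rw [pk_add_single, pk_add_single, pk_eq 0 t x i, smul_eq_mul]
  simp only [Pi.zero_apply, ← sub_eq_add_neg]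
  field_simp
  ring

lemma exists_norm_eq (hd : 0 < d) (x : Fin d → ℤ) : ∃ i, ‖x‖ = |(x i : ℝ)| := by
  have : Nonempty (Fin d) := ⟨⟨0, hd⟩⟩
  by_contra! h
  have h2 : ∀ i, ‖x i‖ < ‖x‖ := fun i =>
    lt_of_le_of_ne (norm_le_pi_norm x i) fun he => h i (by rw [← he, Int.norm_eq_abs])
  exact lt_irrefl _ ((pi_norm_lt_iff ((norm_nonneg _).trans_lt (h2 ⟨0, hd⟩))).2 h2)

lemma exists_hk_bound (k : ℕ) : ∃ C : ℝ, 0 < C ∧ ∀ α ≤ 3, ∀ t : ℝ, 0 ≤ t → ∀ j : ℤ,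
    (1 + |(j : ℝ)|) ^ k * |hk α t j| * √(1 + t) ^ (α + 1) ≤ C * √(1 + t) ^ k := by
  choose C hC h using pow_mul_abs_hk_le k
  refine ⟨∑ α ∈ Finset.range 4, C α, Finset.sum_pos (fun α _ => hC α) ⟨0, by simp⟩,
    fun α hα t ht j => (h α t ht j).trans ?_⟩
  gcongr
  exact Finset.single_le_sum (f := C) (fun i _ => (hC i).le) (Finset.mem_range.2 (by omega))

/-- The Gaussian-type bound on the heat kernel and its first three differences. -/
lemma exists_pk_bound (hd : 0 < d) : ∃ C : ℝ, 0 < C ∧ ∀ α : Fin d → ℕ, ∑ i, α i ≤ 3 →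
    ∀ t : ℝ, 0 ≤ t → ∀ x, |pk α t x| ≤
      C * √(1 + t) ^ (3 - ∑ i, α i) * ((√(1 + t) + ‖x‖) ^ (d + 3))⁻¹ := by
  obtain ⟨A, hA, hA'⟩ := exists_hk_bound 0
  obtain ⟨B, hB, hB'⟩ := exists_hk_bound (d + 3)
  refine ⟨d ^ (d + 3) * (2 ^ (d + 3) * (2 * (A + B) ^ d)), by positivity, fun α hα t ht x => ?_⟩
  set n := ∑ i, α i with hn
  set a := √(1 + t) with ha
  set b := √(1 + t / d) with hb
  have hdr : (1 : ℝ) ≤ d := by exact_mod_cast hd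
  have hb1 : 1 ≤ b := one_le_sqrt.2 (by have : 0 ≤ t / d := by positivity
                                        linarith)
  have hba : b ≤ a := sqrt_le_sqrt (by
    have : t / d ≤ t := div_le_self ht hdr
    linarith)
  have hab : a ≤ d * b := by
    rw [ha, hb, ← sqrt_sq (show (0 : ℝ) ≤ d by positivity), ← sqrt_mul (sq_nonneg _),
      sqrt_sq (by positivity)]
    refine sqrt_le_sqrt ?_
    rw [mul_add, show (d : ℝ) ^ 2 * (t / d) = d * t by field_simp]
    nlinarith
  have ha0 : 0 < a := by linarith
  have hαi : ∀ i, α i ≤ 3 := fun i =>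
    (Finset.single_le_sum (f := α) (fun _ _ => Nat.zero_le _) (Finset.mem_univ i)).trans hα
  have hdt : 0 ≤ t / d := by positivity
  have hpow : b ^ (n + d) = ∏ i, b ^ (α i + 1) := by
    rw [Finset.prod_pow_eq_pow_sum, Finset.sum_add_distrib, hn]; simp
  have f1 : |pk α t x| * b ^ (n + d) ≤ (A + B) ^ d := by
    rw [pk, Finset.abs_prod, hpow, ← Finset.prod_mul_distrib]
    refine (Finset.prod_le_prod (fun i _ => by positivity) (g := fun _ => A + B)
      fun i _ => ?_).trans (by simp)
    have := hA' (α i) (hαi i) _ hdt (x i)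
    simp only [pow_zero, one_mul, mul_one] at this
    linarith
  obtain ⟨i₀, hi₀⟩ := exists_norm_eq hd x
  have f2 : (1 + ‖x‖) ^ (d + 3) * (|pk α t x| * b ^ (n + d)) ≤ (A + B) ^ d * b ^ (d + 3) := by
    have e1 : (1 + ‖x‖) ^ (d + 3) = ∏ i, if i = i₀ then (1 + |(x i : ℝ)|) ^ (d + 3) else 1 := by
      rw [Finset.prod_ite_eq' Finset.univ i₀, if_pos (Finset.mem_univ _), hi₀]
    have e2 : (A + B) ^ d * b ^ (d + 3) = ∏ i, (A + B) * if i = i₀ then b ^ (d + 3) else 1 := by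
      rw [Finset.prod_mul_distrib, Finset.prod_ite_eq' Finset.univ i₀,
        if_pos (Finset.mem_univ _)]
      simp
    rw [pk, Finset.abs_prod, hpow, ← Finset.prod_mul_distrib, e1, e2, ← Finset.prod_mul_distrib]
    refine Finset.prod_le_prod (fun i _ => by split_ifs <;> positivity) fun i _ => ?_
    split_ifs with h
    · have := hB' (α i) (hαi i) _ hdt (x i)
      rw [← mul_assoc]
      refine this.trans ?_
      gcongr
      linarith
    · have := hA' (α i) (hαi i) _ hdt (x i)
      simp only [pow_zero, one_mul, mul_one] at this ⊢
      linarith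
  have f3 : (a + ‖x‖) ^ (d + 3) * (|pk α t x| * b ^ (n + d)) ≤
      2 ^ (d + 3) * (2 * (A + B) ^ d) * a ^ (d + 3) := by
    have g1 : (a + ‖x‖) ^ (d + 3) ≤ 2 ^ (d + 3) * (a ^ (d + 3) + (1 + ‖x‖) ^ (d + 3)) := by
      refine (pow_le_pow_left₀ (by positivity) (show a + ‖x‖ ≤ a + (1 + ‖x‖) by linarith) _).trans
        ((add_pow_le ha0.le (by positivity) _).trans ?_)
      gcongr
      · norm_num
      · omega
    calc _ ≤ 2 ^ (d + 3) * (a ^ (d + 3) + (1 + ‖x‖) ^ (d + 3)) * (|pk α t x| * b ^ (n + d)) := by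
          gcongr
      _ = 2 ^ (d + 3) * (a ^ (d + 3) * (|pk α t x| * b ^ (n + d)) +
          (1 + ‖x‖) ^ (d + 3) * (|pk α t x| * b ^ (n + d))) := by ring
      _ ≤ 2 ^ (d + 3) * (a ^ (d + 3) * (A + B) ^ d + (A + B) ^ d * a ^ (d + 3)) := by
          refine mul_le_mul_of_nonneg_left (add_le_add (by gcongr) (f2.trans (by gcongr)))
            (by positivity)
      _ = _ := by ring
  have f4 : a ^ (n + d) ≤ d ^ (d + 3) * b ^ (n + d) := by
    calc a ^ (n + d) ≤ (d * b) ^ (n + d) := by gcongr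
      _ = d ^ (n + d) * b ^ (n + d) := mul_pow _ _ _
      _ ≤ _ := by
        gcongr ?_ * _
        exact pow_le_pow_right₀ hdr (by omega)
  have hx0 : 0 < a + ‖x‖ := by positivity
  rw [← div_eq_mul_inv, le_div_iff₀ (by positivity)]
  refine le_of_mul_le_mul_right ?_ (pow_pos ha0 (n + d))
  calc |pk α t x| * (a + ‖x‖) ^ (d + 3) * a ^ (n + d)
      ≤ |pk α t x| * (a + ‖x‖) ^ (d + 3) * (d ^ (d + 3) * b ^ (n + d)) := by gcongr
    _ = d ^ (d + 3) * ((a + ‖x‖) ^ (d + 3) * (|pk α t x| * b ^ (n + d))) := by ring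
    _ ≤ d ^ (d + 3) * (2 ^ (d + 3) * (2 * (A + B) ^ d) * a ^ (d + 3)) := by gcongr
    _ = _ := by
      rw [show a ^ (d + 3) = a ^ (3 - n) * a ^ (n + d) by rw [← pow_add]; congr 1; omega]
      ring

/-- The bound on the differences of the heat kernel without time decay. -/
lemma exists_pk_bound_pow (hd : 0 < d) : ∃ C : ℝ, 0 < C ∧ ∀ α : Fin d → ℕ, ∑ i, α i ≤ 3 →
    ∀ t : ℝ, 0 ≤ t → ∀ x, |pk α t x| ≤ C * ((√(1 + t) + ‖x‖) ^ (d + ∑ i, α i))⁻¹ := by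
  obtain ⟨C, hC, h⟩ := exists_pk_bound hd
  refine ⟨C, hC, fun α hα t ht x => (h α hα t ht x).trans ?_⟩
  have ha : 0 < √(1 + t) := sqrt_pos.2 (by linarith)
  rw [mul_assoc]
  refine mul_le_mul_of_nonneg_left ?_ hC.le
  have e : d + 3 = (3 - ∑ i, α i) + (d + ∑ i, α i) := by omega
  have h1 : √(1 + t) ^ (3 - ∑ i, α i) ≤ (√(1 + t) + ‖x‖) ^ (3 - ∑ i, α i) := by
    gcongr
    linarith [norm_nonneg x]
  have h2 : 0 < √(1 + t) + ‖x‖ := by positivity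
  rw [e, pow_add _ (3 - ∑ i, α i), mul_inv, ← mul_assoc, ← div_eq_mul_inv]
  exact mul_le_of_le_one_left (by positivity) ((div_le_one (by positivity)).2 h1)

/-- The bound on the heat kernel keeping the time decay. -/
lemma exists_pk_zero_bound (hd : 0 < d) : ∃ C : ℝ, 0 < C ∧
    ∀ t : ℝ, 0 ≤ t → ∀ x : Fin d → ℤ,
      |pk 0 t x| ≤ C * (√(1 + t) * ((√(1 + t) + ‖x‖) ^ (d + 1))⁻¹) := by
  obtain ⟨C, hC, h⟩ := exists_pk_bound hd
  refine ⟨C, hC, fun t ht x => (h 0 (by simp) t ht x).trans ?_⟩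
  have ha : 0 < √(1 + t) := sqrt_pos.2 (by linarith)
  simp only [Pi.zero_apply, Finset.sum_const_zero, Nat.sub_zero]
  rw [mul_assoc]
  refine mul_le_mul_of_nonneg_left ?_ hC.le
  rw [← div_eq_mul_inv, ← div_eq_mul_inv, div_le_div_iff₀ (by positivity) (by positivity)]
  calc √(1 + t) ^ 3 * (√(1 + t) + ‖x‖) ^ (d + 1)
      = √(1 + t) * (√(1 + t) ^ 2 * (√(1 + t) + ‖x‖) ^ (d + 1)) := by ring
    _ ≤ √(1 + t) * ((√(1 + t) + ‖x‖) ^ 2 * (√(1 + t) + ‖x‖) ^ (d + 1)) := by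
        gcongr
        linarith [norm_nonneg x]
    _ = _ := by rw [← pow_add]; congr 2; omega

end ProductKernel

end WSAW

namespace WSAW

section Resolvent

open Real MeasureTheory

variable {d : ℕ}

/-- The differences of the massive Green function of the simple random walk on `ℤ^d`. -/
noncomputable def green (m : ℝ) (α : Fin d → ℕ) (x : Fin d → ℤ) : ℝ :=
  ∫ t in Set.Ioi (0 : ℝ), exp (-m * t) * pk α t x

/-- The dominating function of the massive Green function. -/
noncomputable def greenDom (m : ℝ) (x : Fin d → ℤ) : ℝ≥0∞ :=
  ∫⁻ t in Set.Ioi (0 : ℝ), ENNReal.ofReal (exp (-m * t)) *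
    (ENNReal.ofReal √(1 + t) * dec (d + 1) √(1 + t) x)

lemma lintegral_inv_pow_le {n : ℕ} (hn : 4 ≤ n) {R : ℝ} (hR : 0 ≤ R) :
    ∫⁻ t in Set.Ioi (0 : ℝ), ENNReal.ofReal (((√(1 + t) + R) ^ n)⁻¹) ≤
      ENNReal.ofReal (2 * ((1 + R) ^ (n - 2))⁻¹) := by
  have hder : ∀ t ∈ Set.Ici (0 : ℝ), HasDerivAt (fun t => -(1 + t + R ^ 2)⁻¹)
      (((1 + t + R ^ 2) ^ 2)⁻¹) t := by
    intro t ht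
    have ht0 : (0 : ℝ) ≤ t := ht
    have h1 : HasDerivAt (fun t : ℝ => 1 + t + R ^ 2) 1 t :=
      ((hasDerivAt_id' t).const_add 1).add_const (R ^ 2)
    have h2 := (h1.inv (by positivity)).neg
    refine h2.congr_deriv ?_
    rw [neg_div, neg_neg, one_div]
  have hnn : ∀ t ∈ Set.Ioi (0 : ℝ), 0 ≤ ((1 + t + R ^ 2) ^ 2)⁻¹ := fun t _ => by positivity
  have hlim : Filter.Tendsto (fun t : ℝ => -(1 + t + R ^ 2)⁻¹) Filter.atTop (nhds 0) := by
    rw [← neg_zero]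
    refine Filter.Tendsto.neg (Filter.Tendsto.comp tendsto_inv_atTop_zero ?_)
    exact Filter.tendsto_atTop_add_const_right _ _
      (Filter.tendsto_atTop_add_const_left _ _ Filter.tendsto_id)
  have h_int := integrableOn_Ioi_deriv_of_nonneg' hder hnn hlim
  have hval := integral_Ioi_of_hasDerivAt_of_nonneg' hder hnn hlim
  have hval' : ∫⁻ t in Set.Ioi (0 : ℝ), ENNReal.ofReal (((1 + t + R ^ 2) ^ 2)⁻¹) =
      ENNReal.ofReal ((1 + R ^ 2)⁻¹) := by
    rw [← ofReal_integral_eq_lintegral_ofReal h_int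
      (Filter.Eventually.of_forall fun t => by positivity), hval]
    congr 1
    ring
  calc _ ≤ ∫⁻ t in Set.Ioi (0 : ℝ), ENNReal.ofReal (((1 + R) ^ (n - 4))⁻¹) *
        ENNReal.ofReal (((1 + t + R ^ 2) ^ 2)⁻¹) := by
        refine setLIntegral_mono' measurableSet_Ioi fun t ht => ?_
        have ht0 : (0 : ℝ) ≤ t := (Set.mem_Ioi.1 ht).le
        rw [← ENNReal.ofReal_mul (by positivity), ← mul_inv]
        refine ENNReal.ofReal_le_ofReal (inv_anti₀ (by positivity) ?_)
        have ha1 : 1 ≤ √(1 + t) := one_le_sqrt.2 (by linarith)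
        have ha2 : √(1 + t) ^ 2 = 1 + t := sq_sqrt (by linarith)
        have e : n = (n - 4) + 4 := by omega
        conv_rhs => rw [e, pow_add]
        gcongr
        calc (1 + t + R ^ 2) ^ 2 ≤ ((√(1 + t) + R) ^ 2) ^ 2 := by
              gcongr
              nlinarith
          _ = _ := by ring
    _ = ENNReal.ofReal (((1 + R) ^ (n - 4))⁻¹) * ENNReal.ofReal ((1 + R ^ 2)⁻¹) := by
        rw [lintegral_const_mul' _ _ ENNReal.ofReal_ne_top, hval']
    _ ≤ _ := by
        rw [← ENNReal.ofReal_mul (by positivity)]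
        refine ENNReal.ofReal_le_ofReal ?_
        have e : n - 2 = (n - 4) + 2 := by omega
        rw [e, pow_add, mul_inv, mul_left_comm]
        gcongr
        rw [← div_eq_mul_inv, inv_eq_one_div, div_le_div_iff₀ (by positivity) (by positivity)]
        nlinarith [sq_nonneg (1 - R)]

lemma measurable_dec (n : ℕ) (x : Fin d → ℤ) : Measurable fun t => dec n √(1 + t) x := by
  unfold dec
  fun_prop

lemma greenDom_le (hd : 5 ≤ d) {m : ℝ} (hm : 0 < m) (x : Fin d → ℤ) :
    greenDom m x ≤ ENNReal.ofReal 2 * dec (d - 2) 1 x := by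
  rw [dec, ← ENNReal.ofReal_mul (by norm_num)]
  refine le_trans ?_ (lintegral_inv_pow_le (n := d) (by omega) (norm_nonneg x))
  refine setLIntegral_mono' measurableSet_Ioi fun t ht => ?_
  have ht0 : (0 : ℝ) ≤ t := (Set.mem_Ioi.1 ht).le
  have ha1 : 1 ≤ √(1 + t) := one_le_sqrt.2 (by linarith)
  rw [dec, ← ENNReal.ofReal_mul (by positivity), ← ENNReal.ofReal_mul (by positivity)]
  refine ENNReal.ofReal_le_ofReal ?_
  have h1 : exp (-m * t) ≤ 1 := exp_le_one_iff.2 (by nlinarith)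
  refine (mul_le_of_le_one_left (by positivity) h1).trans ?_
  rw [pow_succ, mul_inv, ← mul_assoc, mul_right_comm, ← div_eq_mul_inv]
  refine mul_le_of_le_one_left (by positivity) ((div_le_one (by positivity)).2 ?_)
  linarith [norm_nonneg x]

lemma lintegral_exp_neg {m : ℝ} (hm : 0 < m) :
    ∫⁻ t in Set.Ioi (0 : ℝ), ENNReal.ofReal (exp (-m * t)) = ENNReal.ofReal m⁻¹ := by
  rw [← ofReal_integral_eq_lintegral_ofReal (integrableOn_exp_mul_Ioi (by linarith) 0)
    (Filter.Eventually.of_forall fun t => (exp_pos _).le), integral_exp_mul_Ioi (by linarith)]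
  simp [neg_div_neg_eq]

lemma lintegral_exp_mul_le {m : ℝ} (hm : 0 < m) {f : ℝ → ℝ≥0∞} {c : ℝ≥0∞} (hc : c ≠ ∞)
    (hf : ∀ t, 0 ≤ t → f t ≤ c) :
    ∫⁻ t in Set.Ioi (0 : ℝ), ENNReal.ofReal (exp (-m * t)) * f t ≤ ENNReal.ofReal m⁻¹ * c := by
  rw [← lintegral_exp_neg hm, ← lintegral_mul_const' _ _ hc]
  exact setLIntegral_mono' measurableSet_Ioi fun t ht => by
    gcongr; exact hf t (Set.mem_Ioi.1 ht).le

lemma measurable_greenDom (m : ℝ) (x : Fin d → ℤ) :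
    Measurable fun t => ENNReal.ofReal (exp (-m * t)) *
      (ENNReal.ofReal √(1 + t) * dec (d + 1) √(1 + t) x) :=
  (by fun_prop : Measurable fun t => ENNReal.ofReal (exp (-m * t))).mul
    ((by fun_prop : Measurable fun t => ENNReal.ofReal √(1 + t)).mul (measurable_dec _ x))

lemma tsum_class_greenDom_le {r : ℕ} (hr : 3 ≤ r) {m : ℝ} (hm : 0 < m) (x : Fin d → ZMod r) :
    (r : ℝ≥0∞) ^ d * ∑' y : Fin d → ℤ, (if red d r y = x ∧ (r : ℝ) ≤ 4 * ‖y‖ then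
      greenDom m y else 0) ≤
      ENNReal.ofReal m⁻¹ * (ENNReal.ofReal (5 ^ (d + 1)) * ENNReal.ofReal (2 * 5 ^ d)) := by
  have h : ∀ y : Fin d → ℤ, (if red d r y = x ∧ (r : ℝ) ≤ 4 * ‖y‖ then greenDom m y else 0) =
      ∫⁻ t in Set.Ioi (0 : ℝ), ENNReal.ofReal (exp (-m * t)) * (ENNReal.ofReal √(1 + t) *
        if red d r y = x ∧ (r : ℝ) ≤ 4 * ‖y‖ then dec (d + 1) √(1 + t) y else 0) := by
    intro y
    split_ifs
    · rfl
    · simp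
  simp only [h]
  rw [← lintegral_tsum fun y => ?_]
  · rw [← lintegral_const_mul' _ _ (by finiteness)]
    simp only [ENNReal.tsum_mul_left, mul_left_comm _ (ENNReal.ofReal (exp _))]
    exact lintegral_exp_mul_le hm (by finiteness) fun t ht =>
      tsum_class_le (a := √(1 + t)) (r := r) (one_le_sqrt.2 (by linarith)) (by omega) x
  · split_ifs
    · exact (measurable_greenDom m y).aemeasurable
    · simp

lemma tsum_dec_mul_greenDom_le {m : ℝ} (hm : 0 < m) (x : Fin d → ℤ) :
    ∑' y : Fin d → ℤ, dec (d + 1) 1 (x - y) * greenDom m y ≤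
      ENNReal.ofReal (2 ^ (d + 3) * 5 ^ d) * greenDom m x := by
  unfold greenDom
  simp only [← lintegral_const_mul' _ _ (dec_ne_top _ _ _)]
  rw [← lintegral_tsum fun y => ((measurable_greenDom m y).const_mul _).aemeasurable,
    ← lintegral_const_mul' _ _ ENNReal.ofReal_ne_top]
  refine setLIntegral_mono' measurableSet_Ioi fun t ht => ?_
  have h := tsum_dec_mul_dec_le (d := d) (a := √(1 + t))
    (one_le_sqrt.2 (by linarith [Set.mem_Ioi.1 ht])) x
  calc _ = ENNReal.ofReal (exp (-m * t)) * (ENNReal.ofReal √(1 + t) *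
        ∑' y : Fin d → ℤ, dec (d + 1) 1 (x - y) * dec (d + 1) √(1 + t) y) := by
        rw [← ENNReal.tsum_mul_left, ← ENNReal.tsum_mul_left]
        exact tsum_congr fun y => by ring
    _ ≤ ENNReal.ofReal (exp (-m * t)) * (ENNReal.ofReal √(1 + t) *
        (ENNReal.ofReal (2 ^ (d + 3) * 5 ^ d) * dec (d + 1) √(1 + t) x)) := by gcongr
    _ = _ := by ring

/-- The bounds on the Green function and its first three differences. -/
lemma exists_green_bound (hd : 5 ≤ d) : ∃ C : ℝ, 0 < C ∧ ∀ m : ℝ, 0 < m →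
    ∀ α : Fin d → ℕ, ∑ i, α i ≤ 3 → ∀ x,
      IntegrableOn (fun t => exp (-m * t) * pk α t x) (Set.Ioi 0) ∧
      ENNReal.ofReal |green m α x| ≤ ENNReal.ofReal C * dec (d + ∑ i, α i - 2) 1 x := by
  obtain ⟨C, hC, h⟩ := exists_pk_bound_pow (d := d) (by omega)
  refine ⟨C * 2, by positivity, fun m hm α hα x => ?_⟩
  have h1 : ∫⁻ t in Set.Ioi (0 : ℝ), ‖exp (-m * t) * pk α t x‖ₑ ≤
      ENNReal.ofReal (C * 2) * dec (d + ∑ i, α i - 2) 1 x := by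
    rw [ENNReal.ofReal_mul hC.le, mul_assoc, dec, ← ENNReal.ofReal_mul (by norm_num)]
    refine le_trans ?_ (mul_le_mul_right (lintegral_inv_pow_le (n := d + ∑ i, α i) (by omega)
      (norm_nonneg x)) _)
    rw [← lintegral_const_mul' _ _ ENNReal.ofReal_ne_top]
    refine setLIntegral_mono' measurableSet_Ioi fun t ht => ?_
    have ht0 : (0 : ℝ) ≤ t := (Set.mem_Ioi.1 ht).le
    rw [Real.enorm_eq_ofReal_abs, ← ENNReal.ofReal_mul hC.le]
    refine ENNReal.ofReal_le_ofReal ?_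
    rw [abs_mul, abs_of_pos (exp_pos _)]
    exact (mul_le_of_le_one_left (abs_nonneg _) (exp_le_one_iff.2 (by nlinarith))).trans
      (h α hα t ht0 x)
  have hmeas : Continuous fun t => exp (-m * t) * pk α t x :=
    (by fun_prop : Continuous fun t => exp (-m * t)).mul (continuous_pk α x)
  refine ⟨⟨hmeas.aestronglyMeasurable, lt_of_le_of_lt h1 ?_⟩, ?_⟩
  · exact ENNReal.mul_lt_top ENNReal.ofReal_lt_top (dec_ne_top _ _ _).lt_top
  · rw [← Real.enorm_eq_ofReal_abs]
    exact (enorm_integral_le_lintegral_enorm _).trans h1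

lemma exists_green_zero_bound (hd : 0 < d) : ∃ C : ℝ, 0 < C ∧ ∀ m : ℝ,
    ∀ x : Fin d → ℤ, ENNReal.ofReal |green m 0 x| ≤ ENNReal.ofReal C * greenDom m x := by
  obtain ⟨C, hC, h⟩ := exists_pk_zero_bound hd
  refine ⟨C, hC, fun m x => ?_⟩
  rw [← Real.enorm_eq_ofReal_abs]
  refine (enorm_integral_le_lintegral_enorm _).trans ?_
  rw [greenDom, ← lintegral_const_mul' _ _ ENNReal.ofReal_ne_top]
  refine setLIntegral_mono' measurableSet_Ioi fun t ht => ?_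
  have ht0 : (0 : ℝ) ≤ t := (Set.mem_Ioi.1 ht).le
  rw [Real.enorm_eq_ofReal_abs, abs_mul, abs_of_pos (exp_pos _), dec,
    ← ENNReal.ofReal_mul (by positivity), ← ENNReal.ofReal_mul (by positivity),
    ← ENNReal.ofReal_mul (by positivity)]
  refine ENNReal.ofReal_le_ofReal ?_
  rw [mul_left_comm]
  exact mul_le_mul_of_nonneg_left (h t ht0 x) (exp_pos _).le

lemma fdiff_green (hd : 5 ≤ d) {m : ℝ} (hm : 0 < m) (α : Fin d → ℕ) (hα : ∑ i, α i ≤ 3)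
    (i : Fin d) : fdiff i (green m α) = green m (α + Pi.single i 1) := by
  obtain ⟨C, hC, h⟩ := exists_green_bound hd
  ext x
  rw [fdiff, green, green, green, ← integral_sub (h m hm α hα _).1 (h m hm α hα _).1]
  simp only [← fdiff_pk, fdiff, mul_sub]

/-- The Green function equation. -/
lemma green_equation (hd : 5 ≤ d) {m : ℝ} (hm : 0 < m) (x : Fin d → ℤ) :
    (1 + m) * green m 0 x - (2 * d : ℝ)⁻¹ *
      ∑ i, (green m 0 (x + Pi.single i 1) + green m 0 (x + Pi.single i (-1))) =
      if x = 0 then 1 else 0 := by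
  obtain ⟨C, hC, h⟩ := exists_green_bound hd
  have hI : ∀ y, IntegrableOn (fun t => exp (-m * t) * pk 0 t y) (Set.Ioi 0) :=
    fun y => (h m hm 0 (by simp) y).1
  set D : ℝ → ℝ := fun t => (2 * d : ℝ)⁻¹ * ∑ i, (exp (-m * t) * pk 0 t (x + Pi.single i 1) +
    exp (-m * t) * pk 0 t (x + Pi.single i (-1))) - (1 + m) * (exp (-m * t) * pk 0 t x) with hD
  have hp : ∀ i, IntegrableOn (fun t => exp (-m * t) * pk 0 t (x + Pi.single i 1) +
      exp (-m * t) * pk 0 t (x + Pi.single i (-1))) (Set.Ioi 0) := fun i => (hI _).add (hI _)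
  have hS : IntegrableOn (fun t => ∑ i, (exp (-m * t) * pk 0 t (x + Pi.single i 1) +
      exp (-m * t) * pk 0 t (x + Pi.single i (-1)))) (Set.Ioi 0) :=
    integrable_finsetSum _ fun i _ => hp i
  have hDint : IntegrableOn D (Set.Ioi 0) := (hS.const_mul _).sub ((hI x).const_mul _)
  have hder : ∀ t ∈ Set.Ici (0 : ℝ), HasDerivAt (fun t => exp (-m * t) * pk 0 t x) (D t) t := by
    intro t _
    have h1 : HasDerivAt (fun t => exp (-m * t)) (exp (-m * t) * (-m * 1)) t :=
      ((hasDerivAt_id' t).const_mul (-m)).exp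
    refine (h1.mul (hasDerivAt_pk (by omega) t x)).congr_deriv ?_
    simp only [hD, ← mul_add, ← Finset.mul_sum]
    ring
  have hlim : Filter.Tendsto (fun t => exp (-m * t) * pk 0 t x) Filter.atTop (nhds 0) := by
    obtain ⟨A, hA, hA'⟩ := exists_pk_bound_pow (d := d) (by omega)
    have h1 : Filter.Tendsto (fun t => A * exp (-m * t)) Filter.atTop (nhds 0) := by
      rw [← mul_zero A]
      refine Filter.Tendsto.const_mul _ (tendsto_exp_atBot.comp ?_)
      exact Filter.tendsto_id.const_mul_atTop_of_neg (by linarith)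
    refine squeeze_zero_norm' ?_ h1
    filter_upwards [Filter.eventually_ge_atTop 0] with t ht
    rw [Real.norm_eq_abs, abs_mul, abs_of_pos (exp_pos _), mul_comm A]
    refine mul_le_mul_of_nonneg_left ((hA' 0 (by simp) t ht x).trans ?_) (exp_pos _).le
    refine mul_le_of_le_one_right hA.le (inv_le_one_of_one_le₀ (one_le_pow₀ ?_))
    linarith [norm_nonneg x, one_le_sqrt.2 (show 1 ≤ 1 + t by linarith)]
  have hF := integral_Ioi_of_hasDerivAt_of_tendsto' hder hDint hlim
  have e1 : ∫ t in Set.Ioi (0 : ℝ), D t = (2 * d : ℝ)⁻¹ *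
      ∑ i, (green m 0 (x + Pi.single i 1) + green m 0 (x + Pi.single i (-1))) -
      (1 + m) * green m 0 x := by
    rw [hD, integral_sub (hS.const_mul _) ((hI x).const_mul _), integral_const_mul,
      integral_const_mul, integral_finsetSum _ fun i _ => hp i]
    simp only [integral_add (hI _) (hI _), green]
  rw [e1, mul_zero, exp_zero, one_mul, pk_zero_zero] at hF
  linarith

end Resolvent

end WSAW

namespace WSAW

section Taylor

open Real

variable {d : ℕ}

/-- The reflection of the `i`-th coordinate. -/
def reflect (i : Fin d) : (Fin d → ℤ) ≃+ (Fin d → ℤ) :=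
  AddEquiv.piCongrRight fun k => if k = i then AddEquiv.neg ℤ else AddEquiv.refl ℤ

lemma reflect_apply (i : Fin d) (y : Fin d → ℤ) (k : Fin d) :
    reflect i y k = if k = i then -y k else y k := by
  rw [reflect, AddEquiv.piCongrRight_apply]
  split_ifs <;> simp

/-- A function with small differences in a box varies little in that box. -/
lemma abs_sub_le_of_fdiff {h : (Fin d → ℤ) → ℝ} {ρ B : ℝ}
    (hB : ∀ i u, ‖u‖ ≤ ρ → |fdiff i h u| ≤ B) (u : Fin d → ℤ) (hu : ‖u‖ ≤ ρ) :
    |h u - h 0| ≤ d * ‖u‖ * B := by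
  have key : ∀ n : ℕ, ∀ u : Fin d → ℤ, ‖u‖ ≤ ρ → ∑ i, (u i).natAbs = n →
      |h u - h 0| ≤ n * B := by
    intro n
    induction n with
    | zero =>
      intro u _ hn
      have : u = 0 := by
        ext i
        have := (Finset.sum_eq_zero_iff.1 hn) i (Finset.mem_univ i)
        simpa using this
      subst this
      simp
    | succ n ih =>
      intro u hu hn
      obtain ⟨i, hi⟩ : ∃ i, u i ≠ 0 := by
        by_contra! h0
        simp [h0] at hn
      have hstep : ∀ v : ℤ, v.natAbs + 1 = (u i).natAbs → ‖Function.update u i v‖ ≤ ρ ∧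
          ∑ k, (Function.update u i v k).natAbs = n := by
        intro v hv
        constructor
        · refine le_trans ((pi_norm_le_iff_of_nonneg (norm_nonneg _)).2 fun k => ?_) hu
          by_cases hk : k = i
          · subst hk
            rw [Function.update_self]
            refine le_trans ?_ (norm_le_pi_norm u k)
            rw [Int.norm_eq_abs, Int.norm_eq_abs, ← Int.cast_abs, ← Int.cast_abs, Int.cast_le,
              Int.abs_eq_natAbs, Int.abs_eq_natAbs]
            omega
          · rw [Function.update_of_ne hk]
            exact norm_le_pi_norm u k
        · rw [← Finset.add_sum_erase _ _ (Finset.mem_univ i)] at hn ⊢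
          rw [Function.update_self, Finset.sum_congr rfl fun k hk => by
            rw [Function.update_of_ne (Finset.ne_of_mem_erase hk)]]
          omega
      rcases lt_or_gt_of_ne hi with h0 | h0
      · obtain ⟨h1, h2⟩ := hstep (u i + 1) (by omega)
        have h3 := ih _ h1 h2
        have h4 := hB i u hu
        rw [fdiff, add_single_eq_update] at h4
        have := abs_sub_le (h u) (h (Function.update u i (u i + 1))) (h 0)
        rw [abs_sub_comm (h u) (h (Function.update u i (u i + 1)))] at this
        push_cast
        linarith
      · obtain ⟨h1, h2⟩ := hstep (u i - 1) (by omega)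
        have h3 := ih _ h1 h2
        have h4 := hB i _ h1
        rw [fdiff, add_single_eq_update] at h4
        simp only [Function.update_self, Function.update_idem, sub_add_cancel,
          Function.update_eq_self] at h4
        have := abs_sub_le (h u) (h (Function.update u i (u i - 1))) (h 0)
        push_cast
        linarith
  rcases Nat.eq_zero_or_pos d with hd | hd
  · subst hd
    have : u = 0 := Subsingleton.elim _ _
    subst this
    simp
  have hB0 : 0 ≤ B := (abs_nonneg _).trans (hB ⟨0, hd⟩ u hu)
  refine (key _ u hu rfl).trans (mul_le_mul_of_nonneg_right ?_ hB0)
  push_cast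
  calc ∑ i, ((u i).natAbs : ℝ) ≤ ∑ i : Fin d, ‖u‖ := by
        refine Finset.sum_le_sum fun i _ => ?_
        refine le_trans (le_of_eq ?_) (norm_le_pi_norm u i)
        rw [Int.norm_eq_abs, Nat.cast_natAbs, Int.cast_abs]
    _ = _ := by simp

/-- The second order Taylor polynomial. -/
noncomputable def taylor (S : (Fin d → ℤ) → ℝ) (x u : Fin d → ℤ) : ℝ :=
  S x + ∑ i, (fdiff i S x - fdiff i (fdiff i S) x / 2) * u i +
    ∑ i, ∑ j, fdiff i (fdiff j S) x / 2 * (u i * u j)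

lemma fdiff_comm (i j : Fin d) (S : (Fin d → ℤ) → ℝ) :
    fdiff i (fdiff j S) = fdiff j (fdiff i S) := by
  ext x
  simp only [fdiff, add_right_comm x (Pi.single i 1)]
  ring

lemma fdiff_taylor (S : (Fin d → ℤ) → ℝ) (x u : Fin d → ℤ) (k : Fin d) :
    fdiff k (taylor S x) u = fdiff k S x + ∑ i, fdiff i (fdiff k S) x * u i := by
  have e1 : ∀ i, (u + Pi.single k 1 : Fin d → ℤ) i = u i + if i = k then 1 else 0 := by
    intro i; rw [Pi.add_apply, Pi.single_apply]
  rw [fdiff, taylor, taylor]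
  simp only [e1]
  push_cast
  simp only [mul_add, add_mul, Finset.sum_add_distrib, mul_ite, ite_mul, mul_one, mul_zero,
    zero_mul, one_mul, Finset.sum_ite_eq', Finset.sum_ite_irrel, Finset.sum_const_zero,
    Finset.mem_univ, if_true]
  have e2 : ∀ i, fdiff k (fdiff i S) x = fdiff i (fdiff k S) x := fun i => by rw [fdiff_comm]
  simp only [e2]
  have e3 : ∑ i, fdiff i (fdiff k S) x * (u i : ℝ) =
      ∑ i, fdiff i (fdiff k S) x / 2 * (u i : ℝ) + ∑ i, fdiff i (fdiff k S) x / 2 * (u i : ℝ) := by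
    rw [← Finset.sum_add_distrib]
    exact Finset.sum_congr rfl fun i _ => by ring
  rw [e3]
  ring

/-- Taylor's theorem. -/
lemma abs_sub_taylor_le (S : (Fin d → ℤ) → ℝ) (x u : Fin d → ℤ) {M : ℝ}
    (hM : ∀ i j k w, ‖w‖ ≤ ‖u‖ → |fdiff i (fdiff j (fdiff k S)) (x + w)| ≤ M) :
    |S (x + u) - taylor S x u| ≤ (d * ‖u‖) ^ 3 * M := by
  have tr : ∀ (i : Fin d) (f : (Fin d → ℤ) → ℝ) (w : Fin d → ℤ),
      fdiff i (fun w => f (x + w)) w = fdiff i f (x + w) := fun i f w => by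
    simp only [fdiff, add_assoc]
  have h1 : ∀ j k w, ‖w‖ ≤ ‖u‖ → |fdiff j (fdiff k S) (x + w) - fdiff j (fdiff k S) x| ≤
      d * ‖u‖ * M := by
    intro j k w hw
    have := abs_sub_le_of_fdiff (h := fun w => fdiff j (fdiff k S) (x + w)) (ρ := ‖u‖) (B := M)
      (fun i w hw => by rw [tr]; exact hM i j k w hw) w hw
    simp only [add_zero] at this
    refine this.trans ?_
    have hM0 : 0 ≤ M := (abs_nonneg _).trans (hM j j k 0 (by simp))
    gcongr
  have h2 : ∀ k w, ‖w‖ ≤ ‖u‖ → |fdiff k S (x + w) - fdiff k S x -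
      ∑ i, fdiff i (fdiff k S) x * w i| ≤ d * ‖u‖ * (d * ‖u‖ * M) := by
    intro k w hw
    have := abs_sub_le_of_fdiff (h := fun w => fdiff k S (x + w) - fdiff k S x -
      ∑ i, fdiff i (fdiff k S) x * w i) (ρ := ‖u‖) (B := d * ‖u‖ * M) (fun i w hw => ?_) w hw
    · simp only [add_zero, sub_self, Pi.zero_apply, Int.cast_zero, mul_zero,
        Finset.sum_const_zero, sub_zero] at this
      refine this.trans ?_
      have hM0 : 0 ≤ M := (abs_nonneg _).trans (hM k k k 0 (by simp))
      gcongr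
    · refine le_trans (le_of_eq ?_) (h1 i k w hw)
      congr 1
      have e0 : fdiff i (fdiff k S) (x + w) =
          fdiff k S (x + (w + Pi.single i 1)) - fdiff k S (x + w) := by rw [fdiff, add_assoc]
      rw [e0, fdiff]
      have e1 : ∀ j, (w + Pi.single i 1 : Fin d → ℤ) j = w j + if j = i then 1 else 0 := by
        intro j; rw [Pi.add_apply, Pi.single_apply]
      simp only [e1]
      push_cast
      simp only [mul_add, Finset.sum_add_distrib, mul_ite, mul_one, mul_zero, Finset.sum_ite_eq',
        Finset.mem_univ, if_true]
      ring
  have h3 := abs_sub_le_of_fdiff (h := fun w => S (x + w) - taylor S x w) (ρ := ‖u‖)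
    (B := d * ‖u‖ * (d * ‖u‖ * M)) (fun k w hw => by
      refine le_trans (le_of_eq ?_) (h2 k w hw)
      congr 1
      have e1 := fdiff_taylor S x w k
      rw [fdiff] at e1
      rw [fdiff, fdiff, ← add_assoc]
      linarith) u le_rfl
  have h4 : taylor S x 0 = S x := by simp [taylor]
  simp only [add_zero, h4, sub_self, sub_zero] at h3
  exact h3.trans (le_of_eq (by ring))

lemma abs_taylor_le {S : (Fin d → ℤ) → ℝ} {x : Fin d → ℤ} {A B D : ℝ} (h0 : |S x| ≤ A)
    (h1 : ∀ i, |fdiff i S x| ≤ B) (h2 : ∀ i j, |fdiff i (fdiff j S) x| ≤ D) (u : Fin d → ℤ) :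
    |taylor S x u| ≤ A + d * ((B + D / 2) * ‖u‖) + d * (d * (D / 2 * ‖u‖ ^ 2)) := by
  have hu : ∀ i, |(u i : ℝ)| ≤ ‖u‖ := fun i => by
    rw [← Int.norm_eq_abs]; exact norm_le_pi_norm u i
  rw [taylor]
  refine (abs_add_le _ _).trans (add_le_add ((abs_add_le _ _).trans (add_le_add h0 ?_)) ?_)
  · refine (Finset.abs_sum_le_sum_abs _ _).trans ((Finset.sum_le_sum fun i _ =>
      (?_ : _ ≤ (B + D / 2) * ‖u‖)).trans (by simp))
    rw [abs_mul]
    have hB := (abs_nonneg _).trans (h1 i)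
    have hD := (abs_nonneg _).trans (h2 i i)
    refine mul_le_mul ((abs_sub _ _).trans (add_le_add (h1 i) ?_)) (hu i) (abs_nonneg _)
      (by positivity)
    rw [abs_div, abs_two]
    linarith [h2 i i]
  · refine (Finset.abs_sum_le_sum_abs _ _).trans ((Finset.sum_le_sum fun i _ =>
      (?_ : _ ≤ d * (D / 2 * ‖u‖ ^ 2))).trans (by simp))
    refine (Finset.abs_sum_le_sum_abs _ _).trans ((Finset.sum_le_sum fun j _ =>
      (?_ : _ ≤ D / 2 * ‖u‖ ^ 2)).trans (by simp))
    have hD := (abs_nonneg _).trans (h2 i i)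
    rw [abs_mul, abs_mul, abs_div, abs_two, sq]
    refine mul_le_mul (by linarith [h2 i j])
      (mul_le_mul (hu i) (hu j) (abs_nonneg _) (norm_nonneg _)) (by positivity) (by positivity)

end Taylor

end WSAW

namespace WSAW

section ConvGreen

open Real

variable {d : ℕ}

lemma le_of_ofReal_le_mul_dec {u C : ℝ} (hC : 0 ≤ C) {n : ℕ} {x : Fin d → ℤ}
    (h : ENNReal.ofReal u ≤ ENNReal.ofReal C * dec n 1 x) : u ≤ C * ((1 + ‖x‖) ^ n)⁻¹ := by
  rw [dec, ← ENNReal.ofReal_mul hC, ENNReal.ofReal_le_ofReal_iff (by positivity)] at h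
  exact h

lemma exists_green_diff_bound (hd : 5 ≤ d) : ∃ C : ℝ, 0 < C ∧ ∀ m : ℝ, 0 < m → ∀ x : Fin d → ℤ,
    |green m 0 x| ≤ C * ((1 + ‖x‖) ^ (d - 2))⁻¹ ∧
    (∀ i, |fdiff i (green m 0) x| ≤ C * ((1 + ‖x‖) ^ (d - 1))⁻¹) ∧
    (∀ i j, |fdiff i (fdiff j (green m 0)) x| ≤ C * ((1 + ‖x‖) ^ d)⁻¹) ∧
    (∀ i j k, |fdiff i (fdiff j (fdiff k (green m 0))) x| ≤ C * ((1 + ‖x‖) ^ (d + 1))⁻¹) := by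
  obtain ⟨C, hC, h⟩ := exists_green_bound hd
  have s1 : ∀ i : Fin d, ∑ k, (0 + Pi.single i 1 : Fin d → ℕ) k = 1 := fun i => by simp
  have s2 : ∀ i j : Fin d, ∑ k, (0 + Pi.single j 1 + Pi.single i 1 : Fin d → ℕ) k = 2 :=
    fun i j => by simp [Finset.sum_add_distrib]
  have s3 : ∀ i j l : Fin d, ∑ k, (0 + Pi.single l 1 + Pi.single j 1 + Pi.single i 1 :
    Fin d → ℕ) k = 3 := fun i j l => by simp [Finset.sum_add_distrib]
  have f1 : ∀ {m : ℝ}, 0 < m → ∀ i : Fin d, fdiff i (green m 0) = green m (0 + Pi.single i 1) :=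
    fun hm i => fdiff_green hd hm 0 (by simp) i
  have f2 : ∀ {m : ℝ}, 0 < m → ∀ i j : Fin d, fdiff i (fdiff j (green m 0)) =
      green m (0 + Pi.single j 1 + Pi.single i 1) := fun hm i j => by
    rw [f1 hm, fdiff_green hd hm _ (by rw [s1]; norm_num) i]
  have f3 : ∀ {m : ℝ}, 0 < m → ∀ i j k : Fin d, fdiff i (fdiff j (fdiff k (green m 0))) =
      green m (0 + Pi.single k 1 + Pi.single j 1 + Pi.single i 1) := fun hm i j k => by
    rw [f2 hm, fdiff_green hd hm _ (by rw [s2]; norm_num) i]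
  refine ⟨C, hC, fun m hm x => ⟨?_, fun i => ?_, fun i j => ?_, fun i j k => ?_⟩⟩
  · have := le_of_ofReal_le_mul_dec hC.le (h m hm 0 (by simp) x).2
    simpa using this
  · rw [f1 hm]
    have := le_of_ofReal_le_mul_dec hC.le (h m hm (0 + Pi.single i 1) (by rw [s1]; norm_num) x).2
    rw [s1] at this
    exact this
  · rw [f2 hm]
    have := le_of_ofReal_le_mul_dec hC.le (h m hm (0 + Pi.single j 1 + Pi.single i 1) (by rw [s2]; norm_num) x).2
    rw [s2] at this
    exact this
  · rw [f3 hm]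
    have := le_of_ofReal_le_mul_dec hC.le (h m hm (0 + Pi.single k 1 + Pi.single j 1 + Pi.single i 1) (by rw [s3]) x).2
    rw [s3] at this
    exact this

lemma exists_green_taylor_bound (hd : 5 ≤ d) : ∃ K : ℝ, 0 < K ∧ ∀ m : ℝ, 0 < m →
    ∀ x y : Fin d → ℤ, |green m 0 (x + y) - taylor (green m 0) x y| ≤
      K * (1 + ‖y‖) ^ 3 * (((1 + ‖x‖) ^ (d + 1))⁻¹ +
        ((1 + ‖x‖) ^ 3)⁻¹ * ((1 + ‖x + y‖) ^ (d - 2))⁻¹) := by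
  obtain ⟨C, hC, h⟩ := exists_green_diff_bound hd
  refine ⟨C * (8 + 5 * d + d ^ 2) + d ^ 3 * (C * 2 ^ (d + 1)), by positivity,
    fun m hm x y => ?_⟩
  set X := 1 + ‖x‖ with hX
  set Y := 1 + ‖y‖ with hY
  have hX1 : 1 ≤ X := by linarith [norm_nonneg x]
  have hY1 : 1 ≤ Y := by linarith [norm_nonneg y]
  have hyY : ‖y‖ ≤ Y := by linarith
  set W := (X ^ (d + 1))⁻¹ with hW
  have hW0 : 0 < W := by positivity
  set Z := ((1 + ‖x + y‖) ^ (d - 2))⁻¹ with hZ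
  have hZ0 : 0 < Z := by positivity
  rcases le_total (2 * ‖y‖) ‖x‖ with hc | hc
  · have hM : ∀ i j k w, ‖w‖ ≤ ‖y‖ → |fdiff i (fdiff j (fdiff k (green m 0))) (x + w)| ≤
        C * 2 ^ (d + 1) * W := by
      intro i j k w hw
      refine ((h m hm (x + w)).2.2.2 i j k).trans ?_
      rw [mul_assoc]
      refine mul_le_mul_of_nonneg_left ?_ hC.le
      have h1 : X ≤ 2 * (1 + ‖x + w‖) := by
        have := norm_sub_le (x + w) w
        rw [add_sub_cancel_right] at this
        linarith
      rw [hW, ← div_eq_mul_inv, inv_eq_one_div, div_le_div_iff₀ (by positivity) (by positivity),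
        one_mul, ← mul_pow]
      gcongr
    refine (abs_sub_taylor_le _ x y hM).trans ?_
    calc (d * ‖y‖) ^ 3 * (C * 2 ^ (d + 1) * W) ≤ (d * Y) ^ 3 * (C * 2 ^ (d + 1) * W) := by gcongr
      _ = (0 + d ^ 3 * (C * 2 ^ (d + 1))) * Y ^ 3 * (W + 0) := by ring
      _ ≤ _ := by gcongr <;> positivity
  · have hXY : X ≤ 2 * Y := by linarith
    have p3 : X ^ 3 ≤ 8 * Y ^ 3 := by
      calc X ^ 3 ≤ (2 * Y) ^ 3 := by gcongr
        _ = _ := by ring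
    have p2 : X ^ 2 ≤ 4 * Y ^ 2 := by
      calc X ^ 2 ≤ (2 * Y) ^ 2 := by gcongr
        _ = _ := by ring
    have e0 : (X ^ (d - 2))⁻¹ = X ^ 3 * W := by
      rw [hW, show d + 1 = d - 2 + 3 by omega, pow_add]; field_simp
    have e1 : (X ^ (d - 1))⁻¹ = X ^ 2 * W := by
      rw [hW, show d + 1 = d - 1 + 2 by omega, pow_add]; field_simp
    have e2 : (X ^ d)⁻¹ = X * W := by
      rw [hW, pow_succ]; field_simp
    obtain ⟨g0, g1, g2, -⟩ := h m hm x
    rw [← hX, e0] at g0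
    simp only [← hX, e1] at g1
    simp only [← hX, e2] at g2
    have t1 : |green m 0 (x + y)| ≤ C * 8 * Y ^ 3 * ((X ^ 3)⁻¹ * Z) := by
      refine (h m hm (x + y)).1.trans ?_
      rw [mul_assoc, mul_assoc]
      refine mul_le_mul_of_nonneg_left ?_ hC.le
      calc Z = X ^ 3 * ((X ^ 3)⁻¹ * Z) := by field_simp
        _ ≤ (8 * Y ^ 3) * ((X ^ 3)⁻¹ * Z) := by gcongr
        _ = _ := by ring
    have t2 : |taylor (green m 0) x y| ≤ C * (8 + 5 * d + d ^ 2) * Y ^ 3 * W := by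
      refine (abs_taylor_le g0 g1 g2 y).trans ?_
      calc C * (X ^ 3 * W) + d * ((C * (X ^ 2 * W) + C * (X * W) / 2) * ‖y‖) +
            d * (d * (C * (X * W) / 2 * ‖y‖ ^ 2))
          ≤ C * (8 * Y ^ 3 * W) + d * ((C * (4 * Y ^ 2 * W) + C * (2 * Y * W) / 2) * Y) +
            d * (d * (C * (2 * Y * W) / 2 * Y ^ 2)) := by gcongr
        _ = C * (8 * Y ^ 3 + d * (4 * Y ^ 3 + Y ^ 2 * 1) + d ^ 2 * Y ^ 3) * W := by ring
        _ ≤ C * (8 * Y ^ 3 + d * (4 * Y ^ 3 + Y ^ 2 * Y) + d ^ 2 * Y ^ 3) * W := by gcongr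
        _ = _ := by ring
    have t0 : |green m 0 (x + y) - taylor (green m 0) x y| ≤
        |green m 0 (x + y)| + |taylor (green m 0) x y| := by
      simpa only [Real.norm_eq_abs] using norm_sub_le (green m 0 (x + y)) (taylor (green m 0) x y)
    refine t0.trans ((add_le_add t1 t2).trans ?_)
    have k1 : C * 8 ≤ C * (8 + 5 * d + d ^ 2) + d ^ 3 * (C * 2 ^ (d + 1)) := by
      have : 0 ≤ C * (5 * d + d ^ 2) + d ^ 3 * (C * 2 ^ (d + 1)) := by positivity
      linarith
    have k2 : C * (8 + 5 * d + d ^ 2) ≤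
        C * (8 + 5 * d + d ^ 2) + d ^ 3 * (C * 2 ^ (d + 1)) := by
      have : 0 ≤ d ^ 3 * (C * 2 ^ (d + 1)) := by positivity
      linarith
    have q1 : (0 : ℝ) ≤ Y ^ 3 * ((X ^ 3)⁻¹ * Z) := by positivity
    have q2 : (0 : ℝ) ≤ Y ^ 3 * W := by positivity
    have a1 := mul_le_mul_of_nonneg_right k1 q1
    have a2 := mul_le_mul_of_nonneg_right k2 q2
    generalize C * (8 + 5 * d + d ^ 2) + d ^ 3 * (C * 2 ^ (d + 1)) = A at a1 a2 ⊢
    linarith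

lemma tsum_dec_mul_dec_lower_le (hd : 2 ≤ d) (x : Fin d → ℤ) :
    ∑' y : Fin d → ℤ, dec (d + 1) 1 y * dec (d - 2) 1 (x + y) ≤
      ENNReal.ofReal (2 ^ (d - 2) * (2 * (2 * 5 ^ d))) * dec (d - 2) 1 x := by
  have h1 : ∀ y, dec (d + 1) 1 y * dec (d - 2) 1 (x + y) ≤
      ENNReal.ofReal (2 ^ (d - 2)) * dec (d - 2) 1 x * (dec (d + 1) 1 y + dec (d + 1) 1 (x + y)) := by
    intro y
    have hxy : ‖x‖ ≤ ‖x + y‖ + ‖y‖ := by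
      have := norm_sub_le (x + y) y
      rwa [add_sub_cancel_right] at this
    have e : d + 1 = d - 2 + 3 := by omega
    rcases le_total ‖y‖ ‖x + y‖ with h | h
    · calc _ ≤ dec (d + 1) 1 y * (ENNReal.ofReal (2 ^ (d - 2)) * dec (d - 2) 1 x) := by
            gcongr
            exact dec_le one_pos (by norm_num) (by linarith)
        _ ≤ (dec (d + 1) 1 y + dec (d + 1) 1 (x + y)) *
            (ENNReal.ofReal (2 ^ (d - 2)) * dec (d - 2) 1 x) := by gcongr; exact le_self_add
        _ = _ := mul_comm _ _
    · calc _ = dec (d - 2) 1 y * dec 3 1 y * dec (d - 2) 1 (x + y) := by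
            rw [dec_mul _ _ zero_le_one, ← e]
        _ ≤ (ENNReal.ofReal (2 ^ (d - 2)) * dec (d - 2) 1 x) * dec 3 1 (x + y) *
            dec (d - 2) 1 (x + y) := by
            gcongr
            · exact dec_le one_pos (by norm_num) (by linarith)
            · exact dec_anti one_pos (by linarith)
        _ = (ENNReal.ofReal (2 ^ (d - 2)) * dec (d - 2) 1 x) * dec (d + 1) 1 (x + y) := by
            rw [mul_assoc, dec_mul _ _ zero_le_one, add_comm 3, ← e]
        _ ≤ _ := by gcongr; exact le_add_self
  refine (ENNReal.tsum_le_tsum h1).trans ?_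
  have e : ∑' y, dec (d + 1) 1 (x + y) = ∑' y, dec (d + 1) 1 y :=
    (Equiv.addLeft x).tsum_eq (dec (d + 1) 1)
  rw [ENNReal.tsum_mul_left, ENNReal.tsum_add, e, ← two_mul,
    ENNReal.ofReal_mul (by positivity), ENNReal.ofReal_mul (by positivity), mul_right_comm]
  have := mul_tsum_dec_le (d := d) (a := 1) le_rfl
  rw [ENNReal.ofReal_one, one_mul] at this
  simp only [ENNReal.ofReal_ofNat]
  gcongr

lemma summable_pow_inv : Summable fun y : Fin d → ℤ => ((1 + ‖y‖) ^ (d + 1))⁻¹ := by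
  have h := mul_tsum_dec_le (d := d) (a := 1) le_rfl
  rw [ENNReal.ofReal_one, one_mul] at h
  have h2 := ENNReal.summable_toReal (ne_top_of_le_ne_top ENNReal.ofReal_ne_top h)
  refine h2.congr fun y => ?_
  rw [dec, ENNReal.toReal_ofReal (by positivity)]

/-- Convolution of the Green function with a kernel whose moments up to order two vanish. -/
theorem exists_tsum_mul_green_bound (hd : 5 ≤ d) : ∃ C : ℝ, 0 < C ∧ ∀ m : ℝ, 0 < m →
    ∀ ε : ℝ, 0 ≤ ε → ∀ F : (Fin d → ℤ) → ℝ, (∀ y, |F y| ≤ ε * ((1 + ‖y‖) ^ (d + 4))⁻¹) →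
      (∀ i y, F (reflect i y) = F y) → ∑' y, F y = 0 → (∀ i, ∑' y, F y * (y i : ℝ) ^ 2 = 0) →
      ∀ x, ENNReal.ofReal |∑' y, F y * green m 0 (x + y)| ≤
        ENNReal.ofReal (C * ε) * dec (d + 1) 1 x := by
  obtain ⟨K, hK, hK'⟩ := exists_green_taylor_bound hd
  obtain ⟨A, hA, hA'⟩ := exists_green_diff_bound hd
  refine ⟨K * (2 * 5 ^ d + 2 ^ (d - 2) * (2 * (2 * 5 ^ d))), by positivity,
    fun m hm ε hε F hF hrefl h0 h2 x => ?_⟩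
  have hFpow : ∀ k ≤ 3, ∀ y, |F y| * (1 + ‖y‖) ^ k ≤ ε * ((1 + ‖y‖) ^ (d + 1))⁻¹ := by
    intro k hk y
    have h1 : 1 ≤ 1 + ‖y‖ := by linarith [norm_nonneg y]
    calc |F y| * (1 + ‖y‖) ^ k ≤ ε * ((1 + ‖y‖) ^ (d + 4))⁻¹ * (1 + ‖y‖) ^ 3 := by
          gcongr
          exact hF y
      _ = ε * ((1 + ‖y‖) ^ (d + 1))⁻¹ := by
          rw [show d + 4 = d + 1 + 3 by omega, pow_add _ (d + 1)]
          field_simp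
  have hs : ∀ (k : ℕ), k ≤ 3 → ∀ (f : (Fin d → ℤ) → ℝ) (B : ℝ), 0 ≤ B →
      (∀ y, |f y| ≤ B * (1 + ‖y‖) ^ k) → Summable fun y => F y * f y := by
    intro k hk f B hB hf
    refine Summable.of_norm_bounded (summable_pow_inv.mul_left (B * ε)) fun y => ?_
    rw [Real.norm_eq_abs, abs_mul]
    calc |F y| * |f y| ≤ |F y| * (B * (1 + ‖y‖) ^ k) := by gcongr; exact hf y
      _ = B * (|F y| * (1 + ‖y‖) ^ k) := by ring
      _ ≤ B * (ε * ((1 + ‖y‖) ^ (d + 1))⁻¹) := mul_le_mul_of_nonneg_left (hFpow k hk y) hB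
      _ = _ := by ring
  have hyi : ∀ (y : Fin d → ℤ) i, |(y i : ℝ)| ≤ 1 + ‖y‖ := fun y i => by
    rw [← Int.norm_eq_abs]; linarith [norm_le_pi_norm y i]
  have hodd : ∀ (i : Fin d) (f : (Fin d → ℤ) → ℝ), (∀ y, f (reflect i y) = -f y) →
      ∑' y, F y * f y = 0 := by
    intro i f hf
    have := (reflect i).toEquiv.tsum_eq fun y => F y * f y
    have e : ∀ y, F ((reflect i).toEquiv y) * f ((reflect i).toEquiv y) = -(F y * f y) := by
      intro y
      show F (reflect i y) * f (reflect i y) = _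
      rw [hrefl, hf]; ring
    simp only [e, tsum_neg] at this
    linarith
  have m0 : HasSum (fun y => F y * 1) 0 := by
    have := (hs 0 (by norm_num) (fun _ => 1) 1 zero_le_one (by simp)).hasSum
    simpa [h0] using this
  have m1 : ∀ i, HasSum (fun y => F y * (y i : ℝ)) 0 := by
    intro i
    have h := (hs 1 (by norm_num) (fun y => (y i : ℝ)) 1 zero_le_one
      (fun y => by simpa using hyi y i)).hasSum
    rwa [hodd i (fun y => (y i : ℝ)) fun y => by simp [reflect_apply]] at h
  have m2 : ∀ i j, HasSum (fun y => F y * ((y i : ℝ) * y j)) 0 := by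
    intro i j
    have h := (hs 2 (by norm_num) (fun y => (y i : ℝ) * y j) 1 zero_le_one (fun y => by
      rw [abs_mul, one_mul, sq]
      exact mul_le_mul (hyi y i) (hyi y j) (abs_nonneg _) (by positivity))).hasSum
    by_cases hij : j = i
    · subst hij
      simp only [← sq] at h ⊢
      rwa [h2] at h
    · rwa [hodd i (fun y => (y i : ℝ) * y j) fun y => by simp [reflect_apply, hij]] at h
  have mT : HasSum (fun y => F y * taylor (green m 0) x y) 0 := by
    have h := ((m0.mul_left (green m 0 x)).add (hasSum_sum (s := Finset.univ) fun i _ =>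
      (m1 i).mul_left (fdiff i (green m 0) x - fdiff i (fdiff i (green m 0)) x / 2))).add
      (hasSum_sum (s := Finset.univ) fun i _ => hasSum_sum (s := Finset.univ) fun j _ =>
        (m2 i j).mul_left (fdiff i (fdiff j (green m 0)) x / 2))
    simp only [mul_zero, Finset.sum_const_zero, add_zero] at h
    refine h.congr_fun ?_
    intro y
    simp only [taylor, mul_add, Finset.mul_sum]
    refine congrArg₂ _ (congrArg₂ _ (by ring) (Finset.sum_congr rfl fun i _ => by ring))
      (Finset.sum_congr rfl fun i _ => Finset.sum_congr rfl fun j _ => by ring)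
  have hsS : Summable fun y => F y * green m 0 (x + y) :=
    hs 0 (by norm_num) _ A hA.le fun y => ((hA' m hm (x + y)).1).trans (by
      rw [pow_zero]
      refine mul_le_mul_of_nonneg_left (inv_le_one_of_one_le₀ (one_le_pow₀ ?_)) hA.le
      linarith [norm_nonneg (x + y)])
  have e1 : ∑' y, F y * green m 0 (x + y) =
      ∑' y, F y * (green m 0 (x + y) - taylor (green m 0) x y) := by
    simp only [mul_sub]
    rw [hsS.tsum_sub mT.summable, mT.tsum_eq, sub_zero]
  rw [e1, ← Real.enorm_eq_ofReal_abs]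
  refine (enorm_tsum_le_tsum_enorm).trans ?_
  have hpt : ∀ y, ‖F y * (green m 0 (x + y) - taylor (green m 0) x y)‖ₑ ≤
      ENNReal.ofReal (K * ε) * (dec (d + 1) 1 x * dec (d + 1) 1 y +
        dec 3 1 x * (dec (d + 1) 1 y * dec (d - 2) 1 (x + y))) := by
    intro y
    rw [Real.enorm_eq_ofReal_abs, abs_mul]
    simp only [dec]
    rw [← ENNReal.ofReal_mul (by positivity), ← ENNReal.ofReal_mul (by positivity),
      ← ENNReal.ofReal_mul (by positivity), ← ENNReal.ofReal_add (by positivity) (by positivity),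
      ← ENNReal.ofReal_mul (by positivity)]
    refine ENNReal.ofReal_le_ofReal ?_
    calc _ ≤ |F y| * (K * (1 + ‖y‖) ^ 3 * (((1 + ‖x‖) ^ (d + 1))⁻¹ +
          ((1 + ‖x‖) ^ 3)⁻¹ * ((1 + ‖x + y‖) ^ (d - 2))⁻¹)) := by
          gcongr
          exact hK' m hm x y
      _ = K * (|F y| * (1 + ‖y‖) ^ 3) * (((1 + ‖x‖) ^ (d + 1))⁻¹ +
          ((1 + ‖x‖) ^ 3)⁻¹ * ((1 + ‖x + y‖) ^ (d - 2))⁻¹) := by ring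
      _ ≤ K * (ε * ((1 + ‖y‖) ^ (d + 1))⁻¹) * (((1 + ‖x‖) ^ (d + 1))⁻¹ +
          ((1 + ‖x‖) ^ 3)⁻¹ * ((1 + ‖x + y‖) ^ (d - 2))⁻¹) := by
          exact mul_le_mul_of_nonneg_right
            (mul_le_mul_of_nonneg_left (hFpow 3 le_rfl y) hK.le) (by positivity)
      _ = _ := by ring
  refine (ENNReal.tsum_le_tsum hpt).trans ?_
  rw [ENNReal.tsum_mul_left, ENNReal.tsum_add, ENNReal.tsum_mul_left, ENNReal.tsum_mul_left]
  have hS := mul_tsum_dec_le (d := d) (a := 1) le_rfl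
  rw [ENNReal.ofReal_one, one_mul] at hS
  calc _ ≤ ENNReal.ofReal (K * ε) * (dec (d + 1) 1 x * ENNReal.ofReal (2 * 5 ^ d) +
        dec 3 1 x * (ENNReal.ofReal (2 ^ (d - 2) * (2 * (2 * 5 ^ d))) * dec (d - 2) 1 x)) := by
        gcongr
        exact tsum_dec_mul_dec_lower_le (by omega) x
    _ = ENNReal.ofReal (K * ε) * (ENNReal.ofReal (2 * 5 ^ d) +
        ENNReal.ofReal (2 ^ (d - 2) * (2 * (2 * 5 ^ d)))) * dec (d + 1) 1 x := by
        have e : dec (d + 1) 1 x = dec 3 1 x * dec (d - 2) 1 x := by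
          rw [dec_mul _ _ zero_le_one]; congr 1; omega
        rw [e]; ring
    _ = _ := by
        rw [← ENNReal.ofReal_add (by positivity) (by positivity),
          ← ENNReal.ofReal_mul (by positivity)]
        congr 2
        ring

end ConvGreen

end WSAW

namespace WSAW

section Convolution

variable {E 𝕜 : Type*} [RCLike 𝕜]

/-- The ways of splitting a list into two pieces. -/
def splitEquiv (l : List E) :
    Fin (l.length + 1) ≃ {as : List E × List E // as.1 ++ as.2 = l} where
  toFun i := ⟨(l.take i, l.drop i), List.take_append_drop _ _⟩
  invFun as := ⟨as.1.1.length, by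
    have := congrArg List.length as.2
    rw [List.length_append] at this
    omega⟩
  left_inv i := by
    ext
    have := i.2
    simp only [List.length_take]
    omega
  right_inv := by
    rintro ⟨⟨a, s⟩, rfl⟩
    simp

lemma hasSum_conv {p k φ : List E → 𝕜}
    (h : Summable fun as : List E × List E => p as.1 * k as.2 * φ (as.1 ++ as.2)) :
    HasSum (fun l => conv p k l * φ l)
      (∑' as : List E × List E, p as.1 * k as.2 * φ (as.1 ++ as.2)) := by
  have h1 := h.hasSum
  rw [← (Equiv.sigmaFiberEquiv fun as : List E × List E => as.1 ++ as.2).hasSum_iff] at h1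
  refine h1.sigma fun l => ?_
  rw [← (splitEquiv l).hasSum_iff]
  have h2 := hasSum_fintype fun i : Fin (l.length + 1) => p (l.take i) * k (l.drop i) * φ l
  rw [Fin.sum_univ_eq_sum_range fun i => p (l.take i) * k (l.drop i) * φ l, ← Finset.sum_mul] at h2
  refine h2.congr_fun ?_
  intro i
  simp [splitEquiv, Equiv.sigmaFiberEquiv]

lemma conv_mul_pow (f g : List E → ℝ) (x : 𝕜) (l : List E) :
    conv (fun a => (f a : 𝕜) * x ^ a.length) (fun a => (g a : 𝕜) * x ^ a.length) l =
      ((conv f g l : ℝ) : 𝕜) * x ^ l.length := by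
  simp only [conv, RCLike.ofReal_sum, Finset.sum_mul]
  refine Finset.sum_congr rfl fun i hi => ?_
  have e : x ^ l.length = x ^ (l.take i).length * x ^ (l.drop i).length := by
    rw [← pow_add, ← List.length_append, List.take_append_drop]
  rw [e, RCLike.ofReal_mul]
  ring

end Convolution

section Renewal

variable {E A 𝕜 : Type*} [DecidableEq E] [AddCommGroup A] [DecidableEq A] [RCLike 𝕜]
  {st : E → A} {q : ℝ}

lemma summable_of_tsum_ofReal_norm_ne_top {ι : Type*} {f : ι → 𝕜}
    (h : ∑' i, ENNReal.ofReal ‖f i‖ ≠ ∞) : Summable fun i => ‖f i‖ := by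
  refine (ENNReal.summable_toReal h).congr fun i => ?_
  rw [ENNReal.toReal_ofReal (norm_nonneg _)]

lemma summable_K_mul_pow {x : 𝕜} (hq : 0 ≤ q) (h : ∑' l, wt st q ‖x‖ l ≠ ∞) :
    Summable fun l => ‖(K st q l : 𝕜) * x ^ l.length‖ := by
  refine summable_of_tsum_ofReal_norm_ne_top ?_
  simpa only [norm_mul, RCLike.norm_ofReal, abs_of_nonneg (K_nonneg st hq _), norm_pow, wt] using h

lemma summable_P_mul_pow {x : 𝕜} (h : ∑' l, pWt st q ‖x‖ l ≠ ∞) :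
    Summable fun l => ‖(P st q l : 𝕜) * x ^ l.length‖ := by
  refine summable_of_tsum_ofReal_norm_ne_top ?_
  simpa only [norm_mul, RCLike.norm_ofReal, norm_pow, pWt] using h

/-- The summed renewal equation with a bounded test function. -/
lemma hasSum_renewal {x : 𝕜} (hq : 0 ≤ q) (hK : ∑' l, wt st q ‖x‖ l ≠ ∞)
    (hP : ∑' l, pWt st q ‖x‖ l ≠ ∞) {φ : List E → 𝕜} {B : ℝ} (hφ : ∀ l, ‖φ l‖ ≤ B) :
    (Summable fun as : List E × List E => (P st q as.1 : 𝕜) * x ^ as.1.length *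
      ((K st q as.2 : 𝕜) * x ^ as.2.length) * φ (as.1 ++ as.2)) ∧
    HasSum (fun l => (K st q l : 𝕜) * x ^ l.length * φ l)
      (φ [] + ∑' as : List E × List E, (P st q as.1 : 𝕜) * x ^ as.1.length *
        ((K st q as.2 : 𝕜) * x ^ as.2.length) * φ (as.1 ++ as.2)) := by
  have hs : Summable fun as : List E × List E => (P st q as.1 : 𝕜) * x ^ as.1.length *
      ((K st q as.2 : 𝕜) * x ^ as.2.length) * φ (as.1 ++ as.2) := by
    have h1 := ((summable_P_mul_pow hP).mul_of_nonneg (summable_K_mul_pow hq hK)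
      (fun _ => norm_nonneg _) (fun _ => norm_nonneg _)).mul_right B
    refine Summable.of_norm_bounded h1 fun as => ?_
    rw [norm_mul, norm_mul]
    exact mul_le_mul_of_nonneg_left (hφ _) (by positivity)
  refine ⟨hs, ?_⟩
  have h1 := hasSum_conv (p := fun a => (P st q a : 𝕜) * x ^ a.length)
    (k := fun a => (K st q a : 𝕜) * x ^ a.length) (φ := φ) hs
  have h2 : HasSum (fun l : List E => if l = [] then φ [] else 0) (φ []) := hasSum_ite_eq [] (φ [])
  refine (h2.add h1).congr_fun ?_
  intro l
  rw [conv_mul_pow, K_eq_conv st q l]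
  by_cases hl : l = []
  · subst hl; simp; ring
  · have : l.length ≠ 0 := by simpa using hl
    simp [hl]

end Renewal

section Symmetry

variable {E A : Type*} [DecidableEq E] [AddCommGroup A] [DecidableEq A]
  {st : E → A} {σ : E → E} {φ : A →+ A}

lemma disp_map_step (h : ∀ e, st (σ e) = φ (st e)) (l : List E) :
    disp st (l.map σ) = φ (disp st l) := by
  induction l with
  | nil => simp
  | cons e l ih => simp [ih, h]

lemma hits_map_step (h : ∀ e, st (σ e) = φ (st e)) (hφ : Function.Injective φ) (p : List E)
    (x : A) : hits st (p.map σ) (φ x) = hits st p x := by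
  induction p with
  | nil => simp [hits]
  | cons e p ih =>
    rw [List.map_cons, hits, hits, ih, ← List.map_cons, disp_map_step h, ← map_add]
    simp only [map_eq_zero_iff φ hφ]

lemma cross_map_step (h : ∀ e, st (σ e) = φ (st e)) (hφ : Function.Injective φ) (p l : List E)
    (x : A) : cross st (p.map σ) (φ x) (l.map σ) = cross st p x l := by
  induction l generalizing x with
  | nil => simp [cross]
  | cons e l ih => rw [List.map_cons, cross, cross, h, ← map_add, ih, hits_map_step h hφ]

lemma cross_map_step_zero (h : ∀ e, st (σ e) = φ (st e)) (hφ : Function.Injective φ)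
    (p l : List E) : cross st (p.map σ) 0 (l.map σ) = cross st p 0 l := by
  simpa using cross_map_step h hφ p l 0

lemma K_map_step (h : ∀ e, st (σ e) = φ (st e)) (hφ : Function.Injective φ) (q : ℝ)
    (l : List E) : K st q (l.map σ) = K st q l := by
  have : selfHits st (l.map σ) = selfHits st l := by
    induction l with
    | nil => rfl
    | cons e l ih =>
      rw [List.map_cons, selfHits, selfHits, ih]
      congr 1
      exact cross_map_step_zero h hφ [e] l
  rw [K, K, this]

lemma ker_map_step (h : ∀ e, st (σ e) = φ (st e)) (hφ : Function.Injective φ) (q : ℝ)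
    (p l : List E) : ker st q (p.map σ) (l.map σ) = ker st q p l := by
  rw [ker, ker, K_map_step h hφ, List.map_dropLast.symm, cross_map_step_zero h hφ,
    cross_map_step_zero h hφ]

lemma Y_map_step (h : ∀ e, st (σ e) = φ (st e)) (hφ : Function.Injective φ) (q : ℝ)
    (p l : List E) : Y st q (p.map σ) (l.map σ) = Y st q p l := by
  induction hn : l.length using Nat.strong_induction_on generalizing p l with
  | _ n ih =>
    rw [Y_eq, Y_eq, List.length_map]
    congr 1
    refine Finset.sum_congr rfl fun i hi => ?_
    rw [Finset.mem_range] at hi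
    rw [← List.map_take, ← List.map_drop, ker_map_step h hφ,
      ih (l.drop (i + 1)).length (by rw [List.length_drop]; omega) _ _ rfl]

lemma P_map_step (h : ∀ e, st (σ e) = φ (st e)) (hφ : Function.Injective φ) (q : ℝ)
    (l : List E) : P st q (l.map σ) = P st q l := by
  cases l with
  | nil => rfl
  | cons e l => exact Y_map_step h hφ q [e] l

end Symmetry

end WSAW

namespace WSAW

section Steps

variable {d : ℕ}

lemma wsawStep_true (i : Fin d) : wsawStep d (i, true) = Pi.single i 1 := by
  ext j; simp [wsawStep, Pi.single_apply]

lemma wsawStep_false (i : Fin d) : wsawStep d (i, false) = Pi.single i (-1) := by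
  ext j; simp [wsawStep, Pi.single_apply]

lemma sum_wsawStep {M : Type*} [AddCommMonoid M] (f : (Fin d → ℤ) → M) :
    ∑ e, f (wsawStep d e) = ∑ i, (f (Pi.single i 1) + f (Pi.single i (-1))) := by
  rw [Fintype.sum_prod_type]
  simp only [Fintype.sum_bool, wsawStep_true, wsawStep_false]

lemma norm_wsawStep (e : Fin d × Bool) : ‖wsawStep d e‖ = 1 := by
  obtain ⟨i, b⟩ := e
  cases b
  · rw [wsawStep_false, Pi.norm_single]; simp
  · rw [wsawStep_true, Pi.norm_single]; simp

/-- The reversal of the steps in direction `i`. -/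
def flipStep (i : Fin d) : Fin d × Bool ≃ Fin d × Bool :=
  Function.Involutive.toPerm (fun e => (e.1, if e.1 = i then !e.2 else e.2)) fun e => by
    by_cases h : e.1 = i <;> simp [h, Prod.ext_iff]

lemma wsawStep_flipStep (i : Fin d) (e : Fin d × Bool) :
    wsawStep d (flipStep i e) = reflect i (wsawStep d e) := by
  obtain ⟨j, b⟩ := e
  have h : flipStep i (j, b) = (j, if j = i then !b else b) := rfl
  ext k
  rw [reflect_apply, h]
  by_cases h1 : k = j
  · subst h1
    by_cases h2 : k = i <;> cases b <;> simp [wsawStep, h2]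
  · simp [wsawStep, h1]

/-- The permutation of coordinates exchanging `i` and `j`. -/
def swapCoord (i j : Fin d) : (Fin d → ℤ) →+ (Fin d → ℤ) where
  toFun y := y ∘ Equiv.swap i j
  map_zero' := rfl
  map_add' _ _ := rfl

/-- The corresponding permutation of the steps. -/
def swapStep (i j : Fin d) : Fin d × Bool ≃ Fin d × Bool :=
  (Equiv.swap i j).prodCongr (Equiv.refl Bool)

lemma wsawStep_swapStep (i j : Fin d) (e : Fin d × Bool) :
    wsawStep d (swapStep i j e) = swapCoord i j (wsawStep d e) := by
  obtain ⟨l, b⟩ := e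
  ext k
  have : k = Equiv.swap i j l ↔ Equiv.swap i j k = l :=
    ⟨fun h => by rw [h, Equiv.swap_apply_self], fun h => by rw [← h, Equiv.swap_apply_self]⟩
  simp [swapStep, swapCoord, wsawStep, this]

lemma swapCoord_injective (i j : Fin d) : Function.Injective (swapCoord i j) := by
  intro y z h
  ext k
  have := congrFun h (Equiv.swap i j k)
  simpa [swapCoord] using this

end Steps

section Moments

variable {d : ℕ}

lemma hasSum_step_mul (c : ℝ) (f : (Fin d → ℤ) → ℝ) :
    HasSum (fun y => (∑ e, if y = wsawStep d e then c else 0) * f y)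
      (c * ∑ e, f (wsawStep d e)) := by
  rw [Finset.mul_sum]
  simp only [Finset.sum_mul]
  refine hasSum_sum fun e _ => ?_
  refine (hasSum_ite_eq (wsawStep d e) (c * f (wsawStep d e))).congr_fun ?_
  intro y
  split_ifs with h
  · rw [h]
  · simp

lemma hasSum_zero_mul (c : ℝ) (f : (Fin d → ℤ) → ℝ) :
    HasSum (fun y => (if y = 0 then c else 0) * f y) (c * f 0) := by
  refine (hasSum_ite_eq 0 (c * f 0)).congr_fun ?_
  intro y
  split_ifs with h
  · rw [h]
  · simp

lemma exists_moment_bound (hd : 5 ≤ d) : ∃ C : ℝ, 0 < C ∧ ∀ m : ℝ, 0 < m → ∀ ε : ℝ, 0 ≤ ε →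
    ∀ Φ : (Fin d → ℤ) → ℝ, (∀ y, |Φ y| ≤ ε * ((1 + ‖y‖) ^ (d + 4))⁻¹) →
      (∀ i y, Φ (reflect i y) = Φ y) → ∀ ρ₀ ρ₂ : ℝ, HasSum Φ ρ₀ →
      (∀ i, HasSum (fun y => Φ y * (y i : ℝ) ^ 2) ρ₂) →
      |ρ₀| ≤ C * ε ∧ |ρ₂| ≤ C * ε ∧ ∀ w,
        ENNReal.ofReal |(ρ₀ - d * ρ₂) * green m 0 w + ρ₂ / 2 * ∑ e, green m 0 (w + wsawStep d e) -
          ∑' y, Φ y * green m 0 (w + y)| ≤ ENNReal.ofReal (C * ε) * dec (d + 1) 1 w := by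
  obtain ⟨C, hC, h⟩ := exists_tsum_mul_green_bound hd
  obtain ⟨A, hA, hA'⟩ := exists_green_diff_bound hd
  set s : ℝ := ∑' y : Fin d → ℤ, ((1 + ‖y‖) ^ (d + 1))⁻¹ with hs
  have hs0 : 0 ≤ s := tsum_nonneg fun y => by positivity
  have hsum : HasSum (fun y : Fin d → ℤ => ((1 + ‖y‖) ^ (d + 1))⁻¹) s := summable_pow_inv.hasSum
  set B : ℝ := s + d * s + s / 2 * ((2 * d) * 2 ^ (d + 4)) + 1 with hB
  have hB0 : 0 < B := by positivity
  refine ⟨s + C * B, by positivity, fun m hm ε hε Φ hΦ hrefl ρ₀ ρ₂ h0 h2 => ?_⟩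
  have hX : ∀ y : Fin d → ℤ, 1 ≤ 1 + ‖y‖ := fun y => by linarith [norm_nonneg y]
  have hpow : ∀ y, |Φ y| * (1 + ‖y‖) ^ 3 ≤ ε * ((1 + ‖y‖) ^ (d + 1))⁻¹ := by
    intro y
    calc |Φ y| * (1 + ‖y‖) ^ 3 ≤ ε * ((1 + ‖y‖) ^ (d + 4))⁻¹ * (1 + ‖y‖) ^ 3 := by
          gcongr
          exact hΦ y
      _ = ε * ((1 + ‖y‖) ^ (d + 1))⁻¹ := by
          rw [show d + 4 = d + 1 + 3 by omega, pow_add _ (d + 1)]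
          field_simp
  have hyi : ∀ (y : Fin d → ℤ) i, |(y i : ℝ)| ≤ 1 + ‖y‖ := fun y i => by
    rw [← Int.norm_eq_abs]; linarith [norm_le_pi_norm y i]
  have b0 : |ρ₀| ≤ s * ε := by
    rw [← h0.tsum_eq, mul_comm, ← Real.norm_eq_abs]
    refine tsum_of_norm_bounded (hsum.mul_left ε) fun y => ?_
    refine le_trans ?_ (hpow y)
    rw [Real.norm_eq_abs]
    exact le_mul_of_one_le_right (abs_nonneg _) (one_le_pow₀ (hX y))
  have b2 : |ρ₂| ≤ s * ε := by
    have i : Fin d := ⟨0, by omega⟩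
    rw [← (h2 i).tsum_eq, mul_comm, ← Real.norm_eq_abs]
    refine tsum_of_norm_bounded (hsum.mul_left ε) fun y => ?_
    refine le_trans ?_ (hpow y)
    rw [Real.norm_eq_abs, abs_mul, abs_pow]
    gcongr
    calc |(y i : ℝ)| ^ 2 ≤ (1 + ‖y‖) ^ 2 := by gcongr; exact hyi y i
      _ ≤ (1 + ‖y‖) ^ 3 := pow_le_pow_right₀ (hX y) (by norm_num)
  have hle : s * ε ≤ (s + C * B) * ε := by
    gcongr
    have : 0 ≤ C * B := by positivity
    linarith
  refine ⟨b0.trans hle, b2.trans hle, fun w => ?_⟩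
  set F : (Fin d → ℤ) → ℝ := fun y => (if y = 0 then ρ₀ - d * ρ₂ else 0) +
    (∑ e, if y = wsawStep d e then ρ₂ / 2 else 0) - Φ y with hF
  have hFs : ∀ f : (Fin d → ℤ) → ℝ, ∀ a, HasSum (fun y => Φ y * f y) a →
      HasSum (fun y => F y * f y)
        ((ρ₀ - d * ρ₂) * f 0 + ρ₂ / 2 * ∑ e, f (wsawStep d e) - a) := by
    intro f a hf
    refine (((hasSum_zero_mul _ f).add (hasSum_step_mul _ f)).sub hf).congr_fun ?_
    intro y
    simp only [hF]
    ring
  have hFb : ∀ y, |F y| ≤ B * ε * ((1 + ‖y‖) ^ (d + 4))⁻¹ := by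
    intro y
    have t1 : |if y = 0 then ρ₀ - d * ρ₂ else 0| ≤
        (s + d * s) * ε * ((1 + ‖y‖) ^ (d + 4))⁻¹ := by
      split_ifs with hy
      · subst hy
        simp only [norm_zero, add_zero, one_pow, inv_one, mul_one]
        calc |ρ₀ - d * ρ₂| ≤ |ρ₀| + |d * ρ₂| := by
              simpa only [Real.norm_eq_abs] using norm_sub_le ρ₀ (d * ρ₂)
          _ = |ρ₀| + d * |ρ₂| := by rw [abs_mul, Nat.abs_cast]
          _ ≤ s * ε + d * (s * ε) := by gcongr
          _ = _ := by ring
      · rw [abs_zero]; positivity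
    have t2 : |∑ e, if y = wsawStep d e then ρ₂ / 2 else 0| ≤
        s / 2 * ((2 * d) * 2 ^ (d + 4)) * ε * ((1 + ‖y‖) ^ (d + 4))⁻¹ := by
      refine (Finset.abs_sum_le_sum_abs _ _).trans ?_
      have : ∀ e ∈ (Finset.univ : Finset (Fin d × Bool)),
          |if y = wsawStep d e then ρ₂ / 2 else 0| ≤
          s / 2 * 2 ^ (d + 4) * ε * ((1 + ‖y‖) ^ (d + 4))⁻¹ := by
        intro e _
        split_ifs with hy
        · rw [hy, norm_wsawStep, abs_div, abs_two]
          have e1 : (2 : ℝ) ^ (d + 4) * ((1 + 1) ^ (d + 4))⁻¹ = 1 := by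
            rw [one_add_one_eq_two]; field_simp
          calc |ρ₂| / 2 ≤ (s * ε) / 2 := by gcongr
            _ = s / 2 * ε * (2 ^ (d + 4) * ((1 + 1) ^ (d + 4))⁻¹) := by rw [e1]; ring
            _ = _ := by ring
        · rw [abs_zero]; positivity
      refine (Finset.sum_le_sum this).trans (le_of_eq ?_)
      rw [Finset.sum_const, Finset.card_univ, Fintype.card_prod, Fintype.card_fin,
        Fintype.card_bool, nsmul_eq_mul]
      push_cast
      ring
    calc |F y| ≤ |(if y = 0 then ρ₀ - d * ρ₂ else 0) +
          (∑ e, if y = wsawStep d e then ρ₂ / 2 else 0)| + |Φ y| := by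
          simpa only [Real.norm_eq_abs] using norm_sub_le ((if y = 0 then ρ₀ - d * ρ₂ else 0) +
            (∑ e, if y = wsawStep d e then ρ₂ / 2 else 0)) (Φ y)
      _ ≤ _ := add_le_add ((abs_add_le _ _).trans (add_le_add t1 t2)) (hΦ y)
      _ = _ := by rw [hB]; ring
  have hFr : ∀ i y, F (reflect i y) = F y := by
    intro i y
    have hinj : Function.Injective (reflect (d := d) i) := (reflect i).injective
    have e1 : (∑ e, if reflect i y = wsawStep d e then ρ₂ / 2 else 0) =
        ∑ e, if y = wsawStep d e then ρ₂ / 2 else 0 := by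
      rw [← (flipStep i).sum_comp]
      refine Finset.sum_congr rfl fun e _ => ?_
      rw [wsawStep_flipStep]
      simp only [hinj.eq_iff]
    simp only [hF]
    rw [hrefl, e1]
    simp only [EmbeddingLike.map_eq_zero_iff]
  have hF0 : ∑' y, F y = 0 := by
    have := hFs (fun _ => 1) ρ₀ (by simpa using h0)
    simp only [mul_one, Finset.sum_const, Finset.card_univ, Fintype.card_prod, Fintype.card_fin,
        Fintype.card_bool, nsmul_eq_mul] at this
    rw [this.tsum_eq]
    push_cast
    ring
  have hF2 : ∀ i, ∑' y, F y * (y i : ℝ) ^ 2 = 0 := by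
    intro i
    have := hFs (fun y => (y i : ℝ) ^ 2) ρ₂ (h2 i)
    rw [this.tsum_eq, sum_wsawStep fun y => (y i : ℝ) ^ 2]
    simp [Finset.sum_add_distrib, Pi.single_apply, ite_pow]
    ring
  have hS : Summable fun y => Φ y * green m 0 (w + y) := by
    refine Summable.of_norm_bounded (summable_pow_inv.mul_left (A * ε)) fun y => ?_
    rw [Real.norm_eq_abs, abs_mul]
    have g1 : |green m 0 (w + y)| ≤ A := ((hA' m hm (w + y)).1).trans
      (mul_le_of_le_one_right hA.le (inv_le_one_of_one_le₀ (one_le_pow₀ (hX _))))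
    have g2 : |Φ y| ≤ ε * ((1 + ‖y‖) ^ (d + 1))⁻¹ :=
      (le_mul_of_one_le_right (abs_nonneg _) (one_le_pow₀ (hX y))).trans (hpow y)
    calc _ ≤ ε * ((1 + ‖y‖) ^ (d + 1))⁻¹ * A := by gcongr
      _ = _ := by ring
  have hfin := hFs (fun y => green m 0 (w + y)) _ hS.hasSum
  rw [add_zero] at hfin
  rw [← hfin.tsum_eq]
  refine (h m hm (B * ε) (by positivity) F hFb hFr hF0 hF2 w).trans ?_
  rw [← mul_assoc]
  have : 0 ≤ s * ε := by positivity
  gcongr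
  linarith

end Moments

end WSAW

namespace WSAW

section Fibers

lemma hasSum_fiber {ι A : Type*} [DecidableEq A] (D : ι → A) {R : ι → ℝ} (hR : Summable R)
    {f : A → ℝ} (hf : Summable fun l => R l * f (D l)) :
    HasSum (fun y => (∑' l, if D l = y then R l else 0) * f y) (∑' l, R l * f (D l)) := by
  have h1 := hf.hasSum
  rw [← (Equiv.sigmaFiberEquiv D).hasSum_iff] at h1
  refine h1.sigma fun y => ?_
  have h2 : (∑' l, if D l = y then R l else 0) = ∑' c : {l // D l = y}, R c := by
    have := tsum_subtype {l | D l = y} R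
    refine Eq.trans (tsum_congr fun l => ?_) this.symm
    simp [Set.indicator]
  rw [h2]
  refine ((hR.subtype {l | D l = y}).hasSum.mul_right (f y)).congr_fun ?_
  rintro ⟨l, rfl⟩
  rfl

variable {E A : Type*} [DecidableEq E] [AddCommGroup A] [DecidableEq A] {st : E → A} {q x : ℝ}

/-- The part of the lace kernel that is not the single step. -/
noncomputable def rem (st : E → A) (q x : ℝ) (l : List E) : ℝ :=
  if l.length = 1 then 0 else P st q l * x ^ l.length

/-- The total mass of `rem` at a given displacement. -/
noncomputable def remAt (st : E → A) (q x : ℝ) (y : A) : ℝ :=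
  ∑' l, if disp st l = y then rem st q x l else 0

lemma rem_map {σ : E → E} {φ : A →+ A} (h : ∀ e, st (σ e) = φ (st e))
    (hφ : Function.Injective φ) (l : List E) : rem st q x (l.map σ) = rem st q x l := by
  rw [rem, rem, P_map_step h hφ, List.length_map]

lemma tsum_rem_mul_map {σ : E ≃ E} {φ : A →+ A} (h : ∀ e, st (σ e) = φ (st e))
    (hφ : Function.Injective φ) (f : A → ℝ) :
    ∑' l, rem st q x l * f (disp st l) = ∑' l, rem st q x l * f (φ (disp st l)) := by
  rw [← (Equiv.listEquivOfEquiv σ).tsum_eq]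
  refine tsum_congr fun l => ?_
  have : Equiv.listEquivOfEquiv σ l = l.map σ := rfl
  rw [this, rem_map h hφ, disp_map_step h]

lemma remAt_map {σ : E ≃ E} {φ : A →+ A} (h : ∀ e, st (σ e) = φ (st e))
    (hφ : Function.Injective φ) (y : A) : remAt st q x (φ y) = remAt st q x y := by
  have := tsum_rem_mul_map (q := q) (x := x) h hφ fun z => if z = φ y then 1 else 0
  simp only [mul_ite, mul_one, mul_zero, hφ.eq_iff] at this
  exact this

lemma hasSum_P_mul [Fintype E] {f : A → ℝ} (hf : Summable fun l => rem st q x l * f (disp st l)) :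
    HasSum (fun l => P st q l * x ^ l.length * f (disp st l))
      (x * ∑ e, f (st e) + ∑' l, rem st q x l * f (disp st l)) := by
  have h1 : HasSum (fun l : List E => if l.length = 1 then P st q l * x ^ l.length * f (disp st l)
      else 0) (x * ∑ e, f (st e)) := by
    have : HasSum (fun l : List E => if l.length = 1 then P st q l * x ^ l.length * f (disp st l)
        else 0) (∑ l ∈ Finset.univ.image fun e : E => [e], if l.length = 1 then
          P st q l * x ^ l.length * f (disp st l) else 0) := hasSum_sum_of_ne_finset_zero ?_
    · rw [Finset.sum_image (by simp [Set.InjOn]), ] at this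
      simpa [P, Y_nil, Finset.mul_sum] using this
    · intro l hl
      rw [if_neg]
      intro hl1
      obtain ⟨e, rfl⟩ := List.length_eq_one_iff.1 hl1
      simp at hl
  refine (h1.add hf.hasSum).congr_fun ?_
  intro l
  rw [rem]
  split_ifs <;> simp

end Fibers

section Deconvolution

variable {d : ℕ} {q x : ℝ}

lemma summable_rem_mul {ε : ℝ} (hL : Line (wsawStep d) (fun l => ENNReal.ofReal |rem (wsawStep d) q x l|)
      fun y => ENNReal.ofReal ε * dec (d + 4) 1 y) {f : (Fin d → ℤ) → ℝ} {B : ℝ} (hB : 0 ≤ B)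
    (hf : ∀ y, |f y| ≤ B * (1 + ‖y‖) ^ 3) :
    Summable fun l => rem (wsawStep d) q x l * f (disp (wsawStep d) l) := by
  refine Summable.of_norm (summable_of_tsum_ofReal_norm_ne_top (𝕜 := ℝ) ?_)
  have h1 := hL.tsum_le fun y => ENNReal.ofReal (B * (1 + ‖y‖) ^ 3)
  have h2 : ∀ y : Fin d → ℤ, ENNReal.ofReal ε * dec (d + 4) 1 y * ENNReal.ofReal (B * (1 + ‖y‖) ^ 3) =
      ENNReal.ofReal ε * ENNReal.ofReal B * dec (d + 1) 1 y := by
    intro y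
    have : dec (d + 4) 1 y * ENNReal.ofReal ((1 + ‖y‖) ^ 3) = dec (d + 1) 1 y := by
      rw [dec, dec, ← ENNReal.ofReal_mul (by positivity)]
      congr 1
      rw [show d + 4 = d + 1 + 3 by omega, pow_add _ (d + 1)]
      field_simp
    rw [ENNReal.ofReal_mul hB, ← this]
    ring
  simp only [h2, ENNReal.tsum_mul_left] at h1
  have h3 := mul_tsum_dec_le (d := d) (a := 1) le_rfl
  rw [ENNReal.ofReal_one, one_mul] at h3
  refine ne_top_of_le_ne_top ?_ (le_trans (ENNReal.tsum_le_tsum fun l => ?_) h1)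
  · exact ENNReal.mul_ne_top (ENNReal.mul_ne_top ENNReal.ofReal_ne_top ENNReal.ofReal_ne_top)
      (ne_top_of_le_ne_top ENNReal.ofReal_ne_top h3)
  · rw [← ENNReal.ofReal_mul (abs_nonneg _)]
    refine ENNReal.ofReal_le_ofReal ?_
    rw [norm_mul, Real.norm_eq_abs, Real.norm_eq_abs]
    exact mul_le_mul_of_nonneg_left (hf _) (abs_nonneg _)

lemma abs_remAt_le {ε : ℝ} (hε : 0 ≤ ε)
    (hL : Line (wsawStep d) (fun l => ENNReal.ofReal |rem (wsawStep d) q x l|)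
      fun y => ENNReal.ofReal ε * dec (d + 4) 1 y) (y : Fin d → ℤ) :
    |remAt (wsawStep d) q x y| ≤ ε * ((1 + ‖y‖) ^ (d + 4))⁻¹ := by
  refine le_of_ofReal_le_mul_dec hε ?_
  rw [remAt, ← Real.enorm_eq_ofReal_abs]
  refine enorm_tsum_le_tsum_enorm.trans (le_trans (ENNReal.tsum_le_tsum fun l => ?_) (hL y))
  split_ifs
  · rw [Real.enorm_eq_ofReal_abs]
  · simp

lemma exists_remAt_moments (hd : 5 ≤ d) {ε : ℝ}
    (hL : Line (wsawStep d) (fun l => ENNReal.ofReal |rem (wsawStep d) q x l|)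
      fun y => ENNReal.ofReal ε * dec (d + 4) 1 y) :
    HasSum (remAt (wsawStep d) q x) (∑' l, rem (wsawStep d) q x l) ∧ ∃ ρ₂ : ℝ,
      ∀ i, HasSum (fun y => remAt (wsawStep d) q x y * (y i : ℝ) ^ 2) ρ₂ := by
  have hX : ∀ y : Fin d → ℤ, 1 ≤ 1 + ‖y‖ := fun y => by linarith [norm_nonneg y]
  have hR : Summable (rem (wsawStep d) q x) := by
    simpa using summable_rem_mul hL (f := fun _ => 1) zero_le_one fun y => by
      simpa using one_le_pow₀ (hX y)
  have h2 : ∀ i : Fin d, Summable fun l =>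
      rem (wsawStep d) q x l * ((disp (wsawStep d) l i : ℤ) : ℝ) ^ 2 := fun i =>
    summable_rem_mul hL (f := fun y => (y i : ℝ) ^ 2) zero_le_one fun y => by
      rw [one_mul, abs_pow, ← Int.norm_eq_abs]
      calc ‖y i‖ ^ 2 ≤ (1 + ‖y‖) ^ 2 := by gcongr; linarith [norm_le_pi_norm y i]
        _ ≤ (1 + ‖y‖) ^ 3 := pow_le_pow_right₀ (hX y) (by norm_num)
  refine ⟨?_, ?_⟩
  · have := hasSum_fiber (disp (wsawStep d)) hR (f := fun _ => 1) (by simpa using hR)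
    simp only [mul_one] at this
    exact this
  · have i₀ : Fin d := ⟨0, by omega⟩
    refine ⟨∑' l, rem (wsawStep d) q x l * ((disp (wsawStep d) l i₀ : ℤ) : ℝ) ^ 2, fun i => ?_⟩
    have := hasSum_fiber (disp (wsawStep d)) hR (f := fun y => (y i : ℝ) ^ 2) (h2 i)
    have e := tsum_rem_mul_map (q := q) (x := x) (wsawStep_swapStep i₀ i) (swapCoord_injective i₀ i)
      fun y => (y i₀ : ℝ) ^ 2
    rw [e]
    simp only [remAt]
    simpa [swapCoord] using this

end Deconvolution

end WSAW

namespace WSAW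

section Renewal

variable {𝕜 E A : Type*} [RCLike 𝕜] [DecidableEq E] [AddCommGroup A] [DecidableEq A] {st : E → A}
  {q : ℝ}

lemma tsum_K_mul_one_sub {x : 𝕜} (hq : 0 ≤ q) (hK : ∑' l, wt st q ‖x‖ l ≠ ∞)
    (hP : ∑' l, pWt st q ‖x‖ l ≠ ∞) :
    (∑' l, (K st q l : 𝕜) * x ^ l.length) * (1 - ∑' l, (P st q l : 𝕜) * x ^ l.length) = 1 := by
  have h := (hasSum_renewal hq hK hP (φ := fun _ => (1 : 𝕜)) (B := 1) (by simp)).2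
  simp only [mul_one] at h
  have h1 := tsum_mul_tsum_of_summable_norm (f := fun l => (P st q l : 𝕜) * x ^ l.length)
    (g := fun l => (K st q l : 𝕜) * x ^ l.length) (summable_P_mul_pow hP)
    (summable_K_mul_pow hq hK)
  have h2 := h.tsum_eq
  generalize (∑' l, (K st q l : 𝕜) * x ^ l.length) = χ at h1 h2 ⊢
  generalize (∑' l, (P st q l : 𝕜) * x ^ l.length) = p at h1 ⊢
  rw [← h1] at h2
  linear_combination h2

lemma tsum_mul_renewal {x : ℝ} (hq : 0 ≤ q) (hx : 0 ≤ x) (hK : ∑' l, wt st q x l ≠ ∞)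
    (hP : ∑' l, pWt st q x l ≠ ∞) {f : A → ℝ} {B : ℝ} (hf : ∀ y, |f y| ≤ B) (v : A) {U : A → ℝ}
    (hU : ∀ w, HasSum (fun l => P st q l * x ^ l.length * f (disp st l + w)) (U w)) :
    HasSum (fun l => K st q l * x ^ l.length * f (disp st l - v))
      (f (-v) + ∑' l, K st q l * x ^ l.length * U (disp st l - v)) ∧
    Summable fun l => K st q l * x ^ l.length * U (disp st l - v) := by
  have hx' : ‖x‖ = x := by rw [Real.norm_eq_abs, abs_of_nonneg hx]
  obtain ⟨h1, h2⟩ := hasSum_renewal (𝕜 := ℝ) (st := st) (q := q) (x := x) hq (by rwa [hx'])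
    (by rwa [hx']) (φ := fun l => f (disp st l - v)) (B := B) (fun l => hf _)
  have h3 : ∀ as : List E × List E, (P st q as.1 : ℝ) * x ^ as.1.length *
      (K st q as.2 * x ^ as.2.length) * f (disp st (as.1 ++ as.2) - v) =
      K st q as.2 * x ^ as.2.length *
        (P st q as.1 * x ^ as.1.length * f (disp st as.1 + (disp st as.2 - v))) := by
    intro as
    rw [disp_append, add_sub_assoc]
    ring
  simp only [RCLike.ofReal_real_eq_id, id_eq, h3, disp_nil, zero_sub] at h1 h2
  set F : List E × List E → ℝ := fun as => K st q as.2 * x ^ as.2.length *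
    (P st q as.1 * x ^ as.1.length * f (disp st as.1 + (disp st as.2 - v))) with hF
  have h4 : Summable fun sa : List E × List E => F sa.swap := h1.prod_symm
  have h5 : ∀ s, ∑' a, K st q s * x ^ s.length *
      (P st q a * x ^ a.length * f (disp st a + (disp st s - v))) =
      K st q s * x ^ s.length * U (disp st s - v) := fun s => by
    rw [tsum_mul_left, (hU _).tsum_eq]
  have h6 : HasSum (fun s => ∑' a, F (a, s)) (∑' sa : List E × List E, F sa.swap) :=
    HasSum.prod_fiberwise h4.hasSum fun s => (h4.prod_factor s).hasSum
  simp only [hF, h5] at h6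
  refine ⟨?_, h6.summable⟩
  have h7 : ∑' sa : List E × List E, F sa.swap = ∑' as, F as := (Equiv.prodComm _ _).tsum_eq F
  rw [h6.tsum_eq, h7]
  exact h2

end Renewal

section Deconvolution

variable {d : ℕ} {q x : ℝ}

lemma good_dec (hd : 5 ≤ d) {M : ℝ} (hM : 2 ^ (d - 2) ≤ M) :
    Good (wsawStep d) (fun y => ENNReal.ofReal M * dec (d - 2) 1 y)
      (ENNReal.ofReal (M ^ 2 * (2 * 5 ^ d))) := by
  have h1 : (1 : ℝ) ≤ 2 ^ (d - 2) := one_le_pow₀ (by norm_num)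
  have hM0 : 0 ≤ M := by linarith
  have key : ∀ y : Fin d → ℤ, ‖y‖ ≤ 1 → 1 ≤ ENNReal.ofReal M * dec (d - 2) 1 y := by
    intro y hy
    rw [dec, ← ENNReal.ofReal_mul hM0, ENNReal.one_le_ofReal]
    rw [← div_eq_mul_inv, one_le_div (by positivity)]
    refine le_trans ?_ hM
    gcongr
    linarith
  refine ⟨fun y => by rw [dec_neg], ?_, ?_, key 0 (by simp), fun e => key _ (norm_wsawStep e).le⟩
  · have h3 := mul_tsum_dec_le (d := d) (a := 1) le_rfl
    rw [ENNReal.ofReal_one, one_mul] at h3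
    rw [ENNReal.ofReal_mul (by positivity), ENNReal.ofReal_pow hM0]
    simp only [mul_pow, ENNReal.tsum_mul_left]
    gcongr
    refine le_trans (ENNReal.tsum_le_tsum fun y => ?_) h3
    rw [sq, dec_mul _ _ zero_le_one]
    exact dec_pow_anti (by omega) le_rfl _
  · intro y z
    rw [← mul_min]
    calc _ ≤ ENNReal.ofReal M * (ENNReal.ofReal (2 ^ (d - 2)) * dec (d - 2) 1 (y + z)) := by
          gcongr
          refine dec_min one_pos ?_
          linarith [norm_add_le y z]
      _ = ENNReal.ofReal (2 ^ (d - 2)) * (ENNReal.ofReal M * dec (d - 2) 1 (y + z)) := by ring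
      _ ≤ _ := by
          gcongr
          have : (1 : ℝ) ≤ 5 ^ d := one_le_pow₀ (by norm_num)
          nlinarith

lemma line_rem (hd : 5 ≤ d) {M : ℝ} (hM : 2 ^ (d - 2) ≤ M) (hq : 0 ≤ q) (hq1 : q ≤ 1) (hx : 0 ≤ x)
    (hl : Line (wsawStep d) (wt (wsawStep d) q x) fun y => ENNReal.ofReal M * dec (d - 2) 1 y)
    (hb : 16 * ENNReal.ofReal (1 - q) * ENNReal.ofReal (M ^ 2 * (2 * 5 ^ d)) ^ 3 ≤ 1) :
    Line (wsawStep d) (fun l => ENNReal.ofReal |rem (wsawStep d) q x l|)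
      fun y => ENNReal.ofReal (4 * d * 2 ^ (d - 2) * M ^ 4 * (1 - q)) * dec (d + 4) 1 y := by
  have h1 : (1 : ℝ) ≤ 2 ^ (d - 2) := one_le_pow₀ (by norm_num)
  have hM0 : 0 ≤ M := by linarith
  have hxM : x ≤ M := by
    have e : Fin d × Bool := (⟨0, by omega⟩, true)
    have h2 := (ENNReal.le_tsum [e]).trans (hl (wsawStep d e))
    rw [if_pos (by simp [disp]), wt_singleton] at h2
    have h3 : dec (d - 2) 1 (wsawStep d e) ≤ 1 := by
      rw [dec, ENNReal.ofReal_le_one]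
      exact inv_le_one_of_one_le₀ (one_le_pow₀ (by linarith [norm_nonneg (wsawStep d e)]))
    have h4 := h2.trans (mul_le_mul_right h3 _)
    rw [mul_one] at h4
    exact (ENNReal.ofReal_le_ofReal_iff hM0).1 h4
  intro v
  refine le_trans (le_of_eq ?_) ((tsum_pWt_disp_le (good_dec hd hM) hq hq1 hx hl hb v).trans ?_)
  · refine tsum_congr fun l => ?_
    simp only [rem]
    by_cases h2 : l.length = 1 <;> by_cases h3 : disp (wsawStep d) l = v <;>
      simp [h2, h3, pWt, abs_mul, abs_of_nonneg (pow_nonneg hx _)]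
  · have h2 : ∀ e, ENNReal.ofReal M * dec (d - 2) 1 (v - wsawStep d e) ≤
        ENNReal.ofReal M * (ENNReal.ofReal (2 ^ (d - 2)) * dec (d - 2) 1 v) := by
      intro e
      gcongr
      refine dec_le one_pos (by norm_num) ?_
      have := norm_sub_le v (v - wsawStep d e)
      rw [sub_sub_cancel, norm_wsawStep] at this
      have := norm_sub_norm_le v (wsawStep d e)
      rw [norm_wsawStep] at this
      linarith [norm_nonneg (v - wsawStep d e)]
    calc _ ≤ ENNReal.ofReal M * (2 * ENNReal.ofReal (1 - q) * (ENNReal.ofReal M * dec (d - 2) 1 v) ^ 2 *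
          ∑ e : Fin d × Bool, ENNReal.ofReal M * (ENNReal.ofReal (2 ^ (d - 2)) * dec (d - 2) 1 v)) := by
          refine mul_le_mul ?_ (mul_le_mul_right (Finset.sum_le_sum fun e _ => h2 e) _) zero_le zero_le
          exact ENNReal.ofReal_le_ofReal hxM
      _ = ENNReal.ofReal (4 * d * 2 ^ (d - 2) * M ^ 4 * (1 - q)) *
          (dec (d - 2) 1 v * dec (d - 2) 1 v * dec (d - 2) 1 v) := by
          rw [Finset.sum_const, Finset.card_univ, ENNReal.ofReal_mul (by positivity),
            ENNReal.ofReal_mul (by positivity), ENNReal.ofReal_mul (by positivity),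
            ENNReal.ofReal_mul (by positivity), ENNReal.ofReal_pow hM0]
          simp
          ring
      _ ≤ _ := by
          refine mul_le_mul_right ?_ _
          rw [dec_mul _ _ zero_le_one, dec_mul _ _ zero_le_one]
          exact dec_pow_anti (by omega) le_rfl _

end Deconvolution

end WSAW

namespace WSAW

section TwoPoint

variable {E A : Type*} [DecidableEq E] [AddCommGroup A] [DecidableEq A]

/-- The two-point function. -/
noncomputable def twoPt (st : E → A) (q x : ℝ) (v : A) : ℝ≥0∞ :=
  ∑' l, if disp st l = v then wt st q x l else 0

lemma line_twoPt (st : E → A) (q x : ℝ) : Line st (wt st q x) (twoPt st q x) := fun _ => le_rfl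

end TwoPoint

section Deconvolution

variable {d : ℕ} {q x : ℝ}

lemma deconvolution_identity (hd : 5 ≤ d) (hq : 0 ≤ q) (hx : 0 ≤ x)
    (hK : ∑' l, wt (wsawStep d) q x l ≠ ∞) (hP : ∑' l, pWt (wsawStep d) q x l ≠ ∞) {ε : ℝ}
    (hL : Line (wsawStep d) (fun l => ENNReal.ofReal |rem (wsawStep d) q x l|)
      fun y => ENNReal.ofReal ε * dec (d + 4) 1 y) {m ρ₀ ρ₂ B : ℝ} (hm : 0 < m)
    (hB : ∀ y : Fin d → ℤ, |green m 0 y| ≤ B)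
    (hρ : (2 * d * x + d * ρ₂) * m = 1 - (2 * d * x + ρ₀)) (v : Fin d → ℤ) :
    HasSum (fun l => K (wsawStep d) q l * x ^ l.length *
        ((ρ₀ - d * ρ₂) * green m 0 (disp (wsawStep d) l - v) +
          ρ₂ / 2 * ∑ e, green m 0 (disp (wsawStep d) l - v + wsawStep d e) -
          ∑' y, remAt (wsawStep d) q x y * green m 0 (disp (wsawStep d) l - v + y)))
      (green m 0 (-v) - (2 * d * x + d * ρ₂) *
        ∑' l, if disp (wsawStep d) l = v then K (wsawStep d) q l * x ^ l.length else 0) := by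
  have hB0 : 0 ≤ B := (abs_nonneg _).trans (hB 0)
  have hd0 : (d : ℝ) ≠ 0 := by positivity
  have hS : ∀ w, ∑ e, green m 0 (w + wsawStep d e) =
      2 * d * ((1 + m) * green m 0 w - if w = 0 then 1 else 0) := by
    intro w
    rw [sum_wsawStep fun e => green m 0 (w + e), ← green_equation hd hm w]
    field_simp
    ring
  have hX : ∀ y : Fin d → ℤ, 1 ≤ 1 + ‖y‖ := fun y => by linarith [norm_nonneg y]
  have hR : Summable (rem (wsawStep d) q x) := by
    simpa using summable_rem_mul hL (f := fun _ => 1) zero_le_one fun y => by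
      simpa using one_le_pow₀ (hX y)
  have hRS : ∀ w, Summable fun l => rem (wsawStep d) q x l * green m 0 (disp (wsawStep d) l + w) :=
    fun w => summable_rem_mul hL (f := fun y => green m 0 (y + w)) hB0 fun y =>
      (hB _).trans (le_mul_of_one_le_right hB0 (one_le_pow₀ (hX y)))
  have hU : ∀ w, HasSum (fun l => P (wsawStep d) q l * x ^ l.length *
      green m 0 (disp (wsawStep d) l + w))
      (x * (2 * d * ((1 + m) * green m 0 w - if w = 0 then 1 else 0)) +
        ∑' y, remAt (wsawStep d) q x y * green m 0 (w + y)) := by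
    intro w
    have h1 := hasSum_P_mul (f := fun y => green m 0 (y + w)) (hRS w)
    have h2 := hasSum_fiber (disp (wsawStep d)) hR (f := fun y => green m 0 (y + w)) (hRS w)
    rw [← h2.tsum_eq, ← Finset.sum_congr rfl fun e _ => congrArg (green m 0) (add_comm w _),
      hS w] at h1
    simp only [remAt]
    simpa only [add_comm _ w] using h1
  obtain ⟨h1, h2⟩ := tsum_mul_renewal hq hx hK hP hB v hU
  have hx' : ‖x‖ = x := by rw [Real.norm_eq_abs, abs_of_nonneg hx]
  have hKs : Summable fun l => K (wsawStep d) q l * x ^ l.length :=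
    (summable_K_mul_pow (𝕜 := ℝ) (x := x) hq (by rwa [hx'])).of_norm
  have hKv : Summable fun l => if disp (wsawStep d) l = v then K (wsawStep d) q l * x ^ l.length
      else 0 := by
    refine hKs.of_norm_bounded fun l => ?_
    split_ifs
    · rw [Real.norm_of_nonneg (mul_nonneg (K_nonneg _ hq l) (pow_nonneg hx _))]
    · simpa using mul_nonneg (K_nonneg _ hq l) (pow_nonneg hx _)
  have h3 := (h1.sub h2.hasSum).sub (hKv.hasSum.mul_left (2 * d * x + d * ρ₂))
  rw [add_sub_cancel_right] at h3
  refine h3.congr_fun ?_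
  intro l
  rw [hS]
  by_cases hv : disp (wsawStep d) l = v
  · simp only [hv, sub_self, if_true]
    linear_combination (K (wsawStep d) q l * x ^ l.length * green m 0 0) * hρ
  · simp only [hv, sub_eq_zero, if_false]
    linear_combination (K (wsawStep d) q l * x ^ l.length *
      green m 0 (disp (wsawStep d) l - v)) * hρ

lemma greenDom_neg (m : ℝ) (v : Fin d → ℤ) : greenDom m (-v) = greenDom m v := by
  simp only [greenDom, dec_neg]

/-- Deconvolution: the two-point function is a massive Green function, up to a small
convolution error. -/
lemma exists_deconvolution (hd : 5 ≤ d) : ∃ C : ℝ, 0 < C ∧ ∀ q x ε : ℝ, 0 ≤ q →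
    (4 * d : ℝ)⁻¹ ≤ x → 0 ≤ ε → C * ε ≤ 1 / 4 →
    ∑' l, wt (wsawStep d) q x l ≠ ∞ → ∑' l, pWt (wsawStep d) q x l ≠ ∞ →
    Line (wsawStep d) (fun l => ENNReal.ofReal |rem (wsawStep d) q x l|)
      (fun y => ENNReal.ofReal ε * dec (d + 4) 1 y) →
    ∃ m : ℝ, 0 < m ∧ ENNReal.ofReal m⁻¹ ≤ ENNReal.ofReal (3 / 2) * ∑' l, wt (wsawStep d) q x l ∧
      ∀ v, ENNReal.ofReal (1 / 4) * twoPt (wsawStep d) q x v ≤ ENNReal.ofReal C * greenDom m v +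
        ENNReal.ofReal (C * ε) * ∑' y, twoPt (wsawStep d) q x y * dec (d + 1) 1 (y - v) := by
  obtain ⟨C₁, hC₁, h₁⟩ := exists_moment_bound hd
  obtain ⟨C₂, hC₂, h₂⟩ := exists_green_zero_bound (d := d) (by omega)
  have hd1 : (1 : ℝ) ≤ d := by exact_mod_cast (by omega : 1 ≤ d)
  refine ⟨d * C₁ + C₂, by positivity, fun q x ε hq hx hε hεC hK hP hL => ?_⟩
  have hx0 : 0 < x := lt_of_lt_of_le (by positivity) hx
  have hx' : ‖x‖ = x := by rw [Real.norm_eq_abs, abs_of_pos hx0]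
  obtain ⟨hρ₀, ρ₂, hρ₂⟩ := exists_remAt_moments hd hL
  set ρ₀ := ∑' l, rem (wsawStep d) q x l with hρ₀def
  have hmom := fun m hm => h₁ m hm ε hε (remAt (wsawStep d) q x) (abs_remAt_le hε hL)
    (fun i y => remAt_map (σ := flipStep i) (φ := (reflect i).toAddMonoidHom)
      (wsawStep_flipStep i) (reflect i).injective y) ρ₀ ρ₂ hρ₀ hρ₂
  obtain ⟨hb₀, hb₂, -⟩ := hmom 1 one_pos
  have hb0 : C₁ * ε ≤ d * (C₁ * ε) := le_mul_of_one_le_left (by positivity) hd1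
  have hCε : d * (C₁ * ε) ≤ 1 / 4 := by nlinarith [mul_nonneg hC₂.le hε]
  have hb₂' : |d * ρ₂| ≤ 1 / 4 := by
    rw [abs_mul, abs_of_nonneg (by positivity : (0 : ℝ) ≤ d)]
    exact (mul_le_mul_of_nonneg_left hb₂ (by positivity)).trans hCε
  have hb₀' : |ρ₀| ≤ 1 / 4 := hb₀.trans (hb0.trans hCε)
  rw [abs_le] at hb₂' hb₀'
  have hR : Summable (rem (wsawStep d) q x) := by
    simpa using summable_rem_mul hL (f := fun _ => 1) zero_le_one fun y => by
      simpa using one_le_pow₀ (show (1 : ℝ) ≤ 1 + ‖y‖ by linarith [norm_nonneg y])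
  have hc0 : ∑' l, P (wsawStep d) q l * x ^ l.length = 2 * d * x + ρ₀ := by
    have := (hasSum_P_mul (st := wsawStep d) (q := q) (x := x) (f := fun _ => 1)
      (by simpa using hR)).tsum_eq
    simp only [mul_one] at this
    rw [this]
    simp
    ring
  have hχ := tsum_K_mul_one_sub (𝕜 := ℝ) (st := wsawStep d) (x := x) hq (by rwa [hx']) (by rwa [hx'])
  simp only [RCLike.ofReal_real_eq_id, id_eq, hc0] at hχ
  have hχ' : ENNReal.ofReal (∑' l, K (wsawStep d) q l * x ^ l.length) =
      ∑' l, wt (wsawStep d) q x l :=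
    ENNReal.ofReal_tsum_of_nonneg (fun l => mul_nonneg (K_nonneg _ hq l) (pow_nonneg hx0.le _))
      (summable_K_mul_pow (𝕜 := ℝ) (x := x) hq (by rwa [hx'])).of_norm
  set χ := ∑' l, K (wsawStep d) q l * x ^ l.length with hχdef
  have hχ0 : 0 < χ := by
    have : 0 ≤ χ := tsum_nonneg fun l => mul_nonneg (K_nonneg _ hq l) (pow_nonneg hx0.le _)
    rcases this.lt_or_eq with h | h
    · exact h
    · rw [← h, zero_mul] at hχ
      exact absurd hχ (by norm_num)
  have hmass : 0 < 1 - (2 * d * x + ρ₀) := by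
    by_contra h
    nlinarith
  have h2dx : 1 / 2 ≤ 2 * d * x := by
    rw [inv_le_iff_one_le_mul₀ (by positivity)] at hx
    linarith
  set c₂ := 2 * d * x + d * ρ₂ with hc₂
  have hc₂1 : 1 / 4 ≤ c₂ := by linarith
  have hc₂2 : c₂ ≤ 3 / 2 := by linarith
  have hm : 0 < (1 - (2 * d * x + ρ₀)) / c₂ := by positivity
  obtain ⟨-, -, hQ⟩ := hmom _ hm
  have hG := h₂ ((1 - (2 * d * x + ρ₀)) / c₂)
  set m := (1 - (2 * d * x + ρ₀)) / c₂ with hmdef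
  have hmc : c₂ * m = 1 - (2 * d * x + ρ₀) := by rw [hmdef]; field_simp
  refine ⟨m, hm, ?_, fun v => ?_⟩
  · rw [← hχ', ← ENNReal.ofReal_mul (by norm_num)]
    refine ENNReal.ofReal_le_ofReal ?_
    rw [inv_le_iff_one_le_mul₀ hm, ← hχ, ← hmc]
    have : 0 ≤ χ * m := by positivity
    nlinarith
  obtain ⟨C₃, hC₃, h₃⟩ := exists_green_diff_bound hd
  have hGb : ∀ y : Fin d → ℤ, |green m 0 y| ≤ C₃ := fun y =>
    ((h₃ m hm y).1).trans (mul_le_of_le_one_right hC₃.le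
      (inv_le_one_of_one_le₀ (one_le_pow₀ (by linarith [norm_nonneg y]))))
  have hI := deconvolution_identity hd hq hx0.le hK hP hL hm hGb hmc v
  set Q : (Fin d → ℤ) → ℝ := fun w => (ρ₀ - d * ρ₂) * green m 0 w + ρ₂ / 2 *
    ∑ e, green m 0 (w + wsawStep d e) - ∑' y, remAt (wsawStep d) q x y * green m 0 (w + y) with hQdef
  set g := ∑' l, (if disp (wsawStep d) l = v then K (wsawStep d) q l * x ^ l.length else 0) with hg
  have hg' : twoPt (wsawStep d) q x v ≤ ENNReal.ofReal g := by
    rw [hg, ENNReal.ofReal_tsum_of_nonneg]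
    · refine ENNReal.tsum_le_tsum fun l => ?_
      split_ifs
      · rfl
      · exact zero_le
    · intro l
      split_ifs
      · exact mul_nonneg (K_nonneg _ hq l) (pow_nonneg hx0.le _)
      · exact le_rfl
    · refine (summable_K_mul_pow (𝕜 := ℝ) (x := x) hq (by rwa [hx'])).of_norm_bounded fun l => ?_
      split_ifs
      · exact le_rfl
      · rw [norm_zero]
        exact norm_nonneg _
  have hg0 : 0 ≤ g := tsum_nonneg fun l => by
    split_ifs
    · exact mul_nonneg (K_nonneg _ hq l) (pow_nonneg hx0.le _)
    · exact le_rfl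
  calc ENNReal.ofReal (1 / 4) * twoPt (wsawStep d) q x v
      ≤ ENNReal.ofReal (1 / 4) * ENNReal.ofReal g := mul_le_mul_right hg' _
    _ = ENNReal.ofReal (1 / 4 * g) := (ENNReal.ofReal_mul (by norm_num)).symm
    _ ≤ ENNReal.ofReal (|green m 0 (-v)| +
        |∑' l, K (wsawStep d) q l * x ^ l.length * Q (disp (wsawStep d) l - v)|) := by
        refine ENNReal.ofReal_le_ofReal ?_
        have h4 := hI.tsum_eq
        have : c₂ * g = green m 0 (-v) -
          ∑' l, K (wsawStep d) q l * x ^ l.length * Q (disp (wsawStep d) l - v) := by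
          linarith
        calc 1 / 4 * g ≤ c₂ * g := mul_le_mul_of_nonneg_right hc₂1 hg0
          _ ≤ |c₂ * g| := le_abs_self _
          _ ≤ _ := by
              rw [this]
              simpa only [Real.norm_eq_abs] using norm_sub_le (green m 0 (-v)) _
    _ = ENNReal.ofReal |green m 0 (-v)| + ENNReal.ofReal
        |∑' l, K (wsawStep d) q l * x ^ l.length * Q (disp (wsawStep d) l - v)| :=
        ENNReal.ofReal_add (abs_nonneg _) (abs_nonneg _)
    _ ≤ _ := by
        refine add_le_add ?_ ?_
        · refine (hG (-v)).trans ?_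
          rw [greenDom_neg]
          gcongr
          nlinarith
        · rw [← Real.enorm_eq_ofReal_abs]
          refine enorm_tsum_le_tsum_enorm.trans ?_
          calc _ ≤ ∑' l, wt (wsawStep d) q x l * (ENNReal.ofReal (C₁ * ε) *
                dec (d + 1) 1 (disp (wsawStep d) l - v)) := by
                refine ENNReal.tsum_le_tsum fun l => ?_
                rw [enorm_mul, Real.enorm_of_nonneg (mul_nonneg (K_nonneg _ hq l)
                  (pow_nonneg hx0.le _)), Real.enorm_eq_ofReal_abs]
                exact mul_le_mul_right (hQ _) _
            _ ≤ _ := (line_twoPt (wsawStep d) q x).tsum_le fun y => ENNReal.ofReal (C₁ * ε) *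
                dec (d + 1) 1 (y - v)
            _ = ENNReal.ofReal (C₁ * ε) *
                ∑' y, twoPt (wsawStep d) q x y * dec (d + 1) 1 (y - v) := by
                rw [← ENNReal.tsum_mul_left]
                exact tsum_congr fun y => by ring
            _ ≤ _ := by
                gcongr
                nlinarith

end Deconvolution

end WSAW

namespace WSAW

open Real in
lemma le_greenDom {d : ℕ} {m : ℝ} (hm : 0 < m) (x : Fin d → ℤ) :
    ENNReal.ofReal (exp (-m) * (2 ^ (d + 1))⁻¹) * dec (d + 1) 1 x ≤ greenDom m x := by
  have h : ∀ t ∈ Set.Ioc (0 : ℝ) 1, ENNReal.ofReal (exp (-m) * (2 ^ (d + 1))⁻¹) * dec (d + 1) 1 x ≤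
      ENNReal.ofReal (exp (-m * t)) * (ENNReal.ofReal √(1 + t) * dec (d + 1) √(1 + t) x) := by
    intro t ht
    have h1 : 1 ≤ √(1 + t) := one_le_sqrt.2 (by linarith [ht.1])
    have h2 : √(1 + t) ≤ 2 := (sqrt_le_left (by norm_num)).2 (by linarith [ht.2])
    have h3 : dec (d + 1) 1 x ≤ ENNReal.ofReal (2 ^ (d + 1)) * dec (d + 1) √(1 + t) x :=
      dec_le (by linarith) (by norm_num) (by linarith [norm_nonneg x])
    have h4 : ENNReal.ofReal (2 ^ (d + 1))⁻¹ * ENNReal.ofReal (2 ^ (d + 1)) = 1 := by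
      rw [← ENNReal.ofReal_mul (by positivity), inv_mul_cancel₀ (by positivity), ENNReal.ofReal_one]
    calc _ ≤ ENNReal.ofReal (exp (-m) * (2 ^ (d + 1))⁻¹) *
          (ENNReal.ofReal (2 ^ (d + 1)) * dec (d + 1) √(1 + t) x) := mul_le_mul_right h3 _
      _ = ENNReal.ofReal (exp (-m)) * (ENNReal.ofReal (2 ^ (d + 1))⁻¹ * ENNReal.ofReal (2 ^ (d + 1)) *
          dec (d + 1) √(1 + t) x) := by
          rw [ENNReal.ofReal_mul (exp_pos _).le]
          ring
      _ ≤ _ := by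
          rw [h4]
          gcongr
          · nlinarith [ht.2]
          · exact ENNReal.one_le_ofReal.2 h1
  calc _ = ∫⁻ t in Set.Ioc (0 : ℝ) 1,
        ENNReal.ofReal (exp (-m) * (2 ^ (d + 1))⁻¹) * dec (d + 1) 1 x := by simp
    _ ≤ ∫⁻ t in Set.Ioc (0 : ℝ) 1, ENNReal.ofReal (exp (-m * t)) *
        (ENNReal.ofReal √(1 + t) * dec (d + 1) √(1 + t) x) :=
        MeasureTheory.setLIntegral_mono' measurableSet_Ioc h
    _ ≤ _ := MeasureTheory.lintegral_mono_set Set.Ioc_subset_Ioi_self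

lemma norm_disp_le {d : ℕ} (l : List (Fin d × Bool)) : ‖disp (wsawStep d) l‖ ≤ l.length := by
  induction l with
  | nil => simp [disp]
  | cons e l ih =>
    have : disp (wsawStep d) (e :: l) = wsawStep d e + disp (wsawStep d) l := by simp [disp]
    rw [this, List.length_cons, Nat.cast_succ]
    linarith [norm_add_le (wsawStep d e) (disp (wsawStep d) l), norm_wsawStep e]

lemma twoPt_le_dec {d : ℕ} (n : ℕ) {q x : ℝ} (v : Fin d → ℤ) :
    twoPt (wsawStep d) q x v ≤
      (∑' l, ENNReal.ofReal ((1 + l.length) ^ n) * wt (wsawStep d) q x l) * dec n 1 v := by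
  rw [twoPt, ← ENNReal.tsum_mul_right]
  refine ENNReal.tsum_le_tsum fun l => ?_
  split_ifs with h
  · have h1 : 1 ≤ ENNReal.ofReal ((1 + l.length) ^ n) * dec n 1 v := by
      rw [dec, ← ENNReal.ofReal_mul (by positivity), ENNReal.one_le_ofReal, ← div_eq_mul_inv,
        one_le_div (by positivity), ← h]
      gcongr
      exact norm_disp_le l
    calc wt (wsawStep d) q x l = 1 * wt (wsawStep d) q x l := (one_mul _).symm
      _ ≤ ENNReal.ofReal ((1 + l.length) ^ n) * dec n 1 v * wt (wsawStep d) q x l := by gcongr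
      _ = _ := by ring
  · exact zero_le

lemma le_greenDom_of_deconvolution {d : ℕ} (hd : 5 ≤ d) {m : ℝ} (hm : 0 < m)
    {G : (Fin d → ℤ) → ℝ≥0∞} {A : ℝ} {B N₀ : ℝ≥0∞} (hA : 0 ≤ A)
    (hB : B * ENNReal.ofReal (2 ^ (d + 3) * 5 ^ d) ≤ ENNReal.ofReal (1 / 8)) (hN₀ : N₀ ≠ ∞)
    (hG : ∀ v, G v ≤ N₀ * greenDom m v)
    (h : ∀ v, ENNReal.ofReal (1 / 4) * G v ≤ ENNReal.ofReal A * greenDom m v +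
      B * ∑' y, G y * dec (d + 1) 1 (y - v)) (v : Fin d → ℤ) :
    G v ≤ ENNReal.ofReal (8 * A) * greenDom m v := by
  have hg0 : ∀ v : Fin d → ℤ, greenDom m v ≠ 0 := fun v => by
    refine (lt_of_lt_of_le ?_ (le_greenDom hm v)).ne'
    rw [dec, ← ENNReal.ofReal_mul (by positivity), ENNReal.ofReal_pos]
    positivity
  have hgt : ∀ v : Fin d → ℤ, greenDom m v ≠ ∞ := fun v =>
    ne_top_of_le_ne_top (ENNReal.mul_ne_top ENNReal.ofReal_ne_top (dec_ne_top _ _ _))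
      (greenDom_le hd hm v)
  set N := ⨆ v, G v / greenDom m v with hN
  have hGN : ∀ v, G v ≤ N * greenDom m v := fun v =>
    (ENNReal.div_le_iff (hg0 v) (hgt v)).1 (le_iSup (fun v => G v / greenDom m v) v)
  have hNt : N ≠ ∞ := ne_top_of_le_ne_top hN₀
    (iSup_le fun v => (ENNReal.div_le_iff (hg0 v) (hgt v)).2 (hG v))
  have h1 : ∀ v, G v ≤ (ENNReal.ofReal (4 * A) + ENNReal.ofReal (1 / 2) * N) * greenDom m v := by
    intro v
    have h2 : ∑' y, G y * dec (d + 1) 1 (y - v) ≤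
        N * (ENNReal.ofReal (2 ^ (d + 3) * 5 ^ d) * greenDom m v) := by
      refine le_trans ?_ (mul_le_mul_right (tsum_dec_mul_greenDom_le hm v) _)
      rw [← ENNReal.tsum_mul_left]
      refine ENNReal.tsum_le_tsum fun y => ?_
      calc _ ≤ N * greenDom m y * dec (d + 1) 1 (y - v) := by gcongr; exact hGN y
        _ = _ := by rw [← dec_neg, neg_sub]; ring
    have h3 : ENNReal.ofReal 4 * ENNReal.ofReal (1 / 4) = 1 := by
      rw [← ENNReal.ofReal_mul (by norm_num)]; norm_num
    calc G v = ENNReal.ofReal 4 * (ENNReal.ofReal (1 / 4) * G v) := by rw [← mul_assoc, h3, one_mul]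
      _ ≤ ENNReal.ofReal 4 * (ENNReal.ofReal A * greenDom m v +
          B * (N * (ENNReal.ofReal (2 ^ (d + 3) * 5 ^ d) * greenDom m v))) :=
          mul_le_mul_right ((h v).trans (add_le_add_right (mul_le_mul_right h2 _) _)) _
      _ = ENNReal.ofReal 4 * (ENNReal.ofReal A +
          B * ENNReal.ofReal (2 ^ (d + 3) * 5 ^ d) * N) * greenDom m v := by ring
      _ ≤ ENNReal.ofReal 4 * (ENNReal.ofReal A + ENNReal.ofReal (1 / 8) * N) * greenDom m v := by
          gcongr
      _ = _ := by
          rw [mul_add, ← mul_assoc, ← ENNReal.ofReal_mul (by norm_num),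
            ← ENNReal.ofReal_mul (by norm_num)]
          norm_num
  have h2 : N ≤ ENNReal.ofReal (4 * A) + ENNReal.ofReal (1 / 2) * N :=
    iSup_le fun v => (ENNReal.div_le_iff (hg0 v) (hgt v)).2 (h1 v)
  have h3 : N ≤ ENNReal.ofReal (8 * A) := by
    clear_value N
    lift N to NNReal using hNt
    rw [← ENNReal.ofReal_coe_nnreal, ← ENNReal.ofReal_mul (by norm_num),
      ← ENNReal.ofReal_add (by positivity) (by positivity),
      ENNReal.ofReal_le_ofReal_iff (by positivity)] at h2
    rw [← ENNReal.ofReal_coe_nnreal]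
    exact ENNReal.ofReal_le_ofReal (by linarith)
  exact (hGN v).trans (by gcongr)

lemma exists_smallness (a b : ℝ) : ∃ β₀ : ℝ, 0 < β₀ ∧ β₀ ≤ 1 ∧ ∀ β, 0 ≤ β → β ≤ β₀ →
    a * β ≤ 1 ∧ b * β ≤ 1 := by
  refine ⟨(|a| + |b| + 1)⁻¹, by positivity, inv_le_one_of_one_le₀ ?_, fun β h0 hβ => ?_⟩
  · linarith [abs_nonneg a, abs_nonneg b]
  · have h1 : 0 < |a| + |b| + 1 := by positivity
    rw [← one_div, le_div_iff₀ h1] at hβ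
    constructor <;> nlinarith [le_abs_self a, le_abs_self b, mul_nonneg h0 (abs_nonneg a),
      mul_nonneg h0 (abs_nonneg b)]

/-- The bootstrap step: an a priori bound on the two-point function, however bad, yields a bound
by a massive Green function with a universal constant, when the interaction is weak enough. -/
lemma exists_improvement {d : ℕ} (hd : 5 ≤ d) : ∃ K₁ : ℝ, 0 < K₁ ∧ ∀ M : ℝ, 2 ^ (d - 2) ≤ M →
    ∃ β₀ : ℝ, 0 < β₀ ∧ β₀ ≤ 1 ∧ ∀ q : ℝ, 1 - β₀ ≤ q → q ≤ 1 → ∀ x : ℝ, (4 * d : ℝ)⁻¹ ≤ x →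
    ∑' l, ENNReal.ofReal ((1 + l.length) ^ (d + 1)) * wt (wsawStep d) q x l ≠ ∞ →
    Line (wsawStep d) (wt (wsawStep d) q x) (fun y => ENNReal.ofReal M * dec (d - 2) 1 y) →
    ∃ m : ℝ, 0 < m ∧ ENNReal.ofReal m⁻¹ ≤ ENNReal.ofReal K₁ * ∑' l, wt (wsawStep d) q x l ∧
      ∀ v, twoPt (wsawStep d) q x v ≤ ENNReal.ofReal K₁ * greenDom m v := by
  obtain ⟨C, hC, h⟩ := exists_deconvolution hd
  refine ⟨8 * C + 3 / 2, by positivity, fun M hM => ?_⟩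
  have hM0 : 0 < M := lt_of_lt_of_le (by positivity) hM
  have hd0 : (0 : ℝ) < d := by exact_mod_cast (by omega : 0 < d)
  obtain ⟨β₀, hβ₀, hβ₁, hβ⟩ := exists_smallness (16 * (M ^ 2 * (2 * 5 ^ d)) ^ 3)
    (8 * (C * (4 * d * 2 ^ (d - 2) * M ^ 4)) * (2 ^ (d + 3) * 5 ^ d))
  refine ⟨β₀, hβ₀, hβ₁, fun q hq hq1 x hx hmom hl => ?_⟩
  have hx0 : 0 < x := lt_of_lt_of_le (by positivity) hx
  have hq0 : 0 ≤ q := by linarith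
  obtain ⟨hs1, hs2⟩ := hβ (1 - q) (by linarith) (by linarith)
  have hb : 16 * ENNReal.ofReal (1 - q) * ENNReal.ofReal (M ^ 2 * (2 * 5 ^ d)) ^ 3 ≤ 1 := by
    rw [show (16 : ℝ≥0∞) = ENNReal.ofReal 16 by norm_num, ← ENNReal.ofReal_pow (by positivity),
      ← ENNReal.ofReal_mul (by norm_num), ← ENNReal.ofReal_mul (by linarith),
      ENNReal.ofReal_le_one]
    linarith
  have hL := line_rem hd hM hq0 hq1 hx0.le hl hb
  have hK : ∑' l, wt (wsawStep d) q x l ≠ ∞ := by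
    refine ne_top_of_le_ne_top hmom (ENNReal.tsum_le_tsum fun l => ?_)
    refine le_mul_of_one_le_left zero_le (ENNReal.one_le_ofReal.2 (one_le_pow₀ ?_))
    simp
  have hP : ∑' l, pWt (wsawStep d) q x l ≠ ∞ := by
    refine ne_top_of_le_ne_top (ENNReal.mul_ne_top ENNReal.ofReal_ne_top
      (ENNReal.sum_ne_top.2 fun e _ => ENNReal.add_ne_top.2 ⟨?_, ?_⟩))
      (tsum_pWt_le (good_dec hd hM) hq0 hq1 hx0.le hl (wt_append_le hq0 hq1 hx0.le)
        (kern_wt hq0 hq1 hx0.le) hb)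
    all_goals exact ENNReal.mul_ne_top ENNReal.ofReal_ne_top (dec_ne_top _ _ _)
  have h25 : (1 : ℝ) ≤ 2 ^ (d + 3) * 5 ^ d :=
    one_le_mul_of_one_le_of_one_le (one_le_pow₀ (by norm_num)) (one_le_pow₀ (by norm_num))
  have hε : 0 ≤ 4 * d * 2 ^ (d - 2) * M ^ 4 * (1 - q) := mul_nonneg (by positivity) (by linarith)
  have hCε : C * (4 * d * 2 ^ (d - 2) * M ^ 4 * (1 - q)) * (2 ^ (d + 3) * 5 ^ d) ≤ 1 / 8 := by
    linarith
  obtain ⟨m, hm, hmχ, hG⟩ := h q x _ hq0 hx hε (by nlinarith [mul_nonneg hC.le hε]) hK hP hL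
  refine ⟨m, hm, hmχ.trans ?_, fun v => ?_⟩
  · gcongr
    linarith
  · refine (le_greenDom_of_deconvolution hd hm hC.le ?_
      (N₀ := (∑' l, ENNReal.ofReal ((1 + l.length) ^ (d + 1)) * wt (wsawStep d) q x l) *
        ENNReal.ofReal (Real.exp m * 2 ^ (d + 1))) ?_ (fun v => ?_) hG v).trans ?_
    · rw [← ENNReal.ofReal_mul (by positivity)]
      exact ENNReal.ofReal_le_ofReal hCε
    · exact ENNReal.mul_ne_top hmom ENNReal.ofReal_ne_top
    · refine (twoPt_le_dec (d + 1) v).trans ?_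
      rw [mul_assoc]
      refine mul_le_mul_right (le_trans ?_ (mul_le_mul_right (le_greenDom hm v) _)) _
      rw [← mul_assoc, ← ENNReal.ofReal_mul (by positivity)]
      have : Real.exp m * 2 ^ (d + 1) * (Real.exp (-m) * (2 ^ (d + 1))⁻¹) = 1 := by
        rw [Real.exp_neg]
        field_simp
      rw [this, ENNReal.ofReal_one, one_mul]
    · gcongr
      linarith

end WSAW

namespace WSAW

lemma tsum_list_eq_tsum_ofFn {E : Type*} [Fintype E] (F : List E → ℝ≥0∞) :
    ∑' l, F l = ∑' n : ℕ, ∑ s : Fin n → E, F (List.ofFn s) := by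
  rw [← List.equivSigmaTuple.symm.tsum_eq, ENNReal.tsum_sigma']
  refine tsum_congr fun n => ?_
  rw [tsum_fintype]
  rfl

lemma tsum_list_length {E : Type*} [Fintype E] (f : ℕ → ℝ≥0∞) :
    ∑' l : List E, f l.length = ∑' n, (Fintype.card E : ℝ≥0∞) ^ n * f n := by
  rw [tsum_list_eq_tsum_ofFn]
  refine tsum_congr fun n => ?_
  simp

section

variable {d : ℕ} {q x : ℝ}

lemma wt_le_pow {E A : Type*} [DecidableEq E] [AddCommGroup A] [DecidableEq A] (st : E → A)
    (hq : 0 ≤ q) (hq1 : q ≤ 1) (hx : 0 ≤ x) (l : List E) :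
    wt st q x l ≤ ENNReal.ofReal (x ^ l.length) :=
  ENNReal.ofReal_le_ofReal (mul_le_of_le_one_left (pow_nonneg hx _) (K_le_one st hq hq1 l))

lemma wt_mono {E A : Type*} [DecidableEq E] [AddCommGroup A] [DecidableEq A] (st : E → A)
    (hq : 0 ≤ q) (hx : 0 ≤ x) {y : ℝ} (hxy : x ≤ y) (l : List E) : wt st q x l ≤ wt st q y l :=
  ENNReal.ofReal_le_ofReal (mul_le_mul_of_nonneg_left (pow_le_pow_left₀ hx hxy _)
    (K_nonneg st hq l))

lemma tsum_length_pow_ne_top (hd : 0 < d) (k : ℕ) :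
    ∑' l : List (Fin d × Bool), ENNReal.ofReal ((1 + l.length) ^ k) *
      ENNReal.ofReal ((4 * d : ℝ)⁻¹ ^ l.length) ≠ ∞ := by
  have hd0 : (0 : ℝ) < d := by exact_mod_cast hd
  rw [tsum_list_length fun n => ENNReal.ofReal ((1 + n) ^ k) * ENNReal.ofReal ((4 * d : ℝ)⁻¹ ^ n)]
  have h1 : ∀ n : ℕ, (Fintype.card (Fin d × Bool) : ℝ≥0∞) ^ n * (ENNReal.ofReal ((1 + n) ^ k) *
      ENNReal.ofReal ((4 * d : ℝ)⁻¹ ^ n)) = ENNReal.ofReal (2 * (((n + 1 : ℕ) : ℝ) ^ k *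
        (1 / 2) ^ (n + 1))) := by
    intro n
    have h2 : (Fintype.card (Fin d × Bool) : ℝ≥0∞) = ENNReal.ofReal (2 * d) := by
      rw [ENNReal.ofReal_mul (by norm_num)]
      simp [mul_comm]
    rw [h2, ← ENNReal.ofReal_pow (by positivity), ← ENNReal.ofReal_mul (by positivity),
      ← ENNReal.ofReal_mul (by positivity)]
    congr 1
    have h3 : (2 * d : ℝ) ^ n * (4 * d : ℝ)⁻¹ ^ n = (1 / 2) ^ n := by
      rw [← mul_pow]
      congr 1
      field_simp
      norm_num
    calc _ = (1 + (n : ℝ)) ^ k * ((2 * d : ℝ) ^ n * (4 * d : ℝ)⁻¹ ^ n) := by ring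
      _ = _ := by rw [h3]; push_cast; ring
  simp only [h1]
  have h4 := summable_pow_mul_geometric_of_norm_lt_one k (r := (1 / 2 : ℝ)) (by norm_num)
  exact ((summable_nat_add_iff 1).2 h4 |>.mul_left 2).tsum_ofReal_ne_top

lemma isClosed_twoPt_le (c : (Fin d → ℤ) → ℝ≥0∞) :
    IsClosed {x : ℝ | ∀ v, twoPt (wsawStep d) q x v ≤ c v} := by
  rw [Set.ofPred_forall]
  refine isClosed_iInter fun v => ?_
  have h : {x : ℝ | twoPt (wsawStep d) q x v ≤ c v} = ⋂ s : Finset (List (Fin d × Bool)),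
      {x | ∑ l ∈ s, (if disp (wsawStep d) l = v then wt (wsawStep d) q x l else 0) ≤ c v} := by
    ext x
    simp only [Set.mem_ofPred_eq, Set.mem_iInter]
    exact ⟨fun h s => (ENNReal.sum_le_tsum s).trans h, fun h => by
      rw [twoPt, ENNReal.tsum_eq_iSup_sum]
      exact iSup_le h⟩
  rw [h]
  refine isClosed_iInter fun s => isClosed_le (continuous_finsetSum _ fun l _ => ?_)
    continuous_const
  split_ifs
  · exact ENNReal.continuous_ofReal.comp (by fun_prop)
  · exact continuous_const

/-- Right-continuity of the two-point function, in a weighted norm. -/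
lemma exists_gt_twoPt_le (hd : 5 ≤ d) (hq : 0 ≤ q) {K₀ : ℝ} (hK₀ : 0 < K₀) (hx : 0 < x) {z : ℝ}
    (hxz : x < z)
    (hmom : ∑' l, ENNReal.ofReal ((1 + l.length) ^ (d + 1)) * wt (wsawStep d) q z l ≠ ∞)
    (h : ∀ v, twoPt (wsawStep d) q x v ≤ ENNReal.ofReal K₀ * dec (d - 2) 1 v) :
    ∃ x', x < x' ∧ x' ≤ z ∧
      ∀ v, twoPt (wsawStep d) q x' v ≤ ENNReal.ofReal (2 * K₀) * dec (d - 2) 1 v := by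
  set S := ∑' l, ENNReal.ofReal ((1 + l.length) ^ (d + 1)) * wt (wsawStep d) q z l with hS
  obtain ⟨N, hN⟩ := exists_nat_ge (S.toReal / (K₀ / 2))
  rw [div_le_iff₀ (by positivity)] at hN
  have hN0 : (0 : ℝ) < 1 + N := by positivity
  have hev : ∀ᶠ x' in nhdsWithin x (Set.Ioi x), (x' / x) ^ N < 3 / 2 := by
    have hc : ContinuousAt (fun x' : ℝ => (x' / x) ^ N) x := by fun_prop
    refine (hc.tendsto.mono_left nhdsWithin_le_nhds).eventually_lt_const ?_
    simp [div_self hx.ne']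
    norm_num
  obtain ⟨x', hx', hxx', hx'z⟩ := (hev.and (Ioc_mem_nhdsGT hxz)).exists
  have hx'0 : 0 < x' := hx.trans hxx'
  refine ⟨x', hxx', hx'z, fun v => ?_⟩
  have h1 : ∀ l, (if disp (wsawStep d) l = v then wt (wsawStep d) q x' l else 0) ≤
      ENNReal.ofReal (3 / 2) * (if disp (wsawStep d) l = v then wt (wsawStep d) q x l else 0) +
      ENNReal.ofReal ((1 + N)⁻¹) * (ENNReal.ofReal ((1 + l.length) ^ (d + 1)) *
        wt (wsawStep d) q z l) * dec (d - 2) 1 v := by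
    intro l
    split_ifs with hl
    · rcases le_total l.length N with hlN | hlN
      · refine le_add_right ?_
        rw [wt, wt, ← ENNReal.ofReal_mul (by norm_num)]
        refine ENNReal.ofReal_le_ofReal ?_
        have h2 : x' ^ l.length = (x' / x) ^ l.length * x ^ l.length := by
          rw [div_pow, div_mul_cancel₀ _ (by positivity)]
        have h3 : (x' / x) ^ l.length ≤ 3 / 2 :=
          (pow_le_pow_right₀ ((one_le_div hx).2 hxx'.le) hlN).trans hx'.le
        rw [h2]
        have := mul_nonneg (K_nonneg (wsawStep d) hq l) (pow_nonneg hx.le l.length)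
        nlinarith
      · refine le_add_left ?_
        have h2 : 1 ≤ ENNReal.ofReal ((1 + N)⁻¹) * ENNReal.ofReal ((1 + l.length) ^ (d + 1)) *
            dec (d - 2) 1 v := by
          rw [dec, ← ENNReal.ofReal_mul (by positivity), ← ENNReal.ofReal_mul (by positivity),
            ENNReal.one_le_ofReal, ← div_eq_mul_inv, one_le_div (by positivity)]
          have h3 : ‖v‖ ≤ l.length := hl ▸ norm_disp_le l
          have h4 : (N : ℝ) ≤ l.length := by exact_mod_cast hlN
          calc (1 + ‖v‖) ^ (d - 2) ≤ (1 + (l.length : ℝ)) ^ (d - 2) := by gcongr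
            _ ≤ (1 + (l.length : ℝ)) ^ d := pow_le_pow_right₀ (by linarith [norm_nonneg v]) (by omega)
            _ = (1 + N : ℝ)⁻¹ * ((1 + N) * (1 + (l.length : ℝ)) ^ d) := by field_simp
            _ ≤ (1 + N : ℝ)⁻¹ * ((1 + l.length) * (1 + (l.length : ℝ)) ^ d) := by gcongr
            _ = _ := by ring
        calc wt (wsawStep d) q x' l ≤ 1 * wt (wsawStep d) q z l := by
              rw [one_mul]
              exact wt_mono _ hq hx'0.le hx'z l
          _ ≤ _ := mul_le_mul_left h2 _
          _ = _ := by ring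
    · exact zero_le
  refine (ENNReal.tsum_le_tsum h1).trans ?_
  rw [ENNReal.tsum_add, ENNReal.tsum_mul_left, ENNReal.tsum_mul_right, ENNReal.tsum_mul_left]
  calc _ ≤ ENNReal.ofReal (3 / 2) * (ENNReal.ofReal K₀ * dec (d - 2) 1 v) +
        ENNReal.ofReal (K₀ / 2) * dec (d - 2) 1 v := by
        refine add_le_add (mul_le_mul_right (h v) _) (mul_le_mul_left ?_ _)
        rw [← hS, ← ENNReal.ofReal_toReal hmom, ← ENNReal.ofReal_mul (by positivity)]
        refine ENNReal.ofReal_le_ofReal ?_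
        rw [inv_mul_le_iff₀ hN0]
        nlinarith
    _ = _ := by
        rw [← mul_assoc, ← add_mul, ← ENNReal.ofReal_mul (by norm_num),
          ← ENNReal.ofReal_add (by positivity) (by positivity)]
        ring_nf

/-- The two-point function is bounded by a massive Green function, up to the critical point. -/
lemma exists_twoPt_bound (hd : 5 ≤ d) : ∃ K₁ β₀ : ℝ, 0 < K₁ ∧ 0 < β₀ ∧ β₀ ≤ 1 ∧
    ∀ q : ℝ, 1 - β₀ ≤ q → q ≤ 1 → ∀ z : ℝ, (4 * d : ℝ)⁻¹ ≤ z →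
    ∑' l, ENNReal.ofReal ((1 + l.length) ^ (d + 1)) * wt (wsawStep d) q z l ≠ ∞ →
    ∃ m : ℝ, 0 < m ∧ ENNReal.ofReal m⁻¹ ≤ ENNReal.ofReal K₁ * ∑' l, wt (wsawStep d) q z l ∧
      ∀ v, twoPt (wsawStep d) q z v ≤ ENNReal.ofReal K₁ * greenDom m v := by
  obtain ⟨K₁, hK₁, h⟩ := exists_improvement hd
  set S := ∑' l : List (Fin d × Bool), ENNReal.ofReal ((1 + l.length) ^ (d + 1)) *
      ENNReal.ofReal ((4 * d : ℝ)⁻¹ ^ l.length) with hS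
  have hSt : S ≠ ∞ := tsum_length_pow_ne_top (by omega) _
  set K₀ : ℝ := 2 * K₁ + S.toReal + 2 ^ (d - 2) with hK₀
  have hK₀p : 0 < K₀ := by positivity
  obtain ⟨β₀, hβ₀, hβ₁, h2⟩ := h (2 * K₀) (by
    have : (0 : ℝ) < 2 ^ (d - 2) := by positivity
    have : 0 ≤ S.toReal := ENNReal.toReal_nonneg
    linarith)
  refine ⟨K₁, β₀, hK₁, hβ₀, hβ₁, fun q hq hq1 z hz hmom => ?_⟩
  have hd0 : (0 : ℝ) < d := by exact_mod_cast (by omega : 0 < d)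
  have hz0 : (0 : ℝ) < (4 * d : ℝ)⁻¹ := by positivity
  have hq0 : 0 ≤ q := by linarith
  have hmom' : ∀ x, (4 * d : ℝ)⁻¹ ≤ x → x ≤ z →
      ∑' l, ENNReal.ofReal ((1 + l.length) ^ (d + 1)) * wt (wsawStep d) q x l ≠ ∞ :=
    fun x hx hxz => ne_top_of_le_ne_top hmom (ENNReal.tsum_le_tsum fun l =>
      mul_le_mul_right (wt_mono _ hq0 (hz0.le.trans hx) hxz l) _)
  have himp : ∀ x, (4 * d : ℝ)⁻¹ ≤ x → x ≤ z →
      (∀ v, twoPt (wsawStep d) q x v ≤ ENNReal.ofReal (2 * K₀) * dec (d - 2) 1 v) →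
      ∀ v, twoPt (wsawStep d) q x v ≤ ENNReal.ofReal K₀ * dec (d - 2) 1 v := by
    intro x hx hxz hM v
    obtain ⟨m, hm, -, hG⟩ := h2 q hq hq1 x hx (hmom' x hx hxz) hM
    calc _ ≤ ENNReal.ofReal K₁ * (ENNReal.ofReal 2 * dec (d - 2) 1 v) :=
          (hG v).trans (mul_le_mul_right (greenDom_le hd hm v) _)
      _ ≤ _ := by
          rw [← mul_assoc, ← ENNReal.ofReal_mul hK₁.le]
          gcongr
          have : (0 : ℝ) < 2 ^ (d - 2) := by positivity
          have : 0 ≤ S.toReal := ENNReal.toReal_nonneg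
          linarith
  have hall : Set.Icc (4 * d : ℝ)⁻¹ z ⊆
      {x | ∀ v, twoPt (wsawStep d) q x v ≤ ENNReal.ofReal K₀ * dec (d - 2) 1 v} := by
    refine IsClosed.Icc_subset_of_forall_exists_gt ((isClosed_twoPt_le _).inter isClosed_Icc) ?_ ?_
    · intro v
      refine (twoPt_le_dec (d - 2) v).trans (mul_le_mul_left ?_ _)
      calc _ ≤ S := ENNReal.tsum_le_tsum fun l => mul_le_mul' (ENNReal.ofReal_le_ofReal
            (pow_le_pow_right₀ (by simp) (by omega))) (wt_le_pow _ hq0 hq1 hz0.le l)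
        _ = ENNReal.ofReal S.toReal := (ENNReal.ofReal_toReal hSt).symm
        _ ≤ _ := ENNReal.ofReal_le_ofReal (by
            have : (0 : ℝ) < 2 ^ (d - 2) := by positivity
            linarith)
    · rintro x ⟨hx, hx1, hxz⟩ y hy
      obtain ⟨x', hxx', hx'z, hx'⟩ := exists_gt_twoPt_le hd hq0 hK₀p (hz0.trans_le hx1)
        (lt_min hxz hy) (hmom' _ (hx1.trans (le_min hxz.le (le_of_lt hy))) (min_le_left _ _)) hx
      exact ⟨x', himp x' (hx1.trans hxx'.le) (hx'z.trans (min_le_left _ _)) hx', hxx',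
        hx'z.trans (min_le_right _ _)⟩
  refine h2 q hq hq1 z hz hmom fun v => (hall ⟨hz, le_rfl⟩ v).trans
    (mul_le_mul_left (ENNReal.ofReal_le_ofReal (by linarith)) _)

end

end WSAW

namespace WSAW

section Links

variable {E A : Type*} [AddCommGroup A] [DecidableEq A]

lemma hits_eq_sum (st : E → A) (p : List E) (x : A) :
    hits st p x = ∑ i ∈ Finset.range p.length, if disp st (p.drop i) + x = 0 then 1 else 0 := by
  induction p with
  | nil => simp [hits]
  | cons e p ih =>
    rw [hits, ih, List.length_cons, Finset.sum_range_succ']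
    simp

lemma K_eq_prod {st : E → A} (hst : ∀ e, st e ≠ 0) (q : ℝ) (l : List E) :
    K st q l = ∏ k ∈ Finset.range (l.length + 1), ∏ i ∈ Finset.range k,
      if disp st (l.take i) = disp st (l.take k) then q else 1 := by
  induction l using List.reverseRecOn with
  | nil => simp [K, selfHits]
  | append_singleton p e ih =>
    have h1 : K st q (p ++ [e]) = K st q p * q ^ hits st p (st e) := by
      simp [K, selfHits_append, selfHits, cross, pow_add]
    rw [h1, ih, List.length_append, List.length_singleton, Finset.prod_range_succ _ (p.length + 1)]
    congr 1
    · refine Finset.prod_congr rfl fun k hk => ?_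
      refine Finset.prod_congr rfl fun i hi => ?_
      have hk' := Finset.mem_range.1 hk
      have hi' := Finset.mem_range.1 hi
      rw [List.take_append_of_le_length (by omega), List.take_append_of_le_length (by omega)]
    · rw [hits_eq_sum, ← Finset.prod_pow_eq_pow_sum, List.take_of_length_le (l := p ++ [e]) (by simp),
        Finset.prod_range_succ, List.take_left, if_neg (by simp [hst e]), mul_one]
      refine Finset.prod_congr rfl fun i hi => ?_
      rw [List.take_append_of_le_length (Finset.mem_range.1 hi).le]
      have h2 : disp st p = disp st (p.take i) + disp st (p.drop i) := by
        rw [← disp_append, List.take_append_drop]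
      have h3 : disp st (p.take i) = disp st (p ++ [e]) ↔ disp st (p.drop i) + st e = 0 := by
        simp [h2, add_assoc]
      simp only [h3]
      split_ifs <;> simp

lemma prod_filter_lt (n : ℕ) (f : ℕ → ℕ → ℝ) :
    ∏ p ∈ (Finset.range (n + 1) ×ˢ Finset.range (n + 1)).filter (fun p => p.1 < p.2), f p.1 p.2 =
      ∏ k ∈ Finset.range (n + 1), ∏ i ∈ Finset.range k, f i k := by
  rw [Finset.prod_filter, Finset.prod_product_right]
  refine Finset.prod_congr rfl fun k hk => ?_
  have hk' := Finset.mem_range.1 hk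
  rw [← Finset.prod_filter]
  refine Finset.prod_congr ?_ fun _ _ => rfl
  ext i
  simp only [Finset.mem_filter, Finset.mem_range]
  omega

end Links

section Frozen

variable {d : ℕ}

lemma wsawStep_ne_zero (e : Fin d × Bool) : wsawStep d e ≠ 0 := by
  intro h
  have := norm_wsawStep e
  rw [h] at this
  simp at this

lemma wsawPos_eq_disp {n : ℕ} (s : Fin n → Fin d × Bool) (k : ℕ) :
    wsawPos s k = disp (wsawStep d) ((List.ofFn s).take k) := by
  rw [wsawPos, disp, List.map_take, List.map_ofFn, List.sum_take_ofFn]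
  rfl

lemma wsawWeight_eq_K (β : ℝ) (n : ℕ) (s : Fin n → Fin d × Bool) :
    wsawWeight β n s = K (wsawStep d) (1 - β) (List.ofFn s) := by
  rw [K_eq_prod wsawStep_ne_zero, List.length_ofFn, wsawWeight,
    prod_filter_lt n fun i k => 1 + β * (if wsawPos s i = wsawPos s k then (-1 : ℝ) else 0)]
  refine Finset.prod_congr rfl fun k _ => Finset.prod_congr rfl fun i _ => ?_
  rw [wsawPos_eq_disp, wsawPos_eq_disp]
  split_ifs <;> ring

/-- The steps of the walk on the torus. -/
def torusStep (d r : ℕ) (e : Fin d × Bool) : Fin d → ZMod r := red d r (wsawStep d e)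

lemma torusStep_ne_zero {r : ℕ} (hr : 3 ≤ r) (e : Fin d × Bool) : torusStep d r e ≠ 0 := by
  have : Fact (1 < r) := ⟨by omega⟩
  intro h
  have h1 : ((wsawStep d e e.1 : ℤ) : ZMod r) = 0 := congrFun h e.1
  rw [wsawStep, if_pos rfl] at h1
  revert h1
  cases e.2 <;> simp

lemma wsawPosT_eq_disp (r : ℕ) {n : ℕ} (s : Fin n → Fin d × Bool) (k : ℕ) :
    wsawPosT r s k = disp (torusStep d r) ((List.ofFn s).take k) := by
  rw [disp_map (st := wsawStep d) (stB := torusStep d r) (φ := red d r) fun _ => rfl, ← wsawPos_eq_disp]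
  rfl

lemma wsawWeightT_eq_K {r : ℕ} (hr : 3 ≤ r) (β : ℝ) (n : ℕ) (s : Fin n → Fin d × Bool) :
    wsawWeightT r β n s = K (torusStep d r) (1 - β) (List.ofFn s) := by
  rw [K_eq_prod (torusStep_ne_zero hr), List.length_ofFn, wsawWeightT,
    prod_filter_lt n fun i k => 1 + β * (if wsawPosT r s i = wsawPosT r s k then (-1 : ℝ) else 0)]
  refine Finset.prod_congr rfl fun k _ => Finset.prod_congr rfl fun i _ => ?_
  rw [wsawPosT_eq_disp, wsawPosT_eq_disp]
  split_ifs <;> ring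

lemma tsum_list_mul_pow {E : Type*} [Fintype E] {𝕜 : Type*} [RCLike 𝕜] {F : List E → ℝ} {x : 𝕜}
    (h : Summable fun l : List E => (F l : 𝕜) * x ^ l.length) :
    ∑' l : List E, (F l : 𝕜) * x ^ l.length =
      ∑' n : ℕ, ((∑ s : Fin n → E, F (List.ofFn s) : ℝ) : 𝕜) * x ^ n := by
  rw [← List.equivSigmaTuple.symm.tsum_eq, Summable.tsum_sigma]
  · refine tsum_congr fun n => ?_
    rw [tsum_fintype, RCLike.ofReal_sum, Finset.sum_mul]
    refine Finset.sum_congr rfl fun s _ => ?_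
    simp [List.equivSigmaTuple]
  · exact h.comp_injective List.equivSigmaTuple.symm.injective

lemma chi_eq_tsum {β : ℝ} {z : ℂ} (hβ : β ≤ 1)
    (h : ∑' l, wt (wsawStep d) (1 - β) ‖z‖ l ≠ ∞) :
    chi d β z = ∑' l : List (Fin d × Bool), (K (wsawStep d) (1 - β) l : ℂ) * z ^ l.length := by
  have h1 := (summable_K_mul_pow (by linarith) h).of_norm
  rw [chi]
  refine Eq.trans ?_ (tsum_list_mul_pow h1).symm
  simp only [cZ, wsawWeight_eq_K]
  rfl

lemma chiT_eq_tsum {β : ℝ} {z : ℂ} {r : ℕ} (hr : 3 ≤ r) (hβ : β ≤ 1)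
    (h : ∑' l, wt (torusStep d r) (1 - β) ‖z‖ l ≠ ∞) :
    chiT d r β z = ∑' l : List (Fin d × Bool), (K (torusStep d r) (1 - β) l : ℂ) * z ^ l.length := by
  have h1 := (summable_K_mul_pow (by linarith) h).of_norm
  rw [chiT]
  refine Eq.trans ?_ (tsum_list_mul_pow h1).symm
  simp only [cT, wsawWeightT_eq_K hr]
  rfl

lemma ofReal_chiR {β x : ℝ} (hβ : β ≤ 1) (hx : 0 ≤ x)
    (h : ∑' l, wt (wsawStep d) (1 - β) x l ≠ ∞) :
    ENNReal.ofReal (chiR d β x) = ∑' l, wt (wsawStep d) (1 - β) x l := by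
  have h1 : Summable fun l : List (Fin d × Bool) => K (wsawStep d) (1 - β) l * x ^ l.length := by
    refine (summable_K_mul_pow (𝕜 := ℝ) (x := x) (st := wsawStep d) (q := 1 - β) (by linarith)
      ?_).of_norm
    rwa [Real.norm_of_nonneg hx]
  have h2 : chiR d β x = ∑' l : List (Fin d × Bool), K (wsawStep d) (1 - β) l * x ^ l.length := by
    rw [chiR]
    refine Eq.trans ?_ (tsum_list_mul_pow (𝕜 := ℝ) (F := K (wsawStep d) (1 - β)) (x := x) h1).symm
    simp only [cZ, wsawWeight_eq_K]
    rfl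
  rw [h2, ENNReal.ofReal_tsum_of_nonneg (fun l => mul_nonneg (K_nonneg _ (by linarith) l)
    (pow_nonneg hx _)) h1]
  rfl

end Frozen

end WSAW

namespace WSAW

section CrossBound

variable {E A : Type*} [DecidableEq E] [AddCommGroup A] [DecidableEq A] {st : E → A}
  {T : A → ℝ≥0∞} {C : ℝ≥0∞} {W W' : List E → ℝ≥0∞}

lemma tsum_mul_hits_le (hT : Good st T C) (hl : Line st W T)
    (hW : ∀ l l', W (l ++ l') ≤ W l * W l') (x : A) :
    ∑' a, W a * (hits st a x : ℝ≥0∞) ≤ (∑' a, W a) * T x := by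
  simp only [hits_eq]
  refine (tsum_mul_splitSum₁_le hW fun _ _ s => if s ≠ [] ∧ disp st s + x = 0 then 1 else 0).trans ?_
  rw [← ENNReal.tsum_mul_right]
  refine ENNReal.tsum_le_tsum fun a => ?_
  rw [ENNReal.tsum_mul_left]
  refine mul_le_mul_right ?_ _
  rw [← hT.neg x]
  refine le_trans (ENNReal.tsum_le_tsum fun b => ?_) (hl (-x))
  by_cases h : disp st b = -x
  · rw [if_pos h]
    exact mul_le_of_le_one_right' (by split_ifs <;> simp)
  · rw [if_neg (fun h' => h (eq_neg_of_add_eq_zero_left h'.2)), mul_zero]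
    exact zero_le

lemma tsum_mul_cross_le (hT : Good st T C) (hl : Line st W T) (hl' : Line st W' T)
    (hW : ∀ l l', W (l ++ l') ≤ W l * W l') (hW' : ∀ l l', W' (l ++ l') ≤ W' l * W' l') :
    ∑' s, W' s * ∑' a, W a * (cross st a 0 s : ℝ≥0∞) ≤ (∑' a, W a) * (∑' s, W' s) * C := by
  have h1 : ∀ s, ∑' a, W a * (cross st a 0 s : ℝ≥0∞) ≤
      splitSum (fun t _ => (∑' a, W a) * T (disp st t)) s := by
    intro s
    simp only [cross_eq, splitSum_eq_sum, Finset.mul_sum]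
    rw [Summable.tsum_finsetSum fun _ _ => ENNReal.summable]
    refine Finset.sum_le_sum fun i _ => ?_
    rw [zero_add]
    refine le_trans (ENNReal.tsum_le_tsum fun a => mul_le_mul_right ?_ _)
      (tsum_mul_hits_le hT hl hW _)
    split_ifs <;> simp
  refine (ENNReal.tsum_le_tsum fun s => mul_le_mul_right (h1 s) _).trans ?_
  refine (tsum_mul_splitSum₁_le hW' fun _ t _ => (∑' a, W a) * T (disp st t)).trans ?_
  have h2 : ∀ t, ∑' u, W' t * (W' u * ((∑' a, W a) * T (disp st t))) =
      (∑' a, W a) * (∑' s, W' s) * (W' t * T (disp st t)) := by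
    intro t
    rw [ENNReal.tsum_mul_left, ENNReal.tsum_mul_right]
    ring
  rw [tsum_congr h2, ENNReal.tsum_mul_left]
  refine mul_le_mul_right ?_ _
  refine (hl'.tsum_le T).trans (le_trans (le_of_eq ?_) hT.sq)
  exact tsum_congr fun x => (sq _).symm

lemma wt_mul_wt_le {q x y : ℝ} (hq : 0 ≤ q) (hq1 : q ≤ 1) (hx : 0 ≤ x) (hy : 0 ≤ y)
    (a s : List E) :
    wt st q y a * wt st q x s ≤ ENNReal.ofReal (K st q (a ++ s) * (y ^ a.length * x ^ s.length)) +
      ENNReal.ofReal (1 - q) * (wt st q x s * (wt st q y a * (cross st a 0 s : ℝ≥0∞))) := by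
  have ha := K_nonneg st hq a
  have hs := K_nonneg st hq s
  have h1 := one_sub_pow_le hq (cross st a 0 s)
  have hb : 0 ≤ 1 - q := by linarith
  rw [wt, wt, ← ENNReal.ofReal_natCast, ← ENNReal.ofReal_mul (by positivity),
    ← ENNReal.ofReal_mul (by positivity), ← ENNReal.ofReal_mul (by positivity),
    ← ENNReal.ofReal_mul (by positivity),
    ← ENNReal.ofReal_add (mul_nonneg (K_nonneg st hq _) (by positivity)) (by positivity)]
  refine ENNReal.ofReal_le_ofReal ?_
  have h2 : K st q (a ++ s) = K st q a * (q ^ cross st a 0 s * K st q s) := by rw [K_append, X]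
  rw [h2]
  have h3 : 0 ≤ K st q a * K st q s * (y ^ a.length * x ^ s.length) := by positivity
  nlinarith [mul_le_mul_of_nonneg_left h1 h3]

/-- A lower bound for the growth of the susceptibility. -/
lemma ofReal_sub_mul_tsum_wt_le {q x y : ℝ} (hq : 0 ≤ q) (hq1 : q ≤ 1) (hx : 0 ≤ x) (hxy : x < y)
    (hT : Good st T C) (hl : Line st (wt st q y) T) (hC : ENNReal.ofReal (1 - q) * C ≤ 2⁻¹)
    (hfin : ∑' l, wt st q y l ≠ ∞) :
    ENNReal.ofReal (y - x) * ∑' l, wt st q x l ≤ 2 * ENNReal.ofReal y := by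
  have hy : 0 ≤ y := hx.trans hxy.le
  have hmono := wt_mono (st := st) hq hx hxy.le
  have hle : ∑' l, wt st q x l ≤ ∑' l, wt st q y l := ENNReal.tsum_le_tsum hmono
  have hfin' := ne_top_of_le_ne_top hfin hle
  have hl' : Line st (wt st q x) T := fun v =>
    (ENNReal.tsum_le_tsum fun l => by split_ifs; exacts [hmono l, le_rfl]).trans (hl v)
  set χx := ∑' l, wt st q x l with hχx
  set χy := ∑' l, wt st q y l with hχy
  set S := ∑' a, ∑' s, ENNReal.ofReal (K st q (a ++ s) * (y ^ a.length * x ^ s.length)) with hS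
  have h1 : χy * χx ≤ S + 2⁻¹ * (χy * χx) := by
    calc χy * χx = ∑' a, ∑' s, wt st q y a * wt st q x s := by
          rw [← ENNReal.tsum_mul_right]
          simp only [ENNReal.tsum_mul_left, hχx]
      _ ≤ ∑' a, ∑' s, (ENNReal.ofReal (K st q (a ++ s) * (y ^ a.length * x ^ s.length)) +
          ENNReal.ofReal (1 - q) * (wt st q x s * (wt st q y a * (cross st a 0 s : ℝ≥0∞)))) :=
          ENNReal.tsum_le_tsum fun a => ENNReal.tsum_le_tsum fun s => wt_mul_wt_le hq hq1 hx hy a s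
      _ = S + ENNReal.ofReal (1 - q) *
          ∑' s, wt st q x s * ∑' a, wt st q y a * (cross st a 0 s : ℝ≥0∞) := by
          simp only [ENNReal.tsum_add, ENNReal.tsum_mul_left, hS]
          rw [ENNReal.tsum_comm (f := fun a s => wt st q x s * (wt st q y a * (cross st a 0 s : ℝ≥0∞)))]
          simp only [ENNReal.tsum_mul_left]
      _ ≤ S + ENNReal.ofReal (1 - q) * (χy * χx * C) :=
          add_le_add_right (mul_le_mul_right (tsum_mul_cross_le hT hl hl' (wt_append_le hq hq1 hy)
            (wt_append_le hq hq1 hx)) _) _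
      _ = S + ENNReal.ofReal (1 - q) * C * (χy * χx) := by ring
      _ ≤ _ := add_le_add_right (mul_le_mul_left hC _) _
  have h2 : χy * χx ≤ 2 * S := by
    have hne : χy * χx ≠ ∞ := ENNReal.mul_ne_top hfin hfin'
    have h3 : χy * χx = 2⁻¹ * (χy * χx) + 2⁻¹ * (χy * χx) := by
      rw [← add_mul, ENNReal.inv_two_add_inv_two, one_mul]
    have h4 : 2⁻¹ * (χy * χx) ≤ S := by
      refine (ENNReal.add_le_add_iff_right (a := 2⁻¹ * (χy * χx))
        (ENNReal.mul_ne_top (by simp) hne)).1 ?_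
      rwa [← h3]
    calc _ = 2 * (2⁻¹ * (χy * χx)) := by
          rw [← mul_assoc, ENNReal.mul_inv_cancel (by simp) (by simp), one_mul]
      _ ≤ _ := mul_le_mul_right h4 _
  have h3 : ENNReal.ofReal (y - x) * S ≤ ENNReal.ofReal y * χy := by
    rw [hS, ← tsum_splitSum' (E := E), ← ENNReal.tsum_mul_left, ← ENNReal.tsum_mul_left]
    refine ENNReal.tsum_le_tsum fun l => ?_
    have hKl := K_nonneg st hq l
    have h5 : splitSum (fun a s => ENNReal.ofReal (K st q (a ++ s) * (y ^ a.length * x ^ s.length))) l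
        = ENNReal.ofReal (K st q l * ∑ i ∈ Finset.range (l.length + 1),
          y ^ i * x ^ (l.length - i)) := by
      rw [splitSum_eq_sum, Finset.mul_sum, ENNReal.ofReal_sum_of_nonneg fun i _ => by positivity]
      refine Finset.sum_congr rfl fun i hi => ?_
      have hi' : i ≤ l.length := Nat.lt_succ_iff.1 (Finset.mem_range.1 hi)
      rw [List.take_append_drop, List.length_take, List.length_drop, min_eq_left hi']
    rw [h5, wt, ← ENNReal.ofReal_mul (by linarith), ← ENNReal.ofReal_mul hy]
    refine ENNReal.ofReal_le_ofReal ?_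
    have h6 := (Commute.all y x).mul_geom_sum₂ (l.length + 1)
    have h7 : ∑ i ∈ Finset.range (l.length + 1), y ^ i * x ^ (l.length - i) =
        ∑ i ∈ Finset.range (l.length + 1), y ^ i * x ^ (l.length + 1 - 1 - i) := by simp
    rw [mul_left_comm, h7, h6, pow_succ y]
    have h8 : 0 ≤ x ^ (l.length + 1) := by positivity
    nlinarith [mul_nonneg hKl h8]
  have hpos : χy ≠ 0 := by
    intro h
    have := ENNReal.tsum_eq_zero.1 h []
    rw [wt_nil] at this
    exact one_ne_zero this
  refine (ENNReal.mul_le_mul_iff_right hpos hfin).1 ?_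
  calc χy * (ENNReal.ofReal (y - x) * χx) = ENNReal.ofReal (y - x) * (χy * χx) := by ring
    _ ≤ ENNReal.ofReal (y - x) * (2 * S) := mul_le_mul_right h2 _
    _ = 2 * (ENNReal.ofReal (y - x) * S) := by ring
    _ ≤ 2 * (ENNReal.ofReal y * χy) := mul_le_mul_right h3 _
    _ = _ := by ring

end CrossBound

section Moments

variable {d : ℕ}

lemma tsum_moment_ne_top {β μ : ℝ} (hβ : β ≤ 1) (hμ : HasGrowthConst d β μ) {x : ℝ} (hx : 0 ≤ x)
    (hxμ : x < μ⁻¹) (k : ℕ) :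
    ∑' l, ENNReal.ofReal ((1 + l.length) ^ k) * wt (wsawStep d) (1 - β) x l ≠ ∞ := by
  have hc : ∀ n, 0 ≤ cZ d β n := fun n => Finset.sum_nonneg fun s _ => by
    rw [wsawWeight_eq_K]; exact K_nonneg _ (by linarith) _
  have h1 : ∑' l, ENNReal.ofReal ((1 + l.length) ^ k) * wt (wsawStep d) (1 - β) x l =
      ∑' n : ℕ, ENNReal.ofReal ((1 + n) ^ k * (cZ d β n * x ^ n)) := by
    rw [tsum_list_eq_tsum_ofFn]
    refine tsum_congr fun n => ?_
    rw [cZ, Finset.sum_mul, Finset.mul_sum, ENNReal.ofReal_sum_of_nonneg]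
    · refine Finset.sum_congr rfl fun s _ => ?_
      rw [wsawWeight_eq_K, wt, ← ENNReal.ofReal_mul (by positivity), List.length_ofFn]
    · intro s _
      rw [wsawWeight_eq_K]
      have := K_nonneg (wsawStep d) (q := 1 - β) (by linarith) (List.ofFn s)
      positivity
  obtain ⟨y, hxy, hy⟩ := exists_between hxμ
  have hy0 : 0 < y := hx.trans_lt hxy
  have hμ0 : 0 < μ := inv_pos.1 (hy0.trans hy)
  have hμy : μ < y⁻¹ := (lt_inv_comm₀ hy0 hμ0).1 hy
  have hsum : Summable fun n : ℕ => (1 + n : ℝ) ^ k * (cZ d β n * x ^ n) := by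
    have hr : ‖x / y‖ < 1 := by
      rw [Real.norm_of_nonneg (by positivity), div_lt_one hy0]; exact hxy
    have h2 : Summable fun n : ℕ => 2 ^ k * ((n : ℝ) ^ k * (x / y) ^ n) + 2 ^ k * (x / y) ^ n :=
      ((summable_pow_mul_geometric_of_norm_lt_one k hr).mul_left _).add
        ((summable_geometric_of_norm_lt_one hr).mul_left _)
    refine Summable.of_norm_bounded_eventually_nat h2 ?_
    filter_upwards [hμ.eventually (gt_mem_nhds hμy), Filter.eventually_gt_atTop 0] with n hn hn0
    have h3 : cZ d β n ≤ (y⁻¹) ^ n := by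
      have h4 : cZ d β n = (cZ d β n ^ ((n : ℝ)⁻¹)) ^ n := by
        rw [← Real.rpow_natCast, ← Real.rpow_mul (hc n), inv_mul_cancel₀ (by positivity),
          Real.rpow_one]
      rw [h4]
      exact pow_le_pow_left₀ (Real.rpow_nonneg (hc n) _) hn.le _
    have h5 : (1 + n : ℝ) ^ k ≤ 2 ^ k * (n : ℝ) ^ k := by
      rw [← mul_pow]
      have : (1 : ℝ) ≤ n := by exact_mod_cast hn0
      gcongr
      linarith
    have h6 : 0 ≤ (x / y) ^ n := by positivity
    have h7 : cZ d β n * x ^ n ≤ (x / y) ^ n := by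
      rw [div_pow, div_eq_inv_mul, ← inv_pow]
      gcongr
    have h8 : 0 ≤ cZ d β n * x ^ n := mul_nonneg (hc n) (by positivity)
    rw [Real.norm_of_nonneg (by positivity)]
    calc _ ≤ 2 ^ k * (n : ℝ) ^ k * (x / y) ^ n := by gcongr
      _ ≤ _ := by
        have : 0 ≤ (2 : ℝ) ^ k * (x / y) ^ n := by positivity
        linarith
  rw [h1, ← ENNReal.ofReal_tsum_of_nonneg (fun n => ?_) hsum]
  · exact ENNReal.ofReal_ne_top
  · have := hc n
    positivity

lemma tsum_wt_ne_top_of_moment {E A : Type*} [DecidableEq E] [AddCommGroup A] [DecidableEq A]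
    {st : E → A} {q x : ℝ} {k : ℕ}
    (h : ∑' l : List E, ENNReal.ofReal ((1 + l.length) ^ k) * wt st q x l ≠ ∞) :
    ∑' l, wt st q x l ≠ ∞ := by
  refine ne_top_of_le_ne_top h (ENNReal.tsum_le_tsum fun l => le_mul_of_one_le_left' ?_)
  rw [ENNReal.one_le_ofReal]
  exact one_le_pow₀ (by linarith [Nat.cast_nonneg (α := ℝ) l.length])

end Moments

end WSAW

namespace WSAW

section Torus

variable {d r : ℕ}

/-- The supremum of a function over a residue class. -/
noncomputable def classSup (r : ℕ) (f : (Fin d → ℤ) → ℝ≥0∞) (u : Fin d → ZMod r) : ℝ≥0∞ :=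
  ⨆ y, if red d r y = u then f y else 0

lemma le_classSup (f : (Fin d → ℤ) → ℝ≥0∞) (y : Fin d → ℤ) : f y ≤ classSup r f (red d r y) :=
  le_iSup_of_le y (by rw [if_pos rfl])

lemma good_classSup {f : (Fin d → ℤ) → ℝ≥0∞} {C G γ : ℝ≥0∞} (hr : 3 ≤ r)
    (h : Good (wsawStep d) f C) (hγ : γ ^ 2 * (r : ℝ≥0∞) ^ d ≤ G) :
    Good (torusStep d r) (fun u => classSup r f u + γ) (3 * C + 3 * G) where
  neg u := by
    congr 1
    refine le_antisymm (iSup_le fun y => ?_) (iSup_le fun y => ?_)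
    all_goals
      split_ifs with hy
      · rw [← h.neg y]
        refine (le_classSup (r := r) f (-y)).trans (le_of_eq ?_)
        simp only [map_neg, hy, neg_neg]
      · exact zero_le
  sq := by
    have : NeZero r := ⟨by omega⟩
    have h1 : ∀ u, (classSup r f u + γ) ^ 2 ≤ 3 * classSup r f u ^ 2 + 3 * γ ^ 2 := by
      intro u
      calc _ = classSup r f u ^ 2 + 2 * (classSup r f u * γ) + γ ^ 2 := by ring
        _ ≤ classSup r f u ^ 2 + 2 * (classSup r f u ^ 2 + γ ^ 2) + γ ^ 2 := by
          gcongr; exact mul_le_sq_add_sq _ _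
        _ = _ := by ring
    refine (ENNReal.tsum_le_tsum h1).trans ?_
    rw [ENNReal.tsum_add, ENNReal.tsum_mul_left]
    refine add_le_add (mul_le_mul_right ?_ _) ?_
    · have h2 : ∀ u, classSup r f u ^ 2 ≤ ∑' y, if red d r y = u then f y ^ 2 else 0 := by
        intro u
        rw [classSup, ENNReal.iSup_pow]
        refine iSup_le fun y => ?_
        refine le_trans (le_of_eq ?_) (ENNReal.le_tsum y)
        split_ifs <;> simp
      refine (ENNReal.tsum_le_tsum h2).trans ?_
      rw [ENNReal.tsum_comm]
      refine le_trans (le_of_eq (tsum_congr fun y => ?_)) h.sq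
      rw [tsum_eq_single (red d r y) fun u hu => if_neg (Ne.symm hu), if_pos rfl]
    · rw [tsum_fintype, Finset.sum_const, Finset.card_univ, Fintype.card_fun, ZMod.card,
        Fintype.card_fin, nsmul_eq_mul]
      refine le_trans (le_of_eq ?_) (mul_le_mul_right hγ 3)
      push_cast
      ring
  inf u v := by
    rw [min_add_add_right]
    have h1 : min (classSup r f u) (classSup r f v) ≤ C * classSup r f (u + v) := by
      rw [classSup, classSup, iSup_inf_iSup]
      refine iSup_le fun p => ?_
      by_cases h2 : red d r p.1 = u ∧ red d r p.2 = v
      · simp only [if_pos h2.1, if_pos h2.2]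
        refine (h.inf p.1 p.2).trans (mul_le_mul_right ?_ _)
        refine (le_classSup (r := r) f _).trans (le_of_eq ?_)
        rw [map_add, h2.1, h2.2]
      · rw [not_and_or] at h2
        rcases h2 with h2 | h2
        · simp only [if_neg h2]
          exact inf_le_left.trans zero_le
        · simp only [if_neg h2]
          exact inf_le_right.trans zero_le
    have hC : C ≤ 3 * C + 3 * G := by
      refine le_add_right ?_
      calc C = 1 * C := (one_mul C).symm
        _ ≤ 3 * C := by gcongr; norm_num
    rw [mul_add]
    refine add_le_add (h1.trans (mul_le_mul_left hC _)) ?_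
    exact le_mul_of_one_le_left' (h.one_le.trans hC)
  zero := by
    refine le_add_right (h.zero.trans ?_)
    refine (le_classSup (r := r) f 0).trans (le_of_eq ?_)
    rw [map_zero]
  step e := le_add_right ((h.step e).trans (le_classSup f _))

lemma le_norm_of_red_eq_zero {y : Fin d → ℤ} (h : red d r y = 0) (hy : y ≠ 0) : (r : ℝ) ≤ ‖y‖ := by
  obtain ⟨i, hi⟩ := Function.ne_iff.1 hy
  refine le_trans ?_ (norm_le_pi_norm y i)
  have h1 : ((y i : ℤ) : ZMod r) = 0 := congrFun h i
  rw [ZMod.intCast_zmod_eq_zero_iff_dvd] at h1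
  rw [Int.norm_eq_abs]
  have h2 := Int.le_of_dvd (abs_pos.2 hi) ((dvd_abs _ _).2 h1)
  exact_mod_cast h2

lemma wrap_wrapping (hr : 3 ≤ r) : Wrap (torusStep d r) (wrapping (wsawStep d) (torusStep d r))
    fun l => (r : ℝ) ≤ 4 * ‖disp (wsawStep d) l‖ where
  disp l hl := hl.2
  nil := by
    simp
    omega
  long a b c e h := by
    have h1 := h.2
    rw [disp_map (st := wsawStep d) (stB := torusStep d r) (φ := red d r) fun _ => rfl] at h1
    have h2 := le_norm_of_red_eq_zero h1 h.1
    simp only [disp_append] at h2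
    by_contra! h3
    have h4 := norm_add_le (disp (wsawStep d) a) (disp (wsawStep d) b +
      (disp (wsawStep d) c + disp (wsawStep d) e))
    have h5 := norm_add_le (disp (wsawStep d) b) (disp (wsawStep d) c + disp (wsawStep d) e)
    have h6 := norm_add_le (disp (wsawStep d) c) (disp (wsawStep d) e)
    linarith [h3.1, h3.2.1, h3.2.2.1, h3.2.2.2]

lemma tsum_short_le {f : (Fin d → ℤ) → ℝ≥0∞} (u : Fin d → ZMod r) :
    ∑' y, (if red d r y = u ∧ ¬ (r : ℝ) ≤ 4 * ‖y‖ then f y else 0) ≤ classSup r f u := by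
  by_cases h : ∃ y, red d r y = u ∧ ¬ (r : ℝ) ≤ 4 * ‖y‖
  · obtain ⟨y, hy, hy'⟩ := h
    rw [tsum_eq_single y]
    · rw [if_pos ⟨hy, hy'⟩, ← hy]
      exact le_classSup f y
    · intro z hz
      rw [if_neg]
      rintro ⟨h1, h2⟩
      have h3 := le_norm_of_red_eq_zero (r := r) (y := z - y) (by rw [map_sub, h1, hy, sub_self])
        (sub_ne_zero.2 hz)
      have h4 := norm_sub_le z y
      linarith [norm_nonneg z, norm_nonneg y]
  · push Not at h
    rw [ENNReal.tsum_eq_zero.2 fun y => if_neg ?_]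
    · exact zero_le
    · rintro ⟨h1, h2⟩
      exact h2 (h y h1)

/-- The data required to compare the walks on `ℤ^d` and on the torus. -/
lemma wrapData_torus (hr : 3 ≤ r) {q x : ℝ} (hq : 0 ≤ q) (hq1 : q ≤ 1) (hx : 0 ≤ x)
    {f : (Fin d → ℤ) → ℝ≥0∞} {C G γ : ℝ≥0∞} (h : Good (wsawStep d) f C)
    (hγ : γ ^ 2 * (r : ℝ≥0∞) ^ d ≤ G) (hf : ∀ v, twoPt (wsawStep d) q x v ≤ f v)
    (hlong : ∀ u : Fin d → ZMod r, ∑' y, (if red d r y = u ∧ (r : ℝ) ≤ 4 * ‖y‖ then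
      twoPt (wsawStep d) q x y else 0) ≤ γ) :
    WrapData (torusStep d r) (fun u => classSup r f u + γ) (3 * C + 3 * G) γ (wt (wsawStep d) q x)
      (wrapping (wsawStep d) (torusStep d r)) fun l => (r : ℝ) ≤ 4 * ‖disp (wsawStep d) l‖ := by
  have hdisp : ∀ l, disp (torusStep d r) l = red d r (disp (wsawStep d) l) :=
    disp_map (st := wsawStep d) (stB := torusStep d r) (φ := red d r) fun _ => rfl
  have hl : ∀ (p : (Fin d → ℤ) → Prop) [DecidablePred p],
      ∑' l, (if p (disp (wsawStep d) l) then wt (wsawStep d) q x l else 0) ≤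
      ∑' y, if p y then twoPt (wsawStep d) q x y else 0 := by
    intro p _
    have := (line_twoPt (wsawStep d) q x).tsum_le fun y => if p y then 1 else 0
    simpa using this
  refine ⟨good_classSup hr h hγ, wt_append_le hq hq1 hx, wt_nil, fun u => ?_, wrap_wrapping hr,
    fun u => ?_⟩
  · simp only [hdisp]
    refine (hl fun y => red d r y = u).trans ?_
    calc _ = ∑' y, ((if red d r y = u ∧ ¬ (r : ℝ) ≤ 4 * ‖y‖ then twoPt (wsawStep d) q x y else 0) +
          if red d r y = u ∧ (r : ℝ) ≤ 4 * ‖y‖ then twoPt (wsawStep d) q x y else 0) := by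
          refine tsum_congr fun y => ?_
          by_cases h1 : red d r y = u <;> by_cases h2 : (r : ℝ) ≤ 4 * ‖y‖ <;> simp [h1, h2]
      _ ≤ _ := by
        rw [ENNReal.tsum_add]
        refine add_le_add (le_trans (ENNReal.tsum_le_tsum fun y => ?_) (tsum_short_le u)) (hlong u)
        split_ifs
        exacts [hf y, le_rfl]
  · refine le_trans (le_of_eq (tsum_congr fun l => ?_)) ((hl fun y => red d r y = u ∧
      (r : ℝ) ≤ 4 * ‖y‖).trans (hlong u))
    rw [hdisp, cut]
    by_cases h1 : red d r (disp (wsawStep d) l) = u <;>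
      by_cases h2 : (r : ℝ) ≤ 4 * ‖disp (wsawStep d) l‖ <;> simp [h1, h2]

end Torus

end WSAW

namespace WSAW

section Comparison

variable {E A B : Type*} [Fintype E] [DecidableEq E] [AddCommGroup A] [DecidableEq A]
  [AddCommGroup B] [DecidableEq B] {st : E → A} {φ : A →+ B} {stB : E → B} {q x : ℝ}

lemma Good.ne_top {T : A → ℝ≥0∞} {C : ℝ≥0∞} (h : Good st T C) (hC : C ≠ ∞) (u : A) : T u ≠ ∞ := by
  intro hu
  have h1 := (ENNReal.le_tsum (f := fun x => T x ^ 2) u).trans h.sq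
  rw [hu] at h1
  simp [hC] at h1

lemma tsum_pWt_ne_top {T : A → ℝ≥0∞} {C : ℝ≥0∞} {W : List E → ℝ≥0∞} {b : ℝ≥0∞} (h : Good st T C)
    (hC : C ≠ ∞) (hq : 0 ≤ q) (hq1 : q ≤ 1) (hx : 0 ≤ x) (hl : Line st W T)
    (hW : ∀ l l', W (l ++ l') ≤ W l * W l') (hk : Kern st W b (kerWt st q x))
    (hb : 16 * b * C ^ 3 ≤ 1) : ∑' l, pWt st q x l ≠ ∞ := by
  refine ne_top_of_le_ne_top ?_ (tsum_pWt_le h hq hq1 hx hl hW hk hb)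
  refine ENNReal.mul_ne_top ENNReal.ofReal_ne_top (ENNReal.sum_ne_top.2 fun e _ => ?_)
  exact ENNReal.add_ne_top.2 ⟨h.ne_top hC _, h.ne_top hC _⟩

lemma pWt_mono (hx : 0 ≤ x) {y : ℝ} (hxy : x ≤ y) (l : List E) : pWt st q x l ≤ pWt st q y l := by
  refine ENNReal.ofReal_le_ofReal ?_
  gcongr

lemma norm_tsum_le_of_tsum_ofReal_norm_le {ι 𝕜 : Type*} [RCLike 𝕜] {f : ι → 𝕜} {c : ℝ}
    (hc : 0 ≤ c) (h : ∑' i, ENNReal.ofReal ‖f i‖ ≤ ENNReal.ofReal c) : ‖∑' i, f i‖ ≤ c := by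
  have h1 := summable_of_tsum_ofReal_norm_ne_top (ne_top_of_le_ne_top ENNReal.ofReal_ne_top h)
  refine (norm_tsum_le_tsum_norm h1).trans ?_
  rwa [← ENNReal.ofReal_tsum_of_nonneg (fun i => norm_nonneg _) h1,
    ENNReal.ofReal_le_ofReal_iff hc] at h

/-- The comparison of the susceptibilities of a walk and of its projection. -/
theorem inv_tsum_sub_inv_tsum_le (hφ : ∀ e, stB e = φ (st e)) (hq : 0 ≤ q) (hq1 : q ≤ 1)
    {f : A → ℝ≥0∞} {T : B → ℝ≥0∞} {C₀ C γ : ℝ≥0∞} {L : List E → Prop} {z : ℂ} {c : ℝ}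
    (hz : ‖z‖ ≤ x) (hfin : ∑' l, wt st q x l ≠ ∞)
    (h : Good st f C₀) (hl : Line st (wt st q x) f) (hC₀ : C₀ ≤ C)
    (D : WrapData stB T C γ (wt st q x) (wrapping st stB) L) (hC : C ≠ ∞)
    (hb : 16 * ENNReal.ofReal (1 - q) * C ^ 3 ≤ 1) (hc : 0 ≤ c)
    (hγ : 2432 * ENNReal.ofReal (1 - q) * C ^ 7 * γ ≤ ENNReal.ofReal c) :
    ∑' l, (K st q l : ℂ) * z ^ l.length ≠ 0 ∧ ∑' l, (K stB q l : ℂ) * z ^ l.length ≠ 0 ∧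
      ‖(∑' l, (K stB q l : ℂ) * z ^ l.length)⁻¹ - (∑' l, (K st q l : ℂ) * z ^ l.length)⁻¹‖ ≤ c := by
  have hx : 0 ≤ x := (norm_nonneg z).trans hz
  have hb₀ : 16 * ENNReal.ofReal (1 - q) * C₀ ^ 3 ≤ 1 := le_trans (by gcongr) hb
  have hKx : ∑' l, wt stB q x l ≠ ∞ :=
    ne_top_of_le_ne_top hfin (ENNReal.tsum_le_tsum fun l => wt_proj_le hφ hq hq1 hx l)
  have hP : ∑' l, pWt st q ‖z‖ l ≠ ∞ :=
    ne_top_of_le_ne_top (tsum_pWt_ne_top h (ne_top_of_le_ne_top hC hC₀) hq hq1 hx hl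
      (wt_append_le hq hq1 hx) (kern_wt hq hq1 hx) hb₀)
      (ENNReal.tsum_le_tsum fun l => pWt_mono (norm_nonneg z) hz l)
  have hPB : ∑' l, pWt stB q ‖z‖ l ≠ ∞ :=
    ne_top_of_le_ne_top (tsum_pWt_ne_top D.good hC hq hq1 hx D.line D.sub
      (kern_wt_target hφ hq hq1 hx) hb)
      (ENNReal.tsum_le_tsum fun l => pWt_mono (norm_nonneg z) hz l)
  have hK : ∑' l, wt st q ‖z‖ l ≠ ∞ :=
    ne_top_of_le_ne_top hfin (ENNReal.tsum_le_tsum fun l => wt_mono st hq (norm_nonneg z) hz l)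
  have hKB : ∑' l, wt stB q ‖z‖ l ≠ ∞ :=
    ne_top_of_le_ne_top hKx (ENNReal.tsum_le_tsum fun l => wt_mono stB hq (norm_nonneg z) hz l)
  have h1 := tsum_K_mul_one_sub (𝕜 := ℂ) hq hK hP
  have h2 := tsum_K_mul_one_sub (𝕜 := ℂ) hq hKB hPB
  have h3 := (summable_P_mul_pow (𝕜 := ℂ) hP).of_norm
  have h4 := (summable_P_mul_pow (𝕜 := ℂ) hPB).of_norm
  refine ⟨left_ne_zero_of_mul_eq_one h1, left_ne_zero_of_mul_eq_one h2, ?_⟩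
  have h5 : (∑' l, (K stB q l : ℂ) * z ^ l.length)⁻¹ - (∑' l, (K st q l : ℂ) * z ^ l.length)⁻¹ =
      ∑' l, ((P st q l : ℂ) * z ^ l.length - (P stB q l : ℂ) * z ^ l.length) := by
    refine Eq.trans ?_ (h3.tsum_sub h4).symm
    have h6 := inv_eq_of_mul_eq_one_right h1
    have h7 := inv_eq_of_mul_eq_one_right h2
    refine (congrArg₂ _ h7 h6).trans ?_
    simp
  rw [h5]
  refine norm_tsum_le_of_tsum_ofReal_norm_le hc (le_trans (ENNReal.tsum_le_tsum fun l => ?_)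
    ((tsum_P_sub_P_le hφ hq hq1 hx D hb).trans hγ))
  refine ENNReal.ofReal_le_ofReal ?_
  have h6 : (P st q l : ℂ) * z ^ l.length - (P stB q l : ℂ) * z ^ l.length =
      -(((P stB q l - P st q l : ℝ) : ℂ) * z ^ l.length) := by push_cast; ring
  rw [h6, norm_neg, norm_mul, norm_pow, Complex.norm_real, Real.norm_eq_abs]
  gcongr

end Comparison

section Critical

variable {d : ℕ}

lemma tsum_wt_inv_le_two (hd : 0 < d) {q : ℝ} (hq : 0 ≤ q) (hq1 : q ≤ 1) :
    ∑' l, wt (wsawStep d) q (4 * d : ℝ)⁻¹ l ≤ 2 := by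
  have hd0 : (0 : ℝ) < d := by exact_mod_cast hd
  refine (ENNReal.tsum_le_tsum fun l => wt_le_pow (wsawStep d) hq hq1 (by positivity) l).trans ?_
  rw [tsum_list_length fun n => ENNReal.ofReal ((4 * d : ℝ)⁻¹ ^ n)]
  have h1 : ∀ n : ℕ, (Fintype.card (Fin d × Bool) : ℝ≥0∞) ^ n *
      ENNReal.ofReal ((4 * d : ℝ)⁻¹ ^ n) = 2⁻¹ ^ n := by
    intro n
    rw [ENNReal.ofReal_pow (by positivity), ← mul_pow]
    congr 1
    have h2 : (Fintype.card (Fin d × Bool) : ℝ≥0∞) = ENNReal.ofReal (2 * d) := by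
      rw [ENNReal.ofReal_mul (by norm_num)]
      simp [mul_comm]
    rw [h2, ← ENNReal.ofReal_mul (by positivity)]
    have h3 : (2 * d : ℝ) * (4 * d : ℝ)⁻¹ = 2⁻¹ := by
      field_simp
      norm_num
    rw [h3, ENNReal.ofReal_inv_of_pos (by norm_num)]
    simp
  rw [tsum_congr h1, ENNReal.tsum_geometric, ENNReal.one_sub_inv_two, inv_inv]

/-- The susceptibility is small compared with the volume below the finite-size critical point. -/
lemma tsum_wt_le_of_le {d : ℕ} {β μ s x : ℝ} {f : (Fin d → ℤ) → ℝ≥0∞} {C : ℝ≥0∞} (hβ0 : 0 ≤ β)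
    (hβ : β ≤ 1) (hμ : HasGrowthConst d β μ) (hs : 1 < s) (hx : 0 < x) (hxs : x ≤ μ⁻¹ * (1 - s⁻¹))
    (hf : Good (wsawStep d) f C) (hC : ENNReal.ofReal β * C ≤ 2⁻¹)
    (hline : ∀ y, x ≤ y → y < μ⁻¹ → ∀ v, twoPt (wsawStep d) (1 - β) y v ≤ f v) :
    ∑' l, wt (wsawStep d) (1 - β) x l ≤ ENNReal.ofReal (4 * s) := by
  have hR : 0 < μ⁻¹ := by
    by_contra! h
    have h1 := mul_nonpos_of_nonpos_of_nonneg h (sub_nonneg.2 (inv_le_one_of_one_le₀ hs.le))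
    linarith
  have hs0 : 0 < s := by linarith
  set R := μ⁻¹ with hRdef
  have h1 : R * s⁻¹ ≤ R - x := by linarith
  have h2 : 0 < R * s⁻¹ := by positivity
  set y := (x + R) / 2 with hy
  have h3 := ofReal_sub_mul_tsum_wt_le (st := wsawStep d) (q := 1 - β) (x := x) (y := y)
    (by linarith) (by linarith) hx.le (by linarith) hf
    (fun v => hline y (by linarith) (by linarith) v) (by rwa [sub_sub_cancel])
    (tsum_wt_ne_top_of_moment (k := 0) (tsum_moment_ne_top hβ hμ (by linarith) (by linarith) 0))
  have h4 : ENNReal.ofReal (R * s⁻¹ / 2) * ∑' l, wt (wsawStep d) (1 - β) x l ≤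
      ENNReal.ofReal (R * s⁻¹ / 2) * ENNReal.ofReal (4 * s) := by
    refine (mul_le_mul_left (ENNReal.ofReal_le_ofReal (by linarith)) _).trans (h3.trans ?_)
    rw [← ENNReal.ofReal_mul (by positivity), ← ENNReal.ofReal_ofNat 2,
      ← ENNReal.ofReal_mul (by norm_num)]
    refine ENNReal.ofReal_le_ofReal ?_
    have : R * s⁻¹ / 2 * (4 * s) = 2 * R := by field_simp; norm_num
    rw [this]
    linarith
  exact (ENNReal.mul_le_mul_iff_right (by simpa using half_pos h2) ENNReal.ofReal_ne_top).1 h4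

end Critical

end WSAW

namespace WSAW

section FiniteSize

variable {d : ℕ}

/-- The deconvolution estimate, given a Green function bound for the two-point function. -/
lemma norm_inv_chiT_sub_inv_chi_le (hd : 5 ≤ d) {K₁ M C₂ Ct β x m B : ℝ} {r : ℕ} {z : ℂ}
    (hK₁ : 0 < K₁) (hM : M = 2 * K₁ + 2 ^ (d - 2))
    (hC₂ : C₂ = K₁ * K₁ * (5 ^ (d + 1) * (2 * 5 ^ d)))
    (hCt : Ct = 3 * (M ^ 2 * (2 * 5 ^ d)) + 3 * (16 * C₂ ^ 2))
    (hβ0 : 0 ≤ β) (hβ1 : β ≤ 1) (hβ : 16 * Ct ^ 3 * β ≤ 1) (hr : 3 ≤ r) (hz : ‖z‖ ≤ x)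
    (hfin : ∑' l, wt (wsawStep d) (1 - β) x l ≠ ∞) (hm : 0 < m)
    (hχ : ENNReal.ofReal m⁻¹ ≤ ENNReal.ofReal K₁ * ∑' l, wt (wsawStep d) (1 - β) x l)
    (hG : ∀ v, twoPt (wsawStep d) (1 - β) x v ≤ ENNReal.ofReal K₁ * greenDom m v)
    (hsq : (∑' l, wt (wsawStep d) (1 - β) x l) ^ 2 ≤ 16 * (r : ℝ≥0∞) ^ d) (hB0 : 0 ≤ B)
    (hB : ∑' l, wt (wsawStep d) (1 - β) x l ≤ ENNReal.ofReal B) :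
    chi d β z ≠ 0 ∧ chiT d r β z ≠ 0 ∧
      ‖(chiT d r β z)⁻¹ - (chi d β z)⁻¹‖ ≤ 2432 * Ct ^ 7 * C₂ * β * B / (r : ℝ) ^ d := by
  set S := ∑' l, wt (wsawStep d) (1 - β) x l with hS
  have hx : 0 ≤ x := (norm_nonneg z).trans hz
  have hr0 : (0 : ℝ) < r := by exact_mod_cast (by omega : 0 < r)
  have hV0 : (r : ℝ≥0∞) ^ d ≠ 0 := pow_ne_zero _ (by exact_mod_cast (by omega : r ≠ 0))
  have hVt : (r : ℝ≥0∞) ^ d ≠ ∞ := ENNReal.pow_ne_top (ENNReal.natCast_ne_top r)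
  have hVr : (r : ℝ≥0∞) ^ d = ENNReal.ofReal ((r : ℝ) ^ d) := by
    rw [ENNReal.ofReal_pow hr0.le, ENNReal.ofReal_natCast]
  have hM0 : 0 < M := by rw [hM]; positivity
  have hC₂0 : 0 < C₂ := by rw [hC₂]; positivity
  have hCt0 : 0 < Ct := by rw [hCt]; positivity
  set γ : ℝ≥0∞ := ENNReal.ofReal C₂ * S / (r : ℝ≥0∞) ^ d with hγ
  have hf : ∀ v, twoPt (wsawStep d) (1 - β) x v ≤ ENNReal.ofReal M * dec (d - 2) 1 v := by
    intro v
    refine (hG v).trans ((mul_le_mul_right (greenDom_le hd hm v) _).trans ?_)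
    rw [← mul_assoc, ← ENNReal.ofReal_mul hK₁.le]
    refine mul_le_mul_left (ENNReal.ofReal_le_ofReal ?_) _
    rw [hM]
    have : (0 : ℝ) < 2 ^ (d - 2) := by positivity
    linarith
  have hlong : ∀ u : Fin d → ZMod r, ∑' y, (if red d r y = u ∧ (r : ℝ) ≤ 4 * ‖y‖ then
      twoPt (wsawStep d) (1 - β) x y else 0) ≤ γ := by
    intro u
    rw [hγ, ENNReal.le_div_iff_mul_le (Or.inl hV0) (Or.inl hVt), mul_comm]
    calc (r : ℝ≥0∞) ^ d * ∑' y, (if red d r y = u ∧ (r : ℝ) ≤ 4 * ‖y‖ then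
          twoPt (wsawStep d) (1 - β) x y else 0)
        ≤ (r : ℝ≥0∞) ^ d * (ENNReal.ofReal K₁ * ∑' y, (if red d r y = u ∧ (r : ℝ) ≤ 4 * ‖y‖ then
          greenDom m y else 0)) := by
          rw [← ENNReal.tsum_mul_left (a := ENNReal.ofReal K₁)]
          refine mul_le_mul_right (ENNReal.tsum_le_tsum fun y => ?_) _
          split_ifs
          · exact hG y
          · simp
      _ = ENNReal.ofReal K₁ * ((r : ℝ≥0∞) ^ d * ∑' y, (if red d r y = u ∧ (r : ℝ) ≤ 4 * ‖y‖ then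
          greenDom m y else 0)) := by ring
      _ ≤ ENNReal.ofReal K₁ * (ENNReal.ofReal K₁ * S *
          (ENNReal.ofReal (5 ^ (d + 1)) * ENNReal.ofReal (2 * 5 ^ d))) := by
          refine mul_le_mul_right ((tsum_class_greenDom_le hr hm u).trans ?_) _
          exact mul_le_mul_left hχ _
      _ = ENNReal.ofReal C₂ * S := by
          rw [hC₂, ENNReal.ofReal_mul (p := K₁ * K₁) (by positivity),
            ENNReal.ofReal_mul (p := K₁) hK₁.le,
            ENNReal.ofReal_mul (p := 5 ^ (d + 1)) (by positivity)]
          ring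
  have hγsq : γ ^ 2 * (r : ℝ≥0∞) ^ d ≤ ENNReal.ofReal (16 * C₂ ^ 2) := by
    have h1 : γ * (r : ℝ≥0∞) ^ d = ENNReal.ofReal C₂ * S := ENNReal.div_mul_cancel hV0 hVt
    refine (ENNReal.mul_le_mul_iff_left hV0 hVt).1 ?_
    calc γ ^ 2 * (r : ℝ≥0∞) ^ d * (r : ℝ≥0∞) ^ d = (γ * (r : ℝ≥0∞) ^ d) ^ 2 := by ring
      _ = ENNReal.ofReal C₂ ^ 2 * S ^ 2 := by rw [h1, mul_pow]
      _ ≤ ENNReal.ofReal C₂ ^ 2 * (16 * (r : ℝ≥0∞) ^ d) := mul_le_mul_right hsq _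
      _ = ENNReal.ofReal (16 * C₂ ^ 2) * (r : ℝ≥0∞) ^ d := by
          rw [ENNReal.ofReal_mul (by norm_num), ENNReal.ofReal_pow hC₂0.le, ENNReal.ofReal_ofNat]
          ring
  have hgood := good_dec hd (M := M) (by rw [hM]; linarith)
  have D := wrapData_torus hr (by linarith) (by linarith) hx hgood hγsq hf hlong
  have hCt' : 3 * ENNReal.ofReal (M ^ 2 * (2 * 5 ^ d)) + 3 * ENNReal.ofReal (16 * C₂ ^ 2) =
      ENNReal.ofReal Ct := by
    rw [hCt, ENNReal.ofReal_add (by positivity) (by positivity), ENNReal.ofReal_mul (p := 3) (by norm_num),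
      ENNReal.ofReal_mul (p := 3) (by norm_num), ENNReal.ofReal_ofNat]
  rw [hCt'] at D
  have hfin' : ∑' l, wt (wsawStep d) (1 - β) ‖z‖ l ≠ ∞ :=
    ne_top_of_le_ne_top hfin (ENNReal.tsum_le_tsum fun l =>
      wt_mono (wsawStep d) (by linarith) (norm_nonneg z) hz l)
  have hfinT : ∑' l, wt (torusStep d r) (1 - β) ‖z‖ l ≠ ∞ :=
    ne_top_of_le_ne_top hfin' (ENNReal.tsum_le_tsum fun l =>
      wt_proj_le (st := wsawStep d) (φ := red d r) (fun _ => rfl) (by linarith) (by linarith)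
        (norm_nonneg z) l)
  rw [chi_eq_tsum hβ1 hfin', chiT_eq_tsum hr hβ1 hfinT]
  refine inv_tsum_sub_inv_tsum_le (φ := red d r) (fun _ => rfl) (by linarith) (by linarith) hz hfin
    hgood hf ?_ D ENNReal.ofReal_ne_top ?_ (by positivity) ?_
  · refine ENNReal.ofReal_le_ofReal ?_
    rw [hCt]
    have h1 : 0 < M ^ 2 * (2 * 5 ^ d) := by positivity
    have h2 : 0 < 3 * (16 * C₂ ^ 2) := by positivity
    linarith
  · rw [sub_sub_cancel, ← ENNReal.ofReal_ofNat 16, ← ENNReal.ofReal_mul (by norm_num),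
      ← ENNReal.ofReal_pow hCt0.le, ← ENNReal.ofReal_mul (by positivity), ENNReal.ofReal_le_one]
    linarith
  · rw [sub_sub_cancel, hγ]
    have h1 : 2432 * Ct ^ 7 * C₂ * β * B / (r : ℝ) ^ d =
        2432 * β * Ct ^ 7 * (C₂ * B / (r : ℝ) ^ d) := by ring
    rw [h1, ENNReal.ofReal_mul (by positivity), ENNReal.ofReal_mul (by positivity),
      ENNReal.ofReal_mul (by positivity), ENNReal.ofReal_pow hCt0.le, ENNReal.ofReal_ofNat,
      ENNReal.ofReal_div_of_pos (by positivity), ENNReal.ofReal_mul hC₂0.le, ← hVr]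
    gcongr

lemma chiR_nonneg {β x : ℝ} (hβ : β ≤ 1) (hx : 0 ≤ x) : 0 ≤ chiR d β x :=
  tsum_nonneg fun n => mul_nonneg (Finset.sum_nonneg fun s _ => by
    rw [wsawWeight_eq_K]; exact K_nonneg _ (by linarith) _) (pow_nonneg hx _)

end FiniteSize

end WSAW

open WSAW in
/-- for `|z| ≤ ζ = z_c(1 - V^{-1/2})`, both susceptibilities are nonzero
and `Δ(z) = 1/χ^𝕋(z) - 1/χ(z)` satisfies `|Δ(z)| ≤ C β (r² + χ(|z|))/V`. -/
theorem statement11 (d : ℕ) (hd : 4 < d) :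
    ∃ β0 C : ℝ, 0 < β0 ∧ 0 < C ∧
      ∀ β : ℝ, 0 < β → β ≤ β0 →
        ∀ μ : ℝ, HasGrowthConst d β μ →
          ∀ r : ℕ, 3 ≤ r →
            ∀ z : ℂ, ‖z‖ ≤ μ⁻¹ * (1 - (Real.sqrt ((r : ℝ) ^ d))⁻¹) →
              chi d β z ≠ 0 ∧ chiT d r β z ≠ 0 ∧
              ‖(chiT d r β z)⁻¹ - (chi d β z)⁻¹‖ ≤
                C * β * ((r : ℝ) ^ 2 + chiR d β ‖z‖) / (r : ℝ) ^ d := by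

  obtain ⟨K₁, β₁, hK₁, hβ₁, hβ₁1, hG⟩ := exists_twoPt_bound (d := d) hd
  set M := 2 * K₁ + 2 ^ (d - 2) with hM
  set C₂ := K₁ * K₁ * (5 ^ (d + 1) * (2 * 5 ^ d)) with hC₂
  set Ct := 3 * (M ^ 2 * (2 * 5 ^ d)) + 3 * (16 * C₂ ^ 2) with hCt
  obtain ⟨β₂, hβ₂, hβ₂1, hsm⟩ := exists_smallness (16 * Ct ^ 3) (2 * (M ^ 2 * (2 * 5 ^ d)))
  have hC₂0 : 0 < C₂ := by positivity
  have hCt0 : 0 < Ct := by positivity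
  refine ⟨min β₁ β₂, 2432 * Ct ^ 7 * C₂, lt_min hβ₁ hβ₂, by positivity, ?_⟩
  intro β hβ hβle μ hμ r hr z hz
  obtain ⟨hβle₁, hβle₂⟩ := le_min_iff.1 hβle
  obtain ⟨hs1, hs2⟩ := hsm β hβ.le hβle₂
  have hβ1 : β ≤ 1 := hβle₁.trans hβ₁1
  have hd0 : (0 : ℝ) < d := by exact_mod_cast (by omega : 0 < d)
  have hr3 : (3 : ℝ) ≤ r := by exact_mod_cast hr
  have hχ0 := chiR_nonneg (d := d) hβ1 (norm_nonneg z)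
  have hV1 : (1 : ℝ) < (r : ℝ) ^ d := one_lt_pow₀ (by linarith) (by omega)
  have hVr : ((r : ENNReal)) ^ d = ENNReal.ofReal ((r : ℝ) ^ d) := by
    rw [ENNReal.ofReal_pow (by linarith), ENNReal.ofReal_natCast]
  rcases lt_or_ge ‖z‖ (4 * d : ℝ)⁻¹ with hlt | hge
  · have hmom : ∑' l, ENNReal.ofReal ((1 + l.length) ^ (d + 1)) *
        wt (wsawStep d) (1 - β) (4 * d : ℝ)⁻¹ l ≠ ⊤ :=
      ne_top_of_le_ne_top (tsum_length_pow_ne_top (d := d) (by omega) (d + 1))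
        (ENNReal.tsum_le_tsum fun l => mul_le_mul_right
          (wt_le_pow (wsawStep d) (by linarith) (by linarith) (by positivity) l) _)
    have h2 := tsum_wt_inv_le_two (d := d) (q := 1 - β) (by omega) (by linarith) (by linarith)
    obtain ⟨m, hm, hm1, hm2⟩ := hG (1 - β) (by linarith) (by linarith) _ le_rfl hmom
    refine norm_inv_chiT_sub_inv_chi_le hd hK₁ hM hC₂ hCt hβ.le hβ1 hs1 hr hlt.le
      (tsum_wt_ne_top_of_moment hmom) hm hm1 hm2 ?_ (by positivity) (h2.trans ?_)
    · calc _ ≤ (2 : ENNReal) ^ 2 := by gcongr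
        _ ≤ 16 * 1 := by norm_num
        _ ≤ _ := by
          gcongr
          rw [hVr, ENNReal.one_le_ofReal]
          exact hV1.le
    · rw [← ENNReal.ofReal_ofNat 2]
      exact ENNReal.ofReal_le_ofReal (by nlinarith)
  · have hz0 : 0 < ‖z‖ := lt_of_lt_of_le (by positivity) hge
    set s := √((r : ℝ) ^ d) with hs
    have hs1' : 1 < s := Real.lt_sqrt_of_sq_lt (by simpa using hV1)
    have hmom : ∀ y, ‖z‖ ≤ y → y < μ⁻¹ → ∑' l, ENNReal.ofReal ((1 + l.length) ^ (d + 1)) *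
        wt (wsawStep d) (1 - β) y l ≠ ⊤ := fun y hy hyμ =>
      tsum_moment_ne_top hβ1 hμ ((norm_nonneg z).trans hy) hyμ _
    have hline : ∀ y, ‖z‖ ≤ y → y < μ⁻¹ → ∀ v, twoPt (wsawStep d) (1 - β) y v ≤
        ENNReal.ofReal M * dec (d - 2) 1 v := by
      intro y hy hyμ v
      obtain ⟨m, hm, -, hm2⟩ := hG (1 - β) (by linarith) (by linarith) y (hge.trans hy)
        (hmom y hy hyμ)
      refine (hm2 v).trans ((mul_le_mul_right (greenDom_le hd hm v) _).trans ?_)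
      rw [← mul_assoc, ← ENNReal.ofReal_mul hK₁.le]
      refine mul_le_mul_left (ENNReal.ofReal_le_ofReal ?_) _
      have : (0 : ℝ) < 2 ^ (d - 2) := by positivity
      linarith
    have hχs := tsum_wt_le_of_le hβ.le hβ1 hμ hs1' hz0 hz
      (good_dec hd (M := M) (by linarith)) (by
        rw [← ENNReal.ofReal_mul hβ.le, ← ENNReal.ofReal_ofNat 2,
          ← ENNReal.ofReal_inv_of_pos (by norm_num)]
        exact ENNReal.ofReal_le_ofReal (by linarith)) hline
    have hzμ : ‖z‖ < μ⁻¹ := by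
      by_contra! h
      have h1 : 0 < 1 - s⁻¹ := sub_pos.2 (inv_lt_one_of_one_lt₀ hs1')
      have h2 : 0 < s⁻¹ := by positivity
      have h3 : 0 < μ⁻¹ := by
        by_contra! h3
        have := mul_nonpos_of_nonpos_of_nonneg h3 h1.le
        linarith
      nlinarith
    have hmomz := hmom _ le_rfl hzμ
    obtain ⟨m, hm, hm1, hm2⟩ := hG (1 - β) (by linarith) (by linarith) _ hge hmomz
    have hfin := tsum_wt_ne_top_of_moment hmomz
    refine norm_inv_chiT_sub_inv_chi_le hd hK₁ hM hC₂ hCt hβ.le hβ1 hs1 hr le_rfl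
      hfin hm hm1 hm2 ?_ (by positivity) ?_
    · refine (pow_le_pow_left' hχs 2).trans ?_
      rw [hVr, ← ENNReal.ofReal_pow (by positivity), mul_pow, Real.sq_sqrt (by positivity),
        ENNReal.ofReal_mul (by norm_num)]
      norm_num
    · rw [← ofReal_chiR hβ1 (norm_nonneg z) hfin]
      exact ENNReal.ofReal_le_ofReal (by nlinarith)
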